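/- Let π(x) denote the number of primes p ≤ x, and let π'(x) denote the number of primes p ≤ x that divide a term of the Somos-5 sequence. Then lim_{x → ∞} π'(x)/π(x) = 5087/10752. -/

import Mathlib

open Filter

/-- The Somos-5 sequence. -/
def somos : ℕ → ℚ
  | 0 => 1
  | 1 => 1
  | 2 => 1
  | 3 => 1
  | 4 => 1
  | (m + 5) => (somos (m + 4) * somos (m + 1) + somos (m + 3) * somos (m + 2)) / somos m

/-- The number of primes `p ≤ x`. -/
noncomputable def primePi (x : ℕ) : ℕ :=
  Nat.card {p : ℕ | p ≤ x ∧ p.Prime}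

/-- The number of primes `p ≤ x` dividing some term of the Somos-5 sequence. -/
noncomputable def somosPi (x : ℕ) : ℕ :=
  Nat.card {p : ℕ | p ≤ x ∧ p.Prime ∧ ∃ m, (p : ℤ) ∣ (somos m).num}
open MeasureTheory Topology Set Asymptotics
noncomputable def kk (u : ℝ) : ℝ := (1 - Real.cos (2 * Real.pi * u)) / (2 * Real.pi ^ 2 * u ^ 2)

lemma kk_nonneg (u : ℝ) : 0 ≤ kk u :=
  div_nonneg (by linarith [Real.cos_le_one (2 * Real.pi * u)]) (by positivity)

lemma kk_le (u : ℝ) : kk u ≤ 2 * (1 + u ^ 2)⁻¹ := by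
  by_cases hu : u = 0
  · simp [kk, hu]
  have h1 := Real.one_sub_sq_div_two_le_cos (x := 2 * Real.pi * u)
  have h2 := Real.neg_one_le_cos (2 * Real.pi * u)
  have h3 := Real.pi_gt_three
  have : 0 < u ^ 2 := by positivity
  rw [kk, ← div_eq_mul_inv, div_le_div_iff₀ (by positivity) (by positivity)]
  have h4 : (1 - Real.cos (2 * Real.pi * u)) * u ^ 2 ≤ 2 * u ^ 2 := by nlinarith
  have h5 : 2 * u ^ 2 ≤ 2 * Real.pi ^ 2 * u ^ 2 := by gcongr; nlinarith
  nlinarith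

lemma kk_int : Integrable kk :=
  (integrable_inv_one_add_sq.const_mul 2).mono' (by unfold kk; exact (Measurable.div (by fun_prop) (by fun_prop)).aestronglyMeasurable)
    (ae_of_all _ fun u => by rw [Real.norm_of_nonneg (kk_nonneg u)]; exact kk_le u)

lemma fej {u : ℝ} (hu : u ≠ 0) :
    ∫ y in (-1 : ℝ)..1, ((1 - |y| : ℝ) : ℂ) * Complex.exp (2 * Real.pi * u * Complex.I * y) = kk u := by
  set a : ℂ := 2 * Real.pi * u * Complex.I with ha
  have ha0 : a ≠ 0 := by simp [ha, hu, Real.pi_ne_zero]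
  have ii (b c : ℝ) : IntervalIntegrable (fun y : ℝ => ((1 - |y| : ℝ) : ℂ) * Complex.exp (a * y)) volume b c :=
    Continuous.intervalIntegrable (by fun_prop) _ _
  have he (y : ℝ) : HasDerivAt (fun y : ℝ => Complex.exp (a * y)) (Complex.exp (a * y) * a) y := by
    simpa using ((hasDerivAt_id (y : ℂ)).const_mul a).cexp.comp_ofReal
  have hid (y : ℝ) : HasDerivAt (fun y : ℝ => (y : ℂ)) 1 y := (hasDerivAt_id (y : ℂ)).comp_ofReal
  rw [← intervalIntegral.integral_add_adjacent_intervals (ii (-1) 0) (ii 0 1)]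
  rw [intervalIntegral.integral_congr (g := fun y : ℝ => (1 + y : ℂ) * Complex.exp (a * y)) (a := -1),
    intervalIntegral.integral_congr (g := fun y : ℝ => (1 - y : ℂ) * Complex.exp (a * y)) (a := 0),
    intervalIntegral.integral_eq_sub_of_hasDerivAt (a := -1) (b := 0)
      (f := fun y : ℝ => (1 + y : ℂ) * (Complex.exp (a * y) / a) - Complex.exp (a * y) / a / a),
    intervalIntegral.integral_eq_sub_of_hasDerivAt (a := 0) (b := 1)
      (f := fun y : ℝ => (1 - y : ℂ) * (Complex.exp (a * y) / a) + Complex.exp (a * y) / a / a)]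
  · have h1 : Complex.exp a + Complex.exp (-a) = 2 * Complex.cos (2 * Real.pi * u) := by
      rw [Complex.cos, ha]; ring_nf
    have h2 : a * a = -(4 * Real.pi ^ 2 * u ^ 2) := by
      linear_combination (4 * Real.pi ^ 2 * u ^ 2 : ℂ) * Complex.I_sq
    have h3 : (kk u : ℂ) = -(2 - 2 * Complex.cos (2 * Real.pi * u)) / (a * a) := by
      have : (u : ℂ) ≠ 0 := by exact_mod_cast hu
      have : (Real.pi : ℂ) ≠ 0 := by exact_mod_cast Real.pi_ne_zero
      rw [h2, kk]; push_cast; field_simp; ring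
    rw [h3, ← h1]; push_cast; field_simp; simp; ring
  · intro y _
    exact ((((hid y).const_sub 1).mul ((he y).div_const a)).add (((he y).div_const a).div_const a)).congr_deriv
      (by field_simp; ring)
  · exact Continuous.intervalIntegrable (by fun_prop) _ _
  · intro y _
    exact ((((hid y).const_add 1).mul ((he y).div_const a)).sub (((he y).div_const a).div_const a)).congr_deriv
      (by field_simp; ring)
  · exact Continuous.intervalIntegrable (by fun_prop) _ _
  · intro y hy; rw [uIcc_of_le (by norm_num)] at hy; simp [abs_of_nonneg hy.1]
  · intro y hy; rw [uIcc_of_le (by norm_num)] at hy; simp [abs_of_nonpos hy.2]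
lemma conv_eps {B : ℝ → ℝ} (hB : Measurable B) {C : ℝ} (hC : ∀ t, |B t| ≤ C) {H : ℂ → ℂ}
    (hL : ∀ z : ℂ, 0 < z.re → ∫ t in Ioi (0 : ℝ), (B t : ℂ) * Complex.exp (-z * t) = H z)
    {l e : ℝ} (hl : 0 < l) (he : 0 < e) (x : ℝ) :
    ∫ t in Ioi (0 : ℝ), ((B t * Real.exp (-e * t) * kk (l * (x - t)) : ℝ) : ℂ) =
    ∫ y in Ioc (-1 : ℝ) 1, ((1 - |y| : ℝ) : ℂ) * Complex.exp (2 * Real.pi * l * x * Complex.I * y)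
      * H (e + 2 * Real.pi * l * y * Complex.I) := by
  set F : ℝ → ℝ → ℂ := fun t y => ((B t * Real.exp (-e * t) * (1 - |y|) : ℝ) : ℂ) *
    Complex.exp (2 * Real.pi * (l * (x - t) : ℝ) * Complex.I * y)
  have h1 : ∫ t in Ioi (0 : ℝ), ((B t * Real.exp (-e * t) * kk (l * (x - t)) : ℝ) : ℂ) =
      ∫ t in Ioi (0 : ℝ), ∫ y in Ioc (-1 : ℝ) 1, F t y := by
    refine integral_congr_ae (ae_restrict_of_ae ?_)
    filter_upwards [show ∀ᵐ t : ℝ, t ≠ x by simp [ae_iff]] with t ht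
    have := fej (mul_ne_zero hl.ne' (sub_ne_zero.2 ht.symm))
    rw [intervalIntegral.integral_of_le (by norm_num)] at this
    rw [Complex.ofReal_mul, ← this, ← integral_const_mul]
    refine integral_congr_ae (ae_of_all _ fun y => ?_)
    simp only [F]; push_cast; ring
  rw [h1, integral_integral_swap]
  · refine setIntegral_congr_fun measurableSet_Ioc fun y hy => ?_
    rw [← hL _ (by simpa using he), ← integral_const_mul]
    refine integral_congr_ae (ae_of_all _ fun t => ?_)
    have hE : Complex.exp (-e * t) * Complex.exp (2 * Real.pi * (l * (x - t)) * Complex.I * y) =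
        Complex.exp (2 * Real.pi * l * x * Complex.I * y) *
          Complex.exp (-(e + 2 * Real.pi * l * y * Complex.I) * t) := by
      rw [← Complex.exp_add, ← Complex.exp_add]; ring_nf
    simp only [F]; push_cast
    linear_combination ((B t : ℂ) * (1 - (|y| : ℝ))) * hE
  · have h2 : Integrable (fun t : ℝ => C * Real.exp (-e * t)) (volume.restrict (Ioi 0)) :=
      (integrableOn_exp_mul_Ioi (by linarith) 0).const_mul C
    have h3 : Integrable (fun _ : ℝ => (1 : ℝ)) (volume.restrict (Ioc (-1 : ℝ) 1)) := by
      simp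
    refine (h2.mul_prod h3).mono' ?_ ?_
    · exact Measurable.aestronglyMeasurable (by simp only [F, Function.uncurry_def]; fun_prop)
    · rw [Measure.prod_restrict]
      refine (ae_restrict_iff' (measurableSet_Ioi.prod measurableSet_Ioc)).2 (ae_of_all _ ?_)
      rintro ⟨t, y⟩ ⟨ht, hy⟩
      have hy1 : |y| ≤ 1 := abs_le.2 ⟨hy.1.le, hy.2⟩
      simp only [F, Function.uncurry, norm_mul, Complex.norm_real, Complex.norm_exp]
      have : (2 * Real.pi * ((l * (x - t) : ℝ) : ℂ) * Complex.I * y).re = 0 := by simp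
      rw [this, Real.exp_zero, mul_one, mul_one, Real.norm_eq_abs, Real.norm_eq_abs, Real.norm_eq_abs,
        Real.abs_exp, abs_of_nonneg (by linarith : 0 ≤ 1 - |y|)]
      have := hC t
      have h0 : 0 ≤ |y| := abs_nonneg y
      calc _ ≤ |B t| * Real.exp (-e * t) * 1 := by gcongr; linarith
        _ ≤ _ := by rw [mul_one]; gcongr

lemma conv_zero {B : ℝ → ℝ} (hB : Measurable B) {C : ℝ} (hC : ∀ t, |B t| ≤ C) {H : ℂ → ℂ}
    (hH : ContinuousOn H {z | 0 ≤ z.re})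
    (hL : ∀ z : ℂ, 0 < z.re → ∫ t in Ioi (0 : ℝ), (B t : ℂ) * Complex.exp (-z * t) = H z)
    {l : ℝ} (hl : 0 < l) :
    Tendsto (fun x => ∫ t in Ioi (0 : ℝ), B t * kk (l * (x - t))) atTop (𝓝 0) := by
  have key (x : ℝ) : ((∫ t in Ioi (0 : ℝ), B t * kk (l * (x - t)) : ℝ) : ℂ) =
      ∫ y in Ioc (-1 : ℝ) 1, ((1 - |y| : ℝ) : ℂ) * Complex.exp (2 * Real.pi * l * x * Complex.I * y)
      * H (2 * Real.pi * l * y * Complex.I) := by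
    rw [← integral_complex_ofReal]
    have hk : Integrable (fun t => kk (l * (x - t))) := (kk_int.comp_mul_left' hl.ne').comp_sub_left x
    have T1 : Tendsto (fun e : ℝ => ∫ t in Ioi (0 : ℝ), ((B t * Real.exp (-e * t) * kk (l * (x - t)) : ℝ) : ℂ))
        (𝓝[>] 0) (𝓝 (∫ t in Ioi (0 : ℝ), ((B t * kk (l * (x - t)) : ℝ) : ℂ))) := by
      refine tendsto_integral_filter_of_dominated_convergence (fun t => C * kk (l * (x - t))) ?_ ?_
        (hk.restrict.const_mul C) ?_
      · refine Eventually.of_forall fun e => Measurable.aestronglyMeasurable ?_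
        unfold kk; fun_prop
      · filter_upwards [self_mem_nhdsWithin] with e he
        refine (ae_restrict_iff' measurableSet_Ioi).2 (ae_of_all _ fun t ht => ?_)
        rw [Complex.norm_real, Real.norm_eq_abs, abs_mul, abs_mul, Real.abs_exp, abs_of_nonneg (kk_nonneg _)]
        have : Real.exp (-e * t) ≤ 1 := Real.exp_le_one_iff.2 (by nlinarith [mem_Ioi.1 he, mem_Ioi.1 ht])
        have := hC t
        refine mul_le_mul_of_nonneg_right ?_ (kk_nonneg _)
        calc _ ≤ |B t| * 1 := by gcongr
          _ ≤ C := by simpa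
      · refine ae_of_all _ fun t => ?_
        have : Continuous fun e : ℝ => ((B t * Real.exp (-e * t) * kk (l * (x - t)) : ℝ) : ℂ) := by fun_prop
        have := (this.tendsto 0).mono_left (nhdsWithin_le_nhds (s := Ioi 0))
        simpa using this
    have hc : IsCompact (Icc (0 : ℝ) 1 ×ˢ Icc (-1 : ℝ) 1) := isCompact_Icc.prod isCompact_Icc
    have hcont : ContinuousOn (fun q : ℝ × ℝ => H (q.1 + 2 * Real.pi * l * q.2 * Complex.I))
        (Icc (0 : ℝ) 1 ×ˢ Icc (-1 : ℝ) 1) :=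
      hH.comp (by fun_prop) (fun q hq => by simpa using hq.1.1)
    obtain ⟨D, hD⟩ := hc.exists_bound_of_continuousOn hcont
    have T2 : Tendsto (fun e : ℝ => ∫ y in Ioc (-1 : ℝ) 1, ((1 - |y| : ℝ) : ℂ) *
        Complex.exp (2 * Real.pi * l * x * Complex.I * y) * H (e + 2 * Real.pi * l * y * Complex.I))
        (𝓝[>] 0) (𝓝 (∫ y in Ioc (-1 : ℝ) 1, ((1 - |y| : ℝ) : ℂ) *
        Complex.exp (2 * Real.pi * l * x * Complex.I * y) * H (2 * Real.pi * l * y * Complex.I))) := by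
      have hev : ∀ᶠ e : ℝ in 𝓝[>] 0, e ∈ Ioc (0 : ℝ) 1 := Ioc_mem_nhdsGT (by norm_num)
      refine tendsto_integral_filter_of_dominated_convergence (fun _ => D) ?_ ?_ (by simp) ?_
      · filter_upwards [hev] with e he
        refine ContinuousOn.aestronglyMeasurable ?_ measurableSet_Ioc
        refine ContinuousOn.mul (by fun_prop) ?_
        exact hH.comp (by fun_prop) (fun q hq => by simpa using he.1.le)
      · filter_upwards [hev] with e he
        refine (ae_restrict_iff' measurableSet_Ioc).2 (ae_of_all _ fun y hy => ?_)
        have hy1 : |y| ≤ 1 := abs_le.2 ⟨hy.1.le, hy.2⟩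
        have : (2 * Real.pi * l * x * Complex.I * y).re = 0 := by simp
        rw [norm_mul, norm_mul, Complex.norm_real, Complex.norm_exp, this, Real.exp_zero, mul_one,
          Real.norm_of_nonneg (by linarith)]
        have h3 := hD (e, y) ⟨⟨he.1.le, he.2⟩, ⟨hy.1.le, hy.2⟩⟩
        have h0 : 0 ≤ |y| := abs_nonneg y
        calc _ ≤ 1 * _ := by gcongr; linarith
          _ ≤ D := by simpa using h3
      · refine ae_of_all _ fun y => Tendsto.const_mul _ ?_
        have h4 : ContinuousWithinAt H {z | 0 ≤ z.re} (2 * Real.pi * l * y * Complex.I) := hH _ (by simp)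
        refine h4.tendsto.comp (tendsto_nhdsWithin_iff.2 ⟨?_, ?_⟩)
        · have : Continuous fun e : ℝ => (e : ℂ) + 2 * Real.pi * l * y * Complex.I := by fun_prop
          have := (this.tendsto 0).mono_left (nhdsWithin_le_nhds (s := Ioi 0))
          simpa using this
        · filter_upwards [hev] with e he
          simpa using he.1.le
    refine tendsto_nhds_unique T1 (T2.congr' ?_)
    filter_upwards [self_mem_nhdsWithin] with e he
    exact (conv_eps hB hC hL hl he x).symm
  have RL := Real.tendsto_integral_exp_smul_cocompact ((Ioc (-1 : ℝ) 1).indicator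
    fun y => ((1 - |y| : ℝ) : ℂ) * H (2 * Real.pi * l * y * Complex.I))
  have RL2 := RL.comp ((tendsto_neg_atTop_atBot.comp (tendsto_id.const_mul_atTop hl)).mono_right atBot_le_cocompact)
  refine ((Complex.continuous_re.tendsto 0).comp RL2).congr fun x => ?_
  rw [Function.comp, ← Complex.ofReal_re (∫ t in Ioi (0 : ℝ), B t * kk (l * (x - t))), key]
  congr 1
  rw [ ← integral_indicator measurableSet_Ioc]
  refine integral_congr_ae (ae_of_all _ fun y => ?_)
  by_cases hy : y ∈ Ioc (-1 : ℝ) 1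
  · simp only [indicator_of_mem hy, Function.comp, id, Circle.smul_def, Real.fourierChar_apply, smul_eq_mul]
    rw [← mul_assoc, mul_comm (Complex.exp _)]; congr 3; push_cast; ring
  · simp [indicator_of_notMem hy]
noncomputable def kJ (r : ℝ) : ℝ := ∫ u in (-r)..r, kk u

lemma kk_cv {l : ℝ} (hl : 0 < l) (c : ℝ) : Integrable (fun t => kk (l * (c - t))) :=
  (kk_int.comp_mul_left' hl.ne').comp_sub_left c

lemma kJ_cv {l : ℝ} (hl : 0 < l) {d : ℝ} (hd : 0 ≤ d) (c : ℝ) :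
    ∫ t in Ioc (c - d) (c + d), kk (l * (c - t)) = kJ (l * d) / l := by
  rw [← intervalIntegral.integral_of_le (by linarith)]
  simp_rw [mul_sub l c]
  rw [intervalIntegral.integral_comp_sub_mul (fun u => kk u) hl.ne' (l * c), kJ]
  rw [smul_eq_mul, div_eq_inv_mul]; congr 2 <;> ring

lemma kI_cv {l : ℝ} (hl : 0 < l) (c : ℝ) : ∫ t, kk (l * (c - t)) = (∫ u, kk u) / l := by
  rw [integral_sub_left_eq_self (fun t => kk (l * t)) volume c, Measure.integral_comp_mul_left,
    abs_of_pos (inv_pos.2 hl), smul_eq_mul, div_eq_inv_mul]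

lemma kJ_tendsto : Tendsto kJ atTop (𝓝 (∫ u, kk u)) :=
  intervalIntegral_tendsto_integral kk_int tendsto_neg_atTop_atBot tendsto_id

lemma kI_pos : 0 < ∫ u, kk u := by
  refine (integral_pos_iff_support_of_nonneg kk_nonneg kk_int).2 ?_
  refine lt_of_lt_of_le ?_ (measure_mono (show Ioo (0 : ℝ) (1 / 2) ⊆ _ from fun u hu => ?_))
  · simp
  · have hp := Real.pi_pos
    have : Real.cos (2 * Real.pi * u) < 1 := by
      rw [← Real.cos_zero]
      exact Real.cos_lt_cos_of_nonneg_of_le_pi le_rfl (by nlinarith [hu.2]) (by nlinarith [hu.1])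
    have : 0 < u := hu.1
    exact (div_pos (by linarith) (by positivity)).ne'

theorem tauber {A : ℝ → ℝ} (hA : Measurable A) {C : ℝ} (h0 : ∀ t, 0 ≤ A t) (hC : ∀ t, A t ≤ C)
    (hm : ∀ s t, s ≤ t → A s * Real.exp s ≤ A t * Real.exp t) {H : ℂ → ℂ}
    (hH : ContinuousOn H {z | 0 ≤ z.re})
    (hL : ∀ z : ℂ, 0 < z.re → ∫ t in Ioi (0 : ℝ), ((A t - 1 : ℝ) : ℂ) * Complex.exp (-z * t) = H z) :
    Tendsto A atTop (𝓝 1) := by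
  set I := ∫ u, kk u with hI
  have Ip : 0 < I := kI_pos
  have iA {l : ℝ} (hl : 0 < l) (c : ℝ) : Integrable (fun t => A t * kk (l * (c - t))) :=
    (kk_cv hl c).bdd_mul hA.aestronglyMeasurable (c := C) (ae_of_all _ fun t => by
      rw [Real.norm_of_nonneg (h0 t)]; exact hC t)
  have nn (l c t : ℝ) : 0 ≤ A t * kk (l * (c - t)) := mul_nonneg (h0 t) (kk_nonneg _)
  have kn {l : ℝ} (c t : ℝ) : 0 ≤ kk (l * (c - t)) := kk_nonneg _
  have P {l : ℝ} (hl : 0 < l) : Tendsto (fun x => ∫ t in Ioi (0 : ℝ), A t * kk (l * (x - t))) atTop (𝓝 (I / l)) := by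
    have h1 := conv_zero (hA.sub_const 1) (C := C + 1) (fun t => abs_le.2 ⟨by linarith [h0 t, hC t], by linarith [hC t]⟩) hH hL hl
    have h2 : Tendsto (fun x => ∫ t in Ioi (0 : ℝ), kk (l * (x - t))) atTop (𝓝 (I / l)) := by
      refine tendsto_of_tendsto_of_tendsto_of_le_of_le' ((kJ_tendsto.comp (tendsto_id.const_mul_atTop hl)).div_const l)
        tendsto_const_nhds ?_ (Eventually.of_forall fun x => ?_)
      · filter_upwards [eventually_ge_atTop 0] with x hx
        simp only [Function.comp, id]
        rw [← kJ_cv hl hx]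
        exact setIntegral_mono_set (kk_cv hl x).integrableOn (ae_of_all _ fun t => kk_nonneg _)
          (LE.le.eventuallyLE fun t ht => by simpa using ht.1)
      · rw [hI, ← kI_cv hl x]
        exact setIntegral_le_integral (kk_cv hl x) (ae_of_all _ fun t => kk_nonneg _)
    have h3 := h1.add h2
    rw [zero_add] at h3
    refine h3.congr fun x => ?_
    rw [← integral_add _ (kk_cv hl x).restrict]
    · simp_rw [sub_mul, one_mul, sub_add_cancel]
    · simp_rw [sub_mul, one_mul]; exact ((iA hl x).sub (kk_cv hl x)).restrict
  have Jl {l d : ℝ} (hl : 0 < l) (hd : 0 < d) : kJ (l * d) ≤ I := by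
    have := setIntegral_le_integral (kk_cv hl 0) (s := Ioc (0 - d) (0 + d)) (ae_of_all _ fun t => kk_nonneg _)
    rw [kJ_cv hl hd.le, kI_cv hl] at this
    rwa [div_le_div_iff_of_pos_right hl] at this
  have up {l d x : ℝ} (hl : 0 < l) (hd : 0 < d) (hx : 0 < x) : A x * Real.exp (-(2 * d)) * kJ (l * d) ≤
      l * ∫ t in Ioi (0 : ℝ), A t * kk (l * ((x + d) - t)) := by
    have h1 : ∫ t in Ioc (x + d - d) (x + d + d), A x * Real.exp (-(2 * d)) * kk (l * ((x + d) - t)) ≤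
        ∫ t in Ioi (0 : ℝ), A t * kk (l * ((x + d) - t)) := by
      refine le_trans (setIntegral_mono_on ((kk_cv hl _).integrableOn.const_mul _) (iA hl (x + d)).integrableOn measurableSet_Ioc
        fun t ht => ?_) (setIntegral_mono_set (iA hl (x + d)).integrableOn (ae_of_all _ fun t => nn _ _ _)
          (LE.le.eventuallyLE fun t ht => ?_))
      · refine mul_le_mul_of_nonneg_right ?_ (kk_nonneg _)
        have h2 := hm x t (by linarith [ht.1])
        have h3 : Real.exp t ≤ Real.exp x * Real.exp (2 * d) := by
          rw [← Real.exp_add]; exact Real.exp_le_exp.2 (by linarith [ht.2])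
        rw [Real.exp_neg, ← div_eq_mul_inv, div_le_iff₀ (Real.exp_pos _)]
        refine le_of_mul_le_mul_right (h2.trans ?_) (Real.exp_pos x)
        calc _ ≤ A t * (Real.exp x * Real.exp (2 * d)) := mul_le_mul_of_nonneg_left h3 (h0 t)
          _ = _ := by ring
      · have := ht.1; simp only [mem_Ioi]; linarith
    rw [integral_const_mul, kJ_cv hl hd.le] at h1
    calc _ = l * (A x * Real.exp (-(2 * d)) * (kJ (l * d) / l)) := by field_simp
      _ ≤ _ := by gcongr
  have low {l d x : ℝ} (hl : 0 < l) (hd : 0 < d) :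
      l * ∫ t in Ioi (0 : ℝ), A t * kk (l * ((x - d) - t)) ≤
      A x * Real.exp (2 * d) * kJ (l * d) + C * (I - kJ (l * d)) := by
    have h1 : ∫ t in Ioi (0 : ℝ), A t * kk (l * ((x - d) - t)) ≤ ∫ t, A t * kk (l * ((x - d) - t)) :=
      setIntegral_le_integral (iA hl _) (ae_of_all _ fun t => nn _ _ _)
    rw [← integral_add_compl (s := Ioc (x - d - d) (x - d + d)) measurableSet_Ioc (iA hl _)] at h1
    have h2 : ∫ t in Ioc (x - d - d) (x - d + d), A t * kk (l * ((x - d) - t)) ≤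
        ∫ t in Ioc (x - d - d) (x - d + d), A x * Real.exp (2 * d) * kk (l * ((x - d) - t)) := by
      refine setIntegral_mono_on (iA hl _).integrableOn ((kk_cv hl _).integrableOn.const_mul _) measurableSet_Ioc fun t ht => ?_
      refine mul_le_mul_of_nonneg_right ?_ (kk_nonneg _)
      have h2 := hm t x (by linarith [ht.2])
      have h3 : Real.exp x ≤ Real.exp (2 * d) * Real.exp t := by
        rw [← Real.exp_add]; exact Real.exp_le_exp.2 (by linarith [ht.1])
      refine le_of_mul_le_mul_right (h2.trans ?_) (Real.exp_pos t)
      rw [mul_assoc]; exact mul_le_mul_of_nonneg_left h3 (h0 x)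
    have h3 : ∫ t in (Ioc (x - d - d) (x - d + d))ᶜ, A t * kk (l * ((x - d) - t)) ≤
        ∫ t in (Ioc (x - d - d) (x - d + d))ᶜ, C * kk (l * ((x - d) - t)) :=
      setIntegral_mono_on (iA hl _).integrableOn ((kk_cv hl _).integrableOn.const_mul _) measurableSet_Ioc.compl
        fun t ht => mul_le_mul_of_nonneg_right (hC t) (kk_nonneg _)
    rw [integral_const_mul, kJ_cv hl hd.le] at h2
    rw [integral_const_mul, setIntegral_compl measurableSet_Ioc (kk_cv hl _), kJ_cv hl hd.le, kI_cv hl] at h3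
    calc _ ≤ l * (A x * Real.exp (2 * d) * (kJ (l * d) / l) + C * (I / l - kJ (l * d) / l)) := by
          gcongr; linarith
      _ = _ := by field_simp
  have Jt : Tendsto (fun d : ℝ => kJ (d⁻¹ ^ 2 * d)) (𝓝[>] 0) (𝓝 I) := by
    refine (kJ_tendsto.comp tendsto_inv_nhdsGT_zero).congr' ?_
    filter_upwards [self_mem_nhdsWithin] with d hd
    have : d ≠ 0 := ne_of_gt hd
    simp only [Function.comp]; congr 1; field_simp
  have E1 : Tendsto (fun d : ℝ => Real.exp (2 * d)) (𝓝[>] 0) (𝓝 1) := by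
    have : Continuous fun d : ℝ => Real.exp (2 * d) := by fun_prop
    simpa using (this.tendsto 0).mono_left (nhdsWithin_le_nhds (s := Ioi 0))
  have U : Tendsto (fun d : ℝ => Real.exp (2 * d) * I / kJ (d⁻¹ ^ 2 * d)) (𝓝[>] 0) (𝓝 1) := by
    have := (E1.mul_const I).div Jt Ip.ne'
    rwa [one_mul, div_self Ip.ne'] at this
  have V : Tendsto (fun d : ℝ => (I - C * (I - kJ (d⁻¹ ^ 2 * d))) / (Real.exp (2 * d) * kJ (d⁻¹ ^ 2 * d))) (𝓝[>] 0) (𝓝 1) := by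
    have := (((Jt.const_sub I).const_mul C).const_sub I).div (E1.mul Jt) (by simpa using Ip.ne')
    rwa [one_mul, sub_self, mul_zero, sub_zero, div_self Ip.ne'] at this
  have P0 : ∀ᶠ d : ℝ in 𝓝[>] 0, 0 < d := self_mem_nhdsWithin
  refine tendsto_order.2 ⟨fun b hb => ?_, fun b hb => ?_⟩
  · obtain ⟨d, hd1, hd2, hd3⟩ := ((V.eventually (lt_mem_nhds hb)).and (P0.and
      (Jt.eventually (lt_mem_nhds Ip)))).exists
    have hl : 0 < d⁻¹ ^ 2 := by positivity
    have T := (((P hl).comp (tendsto_atTop_add_const_right _ (-d) tendsto_id)).const_mul (d⁻¹ ^ 2)).sub_const (C * (I - kJ (d⁻¹ ^ 2 * d)))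
    have T := T.div_const (Real.exp (2 * d) * kJ (d⁻¹ ^ 2 * d))
    rw [mul_div_cancel₀ _ hl.ne'] at T
    filter_upwards [T.eventually (lt_mem_nhds hd1)] with x hx
    refine hx.trans_le ?_
    rw [div_le_iff₀ (by positivity)]
    have := low (x := x) hl hd2
    simp only [Function.comp, id, ← sub_eq_add_neg]; linarith
  · obtain ⟨d, hd1, hd2, hd3⟩ := ((U.eventually (gt_mem_nhds hb)).and (P0.and
      (Jt.eventually (lt_mem_nhds Ip)))).exists
    have hl : 0 < d⁻¹ ^ 2 := by positivity
    have T := ((((P hl).comp (tendsto_atTop_add_const_right _ d tendsto_id)).const_mul (d⁻¹ ^ 2)).const_mul (Real.exp (2 * d))).div_const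
      (kJ (d⁻¹ ^ 2 * d))
    rw [mul_div_cancel₀ _ hl.ne'] at T
    filter_upwards [T.eventually (gt_mem_nhds hd1), eventually_gt_atTop 0] with x hx hx0
    refine lt_of_le_of_lt ?_ hx
    rw [le_div_iff₀ hd3]
    have h5 := up (x := x) hl hd2 hx0
    have h6 : Real.exp (2 * d) * Real.exp (-(2 * d)) = 1 := by rw [← Real.exp_add]; simp
    simp only [Function.comp, id]
    calc _ = Real.exp (2 * d) * (A x * Real.exp (-(2 * d)) * kJ (d⁻¹ ^ 2 * d)) := by
          linear_combination (-A x * kJ (d⁻¹ ^ 2 * d)) * h6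
      _ ≤ _ := by gcongr
theorem wiener_ikehara {f : ℕ → ℝ} (hf : ∀ n, 0 ≤ f n) {C : ℝ} (hC0 : 0 ≤ C)
    (hC : ∀ n : ℕ, ∑ k ∈ Finset.Icc 1 n, f k ≤ C * n) {G : ℂ → ℂ} (hG : ContinuousOn G {s | 1 ≤ s.re})
    (hL : ∀ s : ℂ, 1 < s.re → LSeries (fun n => f n) s = 1 / (s - 1) + G s) :
    Tendsto (fun n : ℕ => (∑ k ∈ Finset.Icc 1 n, f k) / n) atTop (𝓝 1) := by
  set S : ℝ → ℝ := fun x => ∑ k ∈ Finset.Icc 1 ⌊x⌋₊, f k with hS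
  have Smono : Monotone S := fun x y h => Finset.sum_le_sum_of_subset_of_nonneg
    (Finset.Icc_subset_Icc le_rfl (Nat.floor_mono h)) fun _ _ _ => hf _
  have S0 (x) : 0 ≤ S x := Finset.sum_nonneg fun _ _ => hf _
  have SC {x : ℝ} (hx : 0 ≤ x) : S x ≤ C * x := (hC _).trans (by gcongr; exact Nat.floor_le hx)
  have Am : Measurable fun t : ℝ => S (Real.exp t) * Real.exp (-t) :=
    (Smono.measurable.comp Real.measurable_exp).mul (by fun_prop)
  have key : Tendsto (fun t : ℝ => S (Real.exp t) * Real.exp (-t)) atTop (𝓝 1) := by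
    have AC (t : ℝ) : S (Real.exp t) * Real.exp (-t) ≤ C := by
      rw [Real.exp_neg, ← div_eq_mul_inv, div_le_iff₀ (Real.exp_pos t)]; exact SC (Real.exp_pos t).le
    refine tauber Am (C := C) (fun t => mul_nonneg (S0 _) (Real.exp_pos _).le) AC (fun s t h => ?_)
      (H := fun z => (G (1 + z) - 1) / (1 + z)) ?_ ?_
    · rw [mul_assoc, mul_assoc, ← Real.exp_add, ← Real.exp_add]
      simpa using Smono (Real.exp_le_exp.2 h)
    · refine ContinuousOn.div ((hG.comp (by fun_prop) fun z hz => by simpa using hz).sub continuousOn_const)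
        (by fun_prop) fun z hz h => ?_
      have := congrArg Complex.re h
      simp at this hz; linarith
    · intro z hz
      have hs : 1 < (1 + z).re := by simpa using hz
      have hne : (1 + z) ≠ 0 := fun h => by rw [h] at hs; simp at hs; linarith
      have hz0 : z ≠ 0 := fun h => by simp [h] at hz
      have h1 := LSeries_eq_mul_integral_of_nonneg f (zero_le_one) hs (by
        refine Asymptotics.IsBigO.of_bound C (Eventually.of_forall fun n => ?_)
        rw [Real.norm_of_nonneg (Finset.sum_nonneg fun _ _ => hf _), Real.rpow_one, Real.norm_natCast]
        exact hC n) hf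
      have h2 : ∫ t in Ioi (1 : ℝ), (∑ k ∈ Finset.Icc 1 ⌊t⌋₊, (f k : ℂ)) * (t : ℂ) ^ (-(1 + z + 1)) =
          ∫ t in Ioi (0 : ℝ), ((S (Real.exp t) * Real.exp (-t) : ℝ) : ℂ) * Complex.exp (-z * t) := by
        have him : Real.exp '' Ioi 0 = Ioi 1 := by
          ext y; constructor
          · rintro ⟨t, ht, rfl⟩; exact Real.one_lt_exp_iff.2 ht
          · exact fun hy => ⟨Real.log y, Real.log_pos hy, Real.exp_log (by linarith [mem_Ioi.1 hy])⟩
        rw [← him, integral_image_eq_integral_abs_deriv_smul measurableSet_Ioi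
          (fun x _ => (Real.hasDerivAt_exp x).hasDerivWithinAt) Real.exp_injective.injOn]
        refine setIntegral_congr_fun measurableSet_Ioi fun t _ => ?_
        rw [abs_of_pos (Real.exp_pos t), Complex.real_smul, Complex.ofReal_exp, Complex.cpow_def_of_ne_zero (Complex.exp_ne_zero _)]
        rw [← Complex.ofReal_exp, ← Complex.ofReal_log (Real.exp_pos t).le, Real.log_exp]
        have : Complex.exp t * Complex.exp (t * -(1 + z + 1)) = Complex.exp (-t) * Complex.exp (-z * t) := by
          rw [← Complex.exp_add, ← Complex.exp_add]; ring_nf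
        simp only [hS]; push_cast
        linear_combination (∑ k ∈ Finset.Icc 1 ⌊Real.exp t⌋₊, (f k : ℂ)) * this
      have i1 : IntegrableOn (fun t : ℝ => Complex.exp (-z * t)) (Ioi 0) :=
        integrableOn_exp_mul_complex_Ioi (by simpa using hz) 0
      have h3 : ∫ t in Ioi (0 : ℝ), Complex.exp (-z * t) = 1 / z := by
        rw [integral_exp_mul_complex_Ioi (by simpa using hz)]; simp [div_neg, neg_div]
      simp only [Complex.ofReal_sub, sub_mul, Complex.ofReal_one, one_mul]
      rw [integral_sub _ i1, h3, ← h2]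
      · rw [hL _ hs] at h1
        have h4 : (1 / z + G (1 + z)) / (1 + z) = ∫ t in Ioi (1 : ℝ), (∑ k ∈ Finset.Icc 1 ⌊t⌋₊, (f k : ℂ)) * (t : ℂ) ^ (-(1 + z + 1)) := by
          rw [div_eq_iff hne, mul_comm, ← h1]; simp
        rw [← h4]; field_simp; ring
      · refine i1.bdd_mul (c := C) (Complex.measurable_ofReal.comp Am).aestronglyMeasurable (ae_of_all _ fun t => ?_)
        rw [Complex.norm_real, Real.norm_of_nonneg (mul_nonneg (S0 _) (Real.exp_pos _).le)]; exact AC t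
  refine (key.comp (Real.tendsto_log_atTop.comp tendsto_natCast_atTop_atTop)).congr' ?_
  filter_upwards [eventually_gt_atTop 0] with n hn
  have : (0 : ℝ) < n := by exact_mod_cast hn
  simp [hS, Real.exp_neg, Real.exp_log this, div_eq_mul_inv]
section A2
open NumberField NumberField.mixedEmbedding NumberField.mixedEmbedding.fundamentalCone
open NumberField.InfinitePlace NumberField.Units NumberField.Units.dirichletUnitTheorem
open scoped Classical nonZeroDivisors
variable (K : Type*) [Field K] [NumberField K]

noncomputable def pb (t ε : ℝ) : Set (realSpace K) :=
  univ.pi fun w => if w = w₀ then Iic t else Ico (-ε) (1 + ε)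

noncomputable def mbox (t ε : ℝ) : Set (mixedSpace K) :=
  normAtAllPlaces ⁻¹' (expMapBasis '' pb K t ε)

lemma meas_pb (t ε : ℝ) : MeasurableSet (pb K t ε) := by
  refine MeasurableSet.univ_pi fun _ ↦ ?_
  split_ifs
  · exact measurableSet_Iic
  · exact measurableSet_Ico

lemma meas_mbox (t ε : ℝ) : MeasurableSet (mbox K t ε) := by
  refine MeasurableSet.preimage ?_ (continuous_normAtAllPlaces K).measurable
  exact MeasurableSet.image_of_continuousOn_injOn (meas_pb K t ε)
    (continuous_expMapBasis K).continuousOn (injective_expMapBasis K).injOn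

lemma vol_mbox : ∃ c : ℝ, 0 < c ∧ ∃ r : ℕ, ∀ t ε : ℝ, -1/2 < ε → volume (mbox K t ε) =
    ENNReal.ofReal (c * Real.exp (Module.finrank ℚ K * t) * (1 + 2 * ε) ^ r) := by
  have hn : 0 < (Module.finrank ℚ K : ℝ) := Nat.cast_pos.mpr Module.finrank_pos
  refine ⟨(2 ^ nrRealPlaces K * (2 * Real.pi) ^ nrComplexPlaces K) *
    ((2:ℝ)⁻¹ ^ nrComplexPlaces K * (regulator K) * (Module.finrank ℚ K)) / Module.finrank ℚ K,
    ?_, (Finset.univ.erase (w₀ : InfinitePlace K)).card, fun t ε hε => ?_⟩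
  · have := regulator_pos K
    positivity
  have := regulator_pos K
  have hpi := Real.pi_pos
  have h1 : (0:ℝ) < 1 + 2 * ε := by linarith
  rw [mbox, volume_eq_two_pow_mul_two_pi_pow_mul_integral Set.preimage_image_preimage
    (meas_mbox K t ε), normAtAllPlaces_image_preimage_expMapBasis,
    setLIntegral_expMapBasis_image (meas_pb K t ε) (by fun_prop)]
  simp_rw [ENNReal.inv_mul_cancel_right
    (Finset.prod_ne_zero_iff.mpr fun _ _ ↦ ENNReal.ofReal_ne_zero_iff.mpr (expMapBasis_pos _ _))
    (ENNReal.prod_ne_top fun _ _ ↦ ENNReal.ofReal_ne_top)]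
  have key : ∫⁻ (x : realSpace K) in pb K t ε, .ofReal (Real.exp (x w₀ * Module.finrank ℚ K)) =
      ENNReal.ofReal (Real.exp (Module.finrank ℚ K * t) / Module.finrank ℚ K *
        (1 + 2 * ε) ^ (Finset.univ.erase (w₀ : InfinitePlace K)).card) := by
    rw [volume_pi, pb, Measure.restrict_pi_pi, lintegral_eq_lmarginal_univ 0,
      lmarginal_erase' _ (by fun_prop) (Finset.mem_univ w₀), if_pos rfl]
    simp_rw [Function.update_self, lmarginal, lintegral_const, Measure.pi_univ, if_neg
      (Finset.ne_of_mem_erase (Subtype.prop _)), Measure.restrict_apply_univ, Real.volume_Ico,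
      mul_comm _ (Module.finrank ℚ K : ℝ)]
    rw [← ofReal_integral_eq_lintegral_ofReal
      (integrableOn_exp_mul_Iic hn _), integral_exp_mul_Iic hn, ENNReal.ofReal_mul (by positivity)]
    · congr 1
      rw [Finset.prod_const, ENNReal.ofReal_pow h1.le, Finset.card_univ, Fintype.card_coe]
      congr 2; ring
    · filter_upwards with _ using Real.exp_nonneg _
  rw [key]
  rw [show (2:ENNReal)⁻¹ = ENNReal.ofReal (2:ℝ)⁻¹ by
    rw [ENNReal.ofReal_inv_of_pos two_pos]; simp,
    show (2:ENNReal) ^ nrRealPlaces K = ENNReal.ofReal (2 ^ nrRealPlaces K) by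
    rw [ENNReal.ofReal_pow two_pos.le]; simp, ← ENNReal.ofReal_natCast,
    ← ENNReal.ofReal_pow (by positivity), ← ENNReal.ofReal_pow (by positivity),
    ← ENNReal.ofReal_mul (by positivity), ← ENNReal.ofReal_mul (by positivity),
    ← ENNReal.ofReal_mul (by positivity), ← ENNReal.ofReal_mul (by positivity),
    ← ENNReal.ofReal_mul (by positivity)]
  congr 1
  field_simp

lemma abs_log_sub {a b c d : ℝ} (hc : 0 < c) (ha : c ≤ a) (hab : |b - a| ≤ d) (hd : d ≤ c / 2) :
    0 < b ∧ |Real.log b - Real.log a| ≤ 2 * d / c := by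
  have h := abs_le.mp hab
  have ha0 : 0 < a := by linarith
  have hb : c / 2 ≤ b := by linarith
  have hb0 : 0 < b := by linarith
  refine ⟨hb0, ?_⟩
  have hd0 : 0 ≤ d := (abs_nonneg _).trans hab
  have e1 := Real.log_le_sub_one_of_pos (div_pos hb0 ha0)
  have e2 := Real.log_le_sub_one_of_pos (div_pos ha0 hb0)
  rw [Real.log_div hb0.ne' ha0.ne'] at e1
  rw [Real.log_div ha0.ne' hb0.ne'] at e2
  have f1 : b / a - 1 ≤ 2 * d / c := by
    rw [div_sub_one ha0.ne', div_le_div_iff₀ ha0 hc]; nlinarith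
  have f2 : a / b - 1 ≤ 2 * d / c := by
    rw [div_sub_one hb0.ne', div_le_div_iff₀ hb0 hc]; nlinarith
  rw [abs_le]; constructor <;> linarith

lemma pert (d : ℝ) (hd : 0 < d) : ∃ C s₀ : ℝ, 0 < C ∧ ∀ s ≥ s₀, ∀ (y y' : mixedSpace K) (x : realSpace K),
    normAtAllPlaces y = expMapBasis x → (∀ w, w ≠ w₀ → x w ∈ Icc (-1 : ℝ) 2) → s ≤ x w₀ →
    ‖y' - y‖ ≤ d → ∃ x' : realSpace K, normAtAllPlaces y' = expMapBasis x' ∧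
      ∀ w, |x' w - x w| ≤ C * Real.exp (-s) := by
  obtain ⟨c, hc0, hc⟩ : ∃ c : ℝ, 0 < c ∧ ∀ x : realSpace K,
      (∀ w, w ≠ w₀ → x w ∈ Icc (-1 : ℝ) 2) → ∀ w, c * Real.exp (x w₀) ≤ expMapBasis x w := by
    have hcomp : IsCompact (univ.pi fun w : InfinitePlace K => if w = w₀ then ({0} : Set ℝ) else Icc (-1) 2) :=
      isCompact_univ_pi fun w => by split_ifs; exacts [isCompact_singleton, isCompact_Icc]
    have hw : ∀ w : InfinitePlace K, ∃ c : ℝ, 0 < c ∧ ∀ x ∈ (univ.pi fun w : InfinitePlace K => if w = w₀ then ({0} : Set ℝ) else Icc (-1) 2), c ≤ expMapBasis x w := by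
      intro w
      obtain ⟨z, _, hz⟩ := hcomp.exists_isMinOn (f := fun x => expMapBasis x w)
        ⟨fun w => 0, by intro w _; dsimp only; split_ifs <;> simp⟩
        ((continuous_apply w).comp (continuous_expMapBasis K)).continuousOn
      exact ⟨_, expMapBasis_pos z w, fun x hx => hz hx⟩
    choose c hc0 hc using hw
    refine ⟨Finset.univ.inf' Finset.univ_nonempty c, by simp [Finset.lt_inf'_iff, hc0], fun x hx w => ?_⟩
    rw [expMapBasis_apply'', mul_comm, Pi.smul_apply, smul_eq_mul]
    gcongr
    refine (Finset.inf'_le c (Finset.mem_univ w)).trans (hc w _ ?_)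
    intro v _
    dsimp only
    split_ifs with h
    · rfl
    · exact hx v h
  obtain ⟨B, hB0, hB⟩ : ∃ B : ℝ, 0 < B ∧ ∀ v : realSpace K, ∀ w,
      |(completeBasis K).equivFun v w| ≤ B * ‖v‖ := by
    let L : realSpace K →L[ℝ] realSpace K := LinearMap.toContinuousLinearMap
      ((completeBasis K).equivFun : realSpace K →ₗ[ℝ] realSpace K)
    refine ⟨‖L‖ + 1, by positivity, fun v w => ?_⟩
    refine (norm_le_pi_norm (L v) w).trans ((L.le_opNorm v).trans ?_)
    gcongr; linarith
  obtain ⟨M, hM⟩ : ∃ M : ℝ, 0 < M ∧ ∀ w : InfinitePlace K, (w.mult : ℝ) ≤ M :=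
    ⟨2, two_pos, fun w => by exact_mod_cast (by unfold mult; split_ifs <;> simp)⟩
  refine ⟨B * (M * (2 * d / c)), Real.log (2 * d / c), by have := hM.1; positivity, fun s hs y y' x hy hx hsx hyy => ?_⟩
  have hes : 2 * d ≤ c * Real.exp s := by
    have := Real.exp_le_exp.mpr hs
    rw [Real.exp_log (by positivity), div_le_iff₀ hc0] at this
    linarith
  have hbase : ∀ w, 0 < normAtAllPlaces y' w ∧
      |Real.log (normAtAllPlaces y' w) - Real.log (expMapBasis x w)| ≤ 2 * d / (c * Real.exp s) := by
    intro w
    refine abs_log_sub (c := c * Real.exp s) (by positivity) (le_trans ?_ (hc x hx w)) ?_ (by linarith)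
    · gcongr
    · rw [← hy, normAtAllPlaces_apply, normAtAllPlaces_apply]
      have h1 : ∀ z : mixedSpace K, normAtPlace w z ≤ ‖z‖ := fun z => by
        rw [norm_eq_sup'_normAtPlace]; exact Finset.le_sup' (fun w => normAtPlace w z) (Finset.mem_univ w)
      have h2 := normAtPlace_add_le w (y' - y) y
      have h3 := normAtPlace_add_le w (y - y') y'
      have h4 := h1 (y' - y)
      have h5 := h1 (y - y')
      rw [norm_sub_rev] at h5
      simp only [sub_add_cancel] at h2 h3
      rw [abs_le]; constructor <;> linarith
  have hpos : normAtAllPlaces y' ∈ (expMapBasis (K := K)).target := by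
    refine Set.mem_univ_pi.mpr (fun w => (hbase w).1)
  refine ⟨expMapBasis.symm (normAtAllPlaces y'), (expMapBasis.right_inv hpos).symm, fun w => ?_⟩
  have e1 : ∀ z : realSpace K, expMapBasis.symm z = (completeBasis K).equivFun (expMap.symm z) :=
    fun z => rfl
  have e2 : x = (completeBasis K).equivFun (expMap.symm (expMapBasis x)) := by
    rw [← e1, expMapBasis.left_inv (by simp [expMapBasis_source])]
  rw [e1]
  conv_lhs => rw [e2]
  rw [← Pi.sub_apply, ← map_sub]
  refine (hB _ w).trans ?_
  rw [show B * (M * (2 * d / c)) * Real.exp (-s) = B * (M * (2 * d / (c * Real.exp s))) by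
    rw [Real.exp_neg]; field_simp]
  gcongr
  have := hM.1
  refine (pi_norm_le_iff_of_nonneg (by positivity)).mpr fun v => ?_
  rw [Pi.sub_apply, expMap_symm_apply, expMap_symm_apply, ← mul_sub, norm_mul, Real.norm_natCast]
  exact mul_le_mul (hM.2 v) (hbase v).2 (norm_nonneg _) hM.1.le
end A2
section A2b
open NumberField NumberField.mixedEmbedding NumberField.mixedEmbedding.fundamentalCone
open NumberField.InfinitePlace NumberField.Units NumberField.Units.dirichletUnitTheorem
open scoped Classical nonZeroDivisors

lemma sandwich_up {E ι : Type*} [NormedAddCommGroup E] [NormedSpace ℝ E] [MeasurableSpace E]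
    [BorelSpace E] [FiniteDimensional ℝ E] (μ : Measure E) [μ.IsAddHaarMeasure] [Fintype ι]
    (b : Module.Basis ι ℝ E) (A : Finset E) (hA : ∀ a ∈ A, a ∈ Submodule.span ℤ (Set.range b))
    (U : Set E) (h : ∀ a ∈ A, ∀ f ∈ ZSpan.fundamentalDomain b, a + f ∈ U) :
    A.card * μ (ZSpan.fundamentalDomain b) ≤ μ U := by
  have : ∀ a : E, MeasurableSet ((fun f => a + f) '' ZSpan.fundamentalDomain b) := fun a =>
    (Homeomorph.addLeft a).measurableEmbedding.measurableSet_image.mpr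
      (ZSpan.fundamentalDomain_measurableSet b)
  calc A.card * μ (ZSpan.fundamentalDomain b) =
      ∑ a ∈ A, μ ((fun f => a + f) '' ZSpan.fundamentalDomain b) := by
        simp only [image_add_left, measure_preimage_add, Finset.sum_const, nsmul_eq_mul]
    _ = μ (⋃ a ∈ A, (fun f => a + f) '' ZSpan.fundamentalDomain b) := by
        rw [measure_biUnion_finset _ (fun a _ => this a)]
        intro a ha a' ha' hne
        rw [Function.onFun, Set.disjoint_left]
        rintro _ ⟨f, hf, rfl⟩ ⟨f', hf', h'⟩
        apply hne
        obtain ⟨v, _, hv⟩ := ZSpan.exist_unique_vadd_mem_fundamentalDomain b (a + f)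
        have e1 := hv ⟨-a, neg_mem (hA a ha)⟩ (by simpa [Submodule.vadd_def] using hf)
        have e2 := hv ⟨-a', neg_mem (hA a' ha')⟩ (by
          simp only [Submodule.vadd_def, vadd_eq_add] ; rw [show a + f = a' + f' from h'.symm]; simpa using hf')
        have := congrArg Subtype.val (e1.trans e2.symm)
        simpa using this
    _ ≤ μ U := measure_mono (by
        intro x hx
        simp only [mem_iUnion, mem_image] at hx
        obtain ⟨a, ha, f, hf, rfl⟩ := hx
        exact h a ha f hf)

lemma sandwich_low {E ι : Type*} [NormedAddCommGroup E] [NormedSpace ℝ E] [MeasurableSpace E]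
    [BorelSpace E] [FiniteDimensional ℝ E] (μ : Measure E) [μ.IsAddHaarMeasure] [Fintype ι]
    (b : Module.Basis ι ℝ E) (A : Finset E)
    (W : Set E) (h : ∀ a ∈ Submodule.span ℤ (Set.range b), ∀ f ∈ ZSpan.fundamentalDomain b,
      a + f ∈ W → a ∈ A) :
    μ W ≤ A.card * μ (ZSpan.fundamentalDomain b) := by
  calc μ W ≤ μ (⋃ a ∈ A, (fun f => a + f) '' ZSpan.fundamentalDomain b) := by
        apply measure_mono
        intro y hy
        obtain ⟨v, hv, _⟩ := ZSpan.exist_unique_vadd_mem_fundamentalDomain b y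
        simp only [mem_iUnion, mem_image]
        refine ⟨-v, h _ (neg_mem v.2) _ hv ?_, _, hv, ?_⟩ <;> simp [Submodule.vadd_def, hy]
    _ ≤ ∑ a ∈ A, μ ((fun f => a + f) '' ZSpan.fundamentalDomain b) := measure_biUnion_finset_le _ _
    _ = _ := by simp only [image_add_left, measure_preimage_add, Finset.sum_const, nsmul_eq_mul]

variable (K : Type*) [Field K] [NumberField K]

lemma mem_mbox {t ε : ℝ} {y : mixedSpace K} : y ∈ mbox K t ε ↔ ∃ x : realSpace K,
    normAtAllPlaces y = expMapBasis x ∧ x w₀ ≤ t ∧ ∀ w, w ≠ w₀ → -ε ≤ x w ∧ x w < 1 + ε := by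
  constructor
  · rintro ⟨x, hx, h⟩
    refine ⟨x, h.symm, ?_, fun w hw => ?_⟩
    · simpa using hx w₀ trivial
    · simpa [hw] using hx w trivial
  · rintro ⟨x, h, h0, h1⟩
    refine ⟨x, fun w _ => ?_, h.symm⟩
    dsimp only
    split_ifs with hw
    · rw [hw]; exact h0
    · exact h1 w hw

lemma mbox_zero (t : ℝ) (y : mixedSpace K) :
    y ∈ mbox K t 0 ↔ y ∈ fundamentalCone K ∧ mixedEmbedding.norm y ≤ Real.exp t ^ Module.finrank ℚ K := by
  have hshift : ∀ (x : realSpace K) (u : ℝ), expMapBasis (fun w => if w = w₀ then x w + u else x w) =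
      Real.exp u • expMapBasis x := by
    intro x u
    rw [expMapBasis_apply', expMapBasis_apply' x, smul_smul, if_pos rfl, ← Real.exp_add, add_comm u]
    conv_lhs =>
      enter [2, w, 2, i]
      rw [if_neg i.prop]
  have e0 : (0:ℝ) < Real.exp (-t) := Real.exp_pos _
  have h1 : y ∈ mbox K t 0 ↔ Real.exp (-t) • y ∈ normLeOne K := by
    rw [normLeOne_eq_preimage, show (normAtAllPlaces ⁻¹' (expMapBasis '' paramSet K)) = mbox K 0 0 by
      simp [mbox, pb, paramSet], mem_mbox, mem_mbox]
    have hs : ∀ (u : ℝ) (z : mixedSpace K),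
        normAtAllPlaces (Real.exp u • z) = Real.exp u • normAtAllPlaces z := by
      intro u z
      ext w
      simp [normAtAllPlaces_apply, normAtPlace_smul]
    constructor
    · rintro ⟨x, h, h0, h1⟩
      refine ⟨fun w => if w = w₀ then x w + -t else x w, ?_, by simpa using h0, fun w hw => ?_⟩
      · rw [hshift, hs, h]
      · simpa [hw] using h1 w hw
    · rintro ⟨x, h, h0, h1⟩
      refine ⟨fun w => if w = w₀ then x w + t else x w, ?_, by simpa using h0, fun w hw => ?_⟩
      · rw [hshift, ← h, ← hs, smul_smul, ← Real.exp_add]; simp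
      · simpa [hw] using h1 w hw
  rw [h1, mem_normLeOne, smul_mem_iff_mem e0.ne', mixedEmbedding.norm_smul, abs_of_pos e0,
    Real.exp_neg, inv_pow, inv_mul_le_iff₀ (by positivity), mul_one]

end A2b
section A2c
open NumberField NumberField.mixedEmbedding NumberField.mixedEmbedding.fundamentalCone
open NumberField.InfinitePlace NumberField.Units NumberField.Units.dirichletUnitTheorem
open scoped Classical nonZeroDivisors
variable (K : Type*) [Field K] [NumberField K]

lemma count_ineq {ι : Type*} [Fintype ι] (b : Module.Basis ι ℝ (mixedSpace K))
    (hfin : ∀ t, ({a | a ∈ Submodule.span ℤ (Set.range b) ∧ a ∈ mbox K t 0}).Finite) :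
    ∃ C c v : ℝ, 0 < C ∧ 0 < c ∧ 0 < v ∧ ∃ r : ℕ, ∀ᶠ s in atTop, ∀ ε, ε = C * Real.exp (-s) →
    v * ({a | a ∈ Submodule.span ℤ (Set.range b) ∧ a ∈ mbox K (2 * s) 0}).ncard ≤
      c * Real.exp (Module.finrank ℚ K * (2 * s + ε)) * (1 + 2 * ε) ^ r +
      v * ({a | a ∈ Submodule.span ℤ (Set.range b) ∧ a ∈ mbox K s 0}).ncard ∧
    c * Real.exp (Module.finrank ℚ K * (2 * s - ε)) * (1 - 2 * ε) ^ r
       ≤ v * ({a | a ∈ Submodule.span ℤ (Set.range b) ∧ a ∈ mbox K (2 * s) 0}).ncard +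
       c * Real.exp (Module.finrank ℚ K * (s + ε)) * (1 - 2 * ε) ^ r := by
  obtain ⟨d, hd0, hd⟩ := (ZSpan.fundamentalDomain_isBounded b).exists_pos_norm_le
  obtain ⟨C, s₀, hC, hpert⟩ := pert K d hd0
  obtain ⟨c, hc, r, hvol⟩ := vol_mbox K
  have hv0 : volume (ZSpan.fundamentalDomain b) ≠ 0 := ZSpan.measure_fundamentalDomain_ne_zero b
  have hv1 : volume (ZSpan.fundamentalDomain b) ≠ ⊤ :=
    (ZSpan.fundamentalDomain_isBounded b).measure_lt_top.ne
  have hlim : Tendsto (fun s => C * Real.exp (-s)) atTop (𝓝 0) := by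
    simpa using (Real.tendsto_exp_neg_atTop_nhds_zero.const_mul C)
  refine ⟨C, c, volume.real (ZSpan.fundamentalDomain b), hC, hc,
    ENNReal.toReal_pos hv0 hv1, r, ?_⟩
  filter_upwards [hlim.eventually (gt_mem_nhds (show (0:ℝ) < 1/4 by norm_num)),
    eventually_ge_atTop s₀, eventually_ge_atTop 1] with s h14 hs hs1 ε hε
  rw [← hε] at h14
  have hε0 : 0 < ε := by rw [hε]; positivity
  set Sg := Submodule.span ℤ (Set.range b) with hSg
  have hsub : ({a | a ∈ Sg ∧ a ∈ mbox K s 0}) ⊆ {a | a ∈ Sg ∧ a ∈ mbox K (2 * s) 0} := by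
    rintro a ⟨h1, h2⟩
    refine ⟨h1, ?_⟩
    obtain ⟨x, h, h0, h'⟩ := (mem_mbox K).mp h2
    exact (mem_mbox K).mpr ⟨x, h, by linarith, h'⟩
  set A : Finset (mixedSpace K) := (hfin (2 * s)).toFinset \ (hfin s).toFinset with hA
  have hAc : ((A.card : ℕ) : ℝ) = ({a | a ∈ Sg ∧ a ∈ mbox K (2 * s) 0}).ncard -
      ({a | a ∈ Sg ∧ a ∈ mbox K s 0}).ncard := by
    rw [hA, Finset.card_sdiff_of_subset (by simpa using hsub), Nat.cast_sub
      (Finset.card_le_card (by simpa using hsub)), Set.ncard_eq_toFinset_card _ (hfin _),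
      Set.ncard_eq_toFinset_card _ (hfin _)]
  have hAm : ∀ a, a ∈ A ↔ a ∈ Sg ∧ a ∈ mbox K (2 * s) 0 ∧ a ∉ mbox K s 0 := by
    intro a; simp [hA]; tauto
  constructor
  · have := sandwich_up volume b A (fun a ha => ((hAm a).mp ha).1) (mbox K (2 * s + ε) ε) (by
      intro a ha f hf
      obtain ⟨_, h2, h3⟩ := (hAm a).mp ha
      obtain ⟨x, h, h0, h'⟩ := (mem_mbox K).mp h2
      have hsx : s ≤ x w₀ := by
        by_contra hlt
        exact h3 ((mem_mbox K).mpr ⟨x, h, (not_le.mp hlt).le, h'⟩)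
      obtain ⟨x', hx', hxx⟩ := hpert s hs a (a + f) x h (fun w hw => by
        have := h' w hw; constructor <;> linarith) hsx (by simpa using hd f hf)
      rw [← hε] at hxx
      refine (mem_mbox K).mpr ⟨x', hx', ?_, fun w hw => ?_⟩
      · linarith [abs_le.mp (hxx w₀)]
      · have := abs_le.mp (hxx w)
        have := h' w hw
        constructor <;> linarith)
    rw [hvol _ _ (by linarith)] at this
    have := ENNReal.toReal_mono ENNReal.ofReal_ne_top this
    rw [ENNReal.toReal_mul, ENNReal.toReal_ofReal (by positivity), ENNReal.toReal_natCast, hAc] at this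
    simp only [Measure.real]
    linarith
  · have := sandwich_low volume b A (mbox K (2 * s - ε) (-ε) \ mbox K (s + ε) (-ε)) (by
      rintro a ha f hf ⟨h2, h3⟩
      obtain ⟨x, h, h0, h'⟩ := (mem_mbox K).mp h2
      have hsx : s + ε < x w₀ := by
        by_contra hlt
        exact h3 ((mem_mbox K).mpr ⟨x, h, (not_lt.mp hlt), h'⟩)
      obtain ⟨x', hx', hxx⟩ := hpert s hs (a + f) a x h (fun w hw => by
        have := h' w hw; constructor <;> linarith) (by linarith) (by simpa using hd f hf)
      rw [← hε] at hxx
      have hw0 := abs_le.mp (hxx w₀)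
      refine (hAm a).mpr ⟨ha, (mem_mbox K).mpr ⟨x', hx', ?_, fun w hw => ?_⟩, fun hc => ?_⟩
      · linarith
      · have := abs_le.mp (hxx w)
        have := h' w hw
        constructor <;> linarith
      · obtain ⟨x'', hx'', h0'', _⟩ := (mem_mbox K).mp hc
        have := injective_expMapBasis K (hx'.symm.trans hx'')
        rw [← this] at h0''
        linarith)
    have h2 := (le_measure_sdiff (μ := volume)).trans this
    rw [hvol _ _ (by linarith), hvol _ _ (by linarith), tsub_le_iff_right] at h2
    have := ENNReal.toReal_mono (by finiteness) h2
    rw [ENNReal.toReal_add (by finiteness) (by finiteness), ENNReal.toReal_mul,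
      ENNReal.toReal_ofReal (by have : 0 < 1 + 2 * -ε := by linarith
                                positivity),
      ENNReal.toReal_ofReal (by have : 0 < 1 + 2 * -ε := by linarith
                                positivity), ENNReal.toReal_natCast, hAc] at this
    simp only [Measure.real]
    have h3 : 0 ≤ (volume (ZSpan.fundamentalDomain b)).toReal * (({a | a ∈ Sg ∧ a ∈ mbox K s 0}).ncard : ℝ) := by
      positivity
    rw [show 1 + 2 * -ε = 1 - 2 * ε by ring] at this
    linarith

lemma count_asymp {ι : Type*} [Fintype ι] (b : Module.Basis ι ℝ (mixedSpace K)) (N : ℝ → ℝ)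
    (hN : ∀ t, N (Real.exp t ^ Module.finrank ℚ K) =
      ({a | a ∈ Submodule.span ℤ (Set.range b) ∧ a ∈ mbox K t 0}).ncard)
    (hfin : ∀ t, ({a | a ∈ Submodule.span ℤ (Set.range b) ∧ a ∈ mbox K t 0}).Finite)
    (hO : N =O[atTop] (fun T => T)) : ∃ κ : ℝ, 0 < κ ∧
    (fun T => N T - κ * T) =O[atTop] (fun T : ℝ => T ^ (1 - 1 / (2 * Module.finrank ℚ K) : ℝ)) := by
  obtain ⟨C, c, v, hC, hc, hv, r, h⟩ := count_ineq K b hfin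
  have hn : 0 < (Module.finrank ℚ K : ℝ) := Nat.cast_pos.mpr Module.finrank_pos
  have hn1 : 1 ≤ (Module.finrank ℚ K : ℝ) := by exact_mod_cast Module.finrank_pos (R := ℚ) (M := K)
  set n : ℝ := (Module.finrank ℚ K : ℝ) with hndef
  refine ⟨c / v, by positivity, ?_⟩
  set φ : ℝ → ℝ := fun ε => Real.exp (n * ε) * (1 + 2 * ε) ^ r
  have hφ : (fun ε => φ ε - 1) =O[𝓝 0] (fun ε => ε) := by
    have : DifferentiableAt ℝ φ 0 := by fun_prop
    simpa [φ] using this.isBigO_sub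
  set s : ℝ → ℝ := fun T => Real.log T / (2 * n)
  have hs : Tendsto s atTop atTop := Real.tendsto_log_atTop.atTop_div_const (by positivity)
  set e : ℝ → ℝ := fun T => C * Real.exp (-(s T))
  have he : Tendsto e atTop (𝓝 0) := by
    simpa using ((Real.tendsto_exp_neg_atTop_nhds_zero.comp hs).const_mul C)
  have heT : ∀ T > 0, e T * T = C * T ^ (1 - 1 / (2 * n)) := by
    intro T hT
    simp only [e, s]
    rw [Real.rpow_def_of_pos hT, mul_assoc]
    nth_rewrite 2 [← Real.exp_log hT]
    rw [← Real.exp_add]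
    congr 2; field_simp; ring
  have hsT : ∀ T > 0, Real.exp (n * (2 * s T)) = T := by
    intro T hT
    rw [show n * (2 * s T) = Real.log T by simp only [s]; field_simp, Real.exp_log hT]
  have hsT2 : ∀ T > 0, Real.exp (n * s T) = T ^ (1/2 : ℝ) := by
    intro T hT
    rw [Real.rpow_def_of_pos hT]; congr 1; simp only [s]; field_simp
  have b1 : (fun T => (φ (e T) - 1) * T) =O[atTop] (fun T : ℝ => T ^ (1 - 1 / (2 * n))) := by
    have := (hφ.comp_tendsto he).mul (isBigO_refl (fun T : ℝ => T) atTop)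
    refine this.trans (IsBigO.of_bound C ?_)
    filter_upwards [eventually_gt_atTop 0] with T hT
    simp only [Function.comp]
    rw [heT T hT, norm_mul, Real.norm_of_nonneg hC.le]
  have b2 : (fun T => (φ (-e T) - 1) * T) =O[atTop] (fun T : ℝ => T ^ (1 - 1 / (2 * n))) := by
    have he' : Tendsto (fun T => - e T) atTop (𝓝 0) := by simpa using he.neg
    have := (hφ.comp_tendsto he').mul (isBigO_refl (fun T : ℝ => T) atTop)
    refine this.trans (IsBigO.of_bound C ?_)
    filter_upwards [eventually_gt_atTop 0] with T hT
    simp only [Function.comp]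
    rw [neg_mul, norm_neg, heT T hT, norm_mul, Real.norm_of_nonneg hC.le]
  have b0 : (fun T : ℝ => T ^ (1/2 : ℝ)) =O[atTop] (fun T : ℝ => T ^ (1 - 1 / (2 * n))) := by
    refine IsBigO.of_bound 1 ?_
    filter_upwards [eventually_ge_atTop 1] with T hT
    rw [one_mul, Real.norm_of_nonneg (by positivity), Real.norm_of_nonneg (by positivity)]
    refine Real.rpow_le_rpow_of_exponent_le hT ?_
    have : 1 / (2 * n) ≤ 1 / 2 := by gcongr; linarith
    linarith
  have b3 : (fun T => N (T ^ (1/2 : ℝ))) =O[atTop] (fun T : ℝ => T ^ (1 - 1 / (2 * n))) :=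
    (hO.comp_tendsto (tendsto_rpow_atTop (by norm_num))).trans b0
  have b4 : (fun T => Real.exp (n * (s T + e T)) * (1 - 2 * e T) ^ r) =O[atTop]
      (fun T : ℝ => T ^ (1 - 1 / (2 * n))) := by
    have : Tendsto (fun T => Real.exp (n * e T) * (1 - 2 * e T) ^ r) atTop
        (𝓝 (Real.exp (n * 0) * (1 - 2 * 0) ^ r)) :=
      ((Real.continuous_exp.tendsto _).comp (he.const_mul n)).mul
        ((tendsto_const_nhds.sub (he.const_mul 2)).pow r)
    have h2 := (this.isBigO_one ℝ).mul b0
    simp only [one_mul] at h2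
    refine h2.congr' ?_ (EventuallyEq.refl _ _)
    filter_upwards [eventually_gt_atTop 0] with T hT
    rw [mul_add, Real.exp_add, hsT2 T hT]; ring
  have main : (fun T => v * N T - c * T) =O[atTop] (fun T : ℝ => T ^ (1 - 1 / (2 * n))) := by
    have hsum := ((b1.norm_left.const_mul_left c).add ((b2.norm_left.const_mul_left c).add
      ((b3.norm_left.const_mul_left v).add (b4.norm_left.const_mul_left c))))
    refine IsBigO.trans (IsBigO.of_bound 1 ?_) hsum
    filter_upwards [hs.eventually h, eventually_gt_atTop 0] with T hT hT0
    obtain ⟨h1, h2⟩ := hT (e T) rfl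
    have hp : Real.exp (s T) ^ Module.finrank ℚ K = T ^ (1/2 : ℝ) := by
      rw [← Real.exp_nat_mul]; exact hsT2 T hT0
    have hp2 : Real.exp (2 * s T) ^ Module.finrank ℚ K = T := by
      rw [← Real.exp_nat_mul]; exact hsT T hT0
    rw [← hN, hp2] at h1 h2
    rw [← hN, hp] at h1
    rw [mul_add, Real.exp_add, hsT T hT0] at h1
    rw [mul_sub, sub_eq_add_neg (n * _), Real.exp_add, hsT T hT0] at h2
    rw [one_mul, Real.norm_eq_abs]
    refine le_trans ?_ (le_abs_self _)
    simp only [Real.norm_eq_abs]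
    have k1 := le_abs_self ((φ (e T) - 1) * T)
    have k2 := neg_abs_le ((φ (-e T) - 1) * T)
    have k3 := le_abs_self (N (T ^ (1/2 : ℝ)))
    have k4 := le_abs_self (Real.exp (n * (s T + e T)) * (1 - 2 * e T) ^ r)
    have p1 := abs_nonneg ((φ (e T) - 1) * T)
    have p2 := abs_nonneg ((φ (-e T) - 1) * T)
    have p3 := abs_nonneg (N (T ^ (1/2 : ℝ)))
    have p4 := abs_nonneg (Real.exp (n * (s T + e T)) * (1 - 2 * e T) ^ r)
    have q1 : c * (T * Real.exp (n * e T)) * (1 + 2 * e T) ^ r = c * ((φ (e T) - 1) * T) + c * T := by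
      simp only [φ]; ring
    have q2 : c * (T * Real.exp (-(n * e T))) * (1 - 2 * e T) ^ r = c * ((φ (-e T) - 1) * T) + c * T := by
      simp only [φ]; rw [show n * -e T = -(n * e T) by ring, show 1 + 2 * - e T = 1 - 2 * e T by ring]; ring
    rw [q1] at h1
    rw [q2] at h2
    rw [mul_assoc] at h2
    have m1 := mul_le_mul_of_nonneg_left k1 hc.le
    have m2 := mul_le_mul_of_nonneg_left k2 hc.le
    have m3 := mul_le_mul_of_nonneg_left k3 hv.le
    have m4 := mul_le_mul_of_nonneg_left k4 hc.le
    have p1 := mul_nonneg hc.le p1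
    have p2 := mul_nonneg hc.le p2
    have p3 := mul_nonneg hv.le p3
    have p4 := mul_nonneg hc.le p4
    rw [abs_le]
    constructor <;> linarith
  refine (main.const_mul_left v⁻¹).congr_left fun T => ?_
  field_simp
end A2c
section A2d
open NumberField NumberField.mixedEmbedding NumberField.mixedEmbedding.fundamentalCone
open NumberField.InfinitePlace NumberField.Units NumberField.Units.dirichletUnitTheorem
open scoped Classical nonZeroDivisors
variable (K : Type*) [Field K] [NumberField K]

lemma class_count (C : ClassGroup (𝓞 K)) : ∃ κ : ℝ, 0 < κ ∧
    (fun T : ℝ => (Nat.card {I : (Ideal (𝓞 K))⁰ // Ideal.absNorm (I : Ideal (𝓞 K)) ≤ T ∧ ClassGroup.mk0 I = C} : ℝ)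
      - κ * T) =O[atTop] (fun T : ℝ => T ^ (1 - 1 / (2 * Module.finrank ℚ K) : ℝ)) := by
  obtain ⟨J, hJ⟩ := ClassGroup.mk0_surjective C⁻¹
  have hJ0 : (0:ℝ) < Ideal.absNorm J.1 := Nat.cast_pos.mpr (Ideal.absNorm_pos_of_nonZeroDivisors J)
  have ht0 : (0:ℝ) < torsionOrder K := Nat.cast_pos.mpr (torsionOrder_pos K)
  set q : ℝ := (Ideal.absNorm J.1 : ℝ)
  have aux₁ : ∀ s : ℝ,
    Nat.card {I : (Ideal (𝓞 K))⁰ // Ideal.absNorm (I : Ideal (𝓞 K)) ≤ s ∧ ClassGroup.mk0 I = C}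
      = Nat.card {I : (Ideal (𝓞 K))⁰ // (J : Ideal (𝓞 K)) ∣ I ∧ Submodule.IsPrincipal (I : Ideal (𝓞 K)) ∧
        Ideal.absNorm (I : Ideal (𝓞 K)) ≤ s * q} := by
    intro s
    simp_rw [← nonZeroDivisors_dvd_iff_dvd_coe]
    refine Nat.card_congr ?_
    refine ((Equiv.dvd J).subtypeEquiv fun I ↦ ?_).trans
      (Equiv.subtypeSubtypeEquivSubtypeInter (fun I : (Ideal (𝓞 K))⁰ ↦ J ∣ I) _)
    rw [← ClassGroup.mk0_eq_one_iff (SetLike.coe_mem _)]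
    simp_rw [Equiv.dvd_apply, Submonoid.coe_mul, ← Submonoid.mul_def, _root_.map_mul, hJ,
      inv_mul_eq_one, Nat.cast_mul, mul_comm s, eq_comm, and_comm, and_congr_left_iff]
    exact fun _ ↦ (mul_le_mul_iff_of_pos_left hJ0).symm
  set cnt : ℝ → ℝ := fun T => (Nat.card {I : (Ideal (𝓞 K))⁰ // Ideal.absNorm (I : Ideal (𝓞 K)) ≤ T ∧ ClassGroup.mk0 I = C} : ℝ) with hcnt
  set N : ℝ → ℝ := fun T => (Nat.card {a : idealSet K J // mixedEmbedding.norm (a : mixedSpace K) ≤ T} : ℝ) with hN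
  have hcN : ∀ T, cnt T * torsionOrder K = N (T * q) := by
    intro T
    simp only [hcnt, hN, aux₁]
    exact_mod_cast card_isPrincipal_dvd_norm_le K J (T * q)
  have hO1 : cnt =O[atTop] (fun T => T) := by
    have := (NumberField.Ideal.tendsto_norm_le_and_mk_eq_div_atTop K C).isBigO_one ℝ
    refine (this.mul (isBigO_refl (fun T : ℝ => T) atTop)).congr' ?_ (by simp [EventuallyEq.rfl])
    filter_upwards [eventually_gt_atTop 0] with T hT
    simp only [hcnt]
    field_simp
  have hNc : N = fun T => torsionOrder K * cnt (T * q⁻¹) := by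
    ext T
    rw [mul_comm, hcN]; congr 1; field_simp
  have hO : N =O[atTop] (fun T => T) := by
    rw [hNc]
    refine (IsBigO.trans (hO1.comp_tendsto (tendsto_id.atTop_mul_const (by positivity : 0 < q⁻¹))) ?_).const_mul_left _
    refine IsBigO.of_bound q⁻¹ (Eventually.of_forall fun T => ?_)
    simp [mul_comm, abs_of_pos hJ0]
  obtain ⟨κ, hκ, h⟩ := count_asymp K (fractionalIdealLatticeBasis K (FractionalIdeal.mk0 K J)) N
    (fun t => by
      rw [span_idealLatticeBasis, hN]
      simp only [← Nat.card_coe_set_eq]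
      congr 1
      refine Nat.card_congr ((Equiv.subtypeSubtypeEquivSubtypeInter _ (fun a : mixedSpace K => mixedEmbedding.norm a ≤ Real.exp t ^ Module.finrank ℚ K)).trans (Equiv.subtypeEquivProp ?_))
      funext a
      simp only [idealSet, mbox_zero, eq_iff_iff]
      constructor
      · rintro ⟨⟨h1, h2⟩, h3⟩; exact ⟨h2, h1, h3⟩
      · rintro ⟨h2, h1, h3⟩; exact ⟨⟨h1, h2⟩, h3⟩)
    (fun t => by
      have hb : Bornology.IsBounded (mbox K t 0) := by
        refine ((isBounded_normLeOne K).smul₀ (Real.exp t)).subset ?_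
        intro y hy
        refine ⟨Real.exp (-t) • y, ?_, by simp [smul_smul, ← Real.exp_add]⟩
        have e0 : (0:ℝ) < Real.exp (-t) := Real.exp_pos _
        have := (mbox_zero K t y).mp hy
        rw [mem_normLeOne, smul_mem_iff_mem e0.ne', mixedEmbedding.norm_smul, abs_of_pos e0,
          Real.exp_neg, inv_pow, inv_mul_le_iff₀ (by positivity), mul_one]
        exact this
      refine (ZSpan.setFinite_inter (fractionalIdealLatticeBasis K (FractionalIdeal.mk0 K J)) hb).subset ?_
      rintro a ⟨h1, h2⟩
      exact ⟨h2, h1⟩) hO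
  refine ⟨κ * q / torsionOrder K, by positivity, ?_⟩
  have h2 := (h.comp_tendsto (tendsto_id.atTop_mul_const hJ0)).const_mul_left (torsionOrder K : ℝ)⁻¹
  refine IsBigO.trans (h2.congr_left fun T => ?_) ?_
  · simp only [Function.comp, id, ← hcN]
    field_simp
    rfl
  · refine IsBigO.of_bound (q ^ (1 - 1 / (2 * Module.finrank ℚ K) : ℝ)) ?_
    filter_upwards [eventually_gt_atTop 0] with T hT
    simp only [Function.comp, id]
    rw [Real.mul_rpow hT.le hJ0.le, norm_mul, mul_comm, Real.norm_of_nonneg (Real.rpow_nonneg hJ0.le _)]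

theorem ideal_count : ∃ κ δ : ℝ, 0 < κ ∧ 0 < δ ∧ δ < 1 ∧
    (fun T : ℝ => (Nat.card {I : (Ideal (𝓞 K))⁰ // Ideal.absNorm (I : Ideal (𝓞 K)) ≤ T} : ℝ) - κ * T)
      =O[atTop] (fun T : ℝ => T ^ (1 - δ)) := by
  choose κ hκ h using class_count K
  have hn1 : 1 ≤ (Module.finrank ℚ K : ℝ) := by exact_mod_cast Module.finrank_pos (R := ℚ) (M := K)
  refine ⟨∑ C, κ C, 1 / (2 * Module.finrank ℚ K), Finset.sum_pos (fun C _ => hκ C) Finset.univ_nonempty,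
    by positivity, by rw [div_lt_one (by positivity)]; linarith, ?_⟩
  refine (IsBigO.fun_sum (s := Finset.univ) (fun C _ => h C)).congr' ?_ (EventuallyEq.refl _ _)
  filter_upwards [eventually_ge_atTop 0] with s hs
  have : Fintype {I : (Ideal (𝓞 K))⁰ // Ideal.absNorm (I : Ideal (𝓞 K)) ≤ s} := by
    simp_rw [← Nat.le_floor_iff hs]
    refine @Fintype.ofFinite _ (Ideal.finite_setOfPred_absNorm_le₀ ⌊s⌋₊)
  let e := fun C : ClassGroup (𝓞 K) ↦ Equiv.subtypeSubtypeEquivSubtypeInter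
    (fun I : (Ideal (𝓞 K))⁰ ↦ Ideal.absNorm I.1 ≤ s) (fun I ↦ ClassGroup.mk0 I = C)
  rw [Finset.sum_sub_distrib, Finset.sum_mul]
  congr 1
  simp_rw [← Nat.card_congr (e _), Nat.card_eq_fintype_card, Fintype.subtype_card]
  rw [Fintype.card, Finset.card_eq_sum_card_fiberwise (f := fun I ↦ ClassGroup.mk0 I.1)
    (t := Finset.univ) (fun _ _ ↦ Finset.mem_univ _), Nat.cast_sum]
end A2d
lemma zeta_cont {a : ℕ → ℝ} (ha : ∀ n, 0 ≤ a n) {κ δ : ℝ} (hδ : 0 < δ) (hδ1 : δ < 1)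
    (hO : (fun T : ℝ => ∑ k ∈ Finset.Icc 1 ⌊T⌋₊, a k - κ * T) =O[atTop] (fun T : ℝ => T ^ (1 - δ))) :
    (∀ s : ℂ, 1 < s.re → LSeriesSummable (fun n => (a n : ℂ)) s) ∧
    ∃ F : ℂ → ℂ, DifferentiableOn ℂ F {s | 1 - δ < s.re} ∧ F 1 = κ ∧
      ∀ s : ℂ, 1 < s.re → (s - 1) * LSeries (fun n => a n) s = F s := by
  have hO1 : (fun n : ℕ ↦ ∑ k ∈ Finset.Icc 1 n, a k) =O[atTop] fun n ↦ (n : ℝ) ^ (1:ℝ) := by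
    have h1 := hO.comp_tendsto (tendsto_natCast_atTop_atTop (R := ℝ))
    have h2 : (fun T : ℝ => T ^ (1 - δ)) =O[atTop] (fun T : ℝ => T ^ (1:ℝ)) := by
      refine IsBigO.of_bound 1 ?_
      filter_upwards [eventually_ge_atTop 1] with T hT
      rw [one_mul, Real.norm_of_nonneg (by positivity), Real.norm_of_nonneg (by positivity)]
      exact Real.rpow_le_rpow_of_exponent_le hT (by linarith)
    have h3 := h1.trans (h2.comp_tendsto tendsto_natCast_atTop_atTop)
    have h4 : (fun n : ℕ => κ * (n:ℝ)) =O[atTop] fun n : ℕ ↦ (n : ℝ) ^ (1:ℝ) := by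
      simpa using isBigO_const_mul_self κ (fun n : ℕ => (n:ℝ)) atTop
    refine (h3.add h4).congr_left fun n => by simp
  refine ⟨fun s hs => LSeriesSummable_of_sum_norm_bigO (r := 1) ?_ zero_le_one hs, ?_⟩
  · refine hO1.congr_left fun n => ?_
    refine Finset.sum_congr rfl fun k _ => ?_
    rw [Complex.norm_real, Real.norm_of_nonneg (ha k)]
  set g : ℝ → ℝ := fun t => ∑ k ∈ Finset.Icc 1 ⌊t⌋₊, a k - κ * t with hg
  set f : ℝ → ℂ := (Ioi 1).indicator fun t => (g t : ℂ) with hf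
  have hNmono : Monotone (fun t : ℝ => ∑ k ∈ Finset.Icc 1 ⌊t⌋₊, a k) := by
    intro x y hxy
    exact Finset.sum_le_sum_of_subset_of_nonneg
      (Finset.Icc_subset_Icc le_rfl (Nat.floor_mono hxy)) (fun _ _ _ => ha _)
  have hgl : LocallyIntegrable g volume :=
    hNmono.locallyIntegrable.sub ((by fun_prop : Continuous fun t => κ * t).locallyIntegrable)
  have hgl' : LocallyIntegrable (fun t => (g t : ℂ)) volume :=
    fun x => by
      obtain ⟨u, hu, h⟩ := hgl x
      exact ⟨u, hu, h.ofReal⟩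
  have hfl : LocallyIntegrable f volume := hgl'.indicator measurableSet_Ioi
  have hft : f =O[atTop] (fun x : ℝ => x ^ (-(δ - 1))) := by
    rw [show -(δ - 1) = 1 - δ by ring]
    refine IsBigO.trans (IsBigO.of_bound 1 (Eventually.of_forall fun t => ?_)) hO
    rw [one_mul, hf]
    by_cases h : t ∈ Ioi (1:ℝ)
    · rw [indicator_of_mem h, Complex.norm_real]
    · rw [indicator_of_notMem h, norm_zero]; positivity
  have hf0 : ∀ b : ℝ, f =O[𝓝[>] 0] (fun x : ℝ => x ^ (-b)) := by
    intro b
    refine IsBigO.of_bound 1 ?_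
    filter_upwards [nhdsWithin_le_nhds (gt_mem_nhds (show (0:ℝ) < 1 by norm_num))] with t ht
    rw [hf, indicator_of_notMem (by simpa using ht.le), norm_zero]; positivity
  have hH : DifferentiableOn ℂ (fun s => mellin f (-s)) {s | 1 - δ < s.re} := by
    intro s hs
    have : DifferentiableAt ℂ (mellin f) (-s) :=
      mellin_differentiableAt_of_isBigO_rpow (hfl.locallyIntegrableOn _) hft
        (by simp only [mem_ofPred_eq, Complex.neg_re] at *; linarith) (hf0 (-s.re - 1)) (by simp)
    exact (this.comp s (differentiableAt_id.neg)).differentiableWithinAt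
  refine ⟨fun s => κ * s + s * (s - 1) * mellin f (-s), ?_, by simp, fun s hs => ?_⟩
  · exact ((differentiableOn_const _).mul differentiableOn_id).add
      (((differentiableOn_id).mul (differentiableOn_id.sub (differentiableOn_const _))).mul hH)
  have hs1 : s - 1 ≠ 0 := by
    intro h
    have := congrArg Complex.re h
    simp at this; linarith
  rw [LSeries_eq_mul_integral_of_nonneg a zero_le_one hs hO1 ha]
  have hmc : MellinConvergent f (-s) :=
    mellinConvergent_of_isBigO_rpow (hfl.locallyIntegrableOn _) hft (by simp; linarith)
      (hf0 (-s.re - 1)) (by simp)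
  have e1 : mellin f (-s) = ∫ t in Ioi (1:ℝ), (g t : ℂ) * (t:ℂ) ^ (-(s + 1)) := by
    rw [mellin, show (fun t : ℝ => (t:ℂ) ^ (-s - 1) • f t) = (Ioi (1:ℝ)).indicator
      (fun t : ℝ => (g t : ℂ) * (t:ℂ) ^ (-(s + 1))) by
        ext t
        by_cases h : t ∈ Ioi (1:ℝ)
        · simp only [hf, indicator_of_mem h, smul_eq_mul]; rw [mul_comm]; congr 2; ring
        · simp only [hf, indicator_of_notMem h, smul_zero]]
    rw [setIntegral_indicator measurableSet_Ioi, inter_eq_right.mpr (Ioi_subset_Ioi zero_le_one)]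
  have i1 : IntegrableOn (fun t : ℝ => (g t : ℂ) * (t:ℂ) ^ (-(s + 1))) (Ioi 1) := by
    have := hmc.mono_set (Ioi_subset_Ioi (zero_le_one (α := ℝ)))
    refine this.congr_fun (fun t ht => ?_) measurableSet_Ioi
    simp only [hf, indicator_of_mem ht, smul_eq_mul]; rw [mul_comm]; congr 2; ring
  have i2 : IntegrableOn (fun t : ℝ => (t:ℂ) ^ (-s)) (Ioi 1) :=
    integrableOn_Ioi_cpow_of_lt (by simp; linarith) one_pos
  have e2 : ∫ t in Ioi (1:ℝ), (∑ k ∈ Finset.Icc 1 ⌊t⌋₊, (a k : ℂ)) * (t:ℂ) ^ (-(s + 1)) =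
      mellin f (-s) + κ * (1 / (s - 1)) := by
    rw [e1]
    have : ∫ t in Ioi (1:ℝ), (t:ℂ) ^ (-s) = 1 / (s - 1) := by
      rw [integral_Ioi_cpow_of_lt (by simp; linarith) one_pos]
      have : -s + 1 ≠ 0 := by intro h; apply hs1; linear_combination -h
      simp only [Complex.ofReal_one, Complex.one_cpow]
      field_simp; ring
    rw [← this, ← integral_const_mul, ← integral_add i1 (i2.const_mul _)]
    refine setIntegral_congr_fun measurableSet_Ioi fun t ht => ?_
    have ht0 : (t:ℂ) ≠ 0 := by
      have : (0:ℝ) < t := one_pos.trans ht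
      exact_mod_cast this.ne'
    simp only [hg]
    rw [show -s = -(s+1) + 1 by ring, Complex.cpow_add _ _ ht0, Complex.cpow_one]
    push_cast; ring
  rw [e2]
  field_simp
  ring
lemma re_nonneg_341 {b : ℕ → ℝ} (hb : ∀ n, 0 ≤ b n)
    (hs : ∀ s : ℂ, 1 < s.re → LSeriesSummable (fun n => (b n : ℂ)) s) {σ : ℝ} (hσ : 1 < σ) (t : ℝ) :
    0 ≤ (3 * LSeries (fun n => b n) σ + 4 * LSeries (fun n => b n) (σ + t * Complex.I) +
      LSeries (fun n => b n) (σ + 2 * t * Complex.I)).re := by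
  have h0 := hs σ (by simpa using hσ)
  have h1 := hs (σ + t * Complex.I) (by simpa using hσ)
  have h2 := hs (σ + 2 * t * Complex.I) (by simpa using hσ)
  have := ((h0.LSeriesHasSum.mul_left 3).add (h1.LSeriesHasSum.mul_left 4)).add h2.LSeriesHasSum
  refine (Complex.hasSum_re this).nonneg fun n => ?_
  rcases n.eq_zero_or_pos with rfl | hn
  · simp
  have hn0 : (n:ℂ) ≠ 0 := by exact_mod_cast hn.ne'
  set z : ℂ := (n:ℂ) ^ (-(t * Complex.I)) with hz
  have hz1 : ‖z‖ = 1 := by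
    rw [hz, ← Complex.ofReal_natCast, Complex.norm_cpow_eq_rpow_re_of_pos (by exact_mod_cast hn)]
    simp
  have e0 : LSeries.term (fun n => (b n : ℂ)) σ n = ((b n * (n:ℝ) ^ (-σ) : ℝ) : ℂ) := by
    rw [LSeries.term_of_ne_zero hn.ne', div_eq_mul_inv, ← Complex.cpow_neg]
    push_cast
    rw [Complex.ofReal_cpow n.cast_nonneg]; simp
  have e1 : LSeries.term (fun n => (b n : ℂ)) (σ + t * Complex.I) n =
      ((b n * (n:ℝ) ^ (-σ) : ℝ) : ℂ) * z := by
    rw [← e0, LSeries.term_of_ne_zero hn.ne', LSeries.term_of_ne_zero hn.ne',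
      Complex.cpow_add _ _ hn0, hz, Complex.cpow_neg]
    field_simp
  have e2 : LSeries.term (fun n => (b n : ℂ)) (σ + 2 * t * Complex.I) n =
      ((b n * (n:ℝ) ^ (-σ) : ℝ) : ℂ) * z ^ 2 := by
    rw [← e0, LSeries.term_of_ne_zero hn.ne', LSeries.term_of_ne_zero hn.ne',
      Complex.cpow_add _ _ hn0, hz, ← Complex.cpow_nat_mul, 
      show ((2:ℕ):ℂ) * -(t * Complex.I) = -(2 * t * Complex.I) by push_cast; ring, Complex.cpow_neg]
    field_simp
  rw [e0, e1, e2, show (3:ℂ) * ((b n * (n:ℝ) ^ (-σ) : ℝ) : ℂ) + 4 * (((b n * (n:ℝ) ^ (-σ) : ℝ) : ℂ) * z) +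
    ((b n * (n:ℝ) ^ (-σ) : ℝ) : ℂ) * z ^ 2 = ((b n * (n:ℝ) ^ (-σ) : ℝ) : ℂ) * (3 + 4 * z + z ^ 2) by ring,
    Complex.re_ofReal_mul]
  refine mul_nonneg (mul_nonneg (hb n) (by positivity)) ?_
  have h5 : z.re ^ 2 + z.im ^ 2 = 1 := by
    have := Complex.sq_norm z
    rw [hz1, Complex.normSq_apply] at this; nlinarith
  have : (3 + 4 * z + z ^ 2).re = 2 * (1 + z.re) ^ 2 := by
    simp [sq]; nlinarith
  rw [this]; positivity

theorem pnt_abs {a Λ : ℕ → ℝ} (ha : ∀ n, 0 ≤ a n) (hΛ : ∀ n, 0 ≤ Λ n) (N : ℕ)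
    (hΛN : ∀ m, Λ m ≤ N * ArithmeticFunction.vonMangoldt m)
    (hconv : ∀ m, m ≠ 0 → ∑ x ∈ m.divisorsAntidiagonal, a x.1 * Λ x.2 = a m * Real.log m)
    {κ δ : ℝ} (hκ : 0 < κ) (hδ : 0 < δ) (hδ1 : δ < 1)
    (hO : (fun T : ℝ => ∑ k ∈ Finset.Icc 1 ⌊T⌋₊, a k - κ * T) =O[atTop] (fun T : ℝ => T ^ (1 - δ))) :
    Tendsto (fun n : ℕ => (∑ k ∈ Finset.Icc 1 n, Λ k) / n) atTop (𝓝 1) := by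
  obtain ⟨hsa, F, hF, hF1, hFL⟩ := zeta_cont ha hδ hδ1 hO
  have hsΛ : ∀ s : ℂ, 1 < s.re → LSeriesSummable (fun n => (Λ n : ℂ)) s := by
    intro s hs
    have h := (ArithmeticFunction.LSeriesSummable_vonMangoldt hs).norm.mul_left (N:ℝ)
    refine Summable.of_norm_bounded h fun n => ?_
    rcases n.eq_zero_or_pos with rfl | hn
    · simp
    rw [LSeries.term_of_ne_zero hn.ne', LSeries.term_of_ne_zero hn.ne', norm_div, norm_div,
      Complex.norm_real, Complex.norm_real, Real.norm_of_nonneg (hΛ n),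
      Real.norm_of_nonneg ArithmeticFunction.vonMangoldt_nonneg, ← mul_div_assoc]
    gcongr
    exact hΛN n
  have hΛ1 : Λ 1 = 0 := le_antisymm (by simpa using hΛN 1) (hΛ 1)
  set b : ℕ → ℝ := fun n => Λ n / Real.log n with hb
  have hb0 : ∀ n, 0 ≤ b n := fun n => div_nonneg (hΛ n) (Real.log_natCast_nonneg n)
  have hbl : ∀ {n : ℕ}, n ≠ 0 → Complex.log n * (b n : ℂ) = (Λ n : ℂ) := by
    intro n hn
    rw [← Complex.natCast_log, ← Complex.ofReal_mul]
    rcases (Nat.one_le_iff_ne_zero.mpr hn).eq_or_lt with h | h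
    · rw [← h, hΛ1]; simp
    · congr 1
      have : Real.log n ≠ 0 := (Real.log_pos (by exact_mod_cast h)).ne'
      simp only [hb]; field_simp
  have hsb : ∀ s : ℂ, 1 < s.re → LSeriesSummable (fun n => (b n : ℂ)) s := by
    intro s hs
    refine Summable.of_norm_bounded ((hsΛ s hs).norm.mul_left (1 / Real.log 2)) fun n => ?_
    rcases n.eq_zero_or_pos with rfl | hn
    · simp
    rw [LSeries.term_of_ne_zero hn.ne', LSeries.term_of_ne_zero hn.ne', norm_div, norm_div,
      Complex.norm_real, Complex.norm_real, Real.norm_of_nonneg (hΛ n),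
      Real.norm_of_nonneg (hb0 n), ← mul_div_assoc]
    gcongr
    rcases (Nat.one_le_iff_ne_zero.mpr hn.ne').eq_or_lt with h | h
    · simp [hb, ← h, hΛ1]
    · have h2 : (2:ℝ) ≤ n := by exact_mod_cast h
      simp only [hb]
      rw [one_div_mul_eq_div]
      have := Real.log_pos (one_lt_two (α := ℝ))
      exact div_le_div_of_nonneg_left (hΛ n) this (Real.log_le_log (by norm_num) h2)
  have habs : ∀ (f : ℕ → ℂ), (∀ s : ℂ, 1 < s.re → LSeriesSummable f s) → ∀ s : ℂ, 1 < s.re →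
      LSeries.abscissaOfAbsConv f < s.re := by
    intro f hf s hs
    refine lt_of_le_of_lt (b := ((1:ℝ):EReal)) ?_ (by exact_mod_cast hs)
    refine LSeries.abscissaOfAbsConv_le_of_forall_lt_LSeriesSummable fun y hy => hf y (by simpa using hy)
  set A : ℂ → ℂ := LSeries (fun n => (a n : ℂ)) with hA
  set B : ℂ → ℂ := LSeries (fun n => (b n : ℂ)) with hB
  set D : ℂ → ℂ := LSeries (fun n => (Λ n : ℂ)) with hD
  have hdB : ∀ s : ℂ, 1 < s.re → HasDerivAt B (-D s) s := by
    intro s hs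
    have := LSeries_hasDerivAt (habs _ hsb s hs)
    rwa [LSeries_congr (g := fun n => (Λ n : ℂ)) (fun {n} hn => ?_) s] at this
    exact hbl hn
  have hdA : ∀ s : ℂ, 1 < s.re → HasDerivAt A (-(A s * D s)) s := by
    intro s hs
    have := LSeries_hasDerivAt (habs _ hsa s hs)
    rw [hA, hD, ← LSeries_convolution' (hsa s hs) (hsΛ s hs)]
    rwa [LSeries_congr (fun {n} hn => ?_) s] at this
    rw [LSeries.convolution_def]
    simp only [LSeries.logMul]
    rw [← Complex.natCast_log]
    have := hconv n hn
    rw [mul_comm]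
    exact_mod_cast this.symm
  have hopen : IsOpen {s : ℂ | 1 < s.re} := isOpen_lt continuous_const Complex.continuous_re
  have hcvx : Convex ℝ {s : ℂ | 1 < s.re} := convex_halfSpace_re_gt 1
  obtain ⟨c, hc⟩ : ∃ c, ∀ s ∈ {s : ℂ | 1 < s.re}, A s * Complex.exp (-B s) = c := by
    have hd : ∀ s : ℂ, 1 < s.re → HasDerivAt (fun s => A s * Complex.exp (-B s)) 0 s := by
      intro s hs
      refine ((hdA s hs).mul ((hdB s hs).neg.cexp)).congr_deriv ?_
      ring
    refine hopen.exists_is_const_of_deriv_eq_zero hcvx.isPreconnected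
      (fun s hs => (hd s hs).differentiableAt.differentiableWithinAt) fun s hs => (hd s hs).deriv
  have hAB : ∀ s : ℂ, 1 < s.re → A s = c * Complex.exp (B s) := by
    intro s hs
    rw [← hc s hs, mul_assoc, ← Complex.exp_add]; simp
  have hUo : IsOpen {s : ℂ | 1 - δ < s.re} := isOpen_lt continuous_const Complex.continuous_re
  have hFat : ∀ s : ℂ, 1 ≤ s.re → DifferentiableAt ℂ F s := fun s hs =>
    (hF s (by rw [mem_ofPred_eq]; linarith)).differentiableAt (hUo.mem_nhds (by rw [mem_ofPred_eq]; linarith))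
  have hlim : ∀ t : ℝ, Tendsto (fun σ : ℝ => (σ + t * Complex.I : ℂ)) (𝓝[>] 1) (𝓝 (1 + t * Complex.I)) := by
    intro t
    have : Continuous (fun σ : ℝ => (σ + t * Complex.I : ℂ)) := by fun_prop
    simpa using (this.tendsto 1).mono_left nhdsWithin_le_nhds
  have hc0 : c ≠ 0 := by
    rintro rfl
    have h1 : Tendsto (fun σ : ℝ => F (σ + (0:ℝ) * Complex.I)) (𝓝[>] 1) (𝓝 (F (1 + (0:ℝ) * Complex.I))) :=
      ((hFat _ (by simp)).continuousAt.tendsto).comp (hlim 0)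
    have h2 : Tendsto (fun σ : ℝ => F (σ + (0:ℝ) * Complex.I)) (𝓝[>] 1) (𝓝 0) := by
      refine tendsto_const_nhds.congr' ?_
      filter_upwards [self_mem_nhdsWithin] with σ hσ
      have h3 : 1 < (σ + (0:ℝ) * Complex.I : ℂ).re := by simpa using hσ
      rw [← hFL _ h3]
      have := hAB _ h3
      rw [this]; ring
    have := tendsto_nhds_unique h1 h2
    simp only [Complex.ofReal_zero, zero_mul, add_zero, hF1] at this
    exact hκ.ne' (by exact_mod_cast this)
  have hFne : ∀ s : ℂ, 1 ≤ s.re → F s ≠ 0 := by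
    intro s hs
    rcases hs.eq_or_lt with h | h
    swap
    · rw [← hFL s h]
      have := hAB s h
      rw [this]
      refine mul_ne_zero (fun h0 => ?_) (mul_ne_zero hc0 (Complex.exp_ne_zero _))
      have := congrArg Complex.re h0
      simp at this; linarith
    intro hs0
    set t := s.im with ht
    have hst : s = 1 + t * Complex.I := by
      apply Complex.ext <;> simp [h.symm, ht]
    by_cases ht0 : t = 0
    · rw [hst, ht0] at hs0
      simp only [Complex.ofReal_zero, zero_mul, add_zero, hF1] at hs0
      exact hκ.ne' (by exact_mod_cast hs0)
    -- bound below
    have hlow : ∀ σ : ℝ, 1 < σ → ‖c‖ ^ 8 ≤ ‖A σ‖ ^ 3 * ‖A (σ + t * Complex.I)‖ ^ 4 *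
        ‖A (σ + 2 * t * Complex.I)‖ := by
      intro σ hσ
      rw [hAB σ (by simpa using hσ), hAB (σ + t * Complex.I) (by simpa using hσ),
        hAB (σ + 2 * t * Complex.I) (by simpa using hσ)]
      simp only [norm_mul, Complex.norm_exp, mul_pow, ← Real.exp_nat_mul]
      have h1 := re_nonneg_341 hb0 hsb hσ t
      have h2 : 1 ≤ Real.exp ((3 * B σ + 4 * B (σ + t * Complex.I) + B (σ + 2 * t * Complex.I)).re) :=
        Real.one_le_exp h1
      have h3 : (3 * B σ + 4 * B (σ + t * Complex.I) + B (σ + 2 * t * Complex.I)).re =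
        ((3:ℕ):ℝ) * (B σ).re + ((4:ℕ):ℝ) * (B (σ + t * Complex.I)).re + (B (σ + 2 * t * Complex.I)).re := by
        simp
      rw [h3, Real.exp_add, Real.exp_add] at h2
      calc ‖c‖ ^ 8 ≤ ‖c‖ ^ 8 * _ := le_mul_of_one_le_right (by positivity) h2
        _ = _ := by ring
    -- upper: tends to zero
    have hsl : Tendsto (fun σ : ℝ => F (σ + t * Complex.I) / (σ - 1)) (𝓝[>] 1) (𝓝 (deriv F s)) := by
      have hd := (hFat s hs).hasDerivAt
      rw [hasDerivAt_iff_tendsto_slope] at hd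
      have hm : Tendsto (fun σ : ℝ => (σ + t * Complex.I : ℂ)) (𝓝[>] 1) (𝓝[≠] s) := by
        refine tendsto_nhdsWithin_iff.mpr ⟨hst ▸ hlim t, ?_⟩
        filter_upwards [self_mem_nhdsWithin] with σ hσ h5
        rw [mem_singleton_iff, hst] at h5
        have := congrArg Complex.re h5
        simp at this; exact (ne_of_gt hσ) this
      refine (hd.comp hm).congr fun σ => ?_
      simp only [Function.comp, slope_def_field, hs0, sub_zero]
      congr 1; rw [hst]; ring
    have hF0 : Tendsto (fun σ : ℝ => F (σ + (0:ℝ) * Complex.I)) (𝓝[>] 1) (𝓝 (F (1 + (0:ℝ) * Complex.I))) :=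
      ((hFat _ (by simp)).continuousAt.tendsto).comp (hlim 0)
    have hF2 : Tendsto (fun σ : ℝ => A (σ + (2 * t : ℝ) * Complex.I)) (𝓝[>] 1)
        (𝓝 (F (1 + (2 * t : ℝ) * Complex.I) / (1 + (2 * t : ℝ) * Complex.I - 1))) := by
      have h1 := ((hFat (1 + (2 * t : ℝ) * Complex.I) (by simp)).continuousAt.tendsto).comp (hlim (2 * t))
      refine (h1.div ((hlim (2 * t)).sub_const 1) (by simp [ht0])).congr' ?_
      filter_upwards [self_mem_nhdsWithin] with σ hσ
      have h3 : 1 < (σ + (2 * t : ℝ) * Complex.I : ℂ).re := by simpa using hσ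
      change F _ / _ = _
      rw [← hFL _ h3]
      rw [mul_div_cancel_left₀]
      intro h0
      have := congrArg Complex.re h0
      simp at this; linarith [show 1 < σ from hσ]
    have hF3 : Tendsto (fun σ : ℝ => (σ + t * Complex.I - 1 : ℂ)) (𝓝[>] 1) (𝓝 (1 + t * Complex.I - 1)) :=
      (hlim t).sub_const 1
    have hz : Tendsto (fun σ : ℝ => (σ - 1)) (𝓝[>] 1) (𝓝 0) := by
      have : Continuous (fun σ : ℝ => σ - 1) := by fun_prop
      simpa using (this.tendsto 1).mono_left nhdsWithin_le_nhds
    have htot := (((hF0.norm.pow 3).mul ((hsl.norm.pow 4).mul hz)).div (hF3.norm.pow 4)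
      (by simp [ht0])).mul hF2.norm
    rw [mul_zero, mul_zero, zero_div, zero_mul] at htot
    have : ‖c‖ ^ 8 ≤ 0 := by
      refine ge_of_tendsto htot ?_
      filter_upwards [self_mem_nhdsWithin] with σ hσ
      have hσ1 : 1 < σ := hσ
      refine (hlow σ hσ1).trans_eq ?_
      have h3 : 1 < (σ + t * Complex.I : ℂ).re := by simpa using hσ
      have h0 : 1 < (σ : ℂ).re := by simpa using hσ
      have n1 : (σ + t * Complex.I - 1 : ℂ) ≠ 0 := by
        intro h0
        have := congrArg Complex.re h0
        simp at this; linarith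
      simp only [Pi.div_apply]
      rw [← hFL _ h3]
      simp only [Complex.ofReal_zero, zero_mul, add_zero]
      rw [← hFL _ h0]
      have n2 : ‖(σ - 1 : ℂ)‖ = σ - 1 := by
        rw [← Complex.ofReal_one, ← Complex.ofReal_sub, Complex.norm_real, Real.norm_of_nonneg]; linarith
      have n3 : σ - 1 ≠ 0 := by linarith
      have n4 : ‖(σ + t * Complex.I - 1 : ℂ)‖ ≠ 0 := norm_ne_zero_iff.mpr n1
      simp only [norm_mul, norm_div, n2]
      push_cast
      field_simp
    have : 0 < ‖c‖ ^ 8 := by positivity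
    linarith
  refine wiener_ikehara (f := Λ) hΛ (C := N * (Real.log 4 + 4)) ?_ ?_
    (G := fun s => -(deriv F s / F s)) ?_ ?_
  · have : 0 ≤ Real.log 4 := Real.log_nonneg (by norm_num)
    positivity
  · intro n
    calc ∑ k ∈ Finset.Icc 1 n, Λ k ≤ ∑ k ∈ Finset.Icc 1 n, N * ArithmeticFunction.vonMangoldt k :=
          Finset.sum_le_sum fun k _ => hΛN k
      _ = N * Chebyshev.psi n := by
          rw [← Finset.mul_sum, Chebyshev.psi, Nat.floor_natCast]; rfl
      _ ≤ _ := by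
          rw [mul_assoc]; gcongr; exact Chebyshev.psi_le_const_mul_self n.cast_nonneg
  · refine ContinuousOn.neg (ContinuousOn.div ?_ (fun s hs => (hFat s hs).continuousAt.continuousWithinAt)
      fun s hs => hFne s hs)
    have := ((hF.deriv hUo).continuousOn)
    exact this.mono fun s hs => by simp only [mem_ofPred_eq] at *; linarith
  · intro s hs
    have h1 : HasDerivAt F (A s + (s - 1) * (-(A s * D s))) s := by
      have := ((hasDerivAt_id s).sub_const 1).mul (hdA s hs)
      refine (this.congr_of_eventuallyEq ?_).congr_deriv (by simp)
      filter_upwards [hopen.mem_nhds hs] with z hz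
      exact (hFL z hz).symm
    have hs1 : s - 1 ≠ 0 := by
      intro h
      have := congrArg Complex.re h
      simp at this; linarith
    have hA0 : A s ≠ 0 := by rw [hAB s hs]; exact mul_ne_zero hc0 (Complex.exp_ne_zero _)
    rw [h1.deriv, ← hFL s hs]
    change D s = 1 / (s - 1) + -((A s + (s - 1) * -(A s * D s)) / ((s - 1) * A s))
    field_simp
    ring
section A3c
open NumberField
open scoped Classical nonZeroDivisors
variable (K : Type*) [Field K] [NumberField K]

noncomputable def idl (m : ℕ) : Finset (Ideal (𝓞 K)) :=
  (Ideal.finite_setOfPred_absNorm_eq (S := 𝓞 K) m).toFinset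

noncomputable def pbox (m : ℕ) : Finset (Ideal (𝓞 K)) :=
  ((Ideal.finite_setOfPred_absNorm_le (S := 𝓞 K) m).toFinset).filter Prime

lemma mem_idl {m : ℕ} {I : Ideal (𝓞 K)} : I ∈ idl K m ↔ Ideal.absNorm I = m := by simp [idl]
lemma mem_pbox {m : ℕ} {I : Ideal (𝓞 K)} : I ∈ pbox K m ↔ Ideal.absNorm I ≤ m ∧ Prime I := by simp [pbox]

noncomputable def lamK (m : ℕ) : ℝ :=
  ∑ P ∈ pbox K m, ∑ k ∈ Finset.Icc 1 m, if Ideal.absNorm P ^ k = m then Real.log (Ideal.absNorm P) else 0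

variable {K} in
lemma two_le_norm {P : Ideal (𝓞 K)} (hP : Prime P) : 2 ≤ Ideal.absNorm P := by
  have h0 : Ideal.absNorm P ≠ 0 := by
    rw [Ne, Ideal.absNorm_eq_zero_iff]; exact hP.ne_zero
  have h1 : Ideal.absNorm P ≠ 1 := by
    rw [Ne, Ideal.absNorm_eq_one_iff]
    intro h; exact hP.not_unit (Ideal.isUnit_iff.mpr h)
  omega

lemma lamK_le (m : ℕ) : lamK K m ≤ Module.finrank ℤ (𝓞 K) * ArithmeticFunction.vonMangoldt m := by
  by_cases hm : ∃ P ∈ pbox K m, ∃ k ∈ Finset.Icc 1 m, Ideal.absNorm P ^ k = m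
  swap
  · have : lamK K m = 0 := by
      refine Finset.sum_eq_zero fun P hP => Finset.sum_eq_zero fun k hk => if_neg fun h => hm ⟨P, hP, k, hk, h⟩
    rw [this]
    exact mul_nonneg (by positivity) ArithmeticFunction.vonMangoldt_nonneg
  obtain ⟨P₀, hP₀, k₀, hk₀, h₀⟩ := hm
  have hp0 := ((mem_pbox K).mp hP₀).2
  haveI : P₀.IsMaximal := (Ideal.isPrime_of_prime hp0).isMaximal hp0.ne_zero
  obtain ⟨p, f, hf, -, hp, he⟩ := Ideal.exists_prime_and_absNorm_eq_pow P₀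
  rw [he, ← pow_mul] at h₀
  have hfk : f * k₀ ≠ 0 := by
    have := (Finset.mem_Icc.mp hk₀).1
    positivity
  rw [← h₀, ArithmeticFunction.vonMangoldt_apply_pow hfk, ArithmeticFunction.vonMangoldt_apply_prime hp, h₀]
  set S := (pbox K m).filter (fun P => (p : 𝓞 K) ∈ P) with hS
  have h1 : lamK K m ≤ ∑ P ∈ S, Real.log (Ideal.absNorm P) := by
    rw [hS, Finset.sum_filter]
    refine Finset.sum_le_sum fun P hP => ?_
    have hPp := ((mem_pbox K).mp hP).2
    have h2 := two_le_norm hPp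
    by_cases h : ∃ k ∈ Finset.Icc 1 m, Ideal.absNorm P ^ k = m
    · obtain ⟨k, hk, hkm⟩ := h
      rw [Finset.sum_eq_single_of_mem k hk, if_pos hkm, if_pos]
      · have h3 : ((Ideal.absNorm P : ℕ) : 𝓞 K) ^ k ∈ P :=
          Ideal.pow_mem_of_mem _ (Ideal.absNorm_mem P) _ (Finset.mem_Icc.mp hk).1
        have h4 : ((p:ℕ) : 𝓞 K) ^ (f * k₀) ∈ P := by
          rw [← Nat.cast_pow, h₀, ← hkm, Nat.cast_pow]; exact h3
        haveI := Ideal.isPrime_of_prime hPp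
        exact Ideal.IsPrime.mem_of_pow_mem this _ h4
      · intro j _ hj
        rw [if_neg]
        intro h5
        exact hj (Nat.pow_right_injective h2 (h5.trans hkm.symm))
    · rw [Finset.sum_eq_zero fun k hk => if_neg fun h5 => h ⟨k, hk, h5⟩]
      split_ifs
      · exact Real.log_natCast_nonneg _
      · rfl
  refine h1.trans ?_
  have h2 : ∏ P ∈ S, P ∣ Ideal.span {(p : 𝓞 K)} := by
    refine Finset.prod_primes_dvd _ (fun P hP => ((mem_pbox K).mp (Finset.mem_filter.mp hP).1).2) fun P hP => ?_
    rw [Ideal.dvd_span_singleton]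
    exact (Finset.mem_filter.mp hP).2
  have h3 := map_dvd Ideal.absNorm h2
  rw [map_prod, Ideal.absNorm_span_natCast] at h3
  have h4 := Nat.le_of_dvd (by have := hp.pos; positivity) h3
  have h5 : ∀ P ∈ S, (Ideal.absNorm P : ℝ) ≠ 0 := fun P hP => by
    have := two_le_norm ((mem_pbox K).mp (Finset.mem_filter.mp hP).1).2
    positivity
  rw [← Real.log_prod h5, ← Real.log_pow]
  refine Real.log_le_log ?_ (by exact_mod_cast h4)
  exact Finset.prod_pos fun P hP => by
    have := two_le_norm ((mem_pbox K).mp (Finset.mem_filter.mp hP).1).2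
    positivity

lemma log_norm {m : ℕ} (hm : m ≠ 0) {I : Ideal (𝓞 K)} (hI : Ideal.absNorm I = m) :
    ∑ P ∈ pbox K m, ∑ k ∈ Finset.Icc 1 m, (if P ^ k ∣ I then Real.log (Ideal.absNorm P) else 0) = Real.log m := by
  have hI0 : I ≠ 0 := by
    rintro rfl
    rw [Ideal.zero_eq_bot, Ideal.absNorm_bot] at hI; exact hm hI.symm
  set s := UniqueFactorizationMonoid.normalizedFactors I with hs
  have hprod : s.prod = I := by
    have := UniqueFactorizationMonoid.prod_normalizedFactors hI0
    rwa [associated_iff_eq] at this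
  have hsp : ∀ P ∈ s, Prime P := fun P hP => UniqueFactorizationMonoid.prime_of_normalized_factor P hP
  have h1 : ∀ P ∈ pbox K m, ∑ k ∈ Finset.Icc 1 m, (if P ^ k ∣ I then Real.log (Ideal.absNorm P) else 0) =
      s.count P * Real.log (Ideal.absNorm P) := by
    intro P hP
    have hPp := ((mem_pbox K).mp hP).2
    rw [← Finset.sum_filter, Finset.sum_const, nsmul_eq_mul]
    congr 2
    have hdv : ∀ k, P ^ k ∣ I ↔ k ≤ s.count P := by
      intro k
      have h2 := UniqueFactorizationMonoid.emultiplicity_eq_count_normalizedFactors hPp.irreducible hI0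
      rw [normalize_eq] at h2
      rw [pow_dvd_iff_le_emultiplicity, h2]
      exact_mod_cast Iff.rfl
    have hle : s.count P ≤ m := by
      have h2 := map_dvd Ideal.absNorm ((hdv (s.count P)).mpr le_rfl)
      rw [hI, map_pow] at h2
      have h3 := Nat.le_of_dvd (Nat.pos_of_ne_zero hm) h2
      have h4 := Nat.pow_le_pow_left (two_le_norm hPp) (s.count P)
      have h5 := Nat.lt_two_pow_self (n := s.count P)
      omega
    have : (Finset.Icc 1 m).filter (fun k => P ^ k ∣ I) = Finset.Icc 1 (s.count P) := by
      ext k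
      simp only [Finset.mem_filter, Finset.mem_Icc, hdv]; omega
    rw [this]; simp
  rw [Finset.sum_congr rfl h1]
  have hsub : s.toFinset ⊆ pbox K m := by
    intro P hP
    rw [Multiset.mem_toFinset] at hP
    refine (mem_pbox K).mpr ⟨?_, hsp P hP⟩
    have := map_dvd Ideal.absNorm (UniqueFactorizationMonoid.dvd_of_mem_normalizedFactors hP)
    rw [hI] at this
    exact Nat.le_of_dvd (Nat.pos_of_ne_zero hm) this
  rw [← Finset.sum_subset hsub (fun P _ hP => by
    rw [Multiset.mem_toFinset] at hP; rw [Multiset.count_eq_zero.mpr hP]; simp)]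
  have h2 : (m:ℝ) = (s.map fun P => (Ideal.absNorm P : ℝ)).prod := by
    rw [← hI, ← hprod, map_multiset_prod, Nat.cast_multiset_prod, Multiset.map_map]; rfl
  rw [h2, Finset.prod_multiset_map_count, Real.log_prod]
  · simp [Real.log_pow]
  · intro P hP
    rw [Multiset.mem_toFinset] at hP
    have := two_le_norm (hsp P hP)
    positivity

lemma conv_idl (m : ℕ) (hm : m ≠ 0) :
    ∑ x ∈ m.divisorsAntidiagonal, ((idl K x.1).card : ℝ) * lamK K x.2 = (idl K m).card * Real.log m := by
  have hl : ∀ x ∈ m.divisorsAntidiagonal, lamK K x.2 = ∑ P ∈ pbox K m, ∑ k ∈ Finset.Icc 1 m,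
      if Ideal.absNorm P ^ k = x.2 then Real.log (Ideal.absNorm P) else 0 := by
    intro x hx
    have hxm : x.2 ≤ m := by
      have := Nat.mem_divisorsAntidiagonal.mp hx
      exact Nat.le_of_dvd (Nat.pos_of_ne_zero hm) ⟨x.1, by rw [mul_comm]; exact this.1.symm⟩
    rw [lamK]
    have h1 : pbox K x.2 ⊆ pbox K m := fun P hP => by
      rw [mem_pbox] at *; exact ⟨hP.1.trans hxm, hP.2⟩
    have h2 : ∀ P ∈ pbox K m, ∑ k ∈ Finset.Icc 1 x.2, (if Ideal.absNorm P ^ k = x.2 then Real.log (Ideal.absNorm P) else 0)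
       = ∑ k ∈ Finset.Icc 1 m, if Ideal.absNorm P ^ k = x.2 then Real.log (Ideal.absNorm P) else 0 := by
      intro P hP
      refine Finset.sum_subset (Finset.Icc_subset_Icc_right hxm) fun k hk hk' => if_neg fun h => hk' ?_
      have h4 := Nat.pow_le_pow_left (two_le_norm ((mem_pbox K).mp hP).2) k
      have h5 := Nat.lt_two_pow_self (n := k)
      rw [Finset.mem_Icc] at *; omega
    rw [Finset.sum_congr rfl fun P hP => h2 P (h1 hP)]
    refine Finset.sum_subset h1 fun P hP hP' => Finset.sum_eq_zero fun k hk => if_neg fun h => hP' ?_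
    rw [mem_pbox] at *
    refine ⟨?_, hP.2⟩
    have := two_le_norm hP.2
    rw [← h]
    exact Nat.le_self_pow (by have := (Finset.mem_Icc.mp hk).1; omega) _
  rw [Finset.sum_congr rfl fun x hx => by rw [hl x hx]]
  simp_rw [Finset.mul_sum]
  rw [Finset.sum_comm]
  simp_rw [fun P => Finset.sum_comm (s := m.divisorsAntidiagonal) (t := Finset.Icc 1 m)
    (f := fun x k => ((idl K x.1).card : ℝ) * if Ideal.absNorm P ^ k = x.2 then Real.log (Ideal.absNorm P) else 0)]
  have hk : ∀ P ∈ pbox K m, ∀ k ∈ Finset.Icc 1 m, ∑ x ∈ m.divisorsAntidiagonal,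
      ((idl K x.1).card : ℝ) * (if Ideal.absNorm P ^ k = x.2 then Real.log (Ideal.absNorm P) else 0) =
      ∑ I ∈ idl K m, if P ^ k ∣ I then Real.log (Ideal.absNorm P) else 0 := by
    intro P hP k hk
    have hPp := ((mem_pbox K).mp hP).2
    have h2 := two_le_norm hPp
    rw [← Finset.sum_filter, Finset.sum_const, nsmul_eq_mul]
    simp_rw [mul_ite, mul_zero]
    rw [← Finset.sum_filter]
    by_cases hd : Ideal.absNorm P ^ k ∣ m
    · obtain ⟨d, hd⟩ := hd
      have hd0 : d ≠ 0 := by rintro rfl; simp at hd; exact hm hd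
      rw [Finset.sum_eq_single_of_mem (d, Ideal.absNorm P ^ k)]
      · congr 2
        refine Finset.card_nbij' (fun J => P ^ k * J) (fun I => if h : P ^ k ∣ I then h.choose else 0) ?_ ?_ ?_ ?_
        · intro J hJ
          simp only [Finset.mem_coe, Finset.mem_filter, mem_idl] at *
          exact ⟨by rw [map_mul, map_pow, hJ, hd], dvd_mul_right _ _⟩
        · intro I hI
          simp only [Finset.mem_coe, Finset.mem_filter, mem_idl] at *
          rw [dif_pos hI.2]
          have h3 := congrArg Ideal.absNorm hI.2.choose_spec
          rw [map_mul, map_pow] at h3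
          exact (Nat.eq_of_mul_eq_mul_left (by positivity) ((hd.symm.trans hI.1.symm).trans h3)).symm
        · intro J hJ
          have h3 : P ^ k ∣ P ^ k * J := dvd_mul_right _ _
          simp only
          rw [dif_pos h3]
          exact (mul_left_cancel₀ (pow_ne_zero _ hPp.ne_zero) h3.choose_spec).symm
        · intro I hI
          simp only [Finset.mem_coe, Finset.mem_filter, mem_idl] at hI
          simp only
          rw [dif_pos hI.2]
          exact hI.2.choose_spec.symm
      · simp only [Finset.mem_filter, Nat.mem_divisorsAntidiagonal, and_true]
        exact ⟨by rw [hd, mul_comm], hm⟩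
      · intro x hx hne
        simp only [Finset.mem_filter, Nat.mem_divisorsAntidiagonal] at hx
        exfalso; apply hne
        ext
        · have h3 := hx.1.1
          rw [← hx.2, hd, mul_comm] at h3
          exact Nat.eq_of_mul_eq_mul_left (by positivity) h3
        · exact hx.2.symm
    · rw [Finset.sum_eq_zero, Finset.filter_false_of_mem]
      · simp
      · intro I hI h3
        have h4 := map_dvd Ideal.absNorm h3
        rw [(mem_idl K).mp hI, map_pow] at h4
        exact hd h4
      · intro x hx
        simp only [Finset.mem_filter, Nat.mem_divisorsAntidiagonal] at hx
        exact absurd ⟨x.1, by rw [hx.2, mul_comm]; exact hx.1.1.symm⟩ hd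
  rw [Finset.sum_congr rfl fun P hP => Finset.sum_congr rfl (hk P hP)]
  simp_rw [fun P => Finset.sum_comm (s := Finset.Icc 1 m) (t := idl K m)
    (f := fun k I => if P ^ k ∣ I then Real.log (Ideal.absNorm P) else 0)]
  rw [Finset.sum_comm, Finset.sum_congr rfl fun I hI => log_norm K hm ((mem_idl K).mp hI)]
  simp

theorem prime_ideal_thm : Tendsto (fun n : ℕ => (∑ p ∈ (Finset.Icc 1 n).filter Nat.Prime,
    (Nat.card {I : Ideal (𝓞 K) // Ideal.absNorm I = p} : ℝ) * Real.log p) / n) atTop (𝓝 1) := by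
  obtain ⟨κ, δ, hκ, hδ, hδ1, hO⟩ := ideal_count K
  have hlam0 : ∀ m, 0 ≤ lamK K m := fun m => Finset.sum_nonneg fun P _ => Finset.sum_nonneg fun k _ => by
    split_ifs
    · exact Real.log_natCast_nonneg _
    · rfl
  have hmain := pnt_abs (a := fun n => ((idl K n).card : ℝ)) (Λ := lamK K) (fun n => by positivity) hlam0
    (Module.finrank ℤ (𝓞 K)) (lamK_le K) (conv_idl K) hκ hδ hδ1 (by
      refine hO.congr_left fun T => ?_
      congr 1
      rw [← Nat.cast_sum]
      congr 1
      rw [← Finset.card_biUnion, ← Nat.card_eq_finsetCard]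
      · refine Nat.card_congr ⟨fun I => ⟨I.1.1, ?_⟩, fun I => ⟨⟨I.1, ?_⟩, ?_⟩, fun I => rfl, fun I => rfl⟩
        · have h0 : Ideal.absNorm (I.1 : Ideal (𝓞 K)) ≠ 0 := by
            rw [Ne, Ideal.absNorm_eq_zero_iff]; exact nonZeroDivisors.coe_ne_zero I.1
          simp only [Finset.mem_biUnion, mem_idl, exists_eq_right', Finset.mem_Icc]
          exact ⟨Nat.one_le_iff_ne_zero.mpr h0, Nat.le_floor I.2⟩
        · have h0 := I.2
          simp only [Finset.mem_biUnion, mem_idl, exists_eq_right', Finset.mem_Icc] at h0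
          rw [mem_nonZeroDivisors_iff_ne_zero]
          intro h
          rw [h, Ideal.zero_eq_bot, Ideal.absNorm_bot] at h0; omega
        · have h0 := I.2
          simp only [Finset.mem_biUnion, mem_idl, exists_eq_right', Finset.mem_Icc] at h0
          exact (Nat.le_floor_iff' (Nat.one_le_iff_ne_zero.mp h0.1)).mp h0.2
      · intro i _ j _ hij
        refine Finset.disjoint_left.mpr fun I hI hJ => hij ?_
        rw [mem_idl] at hI hJ; rw [← hI, hJ])
  have hid1 : (idl K 1).card = 1 := by
    rw [Finset.card_eq_one]
    refine ⟨⊤, ?_⟩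
    ext I; rw [mem_idl, Finset.mem_singleton, Ideal.absNorm_eq_one_iff]
  have hlam1 : lamK K 1 = 0 := le_antisymm (by simpa using lamK_le K 1) (hlam0 1)
  have hp : ∀ p : ℕ, p.Prime → lamK K p = Nat.card {I : Ideal (𝓞 K) // Ideal.absNorm I = p} * Real.log p := by
    intro p hp
    have := conv_idl K p hp.ne_zero
    rw [Nat.sum_divisorsAntidiagonal (fun i j => ((idl K i).card : ℝ) * lamK K j), Nat.Prime.divisors hp,
      Finset.sum_pair (Nat.Prime.ne_one hp).symm, hid1, Nat.div_one, Nat.div_self (Nat.Prime.pos hp), hlam1] at this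
    simp only [Nat.cast_one, one_mul, mul_zero, add_zero] at this
    rw [this]
    congr 2
    rw [idl, ← Nat.card_eq_card_finite_toFinset]; rfl
  have hdiff : Tendsto (fun n : ℕ => (Module.finrank ℤ (𝓞 K) : ℝ) * ((Chebyshev.psi n - Chebyshev.theta n) / n)) atTop (𝓝 0) := by
    have h1 := (Chebyshev.isBigO_psi_sub_theta_sqrt.comp_tendsto (tendsto_natCast_atTop_atTop (R := ℝ)))
    have h2 : (fun x : ℝ => √x) =o[atTop] (fun x : ℝ => x) := by
      refine isLittleO_of_tendsto' ?_ ?_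
      · filter_upwards [eventually_gt_atTop 0] with x hx h; exact absurd h hx.ne'
      · refine (tendsto_inv_atTop_zero.comp Real.tendsto_sqrt_atTop).congr fun x => ?_
        rw [Real.sqrt_div_self', one_div]; rfl
    have h3 := (h1.trans_isLittleO (h2.comp_tendsto (tendsto_natCast_atTop_atTop (R := ℝ)))).tendsto_div_nhds_zero
    simpa using h3.const_mul (Module.finrank ℤ (𝓞 K) : ℝ)
  have h0 : Tendsto (fun n : ℕ => (∑ k ∈ (Finset.Icc 1 n).filter (fun k => ¬ k.Prime), lamK K k) / n) atTop (𝓝 0) := by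
    refine squeeze_zero (fun n => div_nonneg (Finset.sum_nonneg fun k _ => hlam0 k) (by positivity)) (fun n => ?_) hdiff
    rw [← mul_div_assoc]
    gcongr
    have : Chebyshev.psi n - Chebyshev.theta n = ∑ k ∈ (Finset.Icc 1 n).filter (fun k => ¬ k.Prime), ArithmeticFunction.vonMangoldt k := by
      rw [Chebyshev.psi_sub_theta_eq_sum_not_prime, Nat.floor_natCast]; rfl
    rw [this, Finset.mul_sum]
    exact Finset.sum_le_sum fun k _ => lamK_le K k
  have h1 := hmain.sub h0
  rw [sub_zero] at h1
  refine h1.congr fun n => ?_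
  rw [← sub_div, ← Finset.sum_filter_add_sum_filter_not (Finset.Icc 1 n) Nat.Prime, add_sub_cancel_right]
  congr 1
  exact Finset.sum_congr rfl fun p hpp => hp p (Finset.mem_filter.mp hpp).2
end A3c
/-- logarithmically weighted average over the primes -/
noncomputable def LD (w : ℕ → ℝ) (n : ℕ) : ℝ :=
  (∑ p ∈ (Finset.Icc 1 n).filter Nat.Prime, w p * Real.log p) / n

lemma LD_add (v w : ℕ → ℝ) (n : ℕ) : LD (fun p => v p + w p) n = LD v n + LD w n := by
  simp only [LD, add_mul, Finset.sum_add_distrib, add_div]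

lemma LD_mul (c : ℝ) (w : ℕ → ℝ) (n : ℕ) : LD (fun p => c * w p) n = c * LD w n := by
  simp only [LD, mul_assoc, ← Finset.mul_sum, mul_div_assoc]

lemma LD_sum {ι : Type*} (s : Finset ι) (w : ι → ℕ → ℝ) (n : ℕ) :
    LD (fun p => ∑ i ∈ s, w i p) n = ∑ i ∈ s, LD (w i) n := by
  classical
  induction s using Finset.induction_on with
  | empty => simp [LD]
  | insert a s ha ih => simp only [Finset.sum_insert ha, LD_add, ih]

lemma LD_mono {v w : ℕ → ℝ} (h : ∀ p, p.Prime → v p ≤ w p) (n : ℕ) : LD v n ≤ LD w n := by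
  exact div_le_div_of_nonneg_right (Finset.sum_le_sum fun p hp => mul_le_mul_of_nonneg_right
    (h p (Finset.mem_filter.mp hp).2) (Real.log_natCast_nonneg p)) (by positivity)

lemma LD_congr {v w : ℕ → ℝ} (B : ℕ) (h : ∀ p, p.Prime → B ≤ p → v p = w p) {c : ℝ}
    (hv : Tendsto (LD v) atTop (𝓝 c)) : Tendsto (LD w) atTop (𝓝 c) := by
  have : Tendsto (fun n : ℕ => (∑ p ∈ (Finset.Icc 1 B).filter Nat.Prime, (w p - v p) * Real.log p) / (n:ℝ))
      atTop (𝓝 0) := tendsto_const_nhds.div_atTop tendsto_natCast_atTop_atTop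
  have h1 := hv.add this
  rw [add_zero] at h1
  refine h1.congr' ?_
  filter_upwards [eventually_ge_atTop B] with n hn
  rw [Finset.sum_subset (Finset.filter_subset_filter _ (Finset.Icc_subset_Icc_right hn)), LD, LD, ← add_div,
    ← Finset.sum_add_distrib]
  · congr 1
    refine Finset.sum_congr rfl fun p _ => by ring
  · intro p hp hp'
    simp only [Finset.mem_filter, Finset.mem_Icc] at hp hp'
    have : B ≤ p := by by_contra h; exact hp' ⟨⟨hp.1.1, by omega⟩, hp.2⟩
    rw [h p hp.2 this]; simp

open NumberField in
lemma card_hom (K : Type*) [Field K] [NumberField K] (p : ℕ) [hp : Fact p.Prime] :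
    Nat.card {I : Ideal (𝓞 K) // Ideal.absNorm I = p} = Nat.card (𝓞 K →+* ZMod p) := by
  symm
  refine Nat.card_congr (Equiv.ofBijective (fun ψ => ⟨RingHom.ker ψ, ?_⟩) ⟨?_, ?_⟩)
  · have e := RingHom.quotientKerEquivOfSurjective (ZMod.ringHom_surjective ψ)
    rw [Ideal.absNorm_apply, Submodule.cardQuot_apply, Nat.card_congr e.toEquiv, Nat.card_zmod]
  · intro ψ ψ' h
    have h1 : RingHom.ker ψ = RingHom.ker ψ' := congrArg Subtype.val h
    ext x
    obtain ⟨n, hn⟩ := ZMod.intCast_surjective (ψ x)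
    have h2 : x - n ∈ RingHom.ker ψ := by rw [RingHom.mem_ker, map_sub, map_intCast, hn, sub_self]
    rw [h1, RingHom.mem_ker, map_sub, map_intCast, hn, sub_eq_zero] at h2
    exact h2.symm
  · rintro ⟨I, hI⟩
    rw [Ideal.absNorm_apply, Submodule.cardQuot_apply] at hI
    haveI : Finite (𝓞 K ⧸ I) := Nat.finite_of_card_ne_zero (by rw [hI]; exact hp.out.ne_zero)
    haveI := Fintype.ofFinite (𝓞 K ⧸ I)
    have e := ZMod.ringEquivOfPrime (𝓞 K ⧸ I) hp.out (by rw [← Nat.card_eq_fintype_card]; exact hI)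
    refine ⟨e.symm.toRingHom.comp (Ideal.Quotient.mk I), Subtype.ext ?_⟩
    ext x
    simp [RingHom.mem_ker, Ideal.Quotient.eq_zero_iff_mem]

lemma LD_one : Tendsto (LD fun _ => 1) atTop (𝓝 1) := by
  have := prime_ideal_thm ℚ
  refine this.congr fun n => ?_
  unfold LD
  congr 1
  refine Finset.sum_congr rfl fun p hp => ?_
  congr 1
  haveI : Fact p.Prime := ⟨(Finset.mem_filter.mp hp).2⟩
  rw [card_hom]
  haveI : Unique (NumberField.RingOfIntegers ℚ →+* ZMod p) :=
    { default := (Int.castRingHom _).comp Rat.ringOfIntegersEquiv.toRingHom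
      uniq := fun f => by
        have : f.comp Rat.ringOfIntegersEquiv.symm.toRingHom = Int.castRingHom _ := RingHom.ext_int _ _
        ext x
        have h : f (Rat.ringOfIntegersEquiv.symm (Rat.ringOfIntegersEquiv x)) = _ :=
          DFunLike.congr_fun this (Rat.ringOfIntegersEquiv x)
        rw [RingEquiv.symm_apply_apply] at h
        exact h }
  simp

theorem dens_final (S : Set ℕ) {d : ℝ} (h : Tendsto (LD (S.indicator fun _ => 1)) atTop (𝓝 d)) :
    Tendsto (fun x : ℕ => (Nat.card {p : ℕ | p ≤ x ∧ p.Prime ∧ p ∈ S} : ℝ) / (Nat.card {p : ℕ | p ≤ x ∧ p.Prime} : ℝ))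
      atTop (𝓝 d) := by
  classical
  have hc1 : ∀ x : ℕ, Nat.card {p : ℕ | p ≤ x ∧ p.Prime} = ((Finset.Icc 1 x).filter Nat.Prime).card := by
    intro x
    rw [← Nat.card_eq_finsetCard]
    refine Nat.card_congr (Equiv.setCongr ?_)
    ext p; simp only [mem_ofPred_eq, Finset.coe_filter, Finset.mem_Icc]
    exact ⟨fun h => ⟨⟨h.2.one_le, h.1⟩, h.2⟩, fun h => ⟨h.1.2, h.2⟩⟩
  have hc2 : ∀ x : ℕ, Nat.card {p : ℕ | p ≤ x ∧ p.Prime ∧ p ∈ S} = (((Finset.Icc 1 x).filter Nat.Prime).filter (· ∈ S)).card := by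
    intro x
    rw [← Nat.card_eq_finsetCard]
    refine Nat.card_congr (Equiv.setCongr ?_)
    ext p; simp only [mem_ofPred_eq, Finset.coe_filter, Finset.mem_Icc, Finset.mem_filter]
    exact ⟨fun h => ⟨⟨⟨h.2.1.one_le, h.1⟩, h.2.1⟩, h.2.2⟩, fun h => ⟨h.1.1.2, h.1.2, h.2⟩⟩
  simp_rw [hc1, hc2]
  set P : ℕ → Finset ℕ := fun x => (Finset.Icc 1 x).filter Nat.Prime with hP
  have hpi : ∀ x, ((P x).card : ℝ) = Nat.primeCounting x := by
    intro x
    rw [Nat.primeCounting, Nat.primeCounting', Nat.count_eq_card_filter_range]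
    congr 2
    ext p; simp only [hP, Finset.mem_filter, Finset.mem_Icc, Finset.mem_range]
    exact ⟨fun h => ⟨by omega, h.2⟩, fun h => ⟨⟨h.2.one_le, by omega⟩, h.2⟩⟩
  have hth : ∀ x : ℕ, Chebyshev.theta x = ∑ p ∈ P x, Real.log p := by
    intro x; rw [Chebyshev.theta, Nat.floor_natCast]; rfl
  have hO : Tendsto (fun x : ℕ => ((P x).card * Real.log x - Chebyshev.theta x) / x) atTop (𝓝 0) := by
    have h1 := Chebyshev.primeCounting_sub_theta_div_log_isBigO.comp_tendsto (tendsto_natCast_atTop_atTop (R := ℝ))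
    obtain ⟨C, hC⟩ := h1.bound
    have hl : Tendsto (fun x : ℕ => C / Real.log x) atTop (𝓝 0) :=
      tendsto_const_nhds.div_atTop (Real.tendsto_log_atTop.comp tendsto_natCast_atTop_atTop)
    refine squeeze_zero_norm' ?_ hl
    filter_upwards [hC, eventually_gt_atTop 1] with x hx hx1
    have hx0 : (0:ℝ) < x := by positivity
    have hlog : 0 < Real.log x := Real.log_pos (by exact_mod_cast hx1)
    simp only [Function.comp, Nat.floor_natCast, ← hpi] at hx
    have e : ((P x).card * Real.log x - Chebyshev.theta x) / x = ((P x).card - Chebyshev.theta x / Real.log x) * (Real.log x / x) := by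
      field_simp
    rw [e, norm_mul]
    rw [Real.norm_of_nonneg (show 0 ≤ (x:ℝ) / Real.log x ^ 2 by positivity)] at hx
    rw [Real.norm_of_nonneg (show 0 ≤ Real.log x / x by positivity)]
    calc _ ≤ C * ((x:ℝ) / Real.log x ^ 2) * (Real.log x / x) := by gcongr
      _ = _ := by field_simp
  have hS : Tendsto (fun x : ℕ => (((P x).filter (· ∈ S)).card * Real.log x) / x) atTop (𝓝 d) := by
    have h0 : Tendsto (fun x : ℕ => (((P x).filter (· ∈ S)).card * Real.log x) / x - LD (S.indicator fun _ => 1) x) atTop (𝓝 0) := by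
      have e : ∀ x, LD (S.indicator fun _ => 1) x = (∑ p ∈ (P x).filter (· ∈ S), Real.log p) / x := by
        intro x
        rw [LD, Finset.sum_filter (· ∈ S)]
        congr 1
        refine Finset.sum_congr rfl fun p _ => ?_
        by_cases h : p ∈ S <;> simp [h]
      have e2 : ∀ (x : ℕ) (Q : Finset ℕ), Q.card * Real.log x - ∑ p ∈ Q, Real.log p = ∑ p ∈ Q, (Real.log x - Real.log p) := by
        intro x Q; simp [Finset.sum_sub_distrib]
      have h3 : ∀ x : ℕ, ∀ p ∈ P x, 0 ≤ Real.log x - Real.log p := by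
        intro x p hp
        simp only [hP, Finset.mem_filter, Finset.mem_Icc] at hp
        rw [sub_nonneg]
        exact Real.log_le_log (by exact_mod_cast hp.1.1) (by exact_mod_cast hp.1.2)
      refine squeeze_zero (fun x => ?_) (fun x => ?_) hO
      · rw [e, ← sub_div, e2]
        exact div_nonneg (Finset.sum_nonneg fun p hp => h3 x p (Finset.mem_filter.mp hp).1) (by positivity)
      · rw [e, ← sub_div, e2, hth, e2]
        refine div_le_div_of_nonneg_right ?_ (by positivity)
        exact Finset.sum_le_sum_of_subset_of_nonneg (Finset.filter_subset _ _) fun p hp _ => h3 x p hp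
    simpa using h0.add h
  have hP1 : Tendsto (fun x : ℕ => ((P x).card * Real.log x) / x) atTop (𝓝 1) := by
    have h1 : Tendsto (fun x : ℕ => Chebyshev.theta x / x) atTop (𝓝 1) :=
      LD_one.congr fun x => by rw [hth, LD]; simp [hP]
    simpa [← add_div] using hO.add h1
  have := hS.div hP1 one_ne_zero
  rw [div_one] at this
  refine this.congr' ?_
  filter_upwards [eventually_gt_atTop 1] with x hx
  have hx0 : (0:ℝ) < x := by positivity
  have hlog : 0 < Real.log x := Real.log_pos (by exact_mod_cast hx)
  simp only [Pi.div_apply]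
  field_simp
  rfl
section frob
open NumberField

lemma avoid {L : Type*} [Field L] [NumberField L] (x : 𝓞 L) (hx : x ≠ 0) :
    ∃ B : ℕ, ∀ p : ℕ, p.Prime → B ≤ p → ∀ P : Ideal (𝓞 L), P.IsPrime → (p : 𝓞 L) ∈ P → x ∉ P := by
  refine ⟨Ideal.absNorm (Ideal.span {x}) + 1, fun p hp hB P hP hpP hxP => ?_⟩
  have h0 : Ideal.absNorm (Ideal.span {x}) ≠ 0 := by
    rw [Ne, Ideal.absNorm_eq_zero_iff]; simpa using hx
  have h1 : ((Ideal.absNorm (Ideal.span {x}) : ℕ) : 𝓞 L) ∈ P :=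
    (Ideal.span_singleton_le_iff_mem (I := P)).2 hxP (Ideal.absNorm_mem _)
  have hc : Nat.Coprime p (Ideal.absNorm (Ideal.span {x})) :=
    Nat.coprime_of_lt_prime h0 hB hp
  have := Nat.isCoprime_iff_coprime.2 hc
  obtain ⟨a, b, hab⟩ := this
  apply hP.ne_top
  rw [Ideal.eq_top_iff_one]
  have e : (1 : 𝓞 L) = (a : 𝓞 L) * (p : 𝓞 L) + (b : 𝓞 L) * ((Ideal.absNorm (Ideal.span {x}) : ℕ) : 𝓞 L) := by
    have := congrArg (Int.cast : ℤ → 𝓞 L) hab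
    push_cast at this; exact this.symm
  rw [e]
  exact P.add_mem (P.mul_mem_left _ hpP) (P.mul_mem_left _ h1)

variable {L : Type*} [Field L] [NumberField L] [IsGalois ℚ L]

def FrobAt (p : ℕ) (P : Ideal (𝓞 L)) (σ : L ≃ₐ[ℚ] L) : Prop :=
  P.IsMaximal ∧ (p : 𝓞 L) ∈ P ∧ ∀ x : 𝓞 L, σ • x - x ^ p ∈ P

lemma frob_exists (p : ℕ) (hp : p.Prime) : ∃ (P : Ideal (𝓞 L)) (σ : L ≃ₐ[ℚ] L), FrobAt p P σ := by
  have := Fact.mk hp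
  have hmax : (Ideal.span {(p : ℤ)}).IsMaximal := Int.ideal_span_isMaximal_of_prime p
  obtain ⟨P, hP, hlo⟩ := Ideal.exists_maximal_ideal_liesOver_of_isIntegral (S := 𝓞 L) (Ideal.span {(p : ℤ)})
  have hpP : (p : 𝓞 L) ∈ P := by
    have : (p : ℤ) ∈ P.under ℤ := by
      rw [← hlo.over]; exact Ideal.mem_span_singleton_self _
    simpa [Ideal.mem_comap] using this
  have hP0 : P ≠ ⊥ := by
    rintro rfl
    have : (p : 𝓞 L) = 0 := by simpa using hpP
    exact hp.ne_zero (by exact_mod_cast this)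
  have : Finite (𝓞 L ⧸ P) := Ideal.finiteQuotientOfFreeOfNeBot P hP0
  obtain ⟨σ, hσ⟩ := IsArithFrobAt.exists_of_isInvariant ℤ (L ≃ₐ[ℚ] L) P
  refine ⟨P, σ, hP, hpP, fun x => ?_⟩
  have h := hσ x
  rw [← hlo.over, Nat.card_congr (Int.quotientSpanNatEquivZMod p).toEquiv, Nat.card_zmod] at h
  exact h

/-- twisted reduction map -/
noncomputable def tw (H : Subgroup (L ≃ₐ[ℚ] L)) (P : Ideal (𝓞 L)) (g : L ≃ₐ[ℚ] L) :
    𝓞 (IntermediateField.fixedField H) →+* (𝓞 L ⧸ P) :=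
  (Ideal.Quotient.mk P).comp ((MulSemiringAction.toRingHom (L ≃ₐ[ℚ] L) (𝓞 L) g).comp
    (algebraMap (𝓞 (IntermediateField.fixedField H)) (𝓞 L)))

lemma tw_apply (H : Subgroup (L ≃ₐ[ℚ] L)) (P : Ideal (𝓞 L)) (g : L ≃ₐ[ℚ] L) (a) :
    tw H P g a = Ideal.Quotient.mk P (g • algebraMap (𝓞 (IntermediateField.fixedField H)) (𝓞 L) a) := rfl

lemma smul_H (H : Subgroup (L ≃ₐ[ℚ] L)) (h : L ≃ₐ[ℚ] L) (hh : h ∈ H)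
    (a : 𝓞 (IntermediateField.fixedField H)) :
    h • algebraMap (𝓞 (IntermediateField.fixedField H)) (𝓞 L) a = algebraMap _ (𝓞 L) a := by
  apply RingOfIntegers.ext
  exact (IntermediateField.mem_fixedField_iff H _).1 (a : IntermediateField.fixedField H).2 h hh

lemma tw_coset (H : Subgroup (L ≃ₐ[ℚ] L)) (P : Ideal (𝓞 L)) (g g' : L ≃ₐ[ℚ] L)
    (h : g⁻¹ * g' ∈ H) : tw H P g = tw H P g' := by
  ext a
  rw [tw_apply, tw_apply, ← smul_H H _ h a, smul_smul, mul_inv_cancel_left, smul_H H _ h a]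

lemma tw_inj (H : Subgroup (L ≃ₐ[ℚ] L)) (g g' : L ≃ₐ[ℚ] L) :
    ∃ B : ℕ, ∀ p : ℕ, p.Prime → B ≤ p → ∀ P : Ideal (𝓞 L), P.IsPrime → (p : 𝓞 L) ∈ P →
      tw H P g = tw H P g' → g⁻¹ * g' ∈ H := by
  by_cases h : g⁻¹ * g' ∈ H
  · exact ⟨0, fun _ _ _ _ _ _ _ => h⟩
  have h' := h
  rw [← IntermediateField.fixingSubgroup_fixedField H, IntermediateField.mem_fixingSubgroup_iff] at h'
  push Not at h'
  obtain ⟨x, hx, hne⟩ := h'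
  obtain ⟨b, n, hn⟩ : ∃ (b : 𝓞 (IntermediateField.fixedField H)) (n : ℤ), n ≠ 0 ∧
      (b : IntermediateField.fixedField H) = n • (⟨x, hx⟩ : IntermediateField.fixedField H) := by
    have ha : IsAlgebraic ℤ (⟨x, hx⟩ : IntermediateField.fixedField H) :=
      (IsFractionRing.isAlgebraic_iff ℤ ℚ _).2 (IsAlgebraic.of_finite ℚ _)
    obtain ⟨n, hn, hi⟩ := ha.exists_integral_multiple
    exact ⟨⟨_, hi⟩, n, hn, rfl⟩
  obtain ⟨hn, hb⟩ := hn
  have hd : g • algebraMap (𝓞 (IntermediateField.fixedField H)) (𝓞 L) b - g' • algebraMap _ (𝓞 L) b ≠ 0 := by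
    intro h0
    rw [sub_eq_zero] at h0
    have h1 := congrArg (fun y : 𝓞 L => (y : L)) h0
    have h2 : g (n • x) = g' (n • x) := by
      have e : (algebraMap (𝓞 (IntermediateField.fixedField H)) (𝓞 L) b : L) = n • x := by
        change ((b : IntermediateField.fixedField H) : L) = _
        rw [hb]; simp
      rw [← e]; exact h1
    rw [map_zsmul, map_zsmul] at h2
    have h3 : g x = g' x := by
      simpa [hn] using h2
    apply hne
    change g⁻¹ (g' x) = x
    rw [← h3]; exact g.symm_apply_apply x
  obtain ⟨B, hB⟩ := avoid _ hd
  refine ⟨B, fun p hp hpB P hP hpP he => (hB p hp hpB P hP hpP ?_).elim⟩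
  have := RingHom.congr_fun he b
  rw [tw_apply, tw_apply] at this
  exact Ideal.Quotient.eq.1 this

lemma tw_surj (H : Subgroup (L ≃ₐ[ℚ] L)) (p : ℕ) [Fact p.Prime] (P : Ideal (𝓞 L)) [P.IsMaximal]
    (hpP : (p : 𝓞 L) ∈ P) (ι : ZMod p →+* 𝓞 L ⧸ P)
    (ψ : 𝓞 (IntermediateField.fixedField H) →+* ZMod p) : ∃ g, tw H P g = ι.comp ψ := by
  have hsurj : Function.Surjective ψ := ZMod.ringHom_surjective ψ
  have hm : (RingHom.ker ψ).IsMaximal := RingHom.ker_isMaximal_of_surjective ψ hsurj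
  obtain ⟨Q, hQ, hlo⟩ := Ideal.exists_maximal_ideal_liesOver_of_isIntegral (S := 𝓞 L) (RingHom.ker ψ)
  have hunder : ∀ R : Ideal (𝓞 L), R.IsMaximal → (p : 𝓞 L) ∈ R → R.under ℤ = Ideal.span {(p : ℤ)} := by
    intro R hR hpR
    refine ((Int.ideal_span_isMaximal_of_prime p).eq_of_le ?_ ?_).symm
    · exact (Ideal.IsPrime.under ℤ R).ne_top
    · rw [Ideal.span_singleton_le_iff_mem]
      simpa [Ideal.mem_comap] using hpR
  have hQm : ∀ a, algebraMap (𝓞 (IntermediateField.fixedField H)) (𝓞 L) a ∈ Q ↔ ψ a = 0 := fun a => by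
    rw [← RingHom.mem_ker, hlo.over]; rfl
  have hpQ : (p : 𝓞 L) ∈ Q := by
    have := (hQm (p : 𝓞 (IntermediateField.fixedField H))).2 (by simp)
    simpa using this
  obtain ⟨g, hg⟩ := Algebra.IsInvariant.exists_smul_of_under_eq ℤ (𝓞 L) (L ≃ₐ[ℚ] L) P Q
    ((hunder P ‹_› hpP).trans (hunder Q hQ hpQ).symm)
  refine ⟨g⁻¹, ?_⟩
  ext a
  rw [tw_apply]
  obtain ⟨n, hn⟩ := ZMod.intCast_surjective (ψ a)
  have h1 : algebraMap (𝓞 (IntermediateField.fixedField H)) (𝓞 L) (a - n) ∈ Q := by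
    rw [hQm]; simp [hn]
  rw [hg, Ideal.mem_pointwise_smul_iff_inv_smul_mem] at h1
  rw [RingHom.comp_apply, ← hn, map_intCast, ← map_intCast (Ideal.Quotient.mk P), Ideal.Quotient.eq]
  rw [map_sub, map_intCast, smul_sub] at h1
  have e : (g⁻¹ • (n : 𝓞 L)) = n := map_intCast (MulSemiringAction.toRingHom (L ≃ₐ[ℚ] L) (𝓞 L) g⁻¹) n
  rwa [e] at h1

lemma frob_count (H : Subgroup (L ≃ₐ[ℚ] L)) : ∃ B : ℕ, ∀ p : ℕ, p.Prime → B ≤ p →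
    ∀ (P : Ideal (𝓞 L)) (σ : L ≃ₐ[ℚ] L), FrobAt p P σ →
      Nat.card (𝓞 (IntermediateField.fixedField H) →+* ZMod p) =
        Nat.card {x : (L ≃ₐ[ℚ] L) ⧸ H // σ • x = x} := by
  choose B hB using tw_inj H
  refine ⟨∑ g, ∑ g', B g g', fun p hp hpB P σ ⟨hP, hpP, hσ⟩ => ?_⟩
  have := Fact.mk hp
  have inj : ∀ g g', tw H P g = tw H P g' → g⁻¹ * g' ∈ H := fun g g' =>
    hB g g' p hp (le_trans (le_trans (Finset.single_le_sum (f := fun g' => B g g') (fun _ _ => Nat.zero_le _)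
      (Finset.mem_univ g')) (Finset.single_le_sum (f := fun g => ∑ g', B g g') (fun _ _ => Nat.zero_le _)
      (Finset.mem_univ g))) hpB) P hP.isPrime hpP
  letI : Field (𝓞 L ⧸ P) := Ideal.Quotient.field P
  have hchar : CharP (𝓞 L ⧸ P) p := by
    refine (CharP.charP_iff_prime_eq_zero hp).2 ?_
    rw [← map_natCast (Ideal.Quotient.mk P)]
    exact Ideal.Quotient.eq_zero_iff_mem.2 hpP
  let ι : ZMod p →+* 𝓞 L ⧸ P := ZMod.castHom dvd_rfl _
  have htwσ : ∀ g a, tw H P (σ * g) a = tw H P g a ^ p := by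
    intro g a
    rw [tw_apply, tw_apply, ← map_pow, Ideal.Quotient.eq, mul_smul]
    exact hσ _
  have hιp : ∀ z, (ι z) ^ p = ι z := fun z => by rw [← map_pow, ZMod.pow_card]
  have hfix : ∀ g : L ≃ₐ[ℚ] L, (σ • (g : (L ≃ₐ[ℚ] L) ⧸ H) = g) ↔ ∃ ψ, tw H P g = ι.comp ψ := by
    intro (g : L ≃ₐ[ℚ] L)
    rw [MulAction.Quotient.smul_coe, smul_eq_mul, eq_comm, QuotientGroup.eq]
    constructor
    · intro h
      have h1 : ∀ a, tw H P g a ∈ ι.range := by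
        intro a
        have e : tw H P g a ^ p = tw H P g a := by rw [← htwσ, ← tw_coset H P _ _ h]
        have := (Subfield.mem_bot_iff_pow_eq_self (𝓞 L ⧸ P) p).2 e
        have h2 : (⊥ : Subfield (𝓞 L ⧸ P)) ≤ ι.fieldRange := bot_le
        exact h2 this
      let e : ZMod p ≃+* ι.range := RingEquiv.ofBijective ι.rangeRestrict
        ⟨fun x y h => ι.injective (congrArg Subtype.val h), ι.rangeRestrict_surjective⟩
      refine ⟨e.symm.toRingHom.comp ((tw H P g).codRestrict ι.range h1), ?_⟩
      ext a
      exact (congrArg Subtype.val (e.apply_symm_apply ((tw H P g).codRestrict ι.range h1 a))).symm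
    · rintro ⟨ψ, hψ⟩
      apply inj
      ext a
      rw [htwσ, hψ, RingHom.comp_apply, hιp]
  have e1 : (fun x : (L ≃ₐ[ℚ] L) ⧸ H => tw H P x.out) '' {x | σ • x = x} = range (fun ψ => ι.comp ψ) := by
    ext f
    simp only [mem_image, mem_range]
    constructor
    · rintro ⟨x, hx, rfl⟩
      obtain ⟨ψ, hψ⟩ := (hfix x.out).1 (by rw [QuotientGroup.out_eq']; exact hx)
      exact ⟨ψ, hψ.symm⟩
    · rintro ⟨ψ, rfl⟩
      obtain ⟨g, hg⟩ := tw_surj H p P hpP ι ψ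
      refine ⟨g, (hfix g).2 ⟨ψ, hg⟩, ?_⟩
      rw [← hg]
      exact tw_coset H P _ _ (QuotientGroup.eq.1 (QuotientGroup.out_eq' _))
  have c1 := Nat.card_image_of_injective (f := fun x : (L ≃ₐ[ℚ] L) ⧸ H => tw H P x.out) (fun x y h => by
    have := QuotientGroup.eq.2 (inj _ _ h)
    rwa [QuotientGroup.out_eq', QuotientGroup.out_eq'] at this) {x | σ • x = x}
  have c2 := Nat.card_range_of_injective (f := fun ψ : 𝓞 (IntermediateField.fixedField H) →+* ZMod p => ι.comp ψ)
    (fun x y h => RingHom.ext fun a => ι.injective (RingHom.congr_fun h a))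
  rw [← c2, ← e1, c1]
  rfl

lemma frob_LD (σ : ℕ → (L ≃ₐ[ℚ] L)) (hσ : ∀ p, p.Prime → ∃ P, FrobAt p P (σ p))
    (H : Subgroup (L ≃ₐ[ℚ] L)) :
    Tendsto (LD fun p => (Nat.card {x : (L ≃ₐ[ℚ] L) ⧸ H // σ p • x = x} : ℝ)) atTop (𝓝 1) := by
  obtain ⟨B, hB⟩ := frob_count H
  refine LD_congr B (v := fun p => (Nat.card {I : Ideal (𝓞 (IntermediateField.fixedField H)) // Ideal.absNorm I = p} : ℝ))
    (fun p hp hpB => ?_) (prime_ideal_thm _)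
  have := Fact.mk hp
  obtain ⟨P, hP⟩ := hσ p hp
  rw [card_hom, hB p hp hpB P _ hP]
end frob
section artin
variable {G : Type*} [Group G] [Finite G]
open scoped Classical in
lemma card_fix (Z : Subgroup G) (s : G) :
    Nat.card Z * Nat.card {y : G ⧸ Z // s • y = y} = Nat.card {x : G // x⁻¹ * s * x ∈ Z} := by
  rw [mul_comm, ← Nat.card_prod]
  have h : ∀ x : G, (Subgroup.groupEquivQuotientProdSubgroup (s := Z) x).1 = (x : G ⧸ Z) := fun _ => rfl
  have E1 : {x : G // x⁻¹ * s * x ∈ Z} ≃ {q : (G ⧸ Z) × Z // s • q.1 = q.1} :=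
    Subgroup.groupEquivQuotientProdSubgroup.subtypeEquiv fun x => by
      rw [h, MulAction.Quotient.smul_coe, smul_eq_mul, eq_comm (b := (x : G ⧸ Z)), QuotientGroup.eq, mul_assoc]
  have E2 : {y : G ⧸ Z // s • y = y} × Z ≃ {q : (G ⧸ Z) × Z // s • q.1 = q.1} :=
    ⟨fun q => ⟨(q.1.1, q.2), q.1.2⟩, fun q => (⟨q.1.1, q.2⟩, q.1.2), fun _ => rfl, fun _ => rfl⟩
  exact Nat.card_congr (E2.trans E1.symm)

/-- number of conjugators taking `s` to a generator of `Z` -/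
noncomputable def uZ (Z : Subgroup G) (s : G) : ℕ := Nat.card {x : G // Subgroup.zpowers (x⁻¹ * s * x) = Z}
noncomputable def tZ (Z : Subgroup G) : ℕ := Nat.card {x : G // Subgroup.zpowers x = Z}

open scoped Classical in
lemma card_fiber {α : Type*} [Fintype α] [Fintype (Subgroup G)] (f : α → Subgroup G)
    (S : Finset (Subgroup G)) :
    Nat.card {x : α // f x ∈ S} = ∑ Z ∈ S, Nat.card {x : α // f x = Z} := by
  simp only [Nat.card_eq_fintype_card, Fintype.card_subtype]
  rw [Finset.card_eq_sum_card_fiberwise (f := f) (t := S) (by intro x; simp)]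
  refine Finset.sum_congr rfl fun Z hZ => congrArg _ ?_
  ext x; simp only [Finset.mem_filter, Finset.mem_univ, true_and, and_iff_right_iff_imp]
  rintro rfl; exact hZ

open scoped Classical in
lemma LD_uZ (σ : ℕ → G) (h : ∀ H : Subgroup G,
    Tendsto (LD fun p => (Nat.card {x : G ⧸ H // σ p • x = x} : ℝ)) atTop (𝓝 1)) (Z : Subgroup G) :
    Tendsto (LD fun p => (uZ Z (σ p) : ℝ)) atTop (𝓝 (tZ Z)) := by
  have := Fintype.ofFinite G
  have := Fintype.ofFinite (Subgroup G)
  induction Z using WellFoundedLT.induction with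
  | ind Z ih =>
  let S : Finset (Subgroup G) := Finset.univ.filter (· < Z)
  have h1 : ∀ s : G, (Nat.card Z : ℝ) * (Nat.card {y : G ⧸ Z // s • y = y} : ℝ)
      = (uZ Z s : ℝ) + ∑ W ∈ S, (uZ W s : ℝ) := by
    intro s
    have e := card_fiber (fun x : G => Subgroup.zpowers (x⁻¹ * s * x)) (insert Z S)
    rw [Finset.sum_insert (by simp [S])] at e
    have e2 := card_fix Z s
    rw [← Nat.cast_mul, e2]
    have : Nat.card {x : G // x⁻¹ * s * x ∈ Z} = Nat.card {x : G // Subgroup.zpowers (x⁻¹ * s * x) ∈ insert Z S} :=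
      Nat.card_congr (Equiv.subtypeEquivRight fun x => by
        rw [← Subgroup.zpowers_le, le_iff_eq_or_lt]; simp [S])
    rw [this, e]; push_cast; rfl
  have h2 : (Nat.card Z : ℝ) = (tZ Z : ℝ) + ∑ W ∈ S, (tZ W : ℝ) := by
    have e := card_fiber (fun x : G => Subgroup.zpowers x) (insert Z S)
    rw [Finset.sum_insert (by simp [S])] at e
    have : Nat.card Z = Nat.card {x : G // Subgroup.zpowers x ∈ insert Z S} :=
      Nat.card_congr (Equiv.subtypeEquivRight fun x => by
        rw [← Subgroup.zpowers_le, le_iff_eq_or_lt]; simp [S])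
    rw [this, e]; push_cast; rfl
  have h3 := ((h Z).const_mul (Nat.card Z : ℝ)).sub
    (tendsto_finsetSum S fun W hW => ih W (by simpa [S] using hW))
  have e : (tZ Z : ℝ) = Nat.card Z * 1 - ∑ W ∈ S, (tZ W : ℝ) := by rw [h2]; ring
  rw [e]
  refine h3.congr fun n => ?_
  rw [← LD_mul, ← LD_sum S (fun W p => (uZ W (σ p) : ℝ))]
  have : (fun p => (Nat.card Z : ℝ) * (Nat.card {x : G ⧸ Z // σ p • x = x} : ℝ))
    = fun p => (uZ Z (σ p) : ℝ) + ∑ W ∈ S, (uZ W (σ p) : ℝ) := funext fun p => h1 _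
  rw [this, LD_add]; ring

open scoped Classical in
lemma LD_class (σ : ℕ → G) (h : ∀ H : Subgroup G,
    Tendsto (LD fun p => (Nat.card {x : G ⧸ H // σ p • x = x} : ℝ)) atTop (𝓝 1)) (C : Set G)
    (hC : ∀ x s, s ∈ C → x⁻¹ * s * x ∈ C)
    (hz : ∀ s t, Subgroup.zpowers s = Subgroup.zpowers t → s ∈ C → t ∈ C) :
    Tendsto (LD fun p => if σ p ∈ C then 1 else 0) atTop (𝓝 ((Nat.card C : ℝ) / Nat.card G)) := by
  have := Fintype.ofFinite G
  have := Fintype.ofFinite (Subgroup G)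
  have h0 : (Nat.card G : ℝ) ≠ 0 := by exact_mod_cast Nat.card_pos.ne'
  let S : Finset (Subgroup G) := Finset.univ.filter fun Z => ∃ s ∈ C, Subgroup.zpowers s = Z
  have hS : ∀ x, Subgroup.zpowers x ∈ S ↔ x ∈ C := fun x => by
    simp only [S, Finset.mem_filter, Finset.mem_univ, true_and]
    exact ⟨fun ⟨s, hs, e⟩ => hz _ _ e hs, fun hx => ⟨x, hx, rfl⟩⟩
  have h1 : ∀ s : G, (Nat.card G : ℝ) * (if s ∈ C then 1 else 0) = ∑ W ∈ S, (uZ W s : ℝ) := by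
    intro s
    have e := card_fiber (fun x : G => Subgroup.zpowers (x⁻¹ * s * x)) S
    simp only [hS] at e
    have e2 : ∑ W ∈ S, (uZ W s : ℝ) = Nat.card {x : G // x⁻¹ * s * x ∈ C} := by
      rw [e]; push_cast; rfl
    rw [e2]
    have hiff : ∀ x, x⁻¹ * s * x ∈ C ↔ s ∈ C := fun x =>
      ⟨fun hx => by simpa [mul_assoc] using hC x⁻¹ _ hx, hC x s⟩
    simp only [hiff]
    split_ifs with hs
    · rw [mul_one, Nat.card_congr (Equiv.subtypeUnivEquiv fun _ => hs)]
    · simp [hs]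
  have h2 : (Nat.card C : ℝ) = ∑ W ∈ S, (tZ W : ℝ) := by
    have e := card_fiber (fun x : G => Subgroup.zpowers x) S
    simp only [hS] at e
    have e3 : Nat.card C = Nat.card {x // x ∈ C} := rfl
    rw [e3, e]; push_cast; rfl
  have h3 := (tendsto_finsetSum S fun W _ => LD_uZ σ h W).const_mul ((Nat.card G : ℝ)⁻¹)
  rw [← h2, inv_mul_eq_div] at h3
  refine h3.congr fun n => ?_
  rw [← LD_sum S (fun W p => (uZ W (σ p) : ℝ)), ← LD_mul]
  congr 1; funext p
  rw [← h1, inv_mul_cancel_left₀ h0]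
end artin
/-! the curve -/
open scoped Classical
open WeierstrassCurve WeierstrassCurve.Affine

/-- the curve `y^2 = x^3+5x^2-32x` -/
def Wc : WeierstrassCurve ℤ := ⟨0, 5, 0, -32, 0⟩

abbrev EE (F : Type*) [Field F] := (Wc⁄F).toAffine.Point

section curve
variable {F : Type*} [Field F]

def onE (x y : F) : Prop := y ^ 2 = x ^ 3 + 5 * x ^ 2 - 32 * x

lemma Wc_eq (x y : F) : (Wc⁄F).toAffine.Equation x y ↔ onE x y := by
  rw [equation_iff, onE]
  simp [Wc, WeierstrassCurve.map, WeierstrassCurve.baseChange, sub_eq_add_neg]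

lemma Wc_negY (x y : F) : (Wc⁄F).toAffine.negY x y = -y := by
  simp [Wc, WeierstrassCurve.map, WeierstrassCurve.baseChange, negY]

noncomputable def pt (x y : F) : EE F :=
  if h : (Wc⁄F).toAffine.Nonsingular x y then .some x y h else 0

lemma pt_cases (A : EE F) : A = 0 ∨ ∃ x y, onE x y ∧ A = pt x y := by
  rcases A with _ | ⟨x, y, h⟩
  · exact Or.inl rfl
  · exact Or.inr ⟨x, y, (Wc_eq x y).1 h.1, by rw [pt, dif_pos h]⟩

variable [hF : Fact ((102 : F) ≠ 0)]
include hF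

lemma F2 : (2 : F) ≠ 0 := fun h => hF.out (by linear_combination 51 * h)
lemma F3 : (3 : F) ≠ 0 := fun h => hF.out (by linear_combination 34 * h)
lemma F17 : (17 : F) ≠ 0 := fun h => hF.out (by linear_combination 6 * h)

lemma Wc_ns {x y : F} (h : onE x y) : (Wc⁄F).toAffine.Nonsingular x y := by
  refine (equation_iff_nonsingular_of_Δ_ne_zero ?_).1 ((Wc_eq x y).2 h)
  have : (Wc⁄F).toAffine.Δ = 2 ^ 14 * 3 ^ 2 * 17 := by
    simp [Wc, WeierstrassCurve.map, WeierstrassCurve.baseChange, WeierstrassCurve.Δ,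
      WeierstrassCurve.b₂, WeierstrassCurve.b₄, WeierstrassCurve.b₆, WeierstrassCurve.b₈]
    norm_num
  rw [this]
  exact mul_ne_zero (mul_ne_zero (pow_ne_zero _ F2) (pow_ne_zero _ F3)) F17

lemma pt_eq {x y : F} (h : onE x y) : pt x y = .some x y (Wc_ns h) := by rw [pt, dif_pos (Wc_ns h)]

lemma pt_ne {x y : F} (h : onE x y) : pt x y ≠ 0 := by rw [pt_eq h]; exact Point.some_ne_zero _

lemma pt_inj {x y x' y' : F} (h : onE x y) (h' : onE x' y') : pt x y = pt x' y' ↔ x = x' ∧ y = y' := by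
  rw [pt_eq h, pt_eq h']; simp

lemma neg_pt {x y : F} (h : onE x y) : -pt x y = pt x (-y) := by
  have h' : onE x (-y) := by unfold onE at *; rw [neg_sq, h]
  rw [pt_eq h, pt_eq h', Point.neg_some]; congr 1; exact Wc_negY x y

lemma pt_add {x₁ y₁ x₂ y₂ ℓ x₃ y₃ : F} (h₁ : onE x₁ y₁) (h₂ : onE x₂ y₂) (hx : x₁ ≠ x₂)
    (hl : ℓ * (x₁ - x₂) = y₁ - y₂) (e1 : x₃ = ℓ ^ 2 - 5 - x₁ - x₂) (e2 : y₃ = -(ℓ * (x₃ - x₁) + y₁)) :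
    onE x₃ y₃ ∧ pt x₁ y₁ + pt x₂ y₂ = pt x₃ y₃ := by
  have hs : (Wc⁄F).toAffine.slope x₁ x₂ y₁ y₂ = ℓ := by
    rw [slope_of_X_ne hx, div_eq_iff (sub_ne_zero.2 hx), hl]
  have hX : (Wc⁄F).toAffine.addX x₁ x₂ ℓ = x₃ := by
    rw [e1]; simp [Wc, WeierstrassCurve.map, WeierstrassCurve.baseChange, addX]
  have hY : (Wc⁄F).toAffine.addY x₁ x₂ y₁ ℓ = y₃ := by
    rw [addY, Wc_negY, negAddY, hX, e2]
  have hn := nonsingular_add (Wc_ns h₁) (Wc_ns h₂) (fun h => hx h.1)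
  rw [hs, hX, hY] at hn
  have h3 := (Wc_eq x₃ y₃).1 hn.1
  refine ⟨h3, ?_⟩
  rw [pt_eq h₁, pt_eq h₂, pt_eq h3, Point.add_of_X_ne hx]
  simp only [Point.some.injEq]
  rw [hs]; exact ⟨hX, hY⟩

lemma pt_dbl {x₁ y₁ ℓ x₃ y₃ : F} (h₁ : onE x₁ y₁) (hy : y₁ ≠ 0)
    (hl : ℓ * (2 * y₁) = 3 * x₁ ^ 2 + 10 * x₁ - 32) (e1 : x₃ = ℓ ^ 2 - 5 - 2 * x₁)
    (e2 : y₃ = -(ℓ * (x₃ - x₁) + y₁)) : onE x₃ y₃ ∧ pt x₁ y₁ + pt x₁ y₁ = pt x₃ y₃ := by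
  have hy' : y₁ ≠ (Wc⁄F).toAffine.negY x₁ y₁ := by
    rw [Wc_negY]; intro h; exact mul_ne_zero F2 hy (by linear_combination h)
  have hs : (Wc⁄F).toAffine.slope x₁ x₁ y₁ y₁ = ℓ := by
    rw [slope_of_Y_ne rfl hy', Wc_negY, div_eq_iff (by
      rw [sub_neg_eq_add, ← two_mul]; exact mul_ne_zero F2 hy), sub_neg_eq_add, ← two_mul, hl]
    simp [Wc, WeierstrassCurve.map, WeierstrassCurve.baseChange]; ring
  have hX : (Wc⁄F).toAffine.addX x₁ x₁ ℓ = x₃ := by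
    rw [e1]; simp [Wc, WeierstrassCurve.map, WeierstrassCurve.baseChange, addX]; ring
  have hY : (Wc⁄F).toAffine.addY x₁ x₁ y₁ ℓ = y₃ := by
    rw [addY, Wc_negY, negAddY, hX, e2]
  have hn := nonsingular_add (Wc_ns h₁) (Wc_ns h₁) (fun h => hy' h.2)
  rw [hs, hX, hY] at hn
  have h3 := (Wc_eq x₃ y₃).1 hn.1
  refine ⟨h3, ?_⟩
  rw [pt_eq h₁, pt_eq h3, Point.add_self_of_Y_ne hy']
  simp only [Point.some.injEq]
  rw [hs]; exact ⟨hX, hY⟩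

lemma pt_x {x y y' : F} (h : onE x y) (h' : onE x y') : pt x y' = pt x y ∨ pt x y' = -pt x y := by
  have : (y' - y) * (y' + y) = 0 := by unfold onE at *; linear_combination h' - h
  rcases mul_eq_zero.1 this with h1 | h1
  · left; rw [sub_eq_zero.1 h1]
  · right; rw [neg_pt h, eq_neg_of_add_eq_zero_left h1]

end curve

/-- Galois action and specialization on points -/
noncomputable abbrev emap {F K : Type*} [Field F] [Field K] (f : F →+* K) : EE F →+ EE K :=
  Point.map (W' := Wc) (S := ℤ) f.toIntAlgHom

lemma emap_pt {F K : Type*} [Field F] [Field K] [Fact ((102 : F) ≠ 0)] [Fact ((102 : K) ≠ 0)]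
    (f : F →+* K) {x y : F} (h : onE x y) : emap f (pt x y) = pt (f x) (f y) := by
  have h' : onE (f x) (f y) := by
    unfold onE at *; simpa only [map_pow, map_add, map_sub, map_mul, map_ofNat] using congrArg f h
  rw [pt_eq h, pt_eq h']; rfl
section som
variable {F : Type*} [Field F] [hF : Fact ((102 : F) ≠ 0)]

noncomputable def P0 : EE F := pt 8 24
noncomputable def Q0 : EE F := pt 0 0

omit hF in
lemma onP : onE (8 : F) 24 := by unfold onE; norm_num
omit hF in
lemma onQ : onE (0 : F) 0 := by unfold onE; norm_num

def cur (f g : F) : Prop := f * g * (f + g) + f + g + 1 = 5 * f * g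
noncomputable def tp (f g : F) : EE F :=
  pt (4 * (1 - f * g)) (4 * (5 * f * g - 1 - 2 * f - 2 * f ^ 2 * g))

omit hF in
lemma cur_on {f g : F} (h : cur f g) :
    onE (4 * (1 - f * g)) (4 * (5 * f * g - 1 - 2 * f - 2 * f ^ 2 * g)) := by
  unfold cur at h; unfold onE
  linear_combination (64 * f ^ 2 * g + 64 * f) * h

lemma tp_step {f g h : F} (hc : cur f g) (hh : h * (f * g) = g + 1) (hf : f ≠ 0) (hg : g ≠ 0) :
    cur g h ∧ tp f g + P0 = tp g h := by
  have h1 : f * g + 1 ≠ 0 := by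
    intro h1
    have : (6 : F) = 0 := by unfold cur at hc; linear_combination hc - (f + g - 5) * h1
    exact mul_ne_zero F2 F3 (by linear_combination this)
  have hc' : cur g h := by
    have : f * (f * g) * (g * h * (g + h) + g + h + 1 - 5 * g * h) = 0 := by
      unfold cur at hc
      linear_combination (f * (g ^ 2 + g * h + 1 - 5 * g) + (g + 1)) * hh + (g + 1) * hc
    unfold cur
    rcases mul_eq_zero.1 this with h2 | h2
    · exact absurd h2 (mul_ne_zero hf (mul_ne_zero hf hg))
    · linear_combination h2
  refine ⟨hc', ?_⟩
  have hx : 4 * (1 - f * g) ≠ 8 := fun h2 => by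
    have : (4 : F) * (f * g + 1) = 0 := by linear_combination -h2
    exact mul_ne_zero (by rw [show (4 : F) = 2 * 2 by norm_num]; exact mul_ne_zero F2 F2) h1 this
  have hc2 : g ^ 2 + f * g + g * h = 5 * g - 1 := by
    have : f * (g ^ 2 + f * g + g * h - (5 * g - 1)) = 0 := by
      unfold cur at hc; linear_combination hc + hh
    linear_combination (mul_eq_zero.1 this).resolve_left hf
  refine (pt_add (cur_on hc) onP hx (ℓ := 5 - 2 * g) ?_ ?_ ?_).2
  · unfold cur at hc; linear_combination 8 * hc
  · linear_combination -4 * hc2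
  · unfold cur at hc; linear_combination -8 * hc

/-- reductions of the Somos sequence -/
noncomputable def bb (F : Type*) [Field F] (m : ℕ) : F := ((somos m : ℚ) : F)
noncomputable def ff (F : Type*) [Field F] (m : ℕ) : F :=
  bb F m * bb F (m + 3) / (bb F (m + 1) * bb F (m + 2))

lemma som_den {p : ℕ} [CharP F p] (hp : p.Prime) {n : ℕ} (h : ∀ m < n, bb F m ≠ 0) :
    ∀ m, m ≤ n → ((somos m).den : F) ≠ 0 := by
  intro m
  induction m using Nat.strong_induction_on with
  | _ m ih =>
  intro hm
  match m, ih, hm with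
  | 0, _, _ => simp [somos]
  | 1, _, _ => simp [somos]
  | 2, _, _ => simp [somos]
  | 3, _, _ => simp [somos]
  | 4, _, _ => simp [somos]
  | k + 5, ih, hm =>
    rw [somos]
    have h0 := ih k (by omega) (by omega)
    have h1 := ih (k+1) (by omega) (by omega)
    have h2 := ih (k+2) (by omega) (by omega)
    have h3 := ih (k+3) (by omega) (by omega)
    have h4 := ih (k+4) (by omega) (by omega)
    have dd : ∀ x y : ℚ, x.den ∣ y.den → (y.den : F) ≠ 0 → (x.den : F) ≠ 0 := by
      rintro x y ⟨c, hc⟩ hy h; apply hy; rw [hc]; push_cast; rw [h, zero_mul]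
    have mm : ∀ x y : ℚ, (x.den : F) ≠ 0 → (y.den : F) ≠ 0 → ((x * y).den : F) ≠ 0 := by
      intro x y hx hy h
      obtain ⟨c, hc⟩ := Rat.mul_den_dvd x y
      have := mul_ne_zero hx hy
      rw [← Nat.cast_mul, hc] at this; push_cast at this; rw [h, zero_mul] at this; exact this rfl
    have aa : ∀ x y : ℚ, (x.den : F) ≠ 0 → (y.den : F) ≠ 0 → ((x + y).den : F) ≠ 0 := by
      intro x y hx hy h
      obtain ⟨c, hc⟩ := Rat.add_den_dvd x y
      have := mul_ne_zero hx hy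
      rw [← Nat.cast_mul, hc] at this; push_cast at this; rw [h, zero_mul] at this; exact this rfl
    rw [div_eq_mul_inv]
    refine mm _ _ (aa _ _ (mm _ _ h4 h1) (mm _ _ h3 h2)) ?_
    have hk := h k (by omega)
    have hn : ((somos k).num : F) ≠ 0 := by
      intro h; apply hk; rw [bb, Rat.cast_def, h, zero_div]
    have hn0 : (somos k).num ≠ 0 := by intro h; apply hn; rw [h]; simp
    rw [Rat.den_inv, if_neg hn0]
    exact fun h => hn ((CharP.intCast_eq_zero_iff F p _).2
      (Int.natCast_dvd.2 ((CharP.cast_eq_zero_iff F p _).1 h)))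

lemma bb_zero {p : ℕ} [CharP F p] {m : ℕ} (h : ((somos m).den : F) ≠ 0) :
    bb F m = 0 ↔ (p : ℤ) ∣ (somos m).num := by
  rw [bb, Rat.cast_def, div_eq_zero_iff, or_iff_left h, CharP.intCast_eq_zero_iff F p]

lemma bb_rec {p : ℕ} [CharP F p] (hp : p.Prime) {n : ℕ} (h : ∀ m < n, bb F m ≠ 0) {k : ℕ} (hk : k + 5 ≤ n) :
    bb F (k + 5) * bb F k = bb F (k + 4) * bb F (k + 1) + bb F (k + 3) * bb F (k + 2) := by
  have hd := som_den (F := F) hp h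
  have h0 := hd k (by omega)
  have h1 := hd (k+1) (by omega)
  have h2 := hd (k+2) (by omega)
  have h3 := hd (k+3) (by omega)
  have h4 := hd (k+4) (by omega)
  have h5 := hd (k+5) (by omega)
  have hn : somos k ≠ 0 := by
    intro h'; apply h k (by omega); rw [bb, h', Rat.cast_zero]
  have key : somos (k + 5) * somos k = somos (k + 4) * somos (k + 1) + somos (k + 3) * somos (k + 2) := by
    conv_lhs => rw [somos]
    field_simp
  have mm : ∀ x y : ℚ, (x.den : F) ≠ 0 → (y.den : F) ≠ 0 → ((x * y).den : F) ≠ 0 := by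
    intro x y hx hy h
    obtain ⟨c, hc⟩ := Rat.mul_den_dvd x y
    have := mul_ne_zero hx hy
    rw [← Nat.cast_mul, hc] at this; push_cast at this; rw [h, zero_mul] at this; exact this rfl
  have := congrArg (Rat.cast : ℚ → F) key
  rw [Rat.cast_mul_of_ne_zero h5 h0, Rat.cast_add_of_ne_zero (mm _ _ h4 h1) (mm _ _ h3 h2),
    Rat.cast_mul_of_ne_zero h4 h1, Rat.cast_mul_of_ne_zero h3 h2] at this
  exact this

lemma tp_seq {p : ℕ} [CharP F p] (hp : p.Prime) {n : ℕ} (h : ∀ m < n, bb F m ≠ 0) :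
    ∀ k, k + 4 ≤ n → cur (ff F k) (ff F (k+1)) ∧ (k • P0 + Q0 : EE F) = tp (ff F k) (ff F (k+1)) := by
  intro k
  induction k with
  | zero =>
    intro _
    have : ∀ m < 2, ff F m = 1 := by
      intro m hm; interval_cases m <;> simp [ff, bb, somos]
    rw [this 0 (by omega), this 1 (by omega)]
    refine ⟨by unfold cur; norm_num, ?_⟩
    rw [zero_smul, zero_add, tp, Q0]; norm_num
  | succ k ih =>
    intro hk
    obtain ⟨h1, h2⟩ := ih (by omega)
    have b0 := h k (by omega)
    have b1 := h (k+1) (by omega)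
    have b2 := h (k+2) (by omega)
    have b3 := h (k+3) (by omega)
    have b4 := h (k+4) (by omega)
    have hr := bb_rec hp h hk
    have := tp_step (h := ff F (k + 1 + 1)) h1 ?_ ?_ ?_
    · refine ⟨this.1, ?_⟩
      rw [← this.2, ← h2, succ_nsmul]; abel
    · simp only [ff, add_assoc]; norm_num
      field_simp
      linear_combination hr
    · exact div_ne_zero (mul_ne_zero b0 b3) (mul_ne_zero b1 b2)
    · exact div_ne_zero (mul_ne_zero b1 b4) (mul_ne_zero b2 b3)

lemma two_P0 : (P0 + P0 : EE F) = pt 4 (-4) := by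
  have h24 : (24 : F) ≠ 0 := by
    rw [show (24 : F) = 2 ^ 3 * 3 by norm_num]; exact mul_ne_zero (pow_ne_zero _ F2) F3
  refine (pt_dbl onP h24 (ℓ := 5) (by norm_num) (by norm_num) (by norm_num)).2

/-- main result of the Somos part -/
theorem somos_iff [Finite F] {p : ℕ} [CharP F p] (hp : p.Prime) :
    (∃ m, (p : ℤ) ∣ (somos m).num) ↔ ∃ m : ℤ, (m • P0 + Q0 : EE F) = 0 := by
  constructor
  · intro hex
    have hex' : ∃ n, bb F n = 0 := by
      by_contra! hh
      obtain ⟨m, hm⟩ := hex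
      exact hh m ((bb_zero (som_den hp (n := m) (fun i _ => hh i) m le_rfl)).2 hm)
    have hmin := fun m => Nat.find_min hex' (m := m)
    have h0 := Nat.find_spec hex'
    set n := Nat.find hex'
    have hn : 5 ≤ n := by
      by_contra! hn
      interval_cases n <;> simp [bb, somos] at h0
    obtain ⟨k, hk⟩ : ∃ k, n = k + 4 := ⟨n - 4, by omega⟩
    obtain ⟨h1, h2⟩ := tp_seq hp hmin k hk.ge
    have hg : ff F (k + 1) = 0 := by
      rw [ff, add_assoc, ← hk, h0]; simp
    rw [hg] at h1 h2
    have hf : ff F k = -1 := by unfold cur at h1; linear_combination h1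
    rw [hf, tp] at h2
    have h4 : (k • P0 + Q0 : EE F) = -(P0 + P0) := by
      rw [h2, two_P0, neg_pt (by unfold onE; norm_num)]; norm_num
    refine ⟨k + 2, ?_⟩
    rw [add_smul, two_zsmul, natCast_zsmul, add_right_comm, h4]; abel
  · rintro ⟨m, hm⟩
    by_contra hex
    have hb : ∀ n, bb F n ≠ 0 := by
      intro n
      induction n using Nat.strong_induction_on with
      | _ n ih => exact fun h => hex ⟨n, (bb_zero (som_den hp ih n le_rfl)).1 h⟩
    have hfin : Finite (EE F) := by
      refine Finite.of_injective (β := Option (F × F))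
        (fun A => match A with | .zero => none | .some x y _ => some (x, y)) ?_
      rintro (_ | ⟨x, y, h⟩) (_ | ⟨x', y', h'⟩) h <;> simp_all
    obtain ⟨N, hN, hN'⟩ := (isOfFinAddOrder_of_finite (P0 : EE F)).exists_nsmul_eq_zero
    obtain ⟨k, hk⟩ : ∃ k : ℕ, m + N * |m| = k := ⟨(m + N * |m|).toNat, by
      rw [Int.toNat_of_nonneg]
      have : (1 : ℤ) * |m| ≤ N * |m| := mul_le_mul_of_nonneg_right (by exact_mod_cast hN) (abs_nonneg m)
      linarith [neg_abs_le m]⟩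
    have hz : (k • P0 + Q0 : EE F) = 0 := by
      rw [← natCast_zsmul, ← hk, add_smul, mul_comm, mul_smul, natCast_zsmul, hN', smul_zero, add_zero, hm]
    obtain ⟨h1, h2⟩ := tp_seq hp (n := k + 4) (fun i _ => hb i) k le_rfl
    rw [hz] at h2
    exact pt_ne (cur_on h1) h2.symm

end som
section halving
variable {F : Type*} [Field F] [hF : Fact ((102 : F) ≠ 0)]

def Tri (e e' e'' : F) : Prop := e + e' + e'' = -5 ∧ e * e' + e * e'' + e' * e'' = -32 ∧ e * e' * e'' = 0

omit hF in
lemma Tri.on {e e' e'' x y : F} (h : Tri e e' e'') : onE x y ↔ y ^ 2 = (x - e) * (x - e') * (x - e'') := by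
  obtain ⟨h1, h2, h3⟩ := h
  unfold onE
  rw [show (x - e) * (x - e') * (x - e'') = x ^ 3 + 5 * x ^ 2 - 32 * x by
    linear_combination -x ^ 2 * h1 + x * h2 - h3]

omit hF in
lemma Tri.rot {e e' e'' : F} (h : Tri e e' e'') : Tri e' e'' e ∧ Tri e e'' e' := by
  obtain ⟨h1, h2, h3⟩ := h
  exact ⟨⟨by rw [← h1]; ring, by rw [← h2]; ring, by rw [← h3]; ring⟩,
    ⟨by rw [← h1]; ring, by rw [← h2]; ring, by rw [← h3]; ring⟩⟩

omit hF in
lemma Tri.root {e e' e'' : F} (h : Tri e e' e'') : onE e 0 := h.on.2 (by ring)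

lemma Tri.ne {e e' e'' : F} (h : Tri e e' e'') : e ≠ e' := by
  rintro rfl
  obtain ⟨h1, h2, h3⟩ := h
  have h4 : e'' = -5 - 2 * e := by linear_combination h1
  subst h4
  have h5 : e * (e * (2 * e + 5)) = 0 := by linear_combination -h3
  rcases mul_eq_zero.1 h5 with rfl | h5
  · exact pow_ne_zero 5 (F2 (F := F)) (by linear_combination h2)
  rcases mul_eq_zero.1 h5 with rfl | h5
  · exact pow_ne_zero 5 (F2 (F := F)) (by linear_combination h2)
  · have : (3 * 3 * 17 : F) = 0 := by linear_combination (4 : F) * h2 + (6 * e + 5) * h5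
    exact mul_ne_zero (mul_ne_zero F3 F3) F17 this

/-- the square root functions -/
noncomputable def rho (e : F) : EE F → F
  | .zero => 0
  | .some x y _ => ((x - e) ^ 2 - (3 * e ^ 2 + 10 * e - 32)) / (2 * y)

lemma rho_pt (e : F) {x y : F} (h : onE x y) :
    rho e (pt x y) = ((x - e) ^ 2 - (3 * e ^ 2 + 10 * e - 32)) / (2 * y) := by rw [pt_eq h]; rfl

omit hF in
lemma Tri.der {e e' e'' : F} (h : Tri e e' e'') : 3 * e ^ 2 + 10 * e - 32 = (e - e') * (e - e'') := by
  obtain ⟨h1, h2, h3⟩ := h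
  linear_combination -2 * e * h1 - h2 + 4 * e * h1

lemma rho_emap {K : Type*} [Field K] [Fact ((102 : K) ≠ 0)] (f : F →+* K) (e : F) (A : EE F) :
    rho (f e) (emap f A) = f (rho e A) := by
  rcases pt_cases A with rfl | ⟨x, y, h, rfl⟩
  · rw [map_zero]; exact (map_zero f).symm
  · have h' : onE (f x) (f y) := by
      unfold onE at *; simpa only [map_pow, map_add, map_sub, map_mul, map_ofNat] using congrArg f h
    rw [emap_pt f h, rho_pt _ h, rho_pt _ h']
    simp [map_ofNat]

lemma rho_neg (e : F) (A : EE F) : rho e (-A) = -rho e A := by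
  rcases pt_cases A with rfl | ⟨x, y, h, rfl⟩
  · rw [neg_zero]; exact neg_zero.symm
  · have h' : onE x (-y) := by unfold onE at *; rw [neg_sq, h]
    rw [neg_pt h, rho_pt _ h, rho_pt _ h', mul_neg, div_neg]

lemma pt_two {x y : F} (h : onE x y) : pt x y + pt x y = 0 ↔ y = 0 := by
  rw [add_eq_zero_iff_eq_neg, neg_pt h, pt_inj h (by unfold onE at *; rw [neg_sq, h])]
  constructor
  · rintro ⟨-, h⟩
    have : 2 * y = 0 := by linear_combination h
    exact (mul_eq_zero.1 this).resolve_left F2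
  · rintro rfl; simp

lemma rho_sq {e x y x3 y3 : F} (he : onE e 0) (h : onE x y) (h3 : onE x3 y3)
    (hd : pt x y + pt x y = pt x3 y3) : rho e (pt x y) ^ 2 = x3 - e := by
  have hy : y ≠ 0 := fun h0 => pt_ne h3 (hd ▸ (pt_two h).2 h0)
  have h2y := mul_ne_zero (F2 (F := F)) hy
  obtain ⟨h4, h5⟩ := pt_dbl h hy (ℓ := (3 * x ^ 2 + 10 * x - 32) / (2 * y))
    (div_mul_cancel₀ _ h2y) rfl rfl
  rw [h5, pt_inj h4 h3] at hd
  rw [rho_pt e h, ← hd.1]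
  unfold onE at h he
  have q1 := div_mul_cancel₀ ((x - e) ^ 2 - (3 * e ^ 2 + 10 * e - 32)) h2y
  have q2 := div_mul_cancel₀ (3 * x ^ 2 + 10 * x - 32) h2y
  set r := ((x - e) ^ 2 - (3 * e ^ 2 + 10 * e - 32)) / (2 * y)
  set l := (3 * x ^ 2 + 10 * x - 32) / (2 * y)
  refine mul_right_cancel₀ (pow_ne_zero 2 h2y) ?_
  linear_combination (r * (2 * y) + ((x - e) ^ 2 - (3 * e ^ 2 + 10 * e - 32))) * q1
    - (l * (2 * y) + (3 * x ^ 2 + 10 * x - 32)) * q2 + 4 * (5 + 2 * x + e) * h - (4 * e + 8 * x + 20) * he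

lemma Tri.addT {e e' e'' x y : F} (h : Tri e e' e'') (hU : onE x y) (hy : y ≠ 0) :
    onE (e + (e - e') * (e - e'') / (x - e)) (-y * (e - e') * (e - e'') / (x - e) ^ 2) ∧
    pt x y + pt e 0 = pt (e + (e - e') * (e - e'') / (x - e)) (-y * (e - e') * (e - e'') / (x - e) ^ 2) ∧
    x - e ≠ 0 ∧ x - e' ≠ 0 ∧ x - e'' ≠ 0 := by
  have hU' := h.on.1 hU
  have hne : (x - e) * (x - e') * (x - e'') ≠ 0 := hU' ▸ pow_ne_zero 2 hy
  have hx : x - e ≠ 0 := fun h0 => hne (by rw [h0]; ring)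
  have h5 : (5 : F) = -(e + e' + e'') := by linear_combination h.1
  obtain ⟨h1, h2⟩ := pt_add (ℓ := y / (x - e)) hU h.root (sub_ne_zero.1 hx)
    (by rw [div_mul_cancel₀ _ hx, sub_zero])
    (x₃ := e + (e - e') * (e - e'') / (x - e)) (y₃ := -y * (e - e') * (e - e'') / (x - e) ^ 2)
    (by rw [h5]; field_simp; linear_combination -hU') (by field_simp; ring)
  exact ⟨h1, h2, hx, fun h0 => hne (by rw [h0]; ring), fun h0 => hne (by rw [h0]; ring)⟩

lemma rho_add_self {e e' e'' : F} (h : Tri e e' e'') {A : EE F} (hA : A + A ≠ 0) :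
    rho e (A + pt e 0) = rho e A := by
  rcases pt_cases A with rfl | ⟨x, y, hU, rfl⟩
  · simp at hA
  have hy := (pt_two hU).not.1 hA
  obtain ⟨h1, h2, hx, hx', hx''⟩ := h.addT hU hy
  have hy2 := F2 (F := F)
  have n1 := sub_ne_zero.2 h.ne
  have n2 := sub_ne_zero.2 h.rot.2.ne
  rw [h2, rho_pt e h1, rho_pt e hU, h.der]
  field_simp
  ring

lemma rho_add_other {e e' e'' : F} (h : Tri e e' e'') {A : EE F} (hA : A + A ≠ 0) :
    rho e' (A + pt e 0) = -rho e' A := by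
  rcases pt_cases A with rfl | ⟨x, y, hU, rfl⟩
  · simp at hA
  have hy := (pt_two hU).not.1 hA
  obtain ⟨h1, h2, hx, hx', hx''⟩ := h.addT hU hy
  have hy2 := F2 (F := F)
  have n1 := sub_ne_zero.2 h.ne
  have n2 := sub_ne_zero.2 h.rot.2.ne
  rw [h2, rho_pt e' h1, rho_pt e' hU, h.rot.1.der]
  field_simp
  ring

lemma half_coords {e e' e'' : F} (h : Tri e e' e'') {S : EE F} (hS : S + S = pt e 0) :
    onE (e + rho e' S * rho e'' S) (rho e' S * rho e'' S * (rho e' S + rho e'' S)) ∧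
    S = pt (e + rho e' S * rho e'' S) (rho e' S * rho e'' S * (rho e' S + rho e'' S)) ∧
    rho e' S ^ 2 = e - e' ∧ rho e'' S ^ 2 = e - e'' := by
  rcases pt_cases S with rfl | ⟨x, y, hU, rfl⟩
  · rw [add_zero] at hS; exact absurd hS.symm (pt_ne h.root)
  have hy : y ≠ 0 := fun h0 => pt_ne h.root (hS ▸ (pt_two hU).2 h0)
  have r1 := rho_sq h.root hU h.root hS
  have r2 := rho_sq h.rot.1.root hU h.root hS
  have r3 := rho_sq h.rot.2.rot.1.root hU h.root hS
  rw [sub_self, sq_eq_zero_iff] at r1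
  obtain ⟨h1, h2, hx, hx', hx''⟩ := h.addT hU hy
  have hU' := h.on.1 hU
  have hy2 := F2 (F := F)
  have sum3 : ∀ {a b c : F}, Tri a b c → x - c ≠ 0 → rho a (pt x y) + rho b (pt x y) = y / (x - c) := by
    intro a b c ht hc
    rw [rho_pt a hU, rho_pt b hU, ht.der, ht.rot.1.der]
    have := ht.on.1 hU
    field_simp
    linear_combination -2 * this
  have s1 := sum3 h hx''
  have s2 := sum3 h.rot.2 hx'
  have s3 := sum3 h.rot.1 hx
  rw [r1, zero_add] at s1 s2
  have ex : x = e + rho e' (pt x y) * rho e'' (pt x y) := by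
    rw [s1, s2]; field_simp; linear_combination -hU'
  have ey : y = rho e' (pt x y) * rho e'' (pt x y) * (rho e' (pt x y) + rho e'' (pt x y)) := by
    rw [s3, ← sub_eq_iff_eq_add'.2 ex]; field_simp
  rw [← ex, ← ey]
  exact ⟨hU, rfl, r2, r3⟩

end halving
section halving2
variable {F : Type*} [Field F] [hF : Fact ((102 : F) ≠ 0)]

lemma halve [IsAlgClosed F] {e e' e'' : F} (h : Tri e e' e'') (A : EE F) : ∃ B : EE F, B + B = A := by
  rcases pt_cases A with rfl | ⟨x, y, hU, rfl⟩
  · exact ⟨0, add_zero 0⟩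
  obtain ⟨r1, h1⟩ := IsAlgClosed.exists_pow_nat_eq (x - e) (n := 2) (by norm_num)
  obtain ⟨r2, h2⟩ := IsAlgClosed.exists_pow_nat_eq (x - e') (n := 2) (by norm_num)
  obtain ⟨r3, h3, h4⟩ : ∃ r3, r3 ^ 2 = x - e'' ∧ r1 * r2 * r3 = y := by
    obtain ⟨r3, h3⟩ := IsAlgClosed.exists_pow_nat_eq (x - e'') (n := 2) (by norm_num)
    have : (r1 * r2 * r3) ^ 2 = y ^ 2 := by rw [h.on.1 hU, mul_pow, mul_pow, h1, h2, h3]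
    rcases sq_eq_sq_iff_eq_or_eq_neg.1 this with h4 | h4
    · exact ⟨r3, h3, h4⟩
    · exact ⟨-r3, by rw [neg_sq, h3], by rw [mul_neg, h4, neg_neg]⟩
  have ne : ∀ {a b ra rb : F}, a ≠ b → ra ^ 2 = x - a → rb ^ 2 = x - b → ra + rb ≠ 0 := by
    intro a b ra rb hab ha hb h0
    apply hab
    linear_combination ha - hb - (ra - rb) * h0
  have n := mul_ne_zero (mul_ne_zero (ne h.ne h1 h2) (ne h.rot.2.ne h1 h3)) (ne h.rot.1.ne h2 h3)
  have he : e = x - r1 ^ 2 := by rw [h1]; ring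
  have he' : e' = x - r2 ^ 2 := by rw [h2]; ring
  have he'' : e'' = x - r3 ^ 2 := by rw [h3]; ring
  have hon : onE (x + r1 * r2 + r1 * r3 + r2 * r3) ((r1 + r2) * (r1 + r3) * (r2 + r3)) := by
    rw [h.on, he, he', he'']; ring
  obtain ⟨t1, t2, -⟩ := h
  refine ⟨pt (x + r1 * r2 + r1 * r3 + r2 * r3) ((r1 + r2) * (r1 + r3) * (r2 + r3)),
    (pt_dbl hon n (ℓ := r1 + r2 + r3) ?_ ?_ ?_).2⟩
  · rw [he, he', he''] at t1 t2
    linear_combination t2 - (2 * (x + r1 * r2 + r1 * r3 + r2 * r3)) * t1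
  · rw [he, he', he''] at t1
    linear_combination t1
  · linear_combination -h4

lemma Tri.addTT {e e' e'' : F} (h : Tri e e' e'') : pt e 0 + pt e' 0 = pt e'' 0 := by
  refine (pt_add h.root h.rot.1.root h.ne (ℓ := 0) (by ring) ?_ (by ring)).2
  linear_combination h.1

lemma Tri.tor {e e' e'' : F} (h : Tri e e' e'') {A : EE F} (hA : A + A = 0) :
    A = 0 ∨ A = pt e 0 ∨ A = pt e' 0 ∨ A = pt e 0 + pt e' 0 := by
  rcases pt_cases A with rfl | ⟨x, y, hU, rfl⟩
  · exact Or.inl rfl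
  right
  obtain rfl := (pt_two hU).1 hA
  have := h.on.1 hU
  rw [h.addTT]
  have h0 : (x - e) * (x - e') * (x - e'') = 0 := by rw [← this]; ring
  rcases mul_eq_zero.1 h0 with h0 | h0
  · rcases mul_eq_zero.1 h0 with h0 | h0
    · left; rw [sub_eq_zero.1 h0]
    · right; left; rw [sub_eq_zero.1 h0]
  · right; right; rw [sub_eq_zero.1 h0]

/-- compatibility of square roots of `-1` -/
lemma F2_id {a b : F} (h : Tri 0 a b) {S S2 : EE F} (hS : S + S = Q0) (hS2 : S2 + S2 = pt a 0) :
    rho 0 (S + S2) * rho a S = rho 0 S2 * rho b S := by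
  obtain ⟨o1, p1, q1, q2⟩ := half_coords h hS
  obtain ⟨o2, p2, q3, q4⟩ := half_coords h.rot.1.rot.2 hS2
  set r2 := rho a S
  set r3 := rho b S
  set s1 := rho 0 S2
  set s3 := rho b S2
  have ha : a = -r2 ^ 2 := by linear_combination q1
  have hb : b = -r3 ^ 2 := by linear_combination q2
  have e1 := h.1
  have e2 := h.2.1
  have hr2 : r2 ≠ 0 := fun h0 => h.ne (by rw [ha, h0]; ring)
  have hr3 : r3 ≠ 0 := fun h0 => h.rot.2.ne (by rw [hb, h0]; ring)
  have hs3 : s3 ≠ 0 := fun h0 => h.rot.1.ne (by linear_combination s3 * h0 - q4)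
  have h2 := F2 (F := F)
  obtain ⟨i, hi⟩ : ∃ i, s1 = i * r2 := ⟨s1 / r2, by field_simp⟩
  have hi2 : i ^ 2 = -1 := by
    have : r2 ^ 2 * (i ^ 2 + 1) = 0 := by rw [hi] at q3; linear_combination q3 + ha
    linear_combination (mul_eq_zero.1 this).resolve_left (pow_ne_zero 2 hr2)
  have h33 : s3 ^ 2 = r3 ^ 2 - r2 ^ 2 := by rw [q4, ha, hb]; ring
  rw [zero_add] at o1 p1
  rw [hi] at o2 p2
  have hx : r2 * r3 ≠ a + i * r2 * s3 := by
    intro h0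
    have o2' := o2
    rw [← h0] at o2' p2
    have hQ : Q0 ≠ (pt a 0 : EE F) := fun hh => h.ne ((pt_inj onQ h.rot.1.root).1 hh).1
    have hn : -(pt a 0 : EE F) = pt a 0 := by rw [neg_pt h.rot.1.root, neg_zero]
    rcases pt_x o2' o1 with h5 | h5
    · rw [← p1, ← p2] at h5; exact hQ (by rw [← hS, ← hS2, h5])
    · rw [← p1, ← p2] at h5; exact hQ (by rw [← hS, ← hn, ← hS2, h5]; abel)
  obtain ⟨l, hl⟩ : ∃ l, 2 * l = (1 - i) * r3 + (1 + i) * (s3 + r2) := ⟨_ / 2, mul_div_cancel₀ _ h2⟩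
  rw [ha, hb] at e1
  obtain ⟨o3, p3⟩ := pt_add o1 o2 hx (ℓ := l)
    (x₃ := -r3 ^ 2 + r3 * s3) (y₃ := i * r3 * s3 * (r3 - s3)) (by
      rw [ha]; refine mul_left_cancel₀ h2 ?_
      linear_combination (r2 * r3 - (-r2 ^ 2 + i * r2 * s3)) * hl + (r2 * (1 + i)) * h33
        + r2 * s3 * (r3 - s3 + r2) * hi2) (by
      rw [ha]; refine mul_left_cancel₀ (mul_ne_zero h2 h2) ?_
      linear_combination -(2 * l + ((1 - i) * r3 + (1 + i) * (s3 + r2))) * hl - 2 * i * h33 + 4 * e1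
        - (s3 + r2 - r3) ^ 2 * hi2) (by
      refine mul_left_cancel₀ h2 ?_
      linear_combination (-r3 ^ 2 + r3 * s3 - r2 * r3) * hl + r3 * (1 - i) * h33)
  have hy : i * r3 * s3 * (r3 - s3) ≠ 0 := by
    refine mul_ne_zero (mul_ne_zero (mul_ne_zero ?_ hr3) hs3) ?_
    · rintro rfl; norm_num at hi2
    · intro h0; apply hr2; rw [← sq_eq_zero_iff]; linear_combination h33 + (r3 + s3) * h0
  rw [p1, p2, p3, rho_pt 0 o3, hi]
  have h2y := mul_ne_zero h2 hy
  rw [div_mul_eq_mul_div, div_eq_iff h2y]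
  rw [ha, hb] at e2
  linear_combination -(r2 * r3 ^ 2) * h33 + r2 * e2 - 2 * r2 * r3 ^ 2 * s3 * (r3 - s3) * hi2

/-- formula for the square root of two; here `S = 2U`, `S2 = 2 U2` -/
lemma F3_id {a b : F} (h : Tri 0 a b) {U U2 : EE F} (hS : (U + U) + (U + U) = Q0)
    (hS2 : (U2 + U2) + (U2 + U2) = pt a 0) :
    (rho a U / rho 0 U2 * (rho 0 (U2 + U2) / rho a (U + U) +
      rho b (U2 + U2) / (rho a (U + U) + rho b (U + U)))) ^ 2 = 2 := by
  obtain ⟨o1, p1, q1, q2⟩ := half_coords h hS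
  obtain ⟨o2, p2, q3, q4⟩ := half_coords h.rot.1.rot.2 hS2
  set r2 := rho a (U + U)
  set r3 := rho b (U + U)
  set s1 := rho 0 (U2 + U2)
  set s3 := rho b (U2 + U2)
  have sqU : ∀ {e x y : F} {V : EE F}, onE e 0 → onE x y → V + V = pt x y → rho e V ^ 2 = x - e := by
    intro e x y V he hx hV
    rcases pt_cases V with rfl | ⟨x', y', hV', rfl⟩
    · rw [add_zero] at hV; exact absurd hV.symm (pt_ne hx)
    · exact rho_sq he hV' hx hV
  have w1 := sqU h.rot.1.root o1 p1
  have w2 := sqU h.root o2 p2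
  have ha : a = -r2 ^ 2 := by linear_combination q1
  have hb : b = -r3 ^ 2 := by linear_combination q2
  have hr2 : r2 ≠ 0 := fun h0 => h.ne (by rw [ha, h0]; ring)
  have hr : r2 + r3 ≠ 0 := fun h0 => h.rot.1.ne (by rw [ha, hb]; linear_combination (r3 - r2) * h0)
  have hne : a + s1 * s3 - 0 ≠ 0 := by
    intro h0
    have h1 := h.rot.1.rot.2.on.1 o2
    rw [h0] at h1
    apply h.ne.symm
    rw [mul_zero, zero_mul, sq_eq_zero_iff] at h1
    have h2 : a + s1 * s3 = 0 := by linear_combination h0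
    have := (pt_two o2).2 h1
    rw [← p2, hS2] at this
    exact absurd this (pt_ne h.rot.1.root)
  rw [mul_pow, div_pow, w1, w2]
  have e1 : s1 / r2 + s3 / (r2 + r3) = (s1 * (r2 + r3) + s3 * r2) / (r2 * (r2 + r3)) := by
    field_simp
  rw [e1, div_pow, div_mul_div_comm, div_eq_iff (mul_ne_zero hne (pow_ne_zero 2 (mul_ne_zero hr2 hr)))]
  have e3 : s1 ^ 2 = -r2 ^ 2 := by rw [q3, ha]; ring
  have e4 : s3 ^ 2 = r3 ^ 2 - r2 ^ 2 := by rw [q4, ha, hb]; ring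
  clear_value r2 r3 s1 s3
  subst ha
  linear_combination r2 * (r2 + r3) * ((r2 + r3) ^ 2 * e3 + r2 ^ 2 * e4)
end halving2
structure Bas {A : Type*} [AddCommGroup A] (N : ℕ) (X Y : A) : Prop where
  oX : (2 ^ N : ℤ) • X = 0
  oY : (2 ^ N : ℤ) • Y = 0
  span : ∀ x : A, (2 ^ N : ℤ) • x = 0 → ∃ a b : ℤ, x = a • X + b • Y
  ind : ∀ a b : ℤ, a • X + b • Y = 0 → (2 ^ N : ℤ) ∣ a ∧ (2 ^ N : ℤ) ∣ b

lemma Bas.step {A : Type*} [AddCommGroup A] {N : ℕ} {S T X Y : A} (h1 : Bas 1 S T)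
    (hX : (2 ^ N : ℤ) • X = S) (hY : (2 ^ N : ℤ) • Y = T) : Bas (N + 1) X Y := by
  have h2 := h1.oX
  have h3 := h1.oY
  induction N generalizing X Y with
  | zero => simp at hX hY; subst hX hY; exact h1
  | succ N ih =>
    have H := ih (X := (2 : ℤ) • X) (Y := (2 : ℤ) • Y) (by rw [smul_smul, ← pow_succ, hX])
      (by rw [smul_smul, ← pow_succ, hY])
    refine ⟨?_, ?_, ?_, ?_⟩
    · rw [pow_succ', mul_smul, hX]; simpa using h2
    · rw [pow_succ', mul_smul, hY]; simpa using h3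
    · intro x hx
      obtain ⟨a, b, h⟩ := H.span ((2 : ℤ) • x) (by rw [smul_smul, ← pow_succ, hx])
      obtain ⟨c, d, h'⟩ := h1.span (x - a • X - b • Y) (by
        rw [pow_one, smul_sub, smul_sub, h]; module)
      refine ⟨a + c * 2 ^ (N + 1), b + d * 2 ^ (N + 1), ?_⟩
      rw [add_smul, add_smul, mul_smul, mul_smul, hX, hY, sub_sub, sub_eq_iff_eq_add] at *
      rw [h']; abel
    · intro a b h
      obtain ⟨⟨a, rfl⟩, ⟨b, rfl⟩⟩ := H.ind a b (by
        rw [smul_comm a, smul_comm b, ← smul_add, h, smul_zero])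
      rw [mul_comm, mul_comm (2 ^ (N + 1)), mul_smul, mul_smul, hX, hY] at h
      obtain ⟨h, h'⟩ := h1.ind a b h
      rw [pow_one] at h h'
      rw [pow_succ (2 : ℤ) (N + 1)]
      exact ⟨mul_dvd_mul_left _ h, mul_dvd_mul_left _ h'⟩

lemma Bas.iff {A : Type*} [AddCommGroup A] {N : ℕ} {X Y : A} (h : Bas N X Y) (a b a' b' : ℤ) :
    a • X + b • Y = a' • X + b' • Y ↔ (2 ^ N : ℤ) ∣ a - a' ∧ (2 ^ N : ℤ) ∣ b - b' := by
  constructor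
  · intro e
    exact h.ind _ _ (by rw [sub_smul, sub_smul]; rw [← sub_eq_zero] at e; rw [← e]; abel)
  · rintro ⟨⟨u, hu⟩, v, hv⟩
    rw [sub_eq_iff_eq_add] at hu hv
    rw [hu, hv, add_smul, add_smul, mul_comm, mul_smul, h.oX, mul_comm, mul_smul, h.oY]; simp

lemma Tri.bas {F : Type*} [Field F] [hF : Fact ((102 : F) ≠ 0)] {e e' e'' : F} (h : Tri e e' e'') :
    Bas 1 (pt e 0) (pt e' 0) := by
  have z1 : pt e 0 + pt e 0 = 0 := (pt_two h.root).2 rfl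
  have z2 : pt e' 0 + pt e' 0 = 0 := (pt_two h.rot.1.root).2 rfl
  have o1 : (2 : ℤ) • pt e 0 = 0 := by rw [two_smul, z1]
  have o2 : (2 : ℤ) • pt e' 0 = 0 := by rw [two_smul, z2]
  have red : ∀ a : ℤ, ∀ T : EE F, (2 : ℤ) • T = 0 → (2 ∣ a ∧ a • T = 0) ∨ (¬ 2 ∣ a ∧ a • T = T) := by
    intro a T hT
    obtain ⟨b, rfl | rfl⟩ := Int.even_or_odd' a
    · left; rw [mul_comm, mul_smul, hT]; simp
    · right; rw [add_smul, mul_comm, mul_smul, hT]; simp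
  refine ⟨by simpa using o1, by simpa using o2, fun x hx => ?_, fun a b hab => ?_⟩
  · rw [pow_one, two_smul] at hx
    rcases h.tor hx with rfl | rfl | rfl | rfl
    · exact ⟨0, 0, by simp⟩
    · exact ⟨1, 0, by simp⟩
    · exact ⟨0, 1, by simp⟩
    · exact ⟨1, 1, by simp⟩
  · rw [pow_one]
    rcases red a _ o1 with ⟨ha, h1⟩ | ⟨ha, h1⟩ <;> rcases red b _ o2 with ⟨hb, h2⟩ | ⟨hb, h2⟩ <;> rw [h1, h2] at hab
    · exact ⟨ha, hb⟩
    · exact absurd (by simpa using hab) (pt_ne h.rot.1.root)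
    · exact absurd (by simpa using hab) (pt_ne h.root)
    · rw [h.addTT] at hab
      exact absurd hab (pt_ne h.rot.1.rot.1.root)
section reduction
open NumberField
variable {L : Type*} [Field L] [NumberField L]

/-- a place of `L` with its residue characteristic -/
structure Plc (L : Type*) [Field L] [NumberField L] where
  p : ℕ
  pr : p.Prime
  big : 17 < p
  P : Ideal (𝓞 L)
  mx : P.IsMaximal
  mem : (p : 𝓞 L) ∈ P

instance fact102 : Fact ((102 : L) ≠ 0) := ⟨by norm_num⟩

namespace Plc
def k (w : Plc L) := 𝓞 L ⧸ w.P
variable (w : Plc L)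
noncomputable instance : Field w.k :=
  haveI := w.mx
  Ideal.Quotient.field w.P
noncomputable def π : 𝓞 L →+* w.k := Ideal.Quotient.mk w.P
lemma π_zero (x : 𝓞 L) : w.π x = 0 ↔ x ∈ w.P := Ideal.Quotient.eq_zero_iff_mem
instance : Fact w.p.Prime := ⟨w.pr⟩
instance : CharP w.k w.p := by
  have h : ((w.p : ℕ) : w.k) = 0 := by
    rw [← map_natCast w.π, π_zero]; exact w.mem
  exact (CharP.charP_iff_prime_eq_zero w.pr).2 h
instance : Finite w.k := by
  have : w.P ≠ ⊥ := by
    intro h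
    have := w.mem
    rw [h, Ideal.mem_bot] at this
    exact w.pr.ne_zero (by exact_mod_cast this)
  exact Ideal.finiteQuotientOfFreeOfNeBot w.P this
instance : Fact ((102 : w.k) ≠ 0) := ⟨by
  intro h
  have h1 : ((102 : ℕ) : w.k) = 0 := by exact_mod_cast h
  rw [CharP.cast_eq_zero_iff w.k w.p, show 102 = 2 * 3 * 17 by rfl, w.pr.dvd_mul, w.pr.dvd_mul] at h1
  have := w.big
  rcases h1 with (h | h) | h <;> have := Nat.le_of_dvd (by norm_num) h <;> omega⟩

def Rel (x : L) (z : w.k) : Prop := ∃ a b : 𝓞 L, w.π b ≠ 0 ∧ x * algebraMap (𝓞 L) L b = algebraMap (𝓞 L) L a ∧ z * w.π b = w.π a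

variable {w} {x x' : L} {z z' : w.k}
lemma Rel.add (h : w.Rel x z) (h' : w.Rel x' z') : w.Rel (x + x') (z + z') := by
  obtain ⟨a, b, h1, h2, h3⟩ := h
  obtain ⟨a', b', h1', h2', h3'⟩ := h'
  refine ⟨a * b' + a' * b, b * b', by rw [map_mul]; exact mul_ne_zero h1 h1', ?_, ?_⟩
  · simp only [map_mul, map_add]; rw [← h2, ← h2']; ring
  · simp only [map_mul, map_add]; rw [← h3, ← h3']; ring
lemma Rel.mul (h : w.Rel x z) (h' : w.Rel x' z') : w.Rel (x * x') (z * z') := by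
  obtain ⟨a, b, h1, h2, h3⟩ := h
  obtain ⟨a', b', h1', h2', h3'⟩ := h'
  refine ⟨a * a', b * b', by rw [map_mul]; exact mul_ne_zero h1 h1', ?_, ?_⟩
  · simp only [map_mul, map_add]; rw [← h2, ← h2']; ring
  · simp only [map_mul]; rw [← h3, ← h3']; ring
lemma Rel.int (n : ℤ) : w.Rel (n : L) (n : w.k) := ⟨n, 1, by simp, by simp, by rw [map_one, map_intCast, mul_one]⟩
lemma Rel.neg (h : w.Rel x z) : w.Rel (-x) (-z) := by
  simpa using (Rel.int (w := w) (-1)).mul h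
lemma Rel.sub (h : w.Rel x z) (h' : w.Rel x' z') : w.Rel (x - x') (z - z') := by
  rw [sub_eq_add_neg, sub_eq_add_neg]; exact h.add h'.neg
lemma Rel.ne (h : w.Rel x z) (hz : z ≠ 0) : x ≠ 0 := by
  rintro rfl
  obtain ⟨a, b, h1, h2, h3⟩ := h
  have : a = 0 := by
    rw [zero_mul] at h2
    exact (map_eq_zero_iff _ (FaithfulSMul.algebraMap_injective (𝓞 L) L)).1 h2.symm
  rw [this, map_zero] at h3
  exact mul_ne_zero hz h1 h3
lemma Rel.inv (h : w.Rel x z) (hz : z ≠ 0) : w.Rel x⁻¹ z⁻¹ := by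
  have hx := h.ne hz
  obtain ⟨a, b, h1, h2, h3⟩ := h
  refine ⟨b, a, by rw [← h3]; exact mul_ne_zero hz h1, ?_, ?_⟩
  · rw [← h2]; field_simp
  · rw [← h3]; field_simp
lemma Rel.div (h : w.Rel x z) (h' : w.Rel x' z') (hz : z' ≠ 0) : w.Rel (x / x') (z / z') := by
  rw [div_eq_mul_inv, div_eq_mul_inv]; exact h.mul (h'.inv hz)
lemma Rel.fn (h : w.Rel x z) (h' : w.Rel x z') : z = z' := by
  by_contra hne
  exact (h.sub h').ne (sub_ne_zero.2 hne) (sub_self x)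
lemma Rel.pow (h : w.Rel x z) (n : ℕ) : w.Rel (x ^ n) (z ^ n) := by
  induction n with
  | zero => simpa using Rel.int (w := w) 1
  | succ n ih => rw [pow_succ, pow_succ]; exact ih.mul h
lemma Rel.frob (h : w.Rel x z) {σ : L ≃ₐ[ℚ] L} (hσ : ∀ x : 𝓞 L, σ • x - x ^ w.p ∈ w.P) :
    w.Rel (σ x) (z ^ w.p) := by
  have hs : ∀ x : 𝓞 L, w.π (σ • x) = w.π x ^ w.p := fun x => by
    rw [← sub_eq_zero, ← map_pow, ← map_sub, π_zero]; exact hσ x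
  obtain ⟨a, b, h1, h2, h3⟩ := h
  refine ⟨σ • a, σ • b, ?_, ?_, ?_⟩
  · rw [hs]; exact pow_ne_zero _ h1
  · have : ∀ y : 𝓞 L, algebraMap (𝓞 L) L (σ • y) = σ (algebraMap (𝓞 L) L y) := fun y => rfl
    rw [this, this, ← map_mul, h2]
  · rw [hs, hs, ← mul_pow, h3]
lemma Rel.on {y : L} {v : w.k} (h : w.Rel x z) (h' : w.Rel y v) (ho : onE x y) : onE z v := by
  unfold onE at *
  have e1 := h'.pow 2
  have e2 := (((h.pow 3).add ((Rel.int 5).mul (h.pow 2))).sub ((Rel.int 32).mul h))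
  push_cast at e2
  rw [ho] at e1
  exact e1.fn e2

def fil : Filter (Plc L) := comap Plc.p atTop

lemma ev (x : L) : ∀ᶠ w : Plc L in fil, ∃ z, w.Rel x z ∧ (x ≠ 0 → z ≠ 0) := by
  obtain ⟨a, b, hb, rfl⟩ := IsFractionRing.div_surjective (A := 𝓞 L) x
  have hb0 := nonZeroDivisors.ne_zero hb
  have hav : ∀ c : 𝓞 L, c ≠ 0 → ∀ᶠ w : Plc L in fil, w.π c ≠ 0 := by
    intro c hc
    obtain ⟨B, hB⟩ := avoid c hc
    filter_upwards [preimage_mem_comap (eventually_ge_atTop B)] with w hw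
    rw [Ne, π_zero]
    exact hB w.p w.pr hw w.P w.mx.isPrime w.mem
  have hbL : algebraMap (𝓞 L) L b ≠ 0 := by simpa using hb0
  have r0 : ∀ w : Plc L, w.π b ≠ 0 → w.Rel (algebraMap (𝓞 L) L a / algebraMap (𝓞 L) L b) (w.π a / w.π b) := fun w hw =>
    ⟨a, b, hw, by field_simp, by field_simp⟩
  by_cases ha : a = 0
  · filter_upwards [hav b hb0] with w hw
    exact ⟨_, r0 w hw, fun h => absurd (by simp [ha]) h⟩
  · filter_upwards [hav b hb0, hav a ha] with w hw hw'
    exact ⟨_, r0 w hw, fun _ => div_ne_zero hw' hw⟩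

variable (w)
def PRel (A : EE L) (B : EE w.k) : Prop :=
  (A = 0 ∧ B = 0) ∨ ∃ x y u v, onE x y ∧ A = pt x y ∧ w.Rel x u ∧ w.Rel y v ∧ B = pt u v

variable {w}
lemma PRel.fn {A : EE L} {B B' : EE w.k} (h : w.PRel A B) (h' : w.PRel A B') : B = B' := by
  rcases h with ⟨h1, rfl⟩ | ⟨x, y, u, v, ho, h1, r1, r2, rfl⟩ <;>
    rcases h' with ⟨h1', rfl⟩ | ⟨x', y', u', v', ho', h1', r1', r2', rfl⟩
  · rfl
  · exact absurd (h1'.symm.trans h1) (pt_ne ho')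
  · exact absurd (h1.symm.trans h1') (pt_ne ho)
  · obtain ⟨rfl, rfl⟩ := (pt_inj ho ho').1 (h1.symm.trans h1')
    rw [r1.fn r1', r2.fn r2']

variable (w)
noncomputable def red (A : EE L) : EE w.k := if h : ∃ B, w.PRel A B then h.choose else 0

variable {w}
lemma PRel.red {A : EE L} {B : EE w.k} (h : w.PRel A B) : w.red A = B := by
  have h' : ∃ B, w.PRel A B := ⟨B, h⟩
  rw [Plc.red, dif_pos h']
  exact h'.choose_spec.fn h

lemma red_zero : w.red 0 = 0 := PRel.red (Or.inl ⟨rfl, rfl⟩)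
lemma red_pt {x y : L} {u v : w.k} (h : onE x y) (h1 : w.Rel x u) (h2 : w.Rel y v) :
    w.red (pt x y) = pt u v := PRel.red (Or.inr ⟨x, y, u, v, h, rfl, h1, h2, rfl⟩)

lemma ev_ne {A : EE L} (hA : A ≠ 0) : ∀ᶠ w : Plc L in fil, w.red A ≠ 0 := by
  rcases pt_cases A with rfl | ⟨x, y, ho, rfl⟩
  · exact absurd rfl hA
  · filter_upwards [ev x, ev y] with w ⟨u, hu, _⟩ ⟨v, hv, _⟩
    rw [red_pt ho hu hv]
    exact pt_ne (hu.on hv ho)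

lemma ev_frob (A : EE L) : ∀ᶠ w : Plc L in fil, ∀ σ : L ≃ₐ[ℚ] L, (∀ x : 𝓞 L, σ • x - x ^ w.p ∈ w.P) →
    w.red (emap (σ : L →+* L) A) = emap (frobenius w.k w.p) (w.red A) := by
  rcases pt_cases A with rfl | ⟨x, y, ho, rfl⟩
  · refine Eventually.of_forall fun w σ _ => ?_
    rw [map_zero, red_zero, map_zero]
  · filter_upwards [ev x, ev y] with w ⟨u, hu, _⟩ ⟨v, hv, _⟩ σ hσ
    have ho' : onE (σ x) (σ y) := by
      unfold onE at *; simpa only [map_pow, map_add, map_sub, map_mul, map_ofNat] using congrArg σ ho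
    rw [emap_pt _ ho, red_pt ho hu hv, emap_pt _ (hu.on hv ho)]
    exact red_pt ho' (hu.frob hσ) (hv.frob hσ)

lemma ev_add (A B : EE L) : ∀ᶠ w : Plc L in fil, w.red (A + B) = w.red A + w.red B := by
  rcases pt_cases A with rfl | ⟨x, y, ho, rfl⟩
  · exact Eventually.of_forall fun w => by rw [red_zero, zero_add, zero_add]
  rcases pt_cases B with rfl | ⟨x', y', ho', rfl⟩
  · exact Eventually.of_forall fun w => by rw [red_zero, add_zero, add_zero]
  by_cases hx : x = x'
  · subst hx
    by_cases hy : y' = -y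
    · subst hy
      filter_upwards [ev x, ev y] with w ⟨u, hu, _⟩ ⟨v, hv, _⟩
      rw [red_pt ho hu hv, red_pt ho' hu hv.neg, ← neg_pt ho, ← neg_pt (hu.on hv ho), add_neg_cancel,
        add_neg_cancel, red_zero]
    · have hyy : y' = y := by
        have : (y' - y) * (y' + y) = 0 := by unfold onE at *; linear_combination ho' - ho
        rcases mul_eq_zero.1 this with h | h
        · exact sub_eq_zero.1 h
        · exact absurd (eq_neg_of_add_eq_zero_left h) hy
      subst hyy
      have hy0 : y' ≠ 0 := fun h => hy (by rw [h, neg_zero])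
      filter_upwards [ev x, ev y'] with w ⟨u, hu, _⟩ ⟨v, hv, hv0⟩
      have h2v : ((2 : ℤ) : w.k) * v ≠ 0 := mul_ne_zero (by exact_mod_cast F2) (hv0 hy0)
      have hl := ((((Rel.int 3).mul (hu.pow 2)).add ((Rel.int 10).mul hu)).sub (Rel.int 32)).div ((Rel.int 2).mul hv) h2v
      have h3 := ((hl.pow 2).sub (Rel.int 5)).sub ((Rel.int 2).mul hu)
      have h4 := ((hl.mul (h3.sub hu)).add hv).neg
      have q := pt_dbl ho hy0 (ℓ := (3 * x ^ 2 + 10 * x - 32) / (2 * y')) (by field_simp) rfl rfl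
      have hv00 := hv0 hy0
      have := F2 (F := w.k)
      have q' := pt_dbl (hu.on hv ho) (hv0 hy0) (ℓ := (3 * u ^ 2 + 10 * u - 32) / (2 * v)) (by field_simp) rfl rfl
      rw [red_pt ho hu hv, q.2, q'.2]
      push_cast at h3 h4
      exact red_pt q.1 h3 h4
  · filter_upwards [ev x, ev y, ev x', ev y', ev (x - x')] with w ⟨u, hu, _⟩ ⟨v, hv, _⟩ ⟨u', hu', _⟩ ⟨v', hv', _⟩ ⟨d, hd, hd0⟩
    have hd' := hd0 (sub_ne_zero.2 hx)
    rw [hd.fn (hu.sub hu')] at hd'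
    have hl := (hv.sub hv').div (hu.sub hu') hd'
    have h3 := (((hl.pow 2).sub (Rel.int 5)).sub hu).sub hu'
    have h4 := ((hl.mul (h3.sub hu)).add hv).neg
    have q := pt_add ho ho' hx (ℓ := (y - y') / (x - x')) (div_mul_cancel₀ _ (sub_ne_zero.2 hx)) rfl rfl
    have q' := pt_add (hu.on hv ho) (hu'.on hv' ho') (sub_ne_zero.1 hd') (ℓ := (v - v') / (u - u'))
      (div_mul_cancel₀ _ hd') rfl rfl
    rw [red_pt ho hu hv, red_pt ho' hu' hv', q.2, q'.2]
    push_cast at h3 h4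
    exact red_pt q.1 h3 h4
end Plc
end reduction
section special
open NumberField
/-- level structure: division points -/
structure Lev (L : Type*) [Field L] [NumberField L] (K : ℕ) where
  (a b : L) (X Y S : EE L)
  tri : Tri 0 a b
  hX : (2 ^ K : ℤ) • X = Q0
  hY : (2 ^ K : ℤ) • Y = pt a 0
  hS : (2 ^ (K + 1) : ℤ) • S = P0

variable {L : Type*} [Field L] [NumberField L] {K : ℕ}

noncomputable abbrev sg (σ : L ≃ₐ[ℚ] L) : EE L →+ EE L := emap (σ : L →+* L)

lemma emap_P {F K : Type*} [Field F] [Field K] [Fact ((102 : F) ≠ 0)] [Fact ((102 : K) ≠ 0)]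
    (f : F →+* K) : emap f P0 = P0 := by
  rw [P0, emap_pt f onP, map_ofNat, map_ofNat]; rfl
lemma emap_Q {F K : Type*} [Field F] [Field K] [Fact ((102 : F) ≠ 0)] [Fact ((102 : K) ≠ 0)]
    (f : F →+* K) : emap f Q0 = Q0 := by
  rw [Q0, emap_pt f onQ, map_zero]; rfl

def CK (K : ℕ) (σ : L ≃ₐ[ℚ] L) : Prop := ∃ (m : ℤ) (s : EE L), (2 ^ K : ℤ) • s = m • P0 + Q0 ∧ sg σ s = s
def BK (K : ℕ) (σ : L ≃ₐ[ℚ] L) : Prop :=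
  ∀ T : EE L, (2 ^ (K + 1) : ℤ) • T = 0 → sg σ T = T → (2 ^ K : ℤ) • T = 0

namespace Plc
lemma ev_zsmul (m : ℤ) (A : EE L) : ∀ᶠ w : Plc L in fil, w.red (m • A) = m • w.red A := by
  have hn : ∀ B : EE L, ∀ᶠ w : Plc L in fil, w.red (-B) = -w.red B := fun B => by
    filter_upwards [ev_add B (-B)] with w hw
    rw [add_neg_cancel, red_zero] at hw
    exact (neg_eq_of_add_eq_zero_right hw.symm).symm
  induction m with
  | zero => exact Eventually.of_forall fun w => by rw [zero_smul, zero_smul, red_zero]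
  | succ m ih =>
    filter_upwards [ih, ev_add ((m : ℤ) • A) A] with w h1 h2
    rw [add_smul, one_smul, h2, h1, add_smul, one_smul]
  | pred m ih =>
    filter_upwards [ih, ev_add ((-m : ℤ) • A) (-A), hn A] with w h1 h2 h3
    rw [sub_smul, one_smul, sub_eq_add_neg, h2, h1, h3, sub_smul, one_smul, sub_eq_add_neg]

lemma red_P (w : Plc L) : w.red P0 = P0 := by
  have h8 := Rel.int (w := w) 8
  have h24 := Rel.int (w := w) 24
  push_cast at h8 h24
  exact red_pt onP h8 h24
lemma red_Q (w : Plc L) : w.red Q0 = Q0 := by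
  have h8 := Rel.int (w := w) 0
  push_cast at h8
  exact red_pt onQ h8 h8
end Plc

lemma Lev.bas (V : Lev L K) : Bas (K + 1) V.X V.Y := V.tri.bas.step V.hX V.hY

lemma Lev.ev_bas (V : Lev L K) : ∀ᶠ w : Plc L in Plc.fil, Bas (K + 1) (w.red V.X) (w.red V.Y) := by
  filter_upwards [Plc.ev V.a, Plc.ev V.b, Plc.ev_zsmul (2 ^ K) V.X, Plc.ev_zsmul (2 ^ K) V.Y] with w ⟨a, ha, _⟩ ⟨b, hb, _⟩ h1 h2
  rw [V.hX, Plc.red_Q] at h1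
  have h0 := Plc.Rel.int (w := w) 0
  have h5 := Plc.Rel.int (w := w) (-5)
  have h32 := Plc.Rel.int (w := w) (-32)
  push_cast at h0 h5 h32
  rw [V.hY, Plc.red_pt V.tri.rot.1.root ha h0] at h2
  have t : Tri 0 a b := by
    obtain ⟨t1, t2, t3⟩ := V.tri
    refine ⟨?_, ?_, by ring⟩
    · have := (h0.add ha).add hb
      rw [t1] at this; exact this.fn h5
    · have := ((h0.mul ha).add (h0.mul hb)).add (ha.mul hb)
      rw [t2] at this; exact this.fn h32
  exact t.bas.step h1.symm h2.symm

lemma Lev.rep (V : Lev L K) {T : EE L} (hT : (2 ^ (K + 1) : ℤ) • T = 0) :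
    ∃ a ∈ Ico (0 : ℤ) (2 ^ (K + 1)), ∃ b ∈ Ico (0 : ℤ) (2 ^ (K + 1)), a • V.X + b • V.Y = T := by
  obtain ⟨a, b, rfl⟩ := V.bas.span T hT
  have h0 : (0 : ℤ) < 2 ^ (K + 1) := by positivity
  refine ⟨a % 2 ^ (K + 1), ⟨Int.emod_nonneg _ h0.ne', Int.emod_lt_of_pos _ h0⟩, b % 2 ^ (K + 1),
    ⟨Int.emod_nonneg _ h0.ne', Int.emod_lt_of_pos _ h0⟩, ?_⟩
  rw [V.bas.iff]
  constructor
  · rw [dvd_sub_comm]; exact Int.dvd_self_sub_emod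
  · rw [dvd_sub_comm]; exact Int.dvd_self_sub_emod

lemma Lev.spec (V : Lev L K) : ∀ᶠ w : Plc L in Plc.fil, ∀ σ : L ≃ₐ[ℚ] L,
    (∀ x : 𝓞 L, σ • x - x ^ w.p ∈ w.P) →
    ((CK K σ → BK K σ → ∃ m : ℤ, (m • P0 + Q0 : EE w.k) = 0) ∧
      ((∃ m : ℤ, (m • P0 + Q0 : EE w.k) = 0) → CK K σ)) := by
  let Tor : Set (EE L) := {T | (2 ^ (K + 1) : ℤ) • T = 0}
  have hfin : Tor.Finite := by
    refine ((Set.finite_Ico (0 : ℤ) (2 ^ (K + 1))).image2 (fun a b => a • V.X + b • V.Y)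
      (Set.finite_Ico (0 : ℤ) (2 ^ (K + 1)))).subset fun T hT => ?_
    obtain ⟨a, ha, b, hb, e⟩ := V.rep hT
    exact ⟨a, ha, b, hb, e⟩
  let I : Set ℤ := Ico (0 : ℤ) (2 ^ (K + 1))
  have hI : I.Finite := Set.finite_Ico _ _
  let J : Set ℤ := Ico (0 : ℤ) (2 ^ K)
  let g : ℤ → EE L → EE L := fun m T => m • ((2 : ℤ) • V.S) + T
  let 𝒮 : Set (EE L) := image2 g J Tor
  have hS : 𝒮.Finite := (Set.finite_Ico _ _).image2 _ hfin
  have hTS : Tor ⊆ 𝒮 := fun T hT => ⟨0, ⟨le_rfl, by positivity⟩, T, hT, by simp [g]⟩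
  have e1 : ∀ᶠ w : Plc L in Plc.fil, ∀ m ∈ J, ∀ T ∈ Tor, w.red (g m T) = m • w.red ((2 : ℤ) • V.S) + w.red T := by
    rw [eventually_all_finite (Set.finite_Ico _ _)]
    intro m _
    rw [eventually_all_finite hfin]
    intro T _
    filter_upwards [Plc.ev_add (m • ((2 : ℤ) • V.S)) T, Plc.ev_zsmul m ((2 : ℤ) • V.S)] with w h1 h2
    rw [← h2]; exact h1
  have e2 : ∀ᶠ w : Plc L in Plc.fil, ∀ a ∈ I, ∀ b ∈ I, w.red (a • V.X + b • V.Y) = a • w.red V.X + b • w.red V.Y := by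
    rw [eventually_all_finite hI]
    intro a _
    rw [eventually_all_finite hI]
    intro b _
    filter_upwards [Plc.ev_add (a • V.X) (b • V.Y), Plc.ev_zsmul a V.X, Plc.ev_zsmul b V.Y] with w h1 h2 h3
    rw [h1, h2, h3]
  have e3 : ∀ᶠ w : Plc L in Plc.fil, ∀ A ∈ 𝒮, ∀ B ∈ 𝒮, w.red A = w.red B → A = B := by
    rw [eventually_all_finite hS]
    intro A _
    rw [eventually_all_finite hS]
    intro B _
    by_cases hAB : A = B
    · exact Eventually.of_forall fun w _ => hAB
    filter_upwards [Plc.ev_add (A - B) B, Plc.ev_ne (sub_ne_zero.2 hAB)] with w h1 h2 h3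
    rw [sub_add_cancel, h3] at h1
    exact absurd (by simpa using h1) h2
  have e4 : ∀ᶠ w : Plc L in Plc.fil, ∀ A ∈ 𝒮, ∀ σ : L ≃ₐ[ℚ] L, (∀ x : 𝓞 L, σ • x - x ^ w.p ∈ w.P) →
      w.red (sg σ A) = emap (frobenius w.k w.p) (w.red A) := by
    rw [eventually_all_finite hS]
    intro A _
    exact Plc.ev_frob A
  have e5 : ∀ᶠ w : Plc L in Plc.fil, ∀ T ∈ Tor, w.red ((2 ^ K : ℤ) • T) = (2 ^ K : ℤ) • w.red T := by
    rw [eventually_all_finite hfin]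
    intro T _
    exact Plc.ev_zsmul _ T
  have e8 : ∀ᶠ w : Plc L in Plc.fil, ∀ T ∈ Tor, w.red V.X = w.red (V.X - T) + w.red T := by
    rw [eventually_all_finite hfin]
    intro T _
    filter_upwards [Plc.ev_add (V.X - T) T] with w h
    rw [← h, sub_add_cancel]
  filter_upwards [e1, e2, e3, e4, e5, e8, V.ev_bas, Plc.ev_zsmul (2 ^ K) ((2 : ℤ) • V.S)] with w e1 e2 e3 e4 e5 e8 hb e6 σ hσ
  have h2S : (2 ^ K : ℤ) • (2 : ℤ) • V.S = P0 := by rw [smul_smul, ← pow_succ, V.hS]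
  rw [h2S, Plc.red_P] at e6
  have hXT : V.X ∈ Tor := V.bas.oX
  have e7 := e5 _ hXT
  rw [V.hX, Plc.red_Q] at e7
  have lift : ∀ A : EE w.k, (2 ^ (K + 1) : ℤ) • A = 0 → ∃ T ∈ Tor, w.red T = A := by
    intro A hA
    obtain ⟨a, b, rfl⟩ := hb.span A hA
    have hT : (2 ^ (K + 1) : ℤ) • (a • V.X + b • V.Y) = 0 := by
      rw [smul_add, smul_comm, V.bas.oX, smul_comm, V.bas.oY]; simp
    obtain ⟨a', ha', b', hb', e⟩ := V.rep hT
    refine ⟨a' • V.X + b' • V.Y, by rw [e]; exact hT, ?_⟩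
    rw [e2 a' ha' b' hb', hb.iff]
    exact (V.bas.iff _ _ _ _).1 e
  have hQ2 : (2 : ℤ) • (Q0 : EE w.k) = 0 := by rw [two_smul]; exact (pt_two onQ).2 rfl
  have redm : ∀ (m : ℤ), ∃ m0 ∈ J, ∃ m1 : ℤ, m = m0 + 2 ^ K * m1 := fun m =>
    ⟨m % 2 ^ K, ⟨Int.emod_nonneg _ (by positivity), Int.emod_lt_of_pos _ (by positivity)⟩, m / 2 ^ K,
      (Int.emod_add_mul_ediv m (2 ^ K)).symm⟩
  constructor
  · rintro ⟨m, s, hs, hfix⟩ hB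
    obtain ⟨m0, hm0, m1, rfl⟩ := redm m
    -- normalise s
    let T := s - m1 • P0 - m0 • ((2 : ℤ) • V.S)
    have hT2 : (2 ^ K : ℤ) • T = Q0 := by
      simp only [T, smul_sub]
      rw [hs, smul_comm _ m0, h2S, add_smul, mul_smul, smul_comm _ m1]; abel
    have hT : T ∈ Tor := by
      change (2 ^ (K + 1) : ℤ) • T = 0
      rw [pow_succ', mul_smul, hT2, two_smul]; exact (pt_two onQ).2 rfl
    have hgT : g m0 T = s - m1 • P0 := by simp only [g, T]; abel
    have hf : emap (frobenius w.k w.p) (w.red (g m0 T)) = w.red (g m0 T) := by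
      rw [← e4 _ ⟨m0, hm0, T, hT, rfl⟩ σ hσ, hgT, map_sub, map_zsmul, emap_P, hfix]
    set A := w.red (g m0 T) with hA
    have hA2 : (2 ^ K : ℤ) • A = m0 • P0 + Q0 := by
      rw [hA, e1 m0 hm0 T hT, smul_add, smul_comm _ m0, ← e6, ← e5 T hT, hT2, Plc.red_Q]
    have : Finite (EE w.k) := by
      refine Finite.of_injective (fun A : EE w.k => (match A with
        | .zero => none
        | .some x y _ => some (x, y) : Option (w.k × w.k))) ?_
      rintro (_ | ⟨x, y, h⟩) (_ | ⟨x', y', h'⟩) h0 <;> simp_all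
    obtain ⟨f, h, hodd, hfh⟩ := Nat.exists_eq_two_pow_mul_odd (n := addOrderOf A) (addOrderOf_pos A).ne'
    have h0 : (2 ^ f * h : ℤ) • A = 0 := by
      have := addOrderOf_nsmul_eq_zero A
      rw [hfh, ← natCast_zsmul] at this; push_cast at this; exact this
    have key : (2 ^ K * h : ℤ) • A = 0 := by
      by_cases hfK : f ≤ K
      · obtain ⟨c, rfl⟩ := Nat.exists_eq_add_of_le hfK
        rw [pow_add, mul_comm ((2 : ℤ) ^ f), mul_assoc, mul_smul, h0, smul_zero]
      · exfalso
        obtain ⟨c, rfl⟩ := Nat.exists_eq_add_of_lt (not_le.1 hfK)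
        let A' := (2 ^ c * h : ℤ) • A
        have hA' : (2 ^ (K + 1) : ℤ) • A' = 0 := by
          rw [smul_smul, ← h0]; congr 1; ring
        obtain ⟨U, hU, hUA⟩ := lift A' hA'
        have hfU : sg σ U = U := by
          have hsU : sg σ U ∈ Tor := by
            change (2 ^ (K + 1) : ℤ) • sg σ U = 0
            rw [← map_zsmul, show (2 ^ (K + 1) : ℤ) • U = 0 from hU, map_zero]
          refine e3 _ (hTS hsU) _ (hTS hU) ?_
          rw [e4 _ (hTS hU) σ hσ, hUA, map_zsmul, hf]
        have h2 := e5 U hU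
        rw [hB U hU hfU, Plc.red_zero, hUA, smul_smul] at h2
        have h3 : addOrderOf A ∣ 2 ^ K * (2 ^ c * h) := by
          rw [addOrderOf_dvd_iff_nsmul_eq_zero, ← natCast_zsmul]; push_cast; exact h2.symm
        rw [hfh] at h3
        have h4 : 0 < 2 ^ K * (2 ^ c * h) := by have := hodd.pos; positivity
        have := Nat.le_of_dvd h4 h3
        rw [show 2 ^ (K + c + 1) * h = 2 * (2 ^ K * (2 ^ c * h)) by ring] at this
        omega
    rw [mul_comm, mul_smul, hA2, smul_add, smul_smul] at key
    obtain ⟨j, hj⟩ := hodd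
    refine ⟨h * m0, ?_⟩
    rw [← key, hj]
    push_cast
    rw [add_smul _ _ Q0, mul_comm (2 : ℤ) (j : ℤ), mul_smul _ _ Q0, hQ2]; simp
  · rintro ⟨m, hm⟩
    obtain ⟨m0, hm0, m1, rfl⟩ := redm m
    have hR : (2 ^ K : ℤ) • (w.red (g m0 V.X) + m1 • P0) = 0 := by
      rw [e1 m0 hm0 _ hXT, smul_add, smul_add, smul_comm _ m0, ← e6, ← e7, ← hm, add_smul, mul_smul]; abel
    obtain ⟨T, hT, hTR⟩ := lift _ (by rw [pow_succ', mul_smul, hR, smul_zero])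
    have hT0 : (2 ^ K : ℤ) • T = 0 := by
      have hTT : (2 ^ K : ℤ) • T ∈ Tor := by
        change (2 ^ (K + 1) : ℤ) • (2 ^ K : ℤ) • T = 0
        rw [smul_comm, show (2 ^ (K + 1) : ℤ) • T = 0 from hT, smul_zero]
      refine e3 _ (hTS hTT) _ (hTS (show (2 ^ (K + 1) : ℤ) • (0 : EE L) = 0 by simp)) ?_
      rw [e5 T hT, hTR, hR, Plc.red_zero]
    have hU : V.X - T ∈ Tor := by
      change (2 ^ (K + 1) : ℤ) • (V.X - T) = 0
      rw [smul_sub, V.bas.oX, show (2 ^ (K + 1) : ℤ) • T = 0 from hT, sub_zero]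
    have hred : w.red (g m0 (V.X - T)) = -(m1 • P0) := by
      have q := e8 T hT
      rw [hTR, e1 m0 hm0 _ hXT, ← sub_eq_iff_eq_add] at q
      rw [e1 m0 hm0 _ hU, ← q]; abel
    refine ⟨m0, g m0 (V.X - T), ?_, ?_⟩
    · simp only [g]
      rw [smul_add, smul_sub, hT0, V.hX, smul_comm _ m0, h2S, sub_zero]
    · have hs : sg σ (g m0 (V.X - T)) = g m0 (sg σ (V.X - T) + m0 • (sg σ ((2 : ℤ) • V.S) - (2 : ℤ) • V.S)) := by
        simp only [g]; rw [map_add, map_zsmul (sg σ) m0, smul_sub]; abel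
      refine e3 _ ⟨m0, hm0, _, ?_, hs.symm⟩ _ ⟨m0, hm0, _, hU, rfl⟩ ?_
      · change (2 ^ (K + 1) : ℤ) • _ = 0
        rw [smul_add, ← map_zsmul, show (2 ^ (K + 1) : ℤ) • (V.X - T) = 0 from hU, smul_comm, smul_sub, ← map_zsmul,
          pow_succ', mul_smul (2 : ℤ) _ ((2 : ℤ) • V.S), h2S, map_zsmul (sg σ) 2 P0, emap_P]
        simp
      · rw [e4 _ ⟨m0, hm0, _, hU, rfl⟩ σ hσ, hred, map_neg, map_zsmul, emap_P]
end special
section galois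
/-- affine matrix entries -/
@[ext] structure T6 where
  (α β γ δ c d : ℤ)

def T6.mul (s t : T6) : T6 where
  α := s.α + t.α + 2 * s.α * t.α + s.β * t.γ
  β := t.β * (1 + 2 * s.α) + (1 + 2 * t.δ) * s.β
  γ := s.γ * (1 + 2 * t.α) + t.γ * (1 + 2 * s.δ)
  δ := s.δ + t.δ + 2 * s.δ * t.δ + t.β * s.γ
  c := s.c + t.c * (1 + 2 * s.α) + t.d * s.β
  d := s.d + 2 * t.c * s.γ + t.d * (1 + 2 * s.δ)

lemma sgn_par {L : Type*} [Field L] [CharZero L] {m n : ℤ} {x : L} (hx : x ≠ 0)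
    (h : (-1 : L) ^ m * x = (-1) ^ n * x) : 2 ∣ m - n := by
  have h := mul_right_cancel₀ hx h
  rcases Int.even_or_odd m with hm | hm <;> rcases Int.even_or_odd n with hn | hn <;>
    simp only [hm.neg_one_zpow, hn.neg_one_zpow] at h
  · exact (hm.sub hn).two_dvd
  · norm_num at h
  · norm_num at h
  · exact (hm.sub_odd hn).two_dvd

lemma tors_par {A : Type*} [AddCommGroup A] {T : A} (hT : T + T = 0) (m : ℤ) :
    (Even m ∧ m • T = 0) ∨ (Odd m ∧ m • T = T) := by
  rw [← two_zsmul] at hT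
  rcases Int.even_or_odd' m with ⟨b, rfl | rfl⟩
  · left; rw [mul_comm, mul_smul, hT]; simp
  · right; rw [add_smul, mul_comm, mul_smul, hT]; simp

lemma rho_sgn0 {F : Type*} [Field F] [hF : Fact ((102 : F) ≠ 0)] {e e' e'' : F} (h : Tri e e' e'')
    {A : EE F} (hA : A + A ≠ 0) (n m : ℤ) : rho e (A + (n • pt e 0 + m • pt e' 0)) = (-1) ^ m * rho e A := by
  have z1 : pt e 0 + pt e 0 = 0 := (pt_two h.root).2 rfl
  have z2 : pt e' 0 + pt e' 0 = 0 := (pt_two h.rot.1.root).2 rfl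
  rw [add_comm (n • pt e 0), ← add_assoc]
  have h2 : (A + m • pt e' 0) + (A + m • pt e' 0) ≠ 0 := by
    rwa [add_add_add_comm, ← smul_add, z2, smul_zero, add_zero]
  have h1 : rho e (A + m • pt e' 0 + n • pt e 0) = rho e (A + m • pt e' 0) := by
    rcases tors_par z1 n with ⟨_, e⟩ | ⟨_, e⟩ <;> rw [e]
    · rw [add_zero]
    · exact rho_add_self h h2
  rw [h1]
  rcases tors_par z2 m with ⟨p, e⟩ | ⟨p, e⟩ <;> rw [e, p.neg_one_zpow]
  · rw [add_zero, one_mul]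
  · rw [neg_one_mul]; exact rho_add_other h.rot.1.rot.2 hA

variable {L : Type*} [Field L] [NumberField L] {K : ℕ} (V : Lev L K)

namespace Lev
noncomputable abbrev T : EE L := pt V.a 0
noncomputable abbrev tt (n m : ℤ) : EE L := n • Q0 + m • V.T
variable {V}
lemma Q2 : (Q0 : EE L) + Q0 = 0 := (pt_two onQ).2 rfl
variable (V) in
lemma T2 : V.T + V.T = 0 := (pt_two V.tri.rot.1.root).2 rfl
lemma sg0 {A : EE L} (hA : A + A ≠ 0) (n m : ℤ) : rho 0 (A + V.tt n m) = (-1) ^ m * rho 0 A :=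
  rho_sgn0 V.tri hA n m
lemma sga {A : EE L} (hA : A + A ≠ 0) (n m : ℤ) : rho V.a (A + V.tt n m) = (-1) ^ n * rho V.a A := by
  rw [tt, add_comm (n • Q0)]; exact rho_sgn0 V.tri.rot.1.rot.2 hA m n
lemma sgb {A : EE L} (hA : A + A ≠ 0) (n m : ℤ) :
    rho V.b (A + V.tt n m) = (-1) ^ (n + m) * rho V.b A := by
  have e : V.tt n m = m • pt V.b 0 + (n + m) • Q0 := by
    have h0 : V.T = pt V.b 0 + Q0 := V.tri.rot.1.rot.1.addTT.symm
    rw [tt, h0]; module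
  rw [e]
  exact rho_sgn0 V.tri.rot.1.rot.1 hA m (n + m)

end Lev

structure Rp (σ : L ≃ₐ[ℚ] L) (t : T6) : Prop where
  hX : sg σ V.X = (1 + 2 * t.α) • V.X + (2 * t.γ) • V.Y
  hY : sg σ V.Y = t.β • V.X + (1 + 2 * t.δ) • V.Y
  hS : sg σ V.S = V.S + (t.c • V.X + t.d • V.Y)

lemma sg_mul (σ τ : L ≃ₐ[ℚ] L) (A : EE L) : sg (σ * τ) A = sg σ (sg τ A) := by
  rcases pt_cases A with rfl | ⟨x, y, ho, rfl⟩
  · simp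
  · have ho' : onE (τ x) (τ y) := by
      unfold onE at *; simpa only [map_pow, map_add, map_sub, map_mul, map_ofNat] using congrArg τ ho
    rw [emap_pt _ ho, emap_pt _ ho]
    exact (emap_pt (σ : L →+* L) ho').symm

lemma sg_inj (σ : L ≃ₐ[ℚ] L) {A B : EE L} (h : sg σ A = sg σ B) : A = B := by
  have h1 : ∀ C, sg σ⁻¹ (sg σ C) = C := fun C => by
    rw [← sg_mul, inv_mul_cancel]
    rcases pt_cases C with rfl | ⟨x, y, ho, rfl⟩
    · simp
    · rw [emap_pt _ ho]; rfl
  rw [← h1 A, h, h1]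

variable {V}
lemma Rp.mul {σ τ : L ≃ₐ[ℚ] L} {s t : T6} (h : Rp V σ s) (h' : Rp V τ t) : Rp V (σ * τ) (s.mul t) := by
  constructor
  · rw [sg_mul, h'.hX, map_add, map_zsmul, map_zsmul, h.hX, h.hY, T6.mul]; module
  · rw [sg_mul, h'.hY, map_add, map_zsmul, map_zsmul, h.hX, h.hY, T6.mul]; module
  · rw [sg_mul, h'.hS, map_add, map_add, map_zsmul, map_zsmul, h.hX, h.hY, h.hS, T6.mul]; module

variable (V) in
lemma Rp.ex (σ : L ≃ₐ[ℚ] L) : ∃ t, Rp V σ t := by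
  have hb := V.tri.bas
  obtain ⟨a, b, h1⟩ := V.bas.span (sg σ V.X) (by rw [← map_zsmul, V.bas.oX, map_zero])
  obtain ⟨a', b', h2⟩ := V.bas.span (sg σ V.Y) (by rw [← map_zsmul, V.bas.oY, map_zero])
  obtain ⟨c, d, h3⟩ := V.bas.span (sg σ V.S - V.S) (by
    rw [smul_sub, ← map_zsmul, V.hS, emap_P, sub_self])
  have e1 := congrArg ((2 ^ K : ℤ) • ·) h1
  simp only [smul_add] at e1
  rw [← map_zsmul, V.hX, emap_Q, smul_comm, smul_comm _ b, V.hX, V.hY] at e1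
  have e2 := congrArg ((2 ^ K : ℤ) • ·) h2
  simp only [smul_add] at e2
  rw [← map_zsmul, smul_comm, smul_comm _ b', V.hX, V.hY] at e2
  have q1 := (hb.iff 1 0 a b).1 (by rw [one_smul, zero_smul, add_zero]; exact e1)
  rw [pow_one] at q1
  have q2 : ¬ 2 ∣ b' := by
    rintro ⟨u, rfl⟩
    have h4 : (2 * u) • pt V.a 0 = 0 := by
      rw [mul_comm, mul_smul, two_smul, V.T2, smul_zero]
    rw [h4, add_zero] at e2
    have h5 : sg σ (pt V.a 0) = sg σ (a' • Q0) := by rw [e2, map_zsmul, emap_Q]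
    have h6 := (hb.iff 0 1 a' 0).1 (by rw [one_smul, zero_smul, zero_add, zero_smul, add_zero]; exact sg_inj σ h5)
    omega
  obtain ⟨⟨u, hu⟩, ⟨v, hv⟩⟩ := q1
  obtain ⟨w, hw⟩ : ∃ w, b' = 1 + 2 * w := ⟨b' / 2, by omega⟩
  refine ⟨⟨-u, a', -v, w, c, d⟩, ?_, ?_, ?_⟩
  · rw [h1, show a = 1 + 2 * -u by linarith, show b = 2 * -v by linarith]
  · rw [h2, hw]
  · rw [← h3]; abel
end galois
section galois2
variable {L : Type*} [Field L] [NumberField L] {J : ℕ} (V : Lev L (J + 2))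
namespace Lev
noncomputable abbrev U : EE L := (2 ^ J : ℤ) • V.X
noncomputable abbrev U' : EE L := (2 ^ J : ℤ) • V.Y
noncomputable abbrev W : EE L := (2 ^ (J + 2) : ℤ) • V.S
noncomputable def q : L := rho V.a (V.U + V.U) * rho V.b (V.U + V.U)
noncomputable def r : L := rho 0 V.W

lemma hU : (V.U + V.U) + (V.U + V.U) = Q0 := by
  rw [← V.hX, pow_add]; module
lemma hU' : (V.U' + V.U') + (V.U' + V.U') = V.T := by
  rw [T, ← V.hY, pow_add]; module
lemma hW : V.W + V.W = P0 := by
  rw [← V.hS, pow_succ _ (J + 2)]; module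
lemma nU : (V.U + V.U) + (V.U + V.U) ≠ 0 := by rw [hU]; exact pt_ne onQ
lemma nU' : (V.U' + V.U') + (V.U' + V.U') ≠ 0 := by rw [hU']; exact pt_ne V.tri.rot.1.root
lemma nW : V.W + V.W ≠ 0 := by rw [hW]; exact pt_ne onP

lemma q_sq : V.q ^ 2 = -32 := by
  obtain ⟨_, _, h1, h2⟩ := half_coords V.tri V.hU
  rw [q, mul_pow, h1, h2]; linear_combination V.tri.2.1
lemma r_sq : V.r ^ 2 = 8 := by
  obtain h | ⟨x, y, ho, h⟩ := pt_cases V.W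
  · have := V.nW; rw [h] at this; simp at this
  · have := V.hW
    rw [r, h]; rw [h] at this
    rw [rho_sq V.tri.root ho onP this, sub_zero]
end Lev

variable {V} {σ : L ≃ₐ[ℚ] L} {t : T6} (h : Rp V σ t)
include h
namespace Rp
lemma sU : sg σ V.U = (1 + 2 * t.α) • V.U + (2 * t.γ) • V.U' := by
  rw [map_zsmul, h.hX]; module
lemma sU' : sg σ V.U' = t.β • V.U + (1 + 2 * t.δ) • V.U' := by
  rw [map_zsmul, h.hY]; module
lemma sS : sg σ (V.U + V.U) = (V.U + V.U) + V.tt t.α t.γ := by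
  rw [map_add, h.sU, Lev.tt, ← V.hU, ← V.hU']; module
lemma sS' : sg σ (V.U' + V.U') = t.β • (V.U + V.U) + ((V.U' + V.U') + V.tt 0 t.δ) := by
  rw [map_add, h.sU', Lev.tt, ← V.hU, ← V.hU']; module
lemma sW : sg σ V.W = V.W + V.tt t.c t.d := by
  rw [map_zsmul, h.hS, Lev.tt, ← V.hX, Lev.T, ← V.hY]; module

lemma chB : (Even t.β ∧ σ V.a = V.a ∧ σ V.b = V.b) ∨ (Odd t.β ∧ σ V.a = V.b ∧ σ V.b = V.a) := by
  have e := congrArg (sg σ) V.hU'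
  have hra := V.tri.rot.1.root
  have hr : onE (σ V.a) 0 := by
    have h0 := hra
    unfold onE at *; simpa only [map_pow, map_add, map_sub, map_mul, map_ofNat, map_zero] using congrArg σ h0
  rw [map_add, h.sS', emap_pt _ hra, map_zero] at e
  have e' : pt (σ V.a) 0 = t.β • Q0 + V.T := by
    change (_ : EE L) = pt (σ V.a) 0 at e
    have : t.β • Q0 + V.T = t.β • Q0 + (V.T + t.δ • (V.T + V.T)) := by rw [V.T2, smul_zero, add_zero]
    rw [this, ← e, Lev.tt, ← V.hU, ← V.hU']; module
  have hab : σ V.a + σ V.b = V.a + V.b := by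
    have h1 : V.a + V.b = -5 := by linear_combination V.tri.1
    rw [← map_add, h1, map_neg, map_ofNat]
  rcases tors_par (Lev.Q2 (L := L)) t.β with ⟨p, e⟩ | ⟨p, e⟩ <;> rw [e] at e'
  · rw [zero_add, pt_inj hr hra] at e'
    exact Or.inl ⟨p, e'.1, by rw [e'.1] at hab; exact add_left_cancel hab⟩
  · have := V.tri.addTT
    rw [Lev.T, Q0, this, pt_inj hr V.tri.rot.1.rot.1.root] at e'
    exact Or.inr ⟨p, e'.1, by rw [e'.1, add_comm] at hab; exact add_right_cancel hab⟩

lemma cq : σ V.q = (-1) ^ t.γ * V.q := by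
  have hr := fun e => rho_emap (σ : L →+* L) e (V.U + V.U)
  have : σ V.q = rho V.a (sg σ (V.U + V.U)) * rho V.b (sg σ (V.U + V.U)) := by
    rw [Lev.q, map_mul]
    have h1 := hr V.a
    have h2 := hr V.b
    rcases h.chB with ⟨_, ea, eb⟩ | ⟨_, ea, eb⟩
    · rw [show (σ : L →+* L) V.a = V.a from ea] at h1
      rw [show (σ : L →+* L) V.b = V.b from eb] at h2
      rw [h1, h2]; rfl
    · rw [show (σ : L →+* L) V.a = V.b from ea] at h1
      rw [show (σ : L →+* L) V.b = V.a from eb] at h2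
      rw [h1, h2, mul_comm]; rfl
  rw [this, h.sS, V.sga V.nU, V.sgb V.nU, Lev.q, zpow_add₀ (by norm_num)]
  have h2 : ((-1 : L) ^ t.α) * (-1) ^ t.α = 1 := by
    rw [← mul_zpow]; simp
  linear_combination (-1) ^ t.γ * rho V.a (V.U + V.U) * rho V.b (V.U + V.U) * h2

lemma cr : σ V.r = (-1) ^ t.d * V.r := by
  have hr := rho_emap (σ : L →+* L) 0 V.W
  rw [map_zero] at hr
  change _ = σ V.r at hr
  rw [← hr, h.sW, V.sg0 V.nW]; rfl

lemma c17 : σ ((V.a - V.b) / 3) = (-1) ^ t.β * ((V.a - V.b) / 3) := by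
  rw [map_div₀, map_sub, map_ofNat]
  rcases h.chB with ⟨p, ea, eb⟩ | ⟨p, ea, eb⟩ <;> rw [ea, eb, p.neg_one_zpow] <;> ring

/-- if `x² = -1` then its sign is `γ+d` -/
lemma ci {x : L} (hx : x ^ 2 = -1) : σ x = (-1) ^ (t.γ + t.d) * x := by
  have hq := V.q_sq
  have hr := V.r_sq
  have hr0 : V.r ≠ 0 := fun h => by rw [h] at hr; norm_num at hr
  have h2 : (x - V.q / (2 * V.r)) * (x + V.q / (2 * V.r)) = 0 := by
    have : (V.q / (2 * V.r)) ^ 2 = -1 := by rw [div_pow, mul_pow, hq, hr]; norm_num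
    linear_combination hx - this
  have h3 : σ (V.q / (2 * V.r)) = (-1) ^ (t.γ + t.d) * (V.q / (2 * V.r)) := by
    have s2 : ((-1 : L) ^ t.d) * (-1) ^ t.d = 1 := by rw [← mul_zpow]; simp
    have s0 : ((-1 : L) ^ t.d) ≠ 0 := zpow_ne_zero _ (by norm_num)
    rw [map_div₀, map_mul, map_ofNat, h.cq, h.cr, zpow_add₀ (by norm_num)]
    field_simp
    linear_combination -V.q * s2
  rcases mul_eq_zero.1 h2 with h2 | h2
  · rw [sub_eq_zero.1 h2, h3]
  · rw [eq_neg_of_add_eq_zero_left h2, map_neg, h3]; ring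

lemma c2 {x : L} (hx : x ^ 2 = 2) : σ x = (-1) ^ t.d * x := by
  have hr := V.r_sq
  have h2 : (2 * x - V.r) * (2 * x + V.r) = 0 := by linear_combination 4 * hx - hr
  have h3 := h.cr
  rcases mul_eq_zero.1 h2 with h2 | h2
  · have : x = V.r / 2 := by linear_combination h2 / 2
    rw [this, map_div₀, h3, map_ofNat]; ring
  · have : x = -V.r / 2 := by linear_combination h2 / 2
    rw [this, map_div₀, map_neg, h3, map_ofNat]; ring

lemma F2' : 2 ∣ t.α + t.δ + t.β * t.γ - (t.γ + t.d) := by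
  obtain ⟨_, _, h1, h1'⟩ := half_coords V.tri V.hU
  obtain ⟨_, _, h2, h2'⟩ := half_coords V.tri.rot.1.rot.2 V.hU'
  set S := V.U + V.U
  set S' := V.U' + V.U'
  have hab : V.a ≠ 0 := V.tri.ne.symm
  have hbb : V.b ≠ 0 := V.tri.rot.2.ne.symm
  have n1 : rho V.a S ≠ 0 := fun h => by rw [h] at h1; apply hab; linear_combination h1
  have n1' : rho V.b S ≠ 0 := fun h => by rw [h] at h1'; apply hbb; linear_combination h1'
  have n2 : rho 0 S' ≠ 0 := fun h => by rw [h] at h2; apply hab; linear_combination -h2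
  have hi : (rho 0 S' / rho V.a S) ^ 2 = -1 := by
    rw [div_pow, h1, h2]; field_simp; ring
  have c1 := h.ci hi
  have r1 := rho_emap (σ : L →+* L) 0 S'
  have r2 := rho_emap (σ : L →+* L) V.a S
  rw [map_zero] at r1
  change rho 0 (sg σ S') = σ _ at r1
  change rho (σ V.a) (sg σ S) = σ _ at r2
  rw [map_div₀, ← r1, ← r2, h.sS, h.sS'] at c1
  have s0 : ∀ n : ℤ, ((-1 : L) ^ n) ≠ 0 := fun n => zpow_ne_zero _ (by norm_num)
  have key : ∀ n : ℤ, (-1 : L) ^ t.δ / (-1) ^ n * (rho 0 S' / rho V.a S) = (-1) ^ (t.γ + t.d) * (rho 0 S' / rho V.a S) →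
      2 ∣ t.δ - n - (t.γ + t.d) := fun n hn => by
    rw [← zpow_sub₀ (by norm_num)] at hn
    exact sgn_par (div_ne_zero n2 n1) hn
  rcases h.chB with ⟨⟨u, hu⟩, ea, _⟩ | ⟨⟨u, hu⟩, ea, _⟩
  · have e1 : t.β • S + (S' + V.tt 0 t.δ) = S' + V.tt u t.δ := by
      rw [hu, Lev.tt, Lev.tt, ← V.hU]; module
    rw [ea, e1, V.sg0 V.nU', V.sga V.nU] at c1
    have := key t.α (by
      rw [← c1]; change _ = (-1) ^ t.δ * rho 0 S' / ((-1) ^ t.α * rho V.a S)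
      have := s0 t.α
      field_simp)
    rw [hu, show t.α + t.δ + (u + u) * t.γ - (t.γ + t.d) = (t.δ - t.α - (t.γ + t.d)) + 2 * (t.α + u * t.γ) by ring]
    exact dvd_add this (dvd_mul_right _ _)
  · have e1 : t.β • S + (S' + V.tt 0 t.δ) = (S + S') + V.tt u t.δ := by
      rw [hu, Lev.tt, Lev.tt, ← V.hU]; module
    have hn : (S + S') + (S + S') ≠ 0 := by
      rw [add_add_add_comm, V.hU, V.hU', Q0, V.tri.addTT]; exact pt_ne V.tri.rot.1.rot.1.root
    have hid := F2_id V.tri V.hU V.hU'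
    rw [ea, e1, V.sg0 hn, V.sgb V.nU] at c1
    have := key (t.α + t.γ) (by
      rw [← c1]; change _ = (-1) ^ t.δ * rho 0 (S + S') / ((-1) ^ (t.α + t.γ) * rho V.b S)
      have : rho 0 (S + S') = rho 0 S' * rho V.b S / rho V.a S := by rw [eq_div_iff n1]; exact hid
      rw [this]
      have := s0 (t.α + t.γ)
      field_simp)
    rw [hu, show t.α + t.δ + (2 * u + 1) * t.γ - (t.γ + t.d) = (t.δ - (t.α + t.γ) - (t.γ + t.d)) + 2 * (t.α + u * t.γ + t.γ) by ring]
    exact dvd_add this (dvd_mul_right _ _)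

lemma F3' {μ ν a b g e : ℤ} (hμ : μ = 1 ∨ μ = -1) (hν : ν = 1 ∨ ν = -1) (h1 : 1 + 2 * t.α = μ + 4 * a)
    (h2 : t.β = 4 * b) (h3 : t.γ = 2 * g) (h4 : 1 + 2 * t.δ = ν + 4 * e) : 2 ∣ a + e - t.d := by
  have hR := F3_id V.tri V.hU V.hU'
  have c2 := h.c2 hR
  set R := rho V.a V.U / rho 0 V.U' * (rho 0 (V.U' + V.U') / rho V.a (V.U + V.U) +
      rho V.b (V.U' + V.U') / (rho V.a (V.U + V.U) + rho V.b (V.U + V.U))) with hRd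
  have hR0 : R ≠ 0 := fun h => by rw [h] at hR; norm_num at hR
  have eU : sg σ V.U = μ • V.U + V.tt a g := by
    rw [h.sU, h1, h3, Lev.tt, ← V.hU, ← V.hU']; module
  have eU' : sg σ V.U' = ν • V.U' + V.tt b e := by
    rw [h.sU', h2, h4, Lev.tt, ← V.hU, ← V.hU']; module
  have two : ∀ n m : ℤ, V.tt n m + V.tt n m = 0 := fun n m => by
    rw [Lev.tt, add_add_add_comm, ← smul_add, ← smul_add, V.T2, Lev.Q2]; simp
  have eS : sg σ (V.U + V.U) = μ • (V.U + V.U) := by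
    rw [map_add, eU, add_add_add_comm, two, add_zero, smul_add]
  have eS' : sg σ (V.U' + V.U') = ν • (V.U' + V.U') := by
    rw [map_add, eU', add_add_add_comm, two, add_zero, smul_add]
  have sm : ∀ {μ : ℤ}, μ = 1 ∨ μ = -1 → ∀ (x : L) (A : EE L), rho x (μ • A) = μ * rho x A := by
    rintro μ (rfl | rfl) x A
    · simp
    · rw [neg_smul, one_smul, rho_neg]; simp
  have nn : ∀ {μ : ℤ}, μ = 1 ∨ μ = -1 → ∀ (A : EE L), (A + A) + (A + A) ≠ 0 → μ • A + μ • A ≠ 0 := by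
    rintro μ (rfl | rfl) A hA h0
    · apply hA; rw [one_smul] at h0; rw [h0, add_zero]
    · apply hA; rw [neg_smul, one_smul, ← neg_add, neg_eq_zero] at h0; rw [h0, add_zero]
  have ev : Even t.β := ⟨2 * b, by rw [h2]; ring⟩
  obtain ⟨ea, eb⟩ : σ V.a = V.a ∧ σ V.b = V.b := by
    rcases h.chB with ⟨_, h⟩ | ⟨h', _⟩
    · exact h
    · exact absurd ev (by simpa using h')
  have rr : ∀ x A, σ (rho x A) = rho (σ x) (sg σ A) := fun x A => (rho_emap (σ : L →+* L) x A).symm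
  have hs : σ R = (-1) ^ (a - e) * R := by
    have hμ0 : (μ : L) ≠ 0 := by rcases hμ with rfl | rfl <;> norm_num
    have hν0 : (ν : L) ≠ 0 := by rcases hν with rfl | rfl <;> norm_num
    rw [hRd]
    simp only [map_mul, map_div₀, map_add, rr, ea, eb, map_zero]
    rw [← map_add (sg σ) V.U, ← map_add (sg σ) V.U', eS, eS', eU, eU', V.sga (nn hμ _ V.nU), V.sg0 (nn hν _ V.nU')]
    simp only [sm hμ, sm hν]
    rw [zpow_sub₀ (by norm_num), ← mul_add]
    have := zpow_ne_zero e (show (-1 : L) ≠ 0 by norm_num)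
    field_simp
  rw [hs] at c2
  obtain ⟨u, hu⟩ := sgn_par hR0 c2
  exact ⟨u + e, by linarith⟩
end Rp
end galois2
section grp
namespace T6
def det (t : T6) : ℤ := (1 + 2 * t.α) * (1 + 2 * t.δ) - 2 * t.β * t.γ
lemma det_mul (s t : T6) : (s.mul t).det = s.det * t.det := by simp only [det, mul]; ring
/-- `g + 2^j s` with `β` shifted -/
def au (g : T6) (j : ℕ) (s : T6) : T6 :=
  ⟨g.α + 2 ^ j * s.α, g.β + 2 ^ (j + 1) * s.β, g.γ + 2 ^ j * s.γ, g.δ + 2 ^ j * s.δ, g.c + 2 ^ j * s.c, g.d + 2 ^ j * s.d⟩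
def o : T6 := ⟨0, 0, 0, 0, 0, 0⟩
def sig (s : T6) : Fin 6 → ZMod 2 := ![s.α, s.β, s.γ, s.δ, s.c, s.d]
def cls (s : T6) : Fin 3 → ZMod 2 := ![s.β, s.γ, s.d]
end T6
open T6

lemma zsm {ι : Type*} {S : Set (ι → ZMod 2)} (h0 : 0 ∈ S) {v : ι → ZMod 2} (hv : v ∈ S) (n : ZMod 2) :
    (fun i => n * v i) ∈ S := by
  have : n = 0 ∨ n = 1 := by revert n; decide
  rcases this with rfl | rfl
  · convert h0 using 1; ext i; simp
  · simpa using hv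

lemma t20 : (2 : ZMod 2) = 0 := rfl

structure Gp (K : ℕ) (G : T6 → Prop) : Prop where
  one : G o
  mul : ∀ s t, G s → G t → G (s.mul t)
  cong : ∀ g s, G g → G (g.au (K + 1) s)
  f2 : ∀ t, G t → (t.α + t.δ + t.β * t.γ : ZMod 2) = t.γ + t.d
  f3 : ∀ a b g e c d, G ⟨2 * a, 4 * b, 2 * g, 2 * e, c, d⟩ → (a + e : ZMod 2) = d
  f3' : ∀ a b g e c d, G ⟨2 * a, 4 * b, 2 * g, -1 + 2 * e, c, d⟩ → (a + e : ZMod 2) = d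
  g1 : ∃ t, G t ∧ t.cls = ![1, 0, 1]
  g2 : ∃ t, G t ∧ t.cls = ![1, 1, 1]
  g3 : ∃ t, G t ∧ t.cls = ![1, 1, 0]

namespace Gp
variable {K : ℕ} {G : T6 → Prop} (h : Gp K G)
include h

/-- every class is represented -/
lemma cl (v : Fin 3 → ZMod 2) : ∃ t, G t ∧ t.cls = v := by
  let S : Set (Fin 3 → ZMod 2) := {v | ∃ t, G t ∧ t.cls = v}
  have h0 : (0 : Fin 3 → ZMod 2) ∈ S := ⟨o, h.one, by ext i; fin_cases i <;> simp [cls, o]⟩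
  have ad : ∀ {x y}, x ∈ S → y ∈ S → x + y ∈ S := by
    rintro _ _ ⟨s, hs, rfl⟩ ⟨t, ht, rfl⟩
    refine ⟨_, h.mul _ _ hs ht, ?_⟩
    ext i; fin_cases i <;> simp [cls, T6.mul, t20] <;> ring
  have := ad (ad (zsm h0 h.g1 (v 1 + v 0)) (zsm h0 h.g2 (v 2 + v 1 + v 0))) (zsm h0 h.g3 (v 2 + v 0))
  have e : v ∈ S := by
    convert this using 1
    clear * -
    revert v; decide
  exact e

/-- square signatures -/
lemma vp (x y z : ZMod 2) : ∃ a b g e c d : ℤ, G ⟨a, 2 * b, 2 * g, e, c, 2 * d⟩ ∧ 8 ∣ det ⟨a, 2 * b, 2 * g, e, c, 2 * d⟩ - 1 ∧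
    ![(a : ZMod 2), b, c] = ![x, y, z] := by
  let S : Set (Fin 3 → ZMod 2) := {v | ∃ a b g e c d : ℤ, G ⟨a, 2 * b, 2 * g, e, c, 2 * d⟩ ∧ 8 ∣ det ⟨a, 2 * b, 2 * g, e, c, 2 * d⟩ - 1 ∧
    ![(a : ZMod 2), b, c] = v}
  have h0 : (0 : Fin 3 → ZMod 2) ∈ S := ⟨0, 0, 0, 0, 0, 0, h.one, by simp [det], by ext i; fin_cases i <;> simp⟩
  have ad : ∀ {x y}, x ∈ S → y ∈ S → x + y ∈ S := by
    rintro _ _ ⟨a, b, g, e, c, d, hs, h8, rfl⟩ ⟨a', b', g', e', c', d', ht, h8', rfl⟩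
    have := h.mul _ _ hs ht
    have hd := det_mul ⟨a, 2 * b, 2 * g, e, c, 2 * d⟩ ⟨a', 2 * b', 2 * g', e', c', 2 * d'⟩
    have e1 : T6.mul ⟨a, 2 * b, 2 * g, e, c, 2 * d⟩ ⟨a', 2 * b', 2 * g', e', c', 2 * d'⟩ =
      ⟨a + a' + 2 * a * a' + 4 * b * g', 2 * (b' * (1 + 2 * a) + (1 + 2 * e') * b), 2 * (g * (1 + 2 * a') + g' * (1 + 2 * e)),
        e + e' + 2 * e * e' + 4 * b' * g, c + c' * (1 + 2 * a) + 4 * d' * b, 2 * (d + 2 * c' * g + d' * (1 + 2 * e))⟩ := by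
      ext <;> simp only [T6.mul] <;> ring
    rw [e1] at this hd
    refine ⟨_, _, _, _, _, _, this, ?_, ?_⟩
    · rw [hd]
      obtain ⟨u, hu⟩ := h8
      obtain ⟨u', hu'⟩ := h8'
      exact ⟨u + u' + 8 * u * u', by rw [eq_add_of_sub_eq hu, eq_add_of_sub_eq hu']; ring⟩
    · have e4 : (4 : ZMod 2) = 0 := rfl
      ext i; fin_cases i <;> simp [t20, e4] <;> ring
  have sq : ∀ t, G t → ![(t.β * t.γ : ZMod 2), t.β * (1 + t.α + t.δ), t.d * t.β] ∈ S := by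
    intro t ht
    have := h.mul _ _ ht ht
    have hd := det_mul t t
    have e1 : t.mul t = ⟨2 * t.α + 2 * t.α ^ 2 + t.β * t.γ, 2 * (t.β * (1 + t.α + t.δ)), 2 * (t.γ * (1 + t.α + t.δ)),
        2 * t.δ + 2 * t.δ ^ 2 + t.β * t.γ, 2 * (t.c * (1 + t.α)) + t.d * t.β, 2 * (t.c * t.γ + t.d * (1 + t.δ))⟩ := by
      ext <;> simp only [T6.mul] <;> ring
    rw [e1] at this hd
    refine ⟨_, _, _, _, _, _, this, ?_, ?_⟩
    · rw [hd]
      have : Odd t.det := ⟨t.α + t.δ + 2 * t.α * t.δ - t.β * t.γ, by simp only [det]; ring⟩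
      have := Int.eight_dvd_sq_sub_one_of_odd this
      rwa [sq] at this
    · ext i; fin_cases i <;> simp [t20]
  obtain ⟨t1, q1, k1⟩ := h.cl ![1, 0, 0]
  obtain ⟨t2, q2, k2⟩ := h.cl ![1, 0, 1]
  obtain ⟨t3, q3, k3⟩ := h.cl ![1, 1, 0]
  have get : ∀ {t : T6} {u}, t.cls = u → (t.β : ZMod 2) = u 0 ∧ (t.γ : ZMod 2) = u 1 ∧ (t.d : ZMod 2) = u 2 := by
    rintro t _ rfl; exact ⟨rfl, rfl, rfl⟩
  obtain ⟨a1, b1, c1⟩ := get k1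
  obtain ⟨a2, b2, c2⟩ := get k2
  obtain ⟨a3, b3, c3⟩ := get k3
  have f1 := h.f2 _ q1
  have f2 := h.f2 _ q2
  have f3 := h.f2 _ q3
  have s1 := sq _ q1
  have s2 := sq _ q2
  have s3 := sq _ q3
  rw [a1, b1, c1] at f1 s1
  rw [a2, b2, c2] at f2 s2
  rw [a3, b3, c3] at f3 s3
  rw [show (![1, 0, 0] : Fin 3 → ZMod 2) 0 * (1 + t1.α + t1.δ) = 1 by
    generalize (t1.α : ZMod 2) = x at *; generalize (t1.δ : ZMod 2) = y at *; clear s1; revert x y; decide] at s1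
  rw [show (![1, 0, 1] : Fin 3 → ZMod 2) 0 * (1 + t2.α + t2.δ) = 0 by
    generalize (t2.α : ZMod 2) = x at *; generalize (t2.δ : ZMod 2) = y at *; clear s2; revert x y; decide] at s2
  rw [show (![1, 1, 0] : Fin 3 → ZMod 2) 0 * (1 + t3.α + t3.δ) = 1 by
    generalize (t3.α : ZMod 2) = x at *; generalize (t3.δ : ZMod 2) = y at *; clear s3; revert x y; decide] at s3
  have := ad (ad (zsm h0 s1 (x + y)) (zsm h0 s2 z)) (zsm h0 s3 x)
  have e : ![x, y, z] ∈ S := by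
    convert this using 1
    clear * -
    revert x y z; decide
  exact e

omit h in
lemma par0 {x : ℤ} (h : (x : ZMod 2) = 0) : ∃ y, x = 2 * y := by
  rwa [ZMod.intCast_zmod_eq_zero_iff_dvd] at h

lemma det0 {t : T6} (ht : G t) (hc : t.cls = 0) : 8 ∣ t.det - 1 := by
  have hb := congrFun hc 0
  have hg := congrFun hc 1
  have hd := congrFun hc 2
  obtain ⟨α, β, γ, δ, c, d⟩ := t
  obtain ⟨β, rfl⟩ := par0 hb
  obtain ⟨γ, rfl⟩ := par0 hg
  obtain ⟨d, rfl⟩ := par0 hd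
  obtain ⟨a, b, g, e, c', d', h1, h8, hs⟩ := h.vp α β c
  have f1 := h.f2 _ ht
  have f2 := h.f2 _ h1
  have ha := congrFun hs 0
  have hb := congrFun hs 1
  have hc := congrFun hs 2
  simp [t20] at f1 f2 ha hb hc
  obtain ⟨x, hx⟩ := par0 (x := α + a) (by push_cast; rw [ha]; exact CharTwo.add_self_eq_zero _)
  obtain ⟨y, hy⟩ := par0 (x := β + b) (by push_cast; rw [hb]; exact CharTwo.add_self_eq_zero _)
  obtain ⟨w, hw⟩ := par0 (x := δ + e) (by push_cast; linear_combination f1 + f2 - ha - α * t20)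
  have h2 := h.mul _ _ ht h1
  have hm := det_mul ⟨α, 2 * β, 2 * γ, δ, c, 2 * d⟩ ⟨a, 2 * b, 2 * g, e, c', 2 * d'⟩
  obtain rfl : a = 2 * x - α := by linarith
  obtain rfl : b = 2 * y - β := by linarith
  obtain rfl : e = 2 * w - δ := by linarith
  set t : T6 := ⟨α, 2 * β, 2 * γ, δ, c, 2 * d⟩ with htd
  set s : T6 := ⟨2 * x - α, 2 * (2 * y - β), 2 * g, 2 * w - δ, c', 2 * d'⟩ with hsd
  have e1 : t.mul s = ⟨2 * (x + α * (2 * x - α) + 2 * β * g), 4 * (y + 2 * y * α - β * α + 2 * β * w - β * δ), 2 * (γ * (1 + 2 * (2 * x - α)) + g * (1 + 2 * δ)),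
        2 * (w + δ * (2 * w - δ) + 2 * (2 * y - β) * γ), (t.mul s).c, 2 * (d + 2 * c' * γ + d' * (1 + 2 * δ))⟩ := by
    ext <;> simp only [T6.mul, htd, hsd] <;> ring
  rw [e1] at h2 hm
  obtain ⟨z, hz⟩ := par0 (x := x + α * (2 * x - α) + 2 * β * g + (w + δ * (2 * w - δ) + 2 * (2 * y - β) * γ)) (by
    have := h.f3 _ _ _ _ _ _ h2
    push_cast at this ⊢; rw [this, t20]; ring)
  obtain ⟨v, hv⟩ := h8
  have h9 : 8 ∣ t.det * s.det - 1 := by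
    rw [← hm]; simp only [det]
    exact ⟨z + 2 * (x + α * (2 * x - α) + 2 * β * g) * (w + δ * (2 * w - δ) + 2 * (2 * y - β) * γ) - 2 * (y + 2 * y * α - β * α + 2 * β * w - β * δ) * (γ * (1 + 2 * (2 * x - α)) + g * (1 + 2 * δ)), by linear_combination 4 * hz⟩
  have : t.det - 1 = (t.det * s.det - 1) - 8 * (v * t.det) := by linear_combination -t.det * hv
  rw [this]; exact dvd_sub h9 (dvd_mul_right _ _)

lemma detc {t s : T6} (ht : G t) (hs : G s) (hc : t.cls = s.cls) : 8 ∣ t.det - s.det := by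
  have hb := congrFun hc 0
  have hg := congrFun hc 1
  have hd := congrFun hc 2
  have := h.det0 (h.mul _ _ ht hs) (by
    simp [cls] at hb hg hd
    ext i; fin_cases i <;> simp [cls, T6.mul, t20, hb, hg, hd, CharTwo.add_self_eq_zero])
  rw [det_mul] at this
  have o : Odd s.det := ⟨s.α + s.δ + 2 * s.α * s.δ - s.β * s.γ, by simp only [det]; ring⟩
  have := dvd_sub (this.mul_left s.det) ((Int.eight_dvd_sq_sub_one_of_odd o).mul_left t.det)
  rwa [show s.det * (t.det * s.det - 1) - t.det * (s.det ^ 2 - 1) = t.det - s.det by ring] at this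

/-- level one approximation -/
lemma ap1 (t : T6) (ht : (t.α + t.δ + t.β * t.γ : ZMod 2) = t.γ + t.d) :
    ∃ g s, G g ∧ t = g.au 1 s ∧ t.cls = g.cls := by
  obtain ⟨g, hg, hc⟩ := h.cl t.cls
  have hb := congrFun hc 0
  have hg' := congrFun hc 1
  have hd := congrFun hc 2
  simp [cls] at hb hg' hd
  obtain ⟨b0, hb0⟩ := par0 (x := t.β - g.β) (by push_cast; rw [hb, sub_self])
  obtain ⟨a, b, c, e, f, d, h1, -, hs⟩ := h.vp (t.α - g.α) (b0 - (t.α - g.α) * g.β) (t.c - g.c)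
  have ha := congrFun hs 0
  have hb1 := congrFun hs 1
  have hc1 := congrFun hs 2
  simp at ha hb1 hc1
  have f1 := h.f2 _ hg
  have f2 := h.f2 _ h1
  simp [t20] at f2
  obtain ⟨x1, y1⟩ := par0 (x := t.α - (g.α + a)) (by push_cast; rw [ha]; ring)
  obtain ⟨x2, y2⟩ := par0 (x := b0 - b - a * g.β) (by push_cast; rw [hb1, ha]; ring)
  obtain ⟨x3, y3⟩ := par0 (x := t.γ - g.γ) (by push_cast; rw [hg']; ring)
  obtain ⟨x4, y4⟩ := par0 (x := t.δ - (g.δ + e)) (by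
    push_cast
    rw [hb, hg', hd] at f1
    linear_combination ht - f1 - f2 + ha)
  obtain ⟨x5, y5⟩ := par0 (x := t.c - (g.c + f)) (by push_cast; rw [hc1]; ring)
  obtain ⟨x6, y6⟩ := par0 (x := t.d - g.d) (by push_cast; rw [hd]; ring)
  obtain ⟨x7, y7⟩ := par0 (x := a - e) (by push_cast; linear_combination f2 - e * t20)
  refine ⟨_, ⟨x1 - g.α * a - g.β * c, x2 - b * g.α + x7 * g.β, x3 - g.γ * a - c * (1 + 2 * g.δ), x4 - g.δ * e - b * g.γ,
    x5 - f * g.α - d * g.β, x6 - f * g.γ - d * (1 + 2 * g.δ)⟩, h.mul _ _ hg h1, ?_, ?_⟩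
  · ext <;> simp only [T6.mul, au]
    · linear_combination y1
    · linear_combination hb0 + 2 * y2 + g.β * y7 * 2
    · linear_combination y3
    · linear_combination y4
    · linear_combination y5
    · linear_combination y6
  · ext i; fin_cases i <;> simp [cls, T6.mul, t20, hb, hg', hd]

/-- layers -/
def A (G : T6 → Prop) (j : ℕ) : Set (Fin 6 → ZMod 2) := {v | ∃ s, G (o.au j s) ∧ s.sig = v}

lemma A0 (j : ℕ) : 0 ∈ A G j := ⟨o, by simpa [au, o] using h.one, by ext i; fin_cases i <;> simp [sig, o]⟩
lemma Aad (j : ℕ) {x y} (hx : x ∈ A G (j + 1)) (hy : y ∈ A G (j + 1)) : x + y ∈ A G (j + 1) := by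
  obtain ⟨s, hs, rfl⟩ := hx
  obtain ⟨t, ht, rfl⟩ := hy
  refine ⟨⟨s.α + t.α + 2 * (2 ^ (j + 1) * (s.α * t.α + s.β * t.γ)), s.β + t.β + 2 * (2 ^ (j + 1) * (s.α * t.β + t.δ * s.β)),
    s.γ + t.γ + 2 * (2 ^ (j + 1) * (s.γ * t.α + t.γ * s.δ)), s.δ + t.δ + 2 * (2 ^ (j + 1) * (s.δ * t.δ + t.β * s.γ)),
    s.c + t.c + 2 * (2 ^ (j + 1) * (t.c * s.α + t.d * s.β)), s.d + t.d + 2 * (2 ^ (j + 1) * (t.c * s.γ + t.d * s.δ))⟩, ?_, ?_⟩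
  · convert h.mul _ _ hs ht using 1
    ext <;> simp only [T6.mul, au, o] <;> ring
  · ext i; fin_cases i <;> simp [sig, t20]

/-- squares of level `j` -/
lemma Asq {j : ℕ} {s : T6} (hs : G (o.au j s)) : G (o.au (j + 1) ⟨s.α + 2 ^ j * (s.α ^ 2 + s.β * s.γ), s.β + 2 ^ j * s.β * (s.α + s.δ),
    s.γ + 2 ^ j * s.γ * (s.α + s.δ), s.δ + 2 ^ j * (s.δ ^ 2 + s.β * s.γ), s.c + 2 ^ j * (s.α * s.c + s.β * s.d), s.d + 2 ^ j * (s.γ * s.c + s.δ * s.d)⟩) := by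
  convert h.mul _ _ hs hs using 1
  ext <;> simp only [T6.mul, au, o] <;> ring

lemma Asuc {j : ℕ} {v} (hv : v ∈ A G (j + 1)) : v ∈ A G (j + 2) := by
  obtain ⟨s, hs, rfl⟩ := hv
  refine ⟨_, h.Asq hs, ?_⟩
  ext i; fin_cases i <;> simp [sig, pow_succ, t20]

lemma A1g (a b g e c : ℤ) : ![(a + a + b * g : ZMod 2), b * (1 + a + e), g * (1 + a + e), e + e + b * g,
    c + a * c + b * (a + e + g), g * c + (1 + e) * (a + e + g)] ∈ A G 1 := by
  obtain ⟨x, s, hx, e1, -⟩ := h.ap1 ⟨a, 2 * b, g, e, c, a + e + g⟩ (by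
    push_cast; rw [t20]; linear_combination -g * t20)
  obtain ⟨ea, eb, eg, ee, ec, ed⟩ := T6.ext_iff.1 e1
  simp only [au, pow_one, one_add_one_eq_two, show (2 : ℤ) ^ 2 = 4 by norm_num] at ea eb eg ee ec ed
  have := h.Asq (j := 0) (s := ⟨x.α, b - 2 * s.β, x.γ, x.δ, x.c, x.d⟩) (by
    convert hx using 1
    ext <;> simp only [au, o, zero_add, pow_zero, pow_one] <;> linarith)
  refine ⟨_, this, ?_⟩
  have fa : (x.α : ZMod 2) = a := by rw [ea]; push_cast; rw [t20]; ring
  have fg : (x.γ : ZMod 2) = g := by rw [eg]; push_cast; rw [t20]; ring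
  have fe : (x.δ : ZMod 2) = e := by rw [ee]; push_cast; rw [t20]; ring
  have fc : (x.c : ZMod 2) = c := by rw [ec]; push_cast; rw [t20]; ring
  have fd : (x.d : ZMod 2) = a + e + g := by
    have := congrArg (fun z : ℤ => (z : ZMod 2)) ed
    push_cast at this; rw [this, t20]; ring
  have id : ∀ x : ZMod 2, x ^ 2 = x := by decide
  ext i; fin_cases i <;> simp [sig, t20, fa, fg, fe, fc, fd, id] <;> ring

lemma A1 (v : Fin 6 → ZMod 2) (hv : v 0 = v 3) : v ∈ A G 1 := by
  have h0 := h.A0 1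
  have ad := fun {x y} => h.Aad 0 (x := x) (y := y)
  have e1 := h.A1g 0 1 0 0 0
  have e2 := h.A1g 0 0 0 0 1
  have e3 := h.A1g 0 0 1 0 0
  have e4 := h.A1g 0 0 1 0 1
  have e5 := h.A1g 0 1 1 0 0
  have := ad (ad (ad (ad (zsm h0 e1 (v 1 + v 0)) (zsm h0 e2 (v 4 + v 2 + v 5 + v 0))) (zsm h0 e3 (v 5 + v 0))) (zsm h0 e4 (v 2 + v 5))) (zsm h0 e5 (v 0))
  convert this using 1
  clear * - hv
  revert v; decide

lemma A2 (v : Fin 6 → ZMod 2) (j : ℕ) : v ∈ A G (j + 2) := by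
  induction j with
  | succ j ih => exact h.Asuc ih
  | zero =>
    have h0 := h.A0 2
    obtain ⟨x, s, hx, e1, -⟩ := h.ap1 ⟨0, 0, 0, -1, 0, 1⟩ (by simp)
    obtain ⟨ea, eb, eg, ee, ec, ed⟩ := T6.ext_iff.1 e1
    simp only [au, pow_one, one_add_one_eq_two, show (2 : ℤ) ^ 2 = 4 by norm_num] at ea eb eg ee ec ed
    have ex : x = ⟨2 * -s.α, 4 * -s.β, 2 * -s.γ, -1 + 2 * -s.δ, 2 * -s.c, 1 + 2 * -s.d⟩ := by
      ext <;> simp only <;> linarith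
    rw [ex] at hx
    have f := h.f3' _ _ _ _ _ _ hx
    have sq : G (o.au 2 ⟨-s.α + 2 * s.α ^ 2 + 2 * s.β * s.γ, 2 * (s.β * (s.α + s.δ)), 2 * (s.γ * (s.α + s.δ)), s.δ + 2 * s.δ ^ 2 + 2 * s.β * s.γ,
        -s.c * (1 - 2 * s.α) - s.β * (1 - 2 * s.d), 2 * s.c * s.γ - s.δ * (1 - 2 * s.d)⟩) := by
      convert h.mul _ _ hx hx using 1
      ext <;> simp only [T6.mul, au, o] <;> ring
    have hm : _ ∈ A G 2 := ⟨_, sq, rfl⟩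
    simp [sig, t20] at f hm
    have h1 := h.Aad 1 (zsm h0 hm (v 0 - v 3)) (h.Asuc (j := 0) (h.A1 (fun i => v i - (v 0 - v 3) * (![(s.α : ZMod 2), 0, 0, s.δ, s.c - s.β, s.δ] i)) (by
      simp
      linear_combination (v 0 - v 3) * (-f) + (v 0 - v 3) * s.δ * t20)))
    convert h1 using 1
    ext i; simp

lemma stp {g t s : T6} {j : ℕ} (hg : G g) (ht : t = g.au j s)
    (hA : ![(s.α + g.β * s.γ : ZMod 2), s.β + g.β * s.δ, s.γ, s.δ, s.c + g.β * s.d, s.d] ∈ A G j) : ∃ g' s', G g' ∧ t = g'.au (j + 1) s' := by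
  obtain ⟨k, hk, e⟩ := hA
  have q0 := congrFun e 0
  have q1 := congrFun e 1
  have q2 := congrFun e 2
  have q3 := congrFun e 3
  have q4 := congrFun e 4
  have q5 := congrFun e 5
  simp [sig] at q0 q1 q2 q3 q4 q5
  obtain ⟨x0, y0⟩ := par0 (x := s.α - k.α * (1 + 2 * g.α) - g.β * k.γ) (by
    push_cast; rw [t20, q0, q2]; linear_combination -(g.β * s.γ : ZMod 2) * t20)
  obtain ⟨x1, y1⟩ := par0 (x := s.β - k.β * (1 + 2 * g.α) - k.δ * g.β) (by
    push_cast; rw [t20, q1, q3]; linear_combination -(g.β * s.δ : ZMod 2) * t20)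
  obtain ⟨x2, y2⟩ := par0 (x := s.γ - 2 * g.γ * k.α - k.γ * (1 + 2 * g.δ)) (by
    push_cast; rw [t20, q2]; ring)
  obtain ⟨x3, y3⟩ := par0 (x := s.δ - k.δ * (1 + 2 * g.δ) - 2 * k.β * g.γ) (by
    push_cast; rw [t20, q3]; ring)
  obtain ⟨x4, y4⟩ := par0 (x := s.c - k.c * (1 + 2 * g.α) - k.d * g.β) (by
    push_cast; rw [t20, q4, q5]; linear_combination -(g.β * s.d : ZMod 2) * t20)
  obtain ⟨x5, y5⟩ := par0 (x := s.d - 2 * k.c * g.γ - k.d * (1 + 2 * g.δ)) (by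
    push_cast; rw [t20, q5]; ring)
  refine ⟨_, ⟨x0, x1, x2, x3, x4, x5⟩, h.mul _ _ hg hk, ?_⟩
  rw [ht]
  ext <;> simp only [T6.mul, au, o]
  · linear_combination 2 ^ j * y0
  · linear_combination 2 ^ (j + 1) * y1
  · linear_combination 2 ^ j * y2
  · linear_combination 2 ^ j * y3
  · linear_combination 2 ^ j * y4
  · linear_combination 2 ^ j * y5

lemma full {t s : T6} (hs : G s) (hc : t.cls = s.cls) : G t ↔ 8 ∣ t.det - s.det := by
  refine ⟨fun ht => h.detc ht hs hc, fun h8 => ?_⟩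
  have par : (t.α + t.δ + t.β * t.γ : ZMod 2) = t.γ + t.d := by
    have f := h.f2 _ hs
    have hb := congrFun hc 0
    have hg := congrFun hc 1
    have hd := congrFun hc 2
    simp [cls] at hb hg hd
    obtain ⟨u, hu⟩ := h8
    have : ((t.α + t.δ - t.β * t.γ - (s.α + s.δ - s.β * s.γ) : ℤ) : ZMod 2) = 0 := by
      rw [ZMod.intCast_zmod_eq_zero_iff_dvd]
      refine ⟨2 * u - t.α * t.δ + s.α * s.δ, ?_⟩
      simp only [det] at hu
      push_cast
      linarith
    push_cast at this
    rw [hb, hg] at *; rw [hd]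
    linear_combination this + f
  obtain ⟨g, x, hg, e, hgc⟩ := h.ap1 t par
  have hd := dvd_sub h8 (h.detc hg hs (hgc.symm.trans hc))
  obtain ⟨g, x, hg, e⟩ : ∃ g x, G g ∧ t = g.au 2 x := by
    refine h.stp hg e (h.A1 _ ?_)
    obtain ⟨u, hu⟩ := hd
    have : ((x.α + g.β * x.γ - x.δ : ℤ) : ZMod 2) = 0 := by
      rw [ZMod.intCast_zmod_eq_zero_iff_dvd]
      rw [e] at hu
      simp only [det, au] at hu
      refine ⟨u - x.δ + g.β * x.γ - g.δ * x.α - g.α * x.δ - 2 * x.α * x.δ + x.β * g.γ + 2 * x.β * x.γ, ?_⟩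
      push_cast
      norm_num at hu
      linarith
    push_cast at this
    simpa using sub_eq_zero.1 this
  have : ∀ j, ∃ g x, G g ∧ t = g.au (j + 2) x := fun j => by
    induction j with
    | zero => exact ⟨g, x, hg, e⟩
    | succ j ih =>
      obtain ⟨g, x, hg, e⟩ := ih
      exact h.stp hg e (h.A2 _ j)
  obtain ⟨g, x, hg, e⟩ := this K
  rw [e]
  convert h.cong g ⟨2 * x.α, 2 * x.β, 2 * x.γ, 2 * x.δ, 2 * x.c, 2 * x.d⟩ hg using 1
  ext <;> simp only [au] <;> ring

end Gp
end grp
section surj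
open NumberField
variable {L : Type*} [Field L] [NumberField L]

lemma frob_sgn {p k : ℕ} (hp : p = 2 * k + 1) {P : Ideal (𝓞 L)} {σ : L ≃ₐ[ℚ] L}
    (hF : FrobAt p P σ) {x : L} {n m : ℤ} {e : ℕ} (hx : x ^ 2 = n) (hm : σ x = (-1) ^ m * x)
    (hco : IsCoprime (p : ℤ) (4 * n)) (he : (p : ℤ) ∣ n ^ k - (-1) ^ e) : (m : ZMod 2) = e := by
  obtain ⟨hP, hpP, hfr⟩ := hF
  by_contra hne
  have hint : IsIntegral ℤ x := IsIntegral.of_pow (n := 2) (by norm_num) (by rw [hx]; exact isIntegral_algebraMap (R := ℤ) (A := L) (x := n))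
  set y : 𝓞 L := ⟨x, hint⟩ with hy
  have hy2 : y ^ 2 = (n : 𝓞 L) := by
    apply RingOfIntegers.ext
    change algebraMap (𝓞 L) L _ = algebraMap (𝓞 L) L _
    rw [map_pow, map_intCast]; exact hx
  have hsy : σ • y = -(-1) ^ e * y := by
    apply RingOfIntegers.ext
    have h1 : ((σ • y : 𝓞 L) : L) = σ x := rfl
    rw [h1, hm]
    have : ((-1 : L) ^ m) = -(-1) ^ e := by
      rcases Int.even_or_odd m with h | h <;> rcases Nat.even_or_odd e with h' | h'
      · exact absurd (by rw [(ZMod.intCast_zmod_eq_zero_iff_dvd m 2).2 h.two_dvd, (ZMod.natCast_eq_zero_iff e 2).2 h'.two_dvd]) hne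
      · rw [h.neg_one_zpow, h'.neg_one_pow]; ring
      · rw [h.neg_one_zpow, h'.neg_one_pow]
      · obtain ⟨u, rfl⟩ := h
        obtain ⟨v, rfl⟩ := h'
        exact absurd (by push_cast; rw [t20]; ring) hne
    rw [this]; change _ = algebraMap (𝓞 L) L _
    rw [map_mul, map_neg, map_pow, map_neg, map_one]; rfl
  have h1 := hfr y
  have h2 : y ^ p = (n : 𝓞 L) ^ k * y := by rw [hp, pow_succ, pow_mul, hy2]
  obtain ⟨u, hu⟩ := he
  have h3 : (n : 𝓞 L) ^ k = (-1) ^ e + p * u := by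
    have : n ^ k = (-1) ^ e + p * u := by linarith
    exact_mod_cast congrArg (Int.cast : ℤ → 𝓞 L) this
  rw [hsy, h2, h3] at h1
  have h4 : (n * 4 : 𝓞 L) ∈ P := by
    have e1 : ((-1 : 𝓞 L) ^ e) * (-1) ^ e = 1 := by rw [← mul_pow]; simp
    have : (n * 4 : 𝓞 L) = (-(-1) ^ e * y - ((-1) ^ e + p * u) * y) * (-2 * (-1) ^ e * y) - p * (2 * u * y ^ 2 * (-1) ^ e) := by
      rw [← hy2]; linear_combination -4 * y ^ 2 * e1
    rw [this]
    exact P.sub_mem (P.mul_mem_right _ h1) (P.mul_mem_right _ hpP)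
  obtain ⟨s, t, hst⟩ := hco
  apply hP.ne_top
  rw [Ideal.eq_top_iff_one]
  have : (1 : 𝓞 L) = s * p + t * (n * 4) := by
    have := congrArg (Int.cast : ℤ → 𝓞 L) hst
    push_cast at this; rw [← this]; ring
  rw [this]
  exact P.add_mem (P.mul_mem_left _ hpP) (P.mul_mem_left _ h4)

variable [IsGalois ℚ L] {J : ℕ} (V : Lev L (J + 2))

lemma Lev.s17 : ((V.a - V.b) / 3) ^ 2 = 17 := by
  linear_combination (V.a + V.b - 5) / 9 * V.tri.1 - 4 / 9 * V.tri.2.1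

lemma Lev.cls_ex {p k : ℕ} (hpr : p.Prime) (hp : p = 2 * k + 1) {e1 e2 e3 : ℕ} (h1 : IsCoprime (p : ℤ) 68) (h2 : IsCoprime (p : ℤ) (-128)) (h3 : IsCoprime (p : ℤ) 32)
    (d1 : (p : ℤ) ∣ 17 ^ k - (-1) ^ e1) (d2 : (p : ℤ) ∣ (-32) ^ k - (-1) ^ e2) (d3 : (p : ℤ) ∣ 8 ^ k - (-1) ^ e3) :
    ∃ t, (∃ σ, Rp V σ t) ∧ t.cls = ![(e1 : ZMod 2), e2, e3] := by
  obtain ⟨P, σ, hF⟩ := frob_exists (L := L) p hpr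
  obtain ⟨t, ht⟩ := Rp.ex V σ
  refine ⟨t, ⟨σ, ht⟩, ?_⟩
  have q1 := frob_sgn hp hF (n := 17) (by rw [V.s17]; norm_num) ht.c17 (by norm_num; exact h1) d1
  have q2 := frob_sgn hp hF (n := -32) (by rw [V.q_sq]; norm_num) ht.cq (by norm_num; exact h2) d2
  have q3 := frob_sgn hp hF (n := 8) (by rw [V.r_sq]; norm_num) ht.cr (by norm_num; exact h3) d3
  rw [T6.cls, q1, q2, q3]

lemma Lev.gp : Gp (J + 2) (fun t => ∃ σ, Rp V σ t) where
  one := ⟨1, by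
    have h1 : ∀ C : EE L, sg (1 : L ≃ₐ[ℚ] L) C = C := fun C => by
      rcases pt_cases C with rfl | ⟨x, y, ho, rfl⟩
      · simp
      · rw [emap_pt _ ho]; rfl
    constructor <;> rw [h1] <;> simp [T6.o]⟩
  mul := fun s t ⟨σ, h⟩ ⟨τ, h'⟩ => ⟨_, h.mul h'⟩
  cong := by
    rintro g s ⟨σ, h⟩
    have oX := V.bas.oX
    have oY := V.bas.oY
    refine ⟨σ, ?_, ?_, ?_⟩ <;> simp only [T6.au]
    · rw [h.hX]; linear_combination (norm := module) (-(2 * s.α)) • oX - (2 * s.γ) • oY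
    · rw [h.hY]; linear_combination (norm := module) (-(2 * s.β)) • oX - (2 * s.δ) • oY
    · rw [h.hS]; linear_combination (norm := module) (-s.c) • oX - (s.d) • oY
  f2 := by
    rintro t ⟨σ, h⟩
    have := (ZMod.intCast_zmod_eq_zero_iff_dvd _ 2).2 h.F2'
    push_cast at this; linear_combination this
  f3 := by
    rintro a b g e c d ⟨σ, h⟩
    have := (ZMod.intCast_zmod_eq_zero_iff_dvd _ 2).2 (h.F3' (μ := 1) (ν := 1) (.inl rfl) (.inl rfl) (a := a) (b := b) (g := g) (e := e) (by simp; ring) rfl rfl (by simp; ring))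
    push_cast at this; linear_combination this
  f3' := by
    rintro a b g e c d ⟨σ, h⟩
    have := (ZMod.intCast_zmod_eq_zero_iff_dvd _ 2).2 (h.F3' (μ := 1) (ν := -1) (.inl rfl) (.inr rfl) (a := a) (b := b) (g := g) (e := e) (by simp; ring) rfl rfl (by simp; ring))
    push_cast at this; linear_combination this
  g1 := by
    simpa using V.cls_ex (p := 3) (k := 1) (e1 := 1) (e2 := 0) (e3 := 1) (by norm_num) rfl (by norm_num) (by norm_num) (by norm_num) (by norm_num) (by norm_num) (by norm_num)
  g2 := by
    simpa using V.cls_ex (p := 5) (k := 2) (e1 := 1) (e2 := 1) (e3 := 1) (by norm_num) rfl (by norm_num) (by norm_num) (by norm_num) (by norm_num) (by norm_num) (by norm_num)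
  g3 := by
    simpa using V.cls_ex (p := 7) (k := 3) (e1 := 1) (e2 := 1) (e3 := 0) (by norm_num) rfl (by norm_num) (by norm_num) (by norm_num) (by norm_num) (by norm_num) (by norm_num)

section exist
open IntermediateField
lemma lev_lift {N Q : Type*} [Field N] [NumberField N] [Field Q] [Fact ((102 : Q) ≠ 0)] (ι : N →+* Q) {K : ℕ} {a b : N} {X Y S : EE Q}
    (tri : Tri 0 (ι a) (ι b)) (hX : (2 ^ K : ℤ) • X = Q0) (hY : (2 ^ K : ℤ) • Y = pt (ι a) 0) (hS : (2 ^ (K + 1) : ℤ) • S = P0)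
    {x1 y1 x2 y2 x3 y3 : N} (h1 : X = 0 ∨ (onE (ι x1) (ι y1) ∧ X = pt (ι x1) (ι y1))) (h2 : Y = 0 ∨ (onE (ι x2) (ι y2) ∧ Y = pt (ι x2) (ι y2)))
    (h3 : S = 0 ∨ (onE (ι x3) (ι y3) ∧ S = pt (ι x3) (ι y3))) : Nonempty (Lev N K) := by
  have inj : Function.Injective ι := ι.injective
  have mo : ∀ x y, onE x y ↔ onE (ι x) (ι y) := fun x y => by
    unfold onE
    rw [← inj.eq_iff]
    rw [map_pow, map_sub, map_add, map_pow, map_mul, map_mul, map_pow, map_ofNat, map_ofNat]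
  have lift : ∀ (A : EE Q) (x y : N), (A = 0 ∨ (onE (ι x) (ι y) ∧ A = pt (ι x) (ι y))) → ∃ B, emap ι B = A := by
    rintro A x y (rfl | ⟨ho, rfl⟩)
    · exact ⟨0, map_zero _⟩
    · exact ⟨pt x y, emap_pt ι ((mo x y).2 ho)⟩
  have einj : ∀ A B, emap ι A = emap ι B → A = B := by
    intro A B h
    rcases pt_cases A with rfl | ⟨x, y, ho, rfl⟩ <;> rcases pt_cases B with rfl | ⟨x', y', ho', rfl⟩
    · rfl
    · rw [map_zero, emap_pt _ ho'] at h
      exact absurd h.symm (pt_ne ((mo _ _).1 ho'))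
    · rw [map_zero, emap_pt _ ho] at h
      exact absurd h (pt_ne ((mo _ _).1 ho))
    · rw [emap_pt _ ho, emap_pt _ ho', pt_inj ((mo _ _).1 ho) ((mo _ _).1 ho')] at h
      rw [inj h.1, inj h.2]
  obtain ⟨X', rfl⟩ := lift X _ _ h1
  obtain ⟨Y', rfl⟩ := lift Y _ _ h2
  obtain ⟨S', rfl⟩ := lift S _ _ h3
  have tri' : Tri 0 a b := by
    refine ⟨inj ?_, inj ?_, inj ?_⟩ <;> simp only [map_add, map_mul, map_neg, map_ofNat, map_zero]
    · exact tri.1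
    · exact tri.2.1
    · exact tri.2.2
  exact ⟨⟨_, _, X', Y', S', tri', einj _ _ (by rw [map_zsmul, hX, emap_Q]),
    einj _ _ (by rw [map_zsmul, hY, emap_pt ι tri'.rot.1.root, map_zero]), einj _ _ (by rw [map_zsmul, hS, emap_P])⟩⟩

lemma lev_ex (K : ℕ) : ∃ (L : Type) (_ : Field L) (_ : NumberField L), IsGalois ℚ L ∧ Nonempty (Lev L K) := by
  let Q := AlgebraicClosure ℚ
  haveI : IsGalois ℚ Q := by
    have h : @IsGalois ℚ _ Q _ (AlgebraicClosure.instAlgebra ℚ) := @IsAlgClosure.isGalois ℚ (AlgebraicClosure ℚ) _ _ (AlgebraicClosure.instAlgebra ℚ) _ _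
    convert h; exact Subsingleton.elim _ _
  haveI : Fact ((102 : Q) ≠ 0) := ⟨by norm_num⟩
  obtain ⟨a, b, tri⟩ : ∃ a b : Q, Tri 0 a b := by
    obtain ⟨r, hr⟩ := IsAlgClosed.exists_pow_nat_eq (153 : Q) (n := 2) (by norm_num)
    exact ⟨(-5 + r) / 2, (-5 - r) / 2, by ring, by linear_combination -hr / 4, by ring⟩
  have hal : ∀ (n : ℕ) (A : EE Q), ∃ B, (2 ^ n : ℤ) • B = A := by
    intro n A
    induction n with
    | zero => exact ⟨A, by simp⟩
    | succ n ih =>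
      obtain ⟨B, hB⟩ := ih
      obtain ⟨C, hC⟩ := halve tri B
      exact ⟨C, by rw [pow_succ, mul_smul, two_smul, hC, hB]⟩
  have cs : ∀ A : EE Q, ∃ x y : Q, A = 0 ∨ (onE x y ∧ A = pt x y) := fun A => by
    rcases pt_cases A with h | ⟨x, y, h⟩
    · exact ⟨0, 0, .inl h⟩
    · exact ⟨x, y, .inr h⟩
  obtain ⟨X, hX⟩ := hal K Q0
  obtain ⟨Y, hY⟩ := hal K (pt a 0)
  obtain ⟨S, hS⟩ := hal (K + 1) P0
  obtain ⟨x1, y1, h1⟩ := cs X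
  obtain ⟨x2, y2, h2⟩ := cs Y
  obtain ⟨x3, y3, h3⟩ := cs S
  let s : Set Q := {a, b, x1, y1, x2, y2, x3, y3}
  let N := FiniteGaloisIntermediateField.adjoin ℚ s
  have hs : s ⊆ N.toIntermediateField := FiniteGaloisIntermediateField.subset_adjoin ℚ s
  haveI : NumberField N.toIntermediateField := { to_charZero := inferInstance, to_finiteDimensional := inferInstance }
  refine ⟨N.toIntermediateField, inferInstance, this, N.isGalois, ?_⟩
  exact lev_lift (N := N.toIntermediateField) (Q := Q) (N.toIntermediateField.val : N.toIntermediateField →+* Q) (a := ⟨a, hs (by simp [s])⟩) (b := ⟨b, hs (by simp [s])⟩) tri hX hY hS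
    (x1 := ⟨x1, hs (by simp [s])⟩) (y1 := ⟨y1, hs (by simp [s])⟩) (x2 := ⟨x2, hs (by simp [s])⟩) (y2 := ⟨y2, hs (by simp [s])⟩)
    (x3 := ⟨x3, hs (by simp [s])⟩) (y3 := ⟨y3, hs (by simp [s])⟩) h1 h2 h3
end exist
end surj
section meas
open Function
abbrev Z2 := ℤ_[2]
noncomputable instance : MeasurableSpace Z2 := borel Z2
instance : BorelSpace Z2 := ⟨rfl⟩
noncomputable def mu : Measure Z2 := Measure.addHaarMeasure ⊤
instance : IsProbabilityMeasure mu := ⟨by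
  have := Measure.addHaarMeasure_self (K₀ := (⊤ : TopologicalSpace.PositiveCompacts Z2)); simpa [mu] using this⟩
instance : mu.IsAddHaarMeasure := by unfold mu; infer_instance

abbrev V6 := Fin 6 → Z2
noncomputable def mm : Measure V6 := Measure.pi fun _ => mu
instance : IsProbabilityMeasure mm := by unfold mm; infer_instance

lemma par (x : Z2) : (∃ y, x = 2 * y) ∨ ∃ y, x = 2 * y + 1 := by
  have h1 : x - x.zmodRepr ∈ IsLocalRing.maximalIdeal Z2 := (PadicInt.zmodRepr_spec x).2
  have h2 := (PadicInt.zmodRepr_spec x).1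
  rw [PadicInt.maximalIdeal_eq_span_p, Ideal.mem_span_singleton] at h1
  obtain ⟨y, hy⟩ := h1
  have : x.zmodRepr = 0 ∨ x.zmodRepr = 1 := by omega
  rcases this with h | h
  · left; use y; simp only [h] at hy; push_cast at hy; linear_combination hy
  · right; use y; simp only [h] at hy; push_cast at hy; linear_combination hy

lemma two_n (x : Z2) : ¬ (2 : Z2) ∣ 2 * x + 1 := by
  intro ⟨y, hy⟩
  have : IsUnit (2 : Z2) := IsUnit.of_mul_eq_one (y - x) (by linear_combination -hy)
  exact (PadicInt.prime_p (p := 2)).not_isUnit (by exact_mod_cast this)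

lemma unit_o (x : Z2) : IsUnit (2 * x + 1) := by
  by_contra h
  have := PadicInt.isUnit_iff.not.1 h
  have h1 : ‖2 * x + 1‖ < 1 := lt_of_le_of_ne (PadicInt.norm_le_one _) this
  have := (PadicInt.norm_lt_one_iff_dvd _).1 h1
  exact two_n x (by exact_mod_cast this)

lemma two0 : (2 : Z2) ≠ 0 := by norm_num

lemma mu_aff (u : Z2ˣ) (v : Z2) : MeasurePreserving (fun x : Z2 => u * x + v) mu mu :=
  (measurePreserving_add_right mu v).comp
    (AddMonoidHom.measurePreserving (f := AddMonoidHom.mulLeft (u : Z2)) (continuous_const_mul _)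
      (fun y => ⟨u⁻¹ * y, by simp⟩) rfl)

lemma mu_half : mu = (2 : ENNReal)⁻¹ • (mu.map (fun x : Z2 => 2 * x) + mu.map (fun x : Z2 => 2 * x + 1)) := by
  set n := (2 : ENNReal)⁻¹ • (mu.map (fun x : Z2 => 2 * x) + mu.map (fun x : Z2 => 2 * x + 1)) with hn
  have m0 : Measurable (fun x : Z2 => 2 * x) := by fun_prop
  have m1 : Measurable (fun x : Z2 => 2 * x + 1) := by fun_prop
  have p0 := Measure.isProbabilityMeasure_map (μ := mu) m0.aemeasurable
  have p1 := Measure.isProbabilityMeasure_map (μ := mu) m1.aemeasurable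
  have hp : IsProbabilityMeasure n := ⟨by
    simp only [hn, Measure.smul_apply, Measure.add_apply, measure_univ, smul_eq_mul, one_add_one_eq_two]
    exact ENNReal.inv_mul_cancel (by simp) (by simp)⟩
  have hi : n.IsAddLeftInvariant := ⟨fun s => by
    have ms : Measurable (fun x : Z2 => s + x) := by fun_prop
    rw [hn, Measure.map_smul, Measure.map_add _ _ ms, Measure.map_map ms m0, Measure.map_map ms m1]
    rcases par s with ⟨y, rfl⟩ | ⟨y, rfl⟩
    · conv_rhs => rw [← (mu_aff 1 y).map_eq]
      rw [Measure.map_map m0 (by fun_prop), Measure.map_map m1 (by fun_prop)]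
      congr 3 <;> (ext x; simp; ring)
    · rw [add_comm (Measure.map _ _)]
      congr 2
      · conv_rhs => rw [← (mu_aff 1 (y + 1)).map_eq]
        rw [Measure.map_map m0 (by fun_prop)]; congr 1; ext x; simp; ring
      · conv_rhs => rw [← (mu_aff 1 y).map_eq]
        rw [Measure.map_map m1 (by fun_prop)]; congr 1; ext x; simp; ring⟩
  have : n.IsAddHaarMeasure := { lt_top_of_isCompact := fun _ _ => measure_lt_top _ _
                                 open_pos := (isOpenPosMeasure_of_addLeftInvariant_of_compact univ isCompact_univ (by simp)).open_pos }
  exact Measure.isAddHaarMeasure_eq_of_isProbabilityMeasure _ _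

lemma emb {f : V6 → V6} (h : Continuous f) (hi : Injective f) : MeasurableEmbedding f :=
  (h.isClosedEmbedding hi).measurableEmbedding

lemma mm_half (i : Fin 6) : mm = (2 : ENNReal)⁻¹ • (mm.map (fun t => update t i (2 * t i)) + mm.map (fun t => update t i (2 * t i + 1))) := by
  have key : ∀ (f : Z2 → Z2), Measurable f → ∀ s : Fin 6 → Set Z2, (∀ j, MeasurableSet (s j)) →
      mm.map (fun t => update t i (f (t i))) (univ.pi s) = mu (f ⁻¹' s i) * ∏ j ∈ Finset.univ \ {i}, mu (s j) := by
    intro f hf s hs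
    rw [Measure.map_apply (by fun_prop) (.univ_pi hs)]
    have : (fun t : V6 => update t i (f (t i))) ⁻¹' univ.pi s = univ.pi (update s i (f ⁻¹' s i)) := by
      ext t
      simp only [mem_preimage, mem_univ_pi]
      refine forall_congr' fun j => ?_
      rcases eq_or_ne j i with rfl | h <;> simp [*]
    rw [this, mm, Measure.pi_pi]
    have : ∀ j, mu (update s i (f ⁻¹' s i) j) = update (fun j => mu (s j)) i (mu (f ⁻¹' s i)) j := by
      intro j; rcases eq_or_ne j i with rfl | h <;> simp [*]
    simp_rw [this]
    rw [Finset.prod_update_of_mem (Finset.mem_univ _)]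
  conv_lhs => rw [mm]
  refine (Measure.pi_eq fun s hs => ?_)
  rw [Measure.smul_apply, Measure.add_apply, key _ (by fun_prop) s hs, key (fun x => 2 * x + 1) (by fun_prop) s hs, smul_eq_mul, ← add_mul,
    ← mul_assoc, ← Finset.mul_prod_erase _ _ (Finset.mem_univ i), Finset.sdiff_singleton_eq_erase]
  congr 1
  conv_rhs => rw [mu_half]
  simp only [Measure.smul_apply, Measure.add_apply, smul_eq_mul]
  rw [Measure.map_apply (by fun_prop) (hs i), Measure.map_apply (by fun_prop) (hs i)]

/-- `S` has measure `r` -/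
def MM (S : V6 → Prop) (r : ℝ) : Prop := mm.real {t | S t} = r

lemma MM.congr {S T : V6 → Prop} {r : ℝ} (h : MM T r) (e : ∀ t, S t ↔ T t) : MM S r := by
  have : S = T := funext fun t => propext (e t)
  rwa [this]

lemma MM.split (i : Fin 6) {S S1 S2 : V6 → Prop} {r1 r2 : ℝ} (h1 : MM S1 r1) (h2 : MM S2 r2)
    (e1 : ∀ t, S (update t i (2 * t i)) ↔ S1 t) (e2 : ∀ t, S (update t i (2 * t i + 1)) ↔ S2 t) : MM S ((r1 + r2) / 2) := by
  have E : ∀ v : Z2, MeasurableEmbedding (fun t : V6 => update t i (2 * t i + v)) := by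
    refine fun v => emb (by fun_prop) fun s t h => ?_
    ext1 j
    have := congrFun h j
    rcases eq_or_ne j i with rfl | h
    · simpa [two0] using this
    · simpa [h] using this
  have E0 := E 0
  simp only [add_zero] at E0
  rw [MM, Measure.real, mm_half i, Measure.smul_apply, Measure.add_apply, E0.map_apply, (E 1).map_apply, smul_eq_mul,
    ENNReal.toReal_mul, ENNReal.toReal_add (measure_ne_top _ _) (measure_ne_top _ _)]
  simp only [preimage_ofPred_eq, e1, e2]
  rw [MM, Measure.real] at h1 h2
  rw [h1, h2]; simp; ring

lemma MM.sub (i : Fin 6) (w v : V6 → Z2) {S T : V6 → Prop} {r : ℝ} (h : MM S r)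
    (e : ∀ t, T t ↔ S (update t i ((2 * w t + 1) * t i + v t)))
    (iw : ∀ t x, w (update t i x) = w t := by simp) (iv : ∀ t x, v (update t i x) = v t := by simp)
    (cw : Continuous w := by fun_prop) (cv : Continuous v := by fun_prop) : MM T r := by
  set f : V6 → V6 := fun t => update t i ((2 * w t + 1) * t i + v t) with hf
  have E : MeasurableEmbedding f := by
    refine emb (by fun_prop) fun s t h => ?_
    have hj : ∀ j, j ≠ i → s j = t j := fun j hj => by simpa [hf, hj] using congrFun h j
    have h2 : s = update t i (s i) := by
      ext1 j; rcases eq_or_ne j i with rfl | h <;> simp [*]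
    have hi := congrFun h i
    simp only [hf, update_self] at hi
    have a1 : w s = w t := by rw [h2, iw]
    have a2 : v s = v t := by rw [h2, iv]
    rw [a1, a2, add_left_inj] at hi
    rw [h2, (unit_o _).mul_left_cancel hi, update_eq_self]
  have P : MeasurePreserving f mm mm := by
    let ε := MeasurableEquiv.piFinSuccAbove (fun _ : Fin 6 => Z2) i
    have hε : MeasurePreserving ε mm (mu.prod (Measure.pi fun _ => mu)) := measurePreserving_piFinSuccAbove _ i
    have q := MeasurePreserving.skew_product (MeasurePreserving.id (Measure.pi fun _ : Fin 5 => mu))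
      (g := fun a x => (2 * w (i.insertNth 0 a) + 1) * x + v (i.insertNth 0 a)) (μc := mu) (μd := mu)
      (by fun_prop) (Eventually.of_forall fun a => (mu_aff (unit_o (w (i.insertNth 0 a))).unit (v (i.insertNth 0 a))).map_eq)
    have := (hε.symm).comp (((Measure.measurePreserving_swap).comp (q.comp Measure.measurePreserving_swap)).comp hε)
    convert this using 1
    ext1 t
    have hu : ∀ x, i.insertNth x (i.removeNth t) = update t i x := fun x => by simp
    simp [ε, hf, MeasurableEquiv.piFinSuccAbove, Fin.insertNthEquiv, hu, iw, iv]
  have := P.measure_preimage_emb E {t | S t}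
  simp only [preimage_ofPred_eq, hf, ← e] at this
  rw [MM, Measure.real, this]; exact h

lemma MM.tru {S : V6 → Prop} (h : ∀ t, S t) : MM S 1 := by simp [MM, h]
lemma MM.fls {S : V6 → Prop} (h : ∀ t, ¬ S t) : MM S 0 := by simp [MM, h]
lemma MM.bd {S : V6 → Prop} {r : ℝ} (h : MM S r) : 0 ≤ r ∧ r ≤ 1 := h ▸ ⟨measureReal_nonneg, measureReal_le_one⟩
lemma MM.ex (S : V6 → Prop) : ∃ r, MM S r := ⟨_, rfl⟩
lemma MM.uq {S : V6 → Prop} {r s : ℝ} (h : MM S r) (h' : MM S s) : r = s := h.symm.trans h'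
end meas
section comp
open Function
lemma MM.sp (i : Fin 6) {S S1 S2 : V6 → Prop} {r1 r2 r : ℝ} (h1 : MM S1 r1) (h2 : MM S2 r2)
    (e1 : ∀ t, S (update t i (2 * t i)) ↔ S1 t) (e2 : ∀ t, S (update t i (2 * t i + 1)) ↔ S2 t)
    (e : (r1 + r2) / 2 = r := by norm_num) : MM S r := e ▸ h1.split i h2 e1 e2
lemma MM.sf (i : Fin 6) {S S1 : V6 → Prop} {r1 r : ℝ} (h1 : MM S1 r1)
    (e1 : ∀ t, S (update t i (2 * t i)) ↔ S1 t) (e2 : ∀ t, ¬ S (update t i (2 * t i + 1)))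
    (e : r1 / 2 = r := by norm_num) : MM S r :=
  MM.sp i h1 (MM.fls (S := fun _ => False) fun _ h => h) e1 (fun t => iff_false_intro (e2 t)) (by simpa using e)
lemma MM.le0 {S T : V6 → Prop} (h : MM S 0) (e : ∀ t, T t → S t) : MM T 0 :=
  le_antisymm (h ▸ measureReal_mono (fun t ht => e t ht)) measureReal_nonneg

variable {x y z w a b c : Z2}
lemma dc : 2 * x ∣ 2 * y ↔ x ∣ y := mul_dvd_mul_iff_left two0
lemma nd : ¬ 2 * x ∣ 2 * y + 1 := fun h => two_n y ((dvd_mul_right _ _).trans h)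
lemma uL : (2 * w + 1) * x ∣ y ↔ x ∣ y := (unit_o w).mul_left_dvd
lemma uR : x ∣ (2 * w + 1) * y ↔ x ∣ y := (unit_o w).dvd_mul_left
lemma u1 : 2 * w + 1 ∣ y := (unit_o w).dvd
lemma dd (q : Z2) (h : y = z + x * q) : x ∣ y ↔ x ∣ z := by rw [h]; exact dvd_add_left (dvd_mul_right _ _)
lemma d0 {g : Z2} (h : 2 * x ∣ (2 * g + 1) * x) : x = 0 := by
  obtain ⟨q, hq⟩ := h
  by_contra h0
  exact two_n g ⟨q, mul_right_cancel₀ h0 (by linear_combination hq)⟩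

lemma nul (i : Fin 6) : MM (fun t => t i = 0) 0 := by
  obtain ⟨r, h⟩ := MM.ex fun t => t i = 0
  have h' : MM (fun t => t i = 0) (r / 2) := h.sf i (fun t => by simp [two0]) fun t h => two_n (t i) (by simp at h; simp [h])
  have := h.uq h'
  convert h; linarith

lemma lf {i j : Fin 6} (h : i ≠ j) : MM (fun t => t i ∣ t j) (2 / 3) := by
  obtain ⟨r, hr⟩ := MM.ex fun t => t i ∣ t j
  have h1 : MM (fun t => 2 * t i ∣ t j) (r / 2) := hr.sf j (fun t => by simp [h, dc]) (fun t => by simpa [h] using nd)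
  have h2 : MM (fun t => t i ∣ t j) ((r / 2 + 1) / 2) :=
    h1.sp i (MM.tru (S := fun _ => True) fun _ => trivial) (fun t => by simp [h.symm]) (fun t => by simp [h.symm, u1])
  have := hr.uq h2
  convert hr; linarith
lemma lfk {i j : Fin 6} (h : i ≠ j) (k : ℕ) : MM (fun t => 2 ^ k * t i ∣ t j) (2 / 3 / 2 ^ k) := by
  induction k with
  | zero => simpa using lf h
  | succ k ih => exact ih.sf j (fun t => by simp [h, pow_succ', mul_assoc, dc]) (fun t => by simpa [h, pow_succ', mul_assoc] using nd) (by ring)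
lemma lf2 {i j : Fin 6} (h : i ≠ j) : MM (fun t => 2 * t i ∣ t j) (1 / 3) := by
  have := lfk h 1; norm_num at this; exact this

lemma MM.pw (i : Fin 6) {S : V6 → Prop} {r : ℝ} (h : MM S r) (hi : ∀ t x, S (update t i x) ↔ S t) (k : ℕ) :
    MM (fun t => S t ∧ 2 ^ k ∣ t i) (r / 2 ^ k) := by
  induction k with
  | zero => simpa using h
  | succ k ih =>
    refine ih.sf i (fun t => ?_) (fun t h => ?_) (by ring)
    · simp [hi, pow_succ', dc]
    · simp only [pow_succ', update_self] at h; exact nd h.2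
lemma MM.p4 (i : Fin 6) {S : V6 → Prop} {r : ℝ} (h : MM S r) (hi : ∀ t x, S (update t i x) ↔ S t) :
    MM (fun t => S t ∧ 4 ∣ t i) (r / 4) := by
  have := h.pw i hi 2; norm_num at this; exact this

/-- the total constraint -/
lemma Xc (f : V6 → Z2) (hf : Continuous f) (hi : ∀ t x, f (update t 0 x) = f t) :
    MM (fun t => 4 ∣ t 0 + t 3 + 2 * t 0 * t 3 - f t) (1 / 4) := by
  have h := (MM.tru (S := fun _ => True) fun _ => trivial).p4 0 (by simp)
  refine h.sub 0 (fun t => t 3) (fun t => t 3 - f t) (fun t => ?_) (by simp) (by simp [hi])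
  rw [true_and, update_self]; ring_nf

/-- success -/
def Su (α β γ δ c d : Z2) : Prop := 2 * (2 * δ * c - β * d) ∣ 2 * α * d - 2 * γ * c ∧ 2 * (2 * δ * c - β * d) ∣ 4 * α * δ - 2 * β * γ
def Xk (α β γ δ k : Z2) : Prop := 4 ∣ α + δ + 2 * α * δ - β * γ - k

variable (k : Z2)
lemma c1x1 (f : Z2 → Z2) (hf : Continuous f) : MM (fun t => Xk (t 0) (2 * t 1 + 1) (f (t 2)) (t 3) k ∧
    Su (t 0) (2 * t 1 + 1) (f (t 2)) (t 3) (t 4) (2 * t 5 + 1)) (1 / 4) := by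
  refine (Xc (fun t => (2 * t 1 + 1) * f (t 2) + k) (by fun_prop) (by simp)).congr fun t => ?_
  have : ∀ y, 2 * (2 * t 3 * t 4 - (2 * t 1 + 1) * (2 * t 5 + 1)) ∣ 2 * y := fun y => dc.2 (by
    convert (unit_o (t 3 * t 4 - 2 * t 1 * t 5 - t 1 - t 5 - 1)).dvd using 1; ring)
  simp only [Xk, Su]
  rw [and_iff_left ⟨by convert this (t 0 * (2 * t 5 + 1) - f (t 2) * t 4) using 1; ring, by
    convert this (2 * t 0 * t 3 - (2 * t 1 + 1) * f (t 2)) using 1; ring⟩]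
  ring_nf

lemma c110 : MM (fun t => Xk (t 0) (2 * t 1 + 1) (2 * t 2 + 1) (t 3) k ∧
    Su (t 0) (2 * t 1 + 1) (2 * t 2 + 1) (t 3) (t 4) (2 * t 5)) 0 := by
  refine MM.fls fun t h => ?_
  have h2 := h.2.2
  rw [show 4 * t 0 * t 3 - 2 * (2 * t 1 + 1) * (2 * t 2 + 1) = 2 * (2 * (t 0 * t 3 - 2 * t 1 * t 2 - t 1 - t 2 - 1) + 1) by ring,
    show 2 * (2 * t 3 * t 4 - (2 * t 1 + 1) * (2 * t 5)) = 2 * (2 * (t 3 * t 4 - (2 * t 1 + 1) * t 5)) by ring, dc] at h2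
  exact nd h2

lemma c100 : MM (fun t => Xk (t 0) (2 * t 1 + 1) (2 * t 2) (t 3) k ∧
    Su (t 0) (2 * t 1 + 1) (2 * t 2) (t 3) (t 4) (2 * t 5)) (1 / 6) := by
  have h0 : MM (fun t => t 5 ∣ t 2 ∧ 4 ∣ t 0) (1 / 6) := by
    convert (lf (i := 5) (j := 2) (by decide)).p4 0 (fun t x => Iff.rfl) using 1; norm_num
  have h1 : MM (fun t => t 5 ∣ t 2 ∧ 4 ∣ t 0 + t 3 + 2 * t 2 - k) (1 / 6) :=
    h0.sub 0 (fun _ => 0) (fun t => t 3 + 2 * t 2 - k) (fun t => by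
      change _ ↔ t 5 ∣ t 2 ∧ 4 ∣ _
      rw [update_self]; ring_nf)
  have h2 : MM (fun t => t 3 * t 4 - (2 * t 1 + 1) * t 5 ∣ t 2 ∧ 4 ∣ t 0 + t 3 + 2 * t 2 - k) (1 / 6) :=
    h1.sub 5 (fun t => - t 1 - 1) (fun t => t 3 * t 4) (fun t => by
      change _ ↔ _ * t 5 + _ ∣ t 2 ∧ 4 ∣ t 0 + t 3 + 2 * t 2 - k
      ring_nf)
  refine h2.sub 2 (fun t => - t 1 - 1) (fun t => t 0 * t 3) fun t => ?_
  change _ ↔ t 3 * t 4 - (2 * t 1 + 1) * t 5 ∣ _ * t 2 + _ ∧ 4 ∣ t 0 + t 3 + 2 * (_ * t 2 + _) - k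
  rw [and_comm, Su, Xk]
  refine and_congr ?_ (by ring_nf)
  set x := t 3 * t 4 - (2 * t 1 + 1) * t 5 with hx
  set y := (2 * (-t 1 - 1) + 1) * t 2 + t 0 * t 3 with hy
  rw [show 2 * (2 * t 3 * t 4 - (2 * t 1 + 1) * (2 * t 5)) = 2 * (2 * x) by rw [hx]; ring,
    show 2 * t 0 * (2 * t 5) - 2 * (2 * t 2) * t 4 = 2 * (2 * (t 0 * t 5 - t 2 * t 4)) by ring,
    show 4 * t 0 * t 3 - 2 * (2 * t 1 + 1) * (2 * t 2) = 2 * (2 * y) by rw [hy]; ring, dc, dc, dc, dc]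
  exact and_iff_right_of_imp fun h => (uR (w := t 1)).1 ((dd (z := t 4 * y) (-t 0) (by rw [hx, hy]; ring)).2 (h.mul_left _))

lemma c010 : MM (fun t => Xk (t 0) (2 * t 1) (2 * t 2 + 1) (t 3) k ∧
    Su (t 0) (2 * t 1) (2 * t 2 + 1) (t 3) (t 4) (2 * t 5)) 0 := by
  have h1 : MM (fun t => 2 * t 0 * t 5 - (2 * t 2 + 1) * t 4 = 0) 0 :=
    (nul 4).sub 4 (fun t => - t 2 - 1) (fun t => 2 * t 0 * t 5) fun t => by rw [update_self]; ring_nf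
  refine h1.le0 fun t ⟨_, h, h'⟩ => ?_
  set x := t 3 * t 4 - 2 * t 1 * t 5 with hx
  set y := t 0 * t 3 - t 1 * (2 * t 2 + 1) with hy
  set z := 2 * t 0 * t 5 - (2 * t 2 + 1) * t 4 with hz
  rw [show 2 * (2 * t 3 * t 4 - 2 * t 1 * (2 * t 5)) = 2 * (2 * x) by rw [hx]; ring] at h h'
  rw [show 2 * t 0 * (2 * t 5) - 2 * (2 * t 2 + 1) * t 4 = 2 * z by rw [hz]; ring, dc] at h
  rw [show 4 * t 0 * t 3 - 2 * (2 * t 1) * (2 * t 2 + 1) = 2 * (2 * y) by rw [hy]; ring, dc] at h'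
  have := d0 (g := t 2) (x := x) (by
    convert (h'.mul_left (t 5)).sub (h.mul_left (t 3)) using 1; rw [hx, hy, hz]; ring)
  rw [this] at h; simpa using h

lemma c011 : MM (fun t => Xk (t 0) (2 * t 1) (2 * t 2 + 1) (t 3) k ∧
    Su (t 0) (2 * t 1) (2 * t 2 + 1) (t 3) (t 4) (2 * t 5 + 1)) (1 / 12) := by
  have h0 : MM (fun t => 2 * t 1 ∣ t 0 ∧ 4 ∣ t 4) (1 / 12) := by
    convert (lf2 (i := 1) (j := 0) (by decide)).p4 4 (fun t x => Iff.rfl) using 1; norm_num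
  have h1 : MM (fun t => 2 * t 1 ∣ t 0 ∧ 4 ∣ t 0 * (1 + 2 * t 3) + (2 * t 2 + 1) * t 4 + (2 * t 5 + 1) * t 3
      - k * (2 * t 5 + 1) + 2 * (2 * t 2 + 1) * t 1) (1 / 12) :=
    h0.sub 4 (fun t => t 2) (fun t => t 0 * (1 + 2 * t 3) + (2 * t 5 + 1) * t 3
      - k * (2 * t 5 + 1) + 2 * (2 * t 2 + 1) * t 1) (fun t => by
      change _ ↔ 2 * t 1 ∣ t 0 ∧ 4 ∣ _
      rw [update_self]; ring_nf)
  have h2 : MM (fun t => 2 * t 1 ∣ t 0 * (2 * t 5 + 1) - (2 * t 2 + 1) * t 4 ∧ 4 ∣ t 0 * (2 * t 5 + 1) * (1 + 2 * t 3) - 2 * t 3 * (2 * t 2 + 1) * t 4 + (2 * t 5 + 1) * t 3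
      - k * (2 * t 5 + 1) + 2 * (2 * t 2 + 1) * t 1) (1 / 12) :=
    h1.sub 0 (fun t => t 5) (fun t => - (2 * t 2 + 1) * t 4) (fun t => by
      change _ ↔ 2 * t 1 ∣ _ * t 0 + _ ∧ 4 ∣ (_ * t 0 + _) * (1 + 2 * t 3) + (2 * t 2 + 1) * t 4 + (2 * t 5 + 1) * t 3
        - k * (2 * t 5 + 1) + 2 * (2 * t 2 + 1) * t 1
      ring_nf)
  refine h2.sub 1 (fun t => - t 5 - 1) (fun t => t 3 * t 4) fun t => ?_
  change _ ↔ 2 * (_ * t 1 + _) ∣ t 0 * (2 * t 5 + 1) - (2 * t 2 + 1) * t 4 ∧ 4 ∣ t 0 * (2 * t 5 + 1) * (1 + 2 * t 3) - 2 * t 3 * (2 * t 2 + 1) * t 4 + (2 * t 5 + 1) * t 3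
      - k * (2 * t 5 + 1) + 2 * (2 * t 2 + 1) * (_ * t 1 + _)
  rw [and_comm, Su, Xk]
  refine and_congr ?_ ((uR (w := t 5)).symm.trans (by ring_nf))
  set x := (2 * (-t 5 - 1) + 1) * t 1 + t 3 * t 4 with hx
  set z := t 0 * (2 * t 5 + 1) - (2 * t 2 + 1) * t 4 with hz
  set y := t 0 * t 3 - t 1 * (2 * t 2 + 1) with hy
  rw [show 2 * (2 * t 3 * t 4 - 2 * t 1 * (2 * t 5 + 1)) = 2 * (2 * x) by rw [hx]; ring,
    show 2 * t 0 * (2 * t 5 + 1) - 2 * (2 * t 2 + 1) * t 4 = 2 * z by rw [hz]; ring,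
    show 4 * t 0 * t 3 - 2 * (2 * t 1) * (2 * t 2 + 1) = 2 * (2 * y) by rw [hy]; ring, dc, dc, dc]
  exact and_iff_left_of_imp fun h => (uR (w := t 5)).1 ((dd (z := t 3 * z) (2 * t 2 + 1) (by rw [hx, hy, hz]; ring)).2
    (((dvd_mul_left _ _).trans h).mul_left _))

lemma c001 : MM (fun t => Xk (t 0) (2 * t 1) (2 * t 2) (t 3) k ∧
    Su (t 0) (2 * t 1) (2 * t 2) (t 3) (t 4) (2 * t 5 + 1)) (1 / 12) := by
  have h0 : MM (fun t => 2 * t 1 ∣ t 0 ∧ 4 ∣ t 3) (1 / 12) := by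
    convert (lf2 (i := 1) (j := 0) (by decide)).p4 3 (fun t x => Iff.rfl) using 1; norm_num
  have h1 : MM (fun t => 2 * t 1 ∣ t 0 ∧ 4 ∣ (t 0 + 2 * t 2 * t 4) * (1 + 2 * t 3) + (2 * t 5 + 1) * (t 3 - k)) (1 / 12) :=
    h0.sub 3 (fun t => t 5 + t 0 + 2 * t 2 * t 4) (fun t => t 0 + 2 * t 2 * t 4 - (2 * t 5 + 1) * k) (fun t => by
      change _ ↔ 2 * t 1 ∣ t 0 ∧ 4 ∣ _
      rw [update_self]; ring_nf)
  have h2 : MM (fun t => 2 * t 1 ∣ t 0 * (2 * t 5 + 1) - 2 * t 2 * t 4 ∧ 4 ∣ t 0 * (2 * t 5 + 1) * (1 + 2 * t 3) + (2 * t 5 + 1) * (t 3 - k)) (1 / 12) :=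
    h1.sub 0 (fun t => t 5) (fun t => - 2 * t 2 * t 4) (fun t => by
      change _ ↔ 2 * t 1 ∣ _ * t 0 + _ ∧ 4 ∣ (_ * t 0 + _ + 2 * t 2 * t 4) * (1 + 2 * t 3) + (2 * t 5 + 1) * (t 3 - k)
      ring_nf)
  refine h2.sub 1 (fun t => - t 5 - 1) (fun t => t 3 * t 4) fun t => ?_
  change _ ↔ 2 * (_ * t 1 + _) ∣ t 0 * (2 * t 5 + 1) - 2 * t 2 * t 4 ∧ 4 ∣ t 0 * (2 * t 5 + 1) * (1 + 2 * t 3) + (2 * t 5 + 1) * (t 3 - k)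
  rw [and_comm, Su, Xk]
  refine and_congr ?_ ((uR (w := t 5)).symm.trans (dd (-(2 * t 5 + 1) * t 1 * t 2) (by ring)))
  set x := (2 * (-t 5 - 1) + 1) * t 1 + t 3 * t 4 with hx
  set z := t 0 * (2 * t 5 + 1) - 2 * t 2 * t 4 with hz
  set y := t 0 * t 3 - 2 * t 1 * t 2 with hy
  rw [show 2 * (2 * t 3 * t 4 - 2 * t 1 * (2 * t 5 + 1)) = 2 * (2 * x) by rw [hx]; ring,
    show 2 * t 0 * (2 * t 5 + 1) - 2 * (2 * t 2) * t 4 = 2 * z by rw [hz]; ring,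
    show 4 * t 0 * t 3 - 2 * (2 * t 1) * (2 * t 2) = 2 * (2 * y) by rw [hy]; ring, dc, dc, dc]
  exact and_iff_left_of_imp fun h => (uR (w := t 5)).1 ((dd (z := t 3 * z) (2 * t 2) (by rw [hx, hy, hz]; ring)).2
    (((dvd_mul_left _ _).trans h).mul_left _))
end comp
section comp0
open Function
lemma Gk {i j l n : Fin 6} (ij : i ≠ j) (il : i ≠ l) (ni : i ≠ n) (jl : j ≠ l) (jn : j ≠ n) (ln : l ≠ n) (k : ℕ) :
    MM (fun t => 2 * t i ∣ t j ∧ 2 ^ k * t i ∣ t l * t i + t n * t j) (1 / 3 / 2 ^ k) := by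
  obtain ⟨r, h⟩ := MM.ex fun t => 2 * t i ∣ t j ∧ 2 ^ k * t i ∣ t l * t i + t n * t j
  have h1 : MM (fun t => 2 * (2 * t i) ∣ t j ∧ 2 ^ k * (2 * t i) ∣ t l * (2 * t i) + t n * t j) (r / 2) := by
    refine h.sf j (fun t => ?_) (fun t h => ?_)
    · simp only [ne_eq, ij, jl.symm, jn.symm, not_false_eq_true, update_of_ne, update_self, dc]
      rw [← dc (x := 2 ^ k * t i)]; ring_nf
    · simp only [ne_eq, ij, not_false_eq_true, update_of_ne, update_self] at h; exact nd h.1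
  have h2 : MM (fun t => 2 * (2 * t i + 1) ∣ t j ∧ 2 ^ k * (2 * t i + 1) ∣ t l * (2 * t i + 1) + t n * t j) (1 / 2 / 2 ^ k) := by
    have a1 := (MM.tru (S := fun _ => True) fun _ => trivial).pw j (by simp) 1
    have a2 := a1.pw l (fun t x => by simp [jl]) k
    rw [pow_one (2 : ℝ)] at a2
    refine a2.sub l (fun t => t i) (fun t => t n * t j) (fun t => ?_) (by simp [il]) (by simp [ln.symm, jl])
    simp only [true_and, pow_one, update_of_ne jl, update_self]
    rw [mul_comm 2 (2 * t i + 1), mul_comm (2 ^ k), uL, uL]; ring_nf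
  have h3 := h1.sp (S := fun t => 2 * t i ∣ t j ∧ 2 ^ k * t i ∣ t l * t i + t n * t j) i h2
    (fun t => by simp [ij.symm, il.symm, ni.symm]) (fun t => by simp [ij.symm, il.symm, ni.symm]) rfl
  have := h.uq h3
  convert h; rw [div_div] at *; field_simp at this ⊢; linarith

def Fp (k : ℕ) (A b g E c d : Z2) : Prop := 2 * (E * c - b * d) ∣ A * d - g * c ∧ 2 ^ k * (E * c - b * d) ∣ A * E - b * g

lemma dv2 {a b x y : Z2} (h1 : a = 2 * x) (h2 : b = 2 * y) : a ∣ b ↔ x ∣ y := by rw [h1, h2, dc]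
lemma Fp2 {k : ℕ} {A b g E c d : Z2} : Fp k A b g E (2 * c) (2 * d) ↔ Fp (k + 1) A b g E c d :=
  and_congr (dv2 (by ring) (by ring)) (by rw [pow_succ]; ring_nf)

lemma Fo (k : ℕ) : MM (fun t => Fp k (t 0) (t 1) (t 2) (t 3) (2 * t 4 + 1) (t 5)) (1 / 3 / 2 ^ k) := by
  have h := Gk (i := 3) (j := 2) (l := 0) (n := 1) (by decide) (by decide) (by decide) (by decide) (by decide) (by decide) k
  have h1 : MM (fun t => 2 * t 3 ∣ t 0 * t 5 - t 2 * (2 * t 4 + 1) ∧ 2 ^ k * t 3 ∣ t 0 * t 3 + t 1 * (t 0 * t 5 - t 2 * (2 * t 4 + 1))) (1 / 3 / 2 ^ k) :=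
    h.sub 2 (fun t => - t 4 - 1) (fun t => t 0 * t 5) fun t => by
      change _ ↔ 2 * t 3 ∣ _ * t 2 + _ ∧ 2 ^ k * t 3 ∣ t 0 * t 3 + t 1 * (_ * t 2 + _)
      ring_nf
  refine h1.sub 3 (fun t => t 4) (fun t => - t 1 * t 5) fun t => ?_
  change _ ↔ 2 * (_ * t 3 + _) ∣ t 0 * t 5 - t 2 * (2 * t 4 + 1) ∧ 2 ^ k * (_ * t 3 + _) ∣ t 0 * (_ * t 3 + _) + t 1 * (t 0 * t 5 - t 2 * (2 * t 4 + 1))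
  refine and_congr (by ring_nf) (uR (w := t 4).symm.trans (by ring_nf))

lemma Fe (k : ℕ) : MM (fun t => Fp k (t 0) (t 1) (t 2) (t 3) (2 * t 4) (2 * t 5 + 1)) (1 / 3 / 2 ^ k) := by
  have h := Gk (i := 1) (j := 0) (l := 2) (n := 3) (by decide) (by decide) (by decide) (by decide) (by decide) (by decide) k
  have h1 : MM (fun t => 2 * t 1 ∣ t 0 * (2 * t 5 + 1) - t 2 * (2 * t 4) ∧ 2 ^ k * t 1 ∣ t 2 * t 1 + t 3 * (t 0 * (2 * t 5 + 1) - t 2 * (2 * t 4))) (1 / 3 / 2 ^ k) :=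
    h.sub 0 (fun t => t 5) (fun t => - t 2 * (2 * t 4)) fun t => by
      change _ ↔ 2 * t 1 ∣ _ * t 0 + _ ∧ 2 ^ k * t 1 ∣ t 2 * t 1 + t 3 * (_ * t 0 + _)
      ring_nf
  refine h1.sub 1 (fun t => - t 5 - 1) (fun t => t 3 * (2 * t 4)) fun t => ?_
  change _ ↔ 2 * (_ * t 1 + _) ∣ t 0 * (2 * t 5 + 1) - t 2 * (2 * t 4) ∧ 2 ^ k * (_ * t 1 + _) ∣ t 2 * (_ * t 1 + _) + t 3 * (t 0 * (2 * t 5 + 1) - t 2 * (2 * t 4))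
  refine and_congr (by ring_nf) (uR (w := t 5).symm.trans (by ring_nf))

lemma Fk (k : ℕ) : MM (fun t => Fp k (t 0) (t 1) (t 2) (t 3) (t 4) (t 5)) (2 / 7 / 2 ^ k) := by
  choose f hf using fun k => MM.ex fun t => Fp k (t 0) (t 1) (t 2) (t 3) (t 4) (t 5)
  have rec1 : ∀ k, f k = 1 / 4 / 2 ^ k + f (k + 1) / 4 := fun k => by
    have h1 : MM (fun t => Fp k (t 0) (t 1) (t 2) (t 3) (2 * t 4) (t 5)) ((f (k + 1) + 1 / 3 / 2 ^ k) / 2) :=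
      (hf (k + 1)).sp 5 (Fe k) (fun t => Fp2) (fun t => Iff.rfl)
    have h2 := h1.sp (S := fun t => Fp k (t 0) (t 1) (t 2) (t 3) (t 4) (t 5)) 4 (Fo k) (fun t => Iff.rfl) (fun t => Iff.rfl) rfl
    have := (hf k).uq h2
    rw [this]; ring
  have b : ∀ n k, |f k - 2 / 7 / 2 ^ k| ≤ 2 * (1 / 4) ^ n := by
    intro n
    induction n with
    | zero =>
      intro k
      have := (hf k).bd
      have h2 : (2 / 7 / 2 ^ k : ℝ) ≤ 2 / 7 := div_le_self (by norm_num) (one_le_pow₀ (by norm_num))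
      have h3 : (0 : ℝ) ≤ 2 / 7 / 2 ^ k := by positivity
      rw [abs_le]; constructor <;> linarith
    | succ n ih =>
      intro k
      have : f k - 2 / 7 / 2 ^ k = (f (k + 1) - 2 / 7 / 2 ^ (k + 1)) / 4 := by rw [rec1 k, pow_succ]; field_simp; ring
      rw [this, abs_div, pow_succ (1 / 4 : ℝ), abs_of_pos (by norm_num : (0 : ℝ) < 4)]
      linarith [ih (k + 1)]
  have : |f k - 2 / 7 / 2 ^ k| ≤ 0 := by
    refine ge_of_tendsto' (x := atTop) (f := fun n : ℕ => 2 * (1 / 4 : ℝ) ^ n) ?_ fun n => b n k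
    simpa using (tendsto_pow_atTop_nhds_zero_of_lt_one (by norm_num : (0:ℝ) ≤ 1 / 4) (by norm_num)).const_mul 2
  convert hf k using 1
  linarith [abs_nonpos_iff.1 this]

def F1 (A b g E c d : Z2) : Prop := 2 * (E * c - b * d) ∣ A * d - g * c ∧ E * c - b * d ∣ 2 * (A * E - b * g)
lemma F12 {A b g E c d : Z2} : F1 A b g E (2 * c) (2 * d) ↔ Fp 0 A b g E c d :=
  and_congr (dv2 (by ring) (by ring)) (dv2 (by ring) rfl)
lemma mF1 : MM (fun t => F1 (t 0) (t 1) (t 2) (t 3) (t 4) (t 5)) (9 / 28) := by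
  have h0 : MM (fun t => F1 (t 0) (t 1) (t 2) (t 3) (2 * t 4) (t 5)) ((2 / 7 / 2 ^ 0 + 1 / 3 / 2 ^ 0) / 2) := by
    refine (Fk 0).sp 5 (Fe 0) (fun t => ?_) (fun t => ?_) rfl
    · exact F12
    · refine and_congr_right fun h => iff_of_true ?_ ?_
      all_goals
        have : t 3 * (2 * t 4) - t 1 * (2 * t 5 + 1) ∣ t 0 * t 3 - t 1 * t 2 := (uR (w := t 5)).1 ((dd (z := t 3 * (t 0 * (2 * t 5 + 1) - t 2 * (2 * t 4))) (t 2) (by ring)).2 (((dvd_mul_left _ _).trans h).mul_left _))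
      · exact this.mul_left 2
      · simpa using this
  refine h0.sp 4 (Fo 0) (fun t => Iff.rfl) (fun t => ?_)
  refine and_congr_right fun h => iff_of_true ?_ ?_
  all_goals
    have : t 3 * (2 * t 4 + 1) - t 1 * t 5 ∣ t 0 * t 3 - t 1 * t 2 := (uR (w := t 4)).1 ((dd (z := t 1 * (t 0 * t 5 - t 2 * (2 * t 4 + 1))) (t 0) (by ring)).2 (((dvd_mul_left _ _).trans h).mul_left _))
  · exact this.mul_left 2
  · simpa using this

def Wp (A b g E c d : Z2) : Prop := 2 * (E * c - 2 * b * d) ∣ 2 * A * d - g * c ∧ E * c - 2 * b * d ∣ 4 * (A * E - b * g)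
lemma Wp2 {A b g E c d : Z2} : Wp A b g E (2 * c) d ↔ F1 A b g E c d :=
  and_congr (dv2 (by ring) (by ring)) (dv2 (by ring) (by ring))
lemma mW : MM (fun t => Wp (t 0) (t 1) (t 2) (t 3) (t 4) (t 5)) (55 / 168) := by
  have h1 : MM (fun t => 2 * t 3 ∣ 2 * t 0 * t 5 - t 2 * (2 * t 4 + 1)) (1 / 3) :=
    (lf2 (i := 3) (j := 2) (by decide)).sub 2 (fun t => - t 4 - 1) (fun t => 2 * t 0 * t 5) fun t => by
      change _ ↔ 2 * t 3 ∣ _ * t 2 + _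
      ring_nf
  have h2 : MM (fun t => Wp (t 0) (t 1) (t 2) (t 3) (2 * t 4 + 1) (t 5)) (1 / 3) := by
    refine h1.sub 3 (fun t => t 4) (fun t => - 2 * t 1 * t 5) fun t => ?_
    change _ ↔ 2 * (_ * t 3 + _) ∣ 2 * t 0 * t 5 - t 2 * (2 * t 4 + 1)
    rw [Wp, and_iff_left_of_imp fun h => Dvd.dvd.mul_left ((uR (w := t 4)).1 ((dd (z := t 1 * (2 * t 0 * t 5 - t 2 * (2 * t 4 + 1))) (t 0) (by ring)).2 (((dvd_mul_left _ _).trans h).mul_left _))) 4]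
    ring_nf
  exact mF1.sp 4 h2 (fun t => Wp2) (fun t => Iff.rfl)
end comp0
section comp1
open Function
lemma ev {a b : Z2} (x y : Z2) (h1 : a = 2 * x) (h2 : b = 2 * y + 1) : ¬ a ∣ b := by rw [h1, h2]; exact nd
lemma ud {a b : Z2} (x : Z2) (h : a = 2 * x + 1) : a ∣ b := by rw [h]; exact u1
lemma mT : MM (fun _ => True) 1 := MM.tru fun _ => trivial
lemma mF : MM (fun _ => False) 0 := MM.fls fun _ h => h

def Rp0 (A b g E c d : Z2) : Prop := 4 * (E * c - b * d) ∣ 4 * A * d - g * c ∧ E * c - b * d ∣ 4 * A * E - b * g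
lemma Roo : MM (fun t => Rp0 (t 0) (2 * t 1 + 1) (2 * t 2 + 1) (t 3) (t 4) (t 5)) (1 / 8) := by
  have h1 : MM (fun t => Rp0 (t 0) (2 * t 1 + 1) (2 * t 2 + 1) (t 3) (2 * (2 * t 4)) (t 5)) (1 / 2) :=
    mF.sp 5 mT (fun t => iff_false_intro fun h => ev (2 * t 3 * t 4 - (2 * t 1 + 1) * t 5)
        (2 * t 0 * t 3 - 2 * t 1 * t 2 - t 1 - t 2 - 1)
        (by change _ - _ * (2 * _) = _; change t 3 * (2 * (2 * t 4)) - (2 * t 1 + 1) * _ = _; ring)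
        (by change 4 * t 0 * t 3 - (2 * t 1 + 1) * (2 * t 2 + 1) = _; ring) h.2)
      (fun t => iff_true_intro ⟨by
        change 4 * (t 3 * (2 * (2 * t 4)) - (2 * t 1 + 1) * (2 * t 5 + 1)) ∣ 4 * t 0 * (2 * t 5 + 1) - (2 * t 2 + 1) * (2 * (2 * t 4))
        rw [show 4 * t 0 * (2 * t 5 + 1) - (2 * t 2 + 1) * (2 * (2 * t 4)) = 4 * (t 0 * (2 * t 5 + 1) - (2 * t 2 + 1) * t 4) by ring]
        exact mul_dvd_mul_left _ (ud (2 * t 3 * t 4 - 2 * t 1 * t 5 - t 1 - t 5 - 1) (by ring)),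
        ud (2 * t 3 * t 4 - 2 * t 1 * t 5 - t 1 - t 5 - 1) (by
          change t 3 * (2 * (2 * t 4)) - (2 * t 1 + 1) * (2 * t 5 + 1) = _; ring)⟩)
  have h2 : MM (fun t => Rp0 (t 0) (2 * t 1 + 1) (2 * t 2 + 1) (t 3) (2 * t 4) (t 5)) (1 / 4) :=
    h1.sf 4 (fun t => Iff.rfl) (fun t h => by
      have h : 4 * (t 3 * (2 * (2 * t 4 + 1)) - (2 * t 1 + 1) * t 5) ∣ 4 * t 0 * t 5 - (2 * t 2 + 1) * (2 * (2 * t 4 + 1)) := h.1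
      rw [dv2 (x := 2 * (t 3 * (2 * (2 * t 4 + 1)) - (2 * t 1 + 1) * t 5)) (y := 2 * t 0 * t 5 - (2 * t 2 + 1) * (2 * t 4 + 1)) (by ring) (by ring)] at h
      exact ev _ (t 0 * t 5 - 2 * t 2 * t 4 - t 2 - t 4 - 1) rfl (by ring) h)
  exact h2.sf 4 (fun t => Iff.rfl) (fun t h => by
      have h : 4 * (t 3 * (2 * t 4 + 1) - (2 * t 1 + 1) * t 5) ∣ 4 * t 0 * t 5 - (2 * t 2 + 1) * (2 * t 4 + 1) := h.1
      exact ev (2 * (t 3 * (2 * t 4 + 1) - (2 * t 1 + 1) * t 5)) (2 * t 0 * t 5 - 2 * t 2 * t 4 - t 2 - t 4 - 1) (by ring) (by ring) h)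

lemma Roe1 {A b g E c d : Z2} : Rp0 A (2 * b) (2 * g + 1) E c (2 * d + 1) ↔
    8 * (2 * A * E - b * (2 * g + 1)) ∣ 4 * A * (2 * d + 1) - (2 * g + 1) * c := by
  have id : (2 * g + 1) * (E * c - 2 * b * (2 * d + 1)) = 2 * (2 * d + 1) * (2 * A * E - b * (2 * g + 1)) - E * (4 * A * (2 * d + 1) - (2 * g + 1) * c) := by ring
  rw [Rp0, show 4 * A * E - 2 * b * (2 * g + 1) = 2 * (2 * A * E - b * (2 * g + 1)) by ring]
  generalize 4 * A * (2 * d + 1) - (2 * g + 1) * c = z at *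
  generalize E * c - 2 * b * (2 * d + 1) = x at *
  generalize 2 * A * E - b * (2 * g + 1) = w at *
  constructor
  · rintro ⟨⟨q, rfl⟩, -⟩
    have h : (2 * (g + 2 * E * q) + 1) * x = (2 * d + 1) * (2 * w) := by linear_combination id
    have : 2 * w ∣ x := (uR (w := g + 2 * E * q)).1 (by rw [h]; exact dvd_mul_left _ _)
    rw [mul_assoc 4, show 8 * w = 4 * (2 * w) by ring]
    exact mul_dvd_mul_left _ (this.mul_right q)
  · rintro ⟨q, rfl⟩
    have h : (2 * g + 1) * x = (2 * (d - 2 * E * q) + 1) * (2 * w) := by linear_combination id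
    constructor
    · rw [← uL (w := g), show (2 * g + 1) * (4 * x) = 4 * ((2 * g + 1) * x) by ring, h, mul_left_comm, uL]
      exact ⟨q, by ring⟩
    · rw [← uL (w := g), h, uL]

lemma Roe0 {A b g E c d : Z2} (h : Rp0 A (2 * b) (2 * g + 1) E c (2 * d)) : 2 * A * E - b * (2 * g + 1) = 0 := by
  have id : (2 * g + 1) * (E * c - 2 * b * (2 * d)) = 2 * (2 * d) * (2 * A * E - b * (2 * g + 1)) - E * (4 * A * (2 * d) - (2 * g + 1) * c) := by ring
  rw [Rp0, show 4 * A * E - 2 * b * (2 * g + 1) = 2 * (2 * A * E - b * (2 * g + 1)) by ring] at h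
  generalize 4 * A * (2 * d) - (2 * g + 1) * c = z at *
  generalize E * c - 2 * b * (2 * d) = x at *
  generalize 2 * A * E - b * (2 * g + 1) = w at *
  obtain ⟨⟨q, rfl⟩, p, h⟩ := h
  have : x = 0 := d0 (g := g) ⟨d * p - 2 * E * q, by linear_combination id + 2 * d * h⟩
  rw [this] at h; simpa [two0] using h

lemma Roe : MM (fun t => Rp0 (t 0) (2 * t 1) (2 * t 2 + 1) (t 3) (t 4) (t 5)) (1 / 24) := by
  have h0 : MM (fun t => Rp0 (t 0) (2 * t 1) (2 * t 2 + 1) (t 3) (t 4) (2 * t 5)) 0 := by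
    have h1 : MM (fun t => 2 * t 0 * t 3 - t 1 * (2 * t 2 + 1) = 0) 0 :=
      (nul 1).sub 1 (fun t => - t 2 - 1) (fun t => 2 * t 0 * t 3) fun t => by rw [update_self]; ring_nf
    exact h1.le0 fun t h => Roe0 h
  have h1 : MM (fun t => Rp0 (t 0) (2 * t 1) (2 * t 2 + 1) (t 3) (t 4) (2 * t 5 + 1)) (1 / 12) := by
    have a := lfk (i := 1) (j := 4) (by decide) 3
    norm_num at a
    have a1 : MM (fun t => 8 * t 1 ∣ 4 * t 0 * (2 * t 5 + 1) - (2 * t 2 + 1) * t 4) (1 / 12) :=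
      a.sub 4 (fun t => - t 2 - 1) (fun t => 4 * t 0 * (2 * t 5 + 1)) fun t => by
        change _ ↔ 8 * t 1 ∣ _ * t 4 + _
        ring_nf
    refine (a1.sub 1 (fun t => - t 2 - 1) (fun t => 2 * t 0 * t 3) fun t => ?_ : MM (fun t => 8 * (2 * t 0 * t 3 - t 1 * (2 * t 2 + 1)) ∣ 4 * t 0 * (2 * t 5 + 1) - (2 * t 2 + 1) * t 4) _).congr fun t => Roe1
    change _ ↔ 8 * (_ * t 1 + _) ∣ 4 * t 0 * (2 * t 5 + 1) - (2 * t 2 + 1) * t 4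
    ring_nf
  exact h0.sp 5 h1 (fun t => Iff.rfl) (fun t => Iff.rfl)

lemma Reo1 {A b g E c d : Z2} : Rp0 A (2 * b + 1) (2 * g) E c d ↔
    2 * (E * c - (2 * b + 1) * d) ∣ (2 * A * E - (2 * b + 1) * g) * c ∧ E * c - (2 * b + 1) * d ∣ 2 * (2 * A * E - (2 * b + 1) * g) := by
  refine and_congr ?_ (by ring_nf)
  rw [dv2 (x := 2 * (E * c - (2 * b + 1) * d)) (y := 2 * A * d - g * c) (by ring) (by ring), ← uR (w := b)]
  exact dd (-A) (by ring)

/-- leaf: `x = t 5`, `w = t 2` -/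
lemma Reo : MM (fun t => Rp0 (t 0) (2 * t 1 + 1) (2 * t 2) (t 3) (t 4) (t 5)) (13 / 24) := by
  have a0 := lf (i := 5) (j := 2) (by decide)
  have a1 := lf2 (i := 5) (j := 2) (by decide)
  have a2 : MM (fun t => t 5 ∣ 2 * t 2) (5 / 6) := a0.sp 5 mT (fun t => dc) (fun t => iff_true_intro u1)
  have b1 : MM (fun t => 2 * t 5 ∣ t 2 * (2 * t 4) ∧ t 5 ∣ 2 * t 2) (3 / 4) := by
    refine a2.sp 4 a0 (fun t => ?_) (fun t => ?_)
    · refine and_iff_right_of_imp fun h => ?_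
      change 2 * t 5 ∣ t 2 * (2 * (2 * t 4))
      rw [dv2 (x := t 5) (y := 2 * t 2 * t 4) rfl (by ring)]; exact Dvd.dvd.mul_right h _
    · refine (and_iff_left_of_imp fun h => ?_).trans (?_ : _ ↔ t 5 ∣ t 2)
      all_goals try have h : 2 * t 5 ∣ t 2 * (2 * (2 * t 4 + 1)) := h
      all_goals try change 2 * t 5 ∣ t 2 * (2 * (2 * t 4 + 1)) ↔ _
      all_goals rw [dv2 (x := t 5) (y := (2 * t 4 + 1) * t 2) rfl (by ring), uR] at *
      exact h.mul_left 2
  have b2 : MM (fun t => 2 * t 5 ∣ t 2 * t 4 ∧ t 5 ∣ 2 * t 2) (13 / 24) := by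
    refine b1.sp 4 a1 (fun t => Iff.rfl) (fun t => ?_)
    change 2 * t 5 ∣ t 2 * (2 * t 4 + 1) ∧ t 5 ∣ 2 * t 2 ↔ _
    rw [mul_comm (t 2), uR]
    exact and_iff_left_of_imp fun h => ((dvd_mul_left _ _).trans h).mul_left _
  have b3 : MM (fun t => 2 * t 5 ∣ (2 * t 0 * t 3 - (2 * t 1 + 1) * t 2) * t 4 ∧ t 5 ∣ 2 * (2 * t 0 * t 3 - (2 * t 1 + 1) * t 2)) (13 / 24) :=
    b2.sub 2 (fun t => - t 1 - 1) (fun t => 2 * t 0 * t 3) fun t => by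
      change _ ↔ 2 * t 5 ∣ (_ * t 2 + _) * t 4 ∧ t 5 ∣ 2 * (_ * t 2 + _)
      ring_nf
  refine b3.sub 5 (fun t => - t 1 - 1) (fun t => t 3 * t 4) fun t => Reo1.trans ?_
  change _ ↔ 2 * (_ * t 5 + _) ∣ (2 * t 0 * t 3 - (2 * t 1 + 1) * t 2) * t 4 ∧ (_ * t 5 + _) ∣ 2 * (2 * t 0 * t 3 - (2 * t 1 + 1) * t 2)
  ring_nf

lemma Rw {A b g E c d : Z2} : Rp0 A (2 * b) (2 * g) E c d ↔ Wp A b g E c d :=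
  and_congr (dv2 (by ring) (by ring)) (by ring_nf)
lemma mR : MM (fun t => Rp0 (t 0) (t 1) (t 2) (t 3) (t 4) (t 5)) (29 / 112) := by
  have h0 : MM (fun t => Rp0 (t 0) (t 1) (2 * t 2) (t 3) (t 4) (t 5)) (73 / 168) :=
    mW.sp 1 Reo (fun t => Rw) (fun t => Iff.rfl)
  have h1 : MM (fun t => Rp0 (t 0) (t 1) (2 * t 2 + 1) (t 3) (t 4) (t 5)) (1 / 12) :=
    Roe.sp 1 Roo (fun t => Iff.rfl) (fun t => Iff.rfl)
  exact h0.sp 2 h1 (fun t => Iff.rfl) (fun t => Iff.rfl)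
end comp1
section comp2
open Function
def Rz (a b g e c d : Z2) : Prop := 2 * (e * c - b * d) ∣ 2 * (e + 2 * a) * d - g * c ∧ e * c - b * d ∣ 2 * e * (e + 2 * a) - b * g
lemma Rzo1 {a b g e c d : Z2} : Rz a (2 * b + 1) g e c d ↔
    2 * (e * c - (2 * b + 1) * d) ∣ (2 * e * (e + 2 * a) - (2 * b + 1) * g) * c ∧
      e * c - (2 * b + 1) * d ∣ 2 * e * (e + 2 * a) - (2 * b + 1) * g := by
  refine and_congr ?_ Iff.rfl
  rw [← uR (w := b)]
  exact dd (-(e + 2 * a)) (by ring)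
lemma Rzo : MM (fun t => Rz (t 0) (2 * t 1 + 1) (t 2) (t 3) (t 4) (t 5)) (1 / 2) := by
  have a0 := lf (i := 5) (j := 2) (by decide)
  have a1 := lf2 (i := 5) (j := 2) (by decide)
  have b2 : MM (fun t => 2 * t 5 ∣ t 2 * t 4 ∧ t 5 ∣ t 2) (1 / 2) := by
    refine a0.sp 4 a1 (fun t => ?_) (fun t => ?_)
    · refine and_iff_right_of_imp fun h => ?_
      change 2 * t 5 ∣ t 2 * (2 * t 4)
      rw [dv2 (x := t 5) (y := t 2 * t 4) rfl (by ring)]; exact Dvd.dvd.mul_right h _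
    · change 2 * t 5 ∣ t 2 * (2 * t 4 + 1) ∧ t 5 ∣ t 2 ↔ _
      rw [mul_comm (t 2), uR]
      exact and_iff_left_of_imp fun h => ((dvd_mul_left _ _).trans h)
  have b3 : MM (fun t => 2 * t 5 ∣ (2 * t 3 * (t 3 + 2 * t 0) - (2 * t 1 + 1) * t 2) * t 4 ∧ t 5 ∣ 2 * t 3 * (t 3 + 2 * t 0) - (2 * t 1 + 1) * t 2) (1 / 2) :=
    b2.sub 2 (fun t => - t 1 - 1) (fun t => 2 * t 3 * (t 3 + 2 * t 0)) fun t => by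
      change _ ↔ 2 * t 5 ∣ (_ * t 2 + _) * t 4 ∧ t 5 ∣ (_ * t 2 + _)
      ring_nf
  refine b3.sub 5 (fun t => - t 1 - 1) (fun t => t 3 * t 4) fun t => Rzo1.trans ?_
  change _ ↔ 2 * (_ * t 5 + _) ∣ (2 * t 3 * (t 3 + 2 * t 0) - (2 * t 1 + 1) * t 2) * t 4 ∧ (_ * t 5 + _) ∣ 2 * t 3 * (t 3 + 2 * t 0) - (2 * t 1 + 1) * t 2
  ring_nf

def Re (x w d g : Z2) : Prop := x ∣ 2 * w ∧ 2 * x ∣ 2 * d * w - g * x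
lemma Rze1 {a b g e c d : Z2} : Rz a (2 * b) g (2 * e + 1) c d ↔
    Re ((2 * e + 1) * c - 2 * b * d) ((2 * e + 1) * (2 * e + 1 + 2 * a) - b * g) d g := by
  rw [Rz, and_comm]
  refine and_congr (by ring_nf) ?_
  rw [← uR (w := e)]
  ring_nf
lemma Ree : MM (fun t => Re (t 4) ((2 * t 3 + 1) * (2 * t 3 + 1 + 2 * t 0) - t 1 * (2 * t 2)) (t 5) (2 * t 2)) (5 / 8) := by
  have hh : ∀ x w d g : Z2, Re x (2 * w + 1) d (2 * g) ↔ x ∣ 2 ∧ x ∣ d := fun x w d g => by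
    refine and_congr ?_ ?_
    · rw [mul_comm, uR]
    · rw [dv2 (x := x) (y := (2 * w + 1) * d - g * x) rfl (by ring), ← uR (w := w)  (y := d)]
      exact dd (-g) (by ring)
  have h0 : MM (fun t => 2 ∣ t 5) (1 / 2) := mT.sf 5 (fun t => iff_true_intro (dvd_mul_right _ _)) fun t h => two_n _ h
  have h1 : MM (fun t => t 4 ∣ 1 ∧ 2 * t 4 ∣ t 5) (1 / 4) := by
    refine mF.sp 4 h0 (fun t => iff_false_intro fun h => ?_) fun t => ?_
    · exact nd (y := 0) (x := t 4) (by simpa using h.1)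
    · change _ ∧ 2 * (2 * t 4 + 1) ∣ t 5 ↔ _
      rw [mul_comm 2 (2 * t 4 + 1), uL]; exact and_iff_right u1
  have h2 : MM (fun t => t 4 ∣ 2 ∧ t 4 ∣ t 5) (5 / 8) :=
    h1.sp 4 mT (fun t => and_congr (dv2 rfl (by ring)) Iff.rfl) (fun t => iff_true_intro ⟨u1, u1⟩)
  refine h2.congr fun t => ?_
  rw [← hh _ (2 * t 3 ^ 2 + 2 * t 3 + (2 * t 3 + 1) * t 0 - t 1 * t 2) _ (t 2)]
  ring_nf
lemma Rx1 {x w d g : Z2} : Re x w (2 * d + 1) (2 * g + 1) ↔ x ∣ 2 * w ∧ 2 * w ∣ x := by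
  refine and_congr_right fun h => ⟨fun ⟨q, hq⟩ => ?_, fun ⟨q, hq⟩ => ?_⟩
  · rw [← uR (w := g + q)]; exact ⟨2 * d + 1, by linear_combination -hq⟩
  · rcases eq_or_ne x 0 with rfl | h0
    · rw [zero_dvd_iff] at h; exact ⟨0, by linear_combination (2 * d + 1) * h⟩
    obtain ⟨u, hu⟩ := h
    rw [hu] at hq
    have : 1 = u * q := mul_left_cancel₀ h0 (by linear_combination hq)
    rcases par u with ⟨v, rfl⟩ | ⟨v, rfl⟩
    · exact (two_n 0 ⟨v * q, by linear_combination this⟩).elim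
    · exact ⟨2 * d * v + d + v - g, by linear_combination (2 * d + 1) * hu⟩
lemma asc : MM (fun t => t 4 ∣ t 1 ∧ t 1 ∣ t 4) (1 / 3) := by
  obtain ⟨r, hr⟩ := MM.ex fun t => t 4 ∣ t 1 ∧ t 1 ∣ t 4
  have h1 : MM (fun t => 2 * t 4 ∣ t 1 ∧ t 1 ∣ 2 * t 4) (r / 2) := hr.sf 1 (fun t => and_congr dc dc) fun t h => nd h.1
  have h2 : MM (fun t => 2 * t 4 + 1 ∣ t 1 ∧ t 1 ∣ 2 * t 4 + 1) (1 / 2) :=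
    mF.sp 1 mT (fun t => iff_false_intro fun h => nd h.2) fun t => iff_true_intro ⟨u1, u1⟩
  have := hr.uq (h1.sp 4 h2 (fun t => Iff.rfl) (fun t => Iff.rfl) rfl)
  convert hr; linarith
lemma Reo2 : MM (fun t => Re (t 4) (t 1) (t 5) (2 * t 2 + 1)) (1 / 12) := by
  have h1 : MM (fun t => t 4 ∣ 2 * t 1 ∧ 2 * t 1 ∣ t 4) (1 / 6) := asc.sf 4 (fun t => and_congr dc dc) fun t h => nd h.2
  refine ((nul 4).le0 (T := fun t => Re (t 4) (t 1) (2 * t 5) (2 * t 2 + 1)) fun t h => ?_).sp 5 h1 (fun t => Iff.rfl) (fun t => Rx1)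
  obtain ⟨⟨p, h⟩, q, h'⟩ := h
  exact d0 (g := t 2) ⟨t 5 * p - q, by linear_combination -h' + 2 * t 5 * h⟩
lemma Reo3 : MM (fun t => Re (t 4) ((2 * t 3 + 1) * (2 * t 3 + 1 + 2 * t 0) - t 1 * (2 * t 2 + 1)) (t 5) (2 * t 2 + 1)) (1 / 12) :=
  Reo2.sub 1 (fun t => - t 2 - 1) (fun t => (2 * t 3 + 1) * (2 * t 3 + 1 + 2 * t 0)) fun t => by
    change _ ↔ Re (t 4) (_ * t 1 + _) (t 5) (2 * t 2 + 1)
    ring_nf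
lemma Rze : MM (fun t => Rz (t 0) (2 * t 1) (t 2) (2 * t 3 + 1) (t 4) (t 5)) (17 / 48) := by
  have h : MM (fun t => Re (t 4) ((2 * t 3 + 1) * (2 * t 3 + 1 + 2 * t 0) - t 1 * t 2) (t 5) (t 2)) (17 / 48) :=
    Ree.sp 2 Reo3 (fun t => Iff.rfl) (fun t => Iff.rfl)
  refine h.sub 4 (fun t => t 3) (fun t => - 2 * t 1 * t 5) fun t => Rze1.trans ?_
  change _ ↔ Re (_ * t 4 + _) ((2 * t 3 + 1) * (2 * t 3 + 1 + 2 * t 0) - t 1 * t 2) (t 5) (t 2)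
  ring_nf
lemma Rzz : MM (fun t => Rz (t 0) (2 * t 1) (t 2) (2 * t 3) (t 4) (t 5)) (29 / 112) :=
  mR.sub 0 (fun _ => 0) (fun t => t 3) fun t => by
    change _ ↔ Rp0 (_ * t 0 + _) (t 1) (t 2) (t 3) (t 4) (t 5)
    exact and_congr (by ring_nf) (dv2 (by ring) (by ring))
lemma mRz : MM (fun t => Rz (t 0) (t 1) (t 2) (t 3) (t 4) (t 5)) (271 / 672) :=
  MM.sp (r1 := 103 / 336) 1 (Rzz.sp 3 Rze (fun t => Iff.rfl) (fun t => Iff.rfl)) Rzo (fun t => Iff.rfl) (fun t => Iff.rfl)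

def Qp (a b g δ c d : Z2) : Prop := δ * c - 2 * b * d ∣ (δ + 4 * a) * d - g * c ∧ δ * c - 2 * b * d ∣ (δ + 4 * a) * δ - 2 * b * g
lemma mQ : MM (fun t => Qp (t 0) (t 1) (t 2) (t 3) (t 4) (t 5)) (607 / 1344) := by
  have h1 : MM (fun t => Qp (t 0) (t 1) (t 2) (2 * t 3 + 1) (t 4) (t 5)) (1 / 2) := by
    refine mF.sp 4 mT (fun t => iff_false_intro fun h => ?_) (fun t => iff_true_intro ?_)
    · exact ev ((2 * t 3 + 1) * t 4 - t 1 * t 5) (2 * t 3 ^ 2 + 2 * t 3 + 2 * t 0 * (2 * t 3 + 1) - t 1 * t 2) (by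
        change (2 * t 3 + 1) * (2 * t 4) - 2 * t 1 * t 5 = _; ring) (by
        change (2 * t 3 + 1 + 4 * t 0) * (2 * t 3 + 1) - 2 * t 1 * t 2 = _; ring) h.2
    · have : (2 * t 3 + 1) * (2 * t 4 + 1) - 2 * t 1 * t 5 = 2 * (2 * t 3 * t 4 + t 3 + t 4 - t 1 * t 5) + 1 := by ring
      exact ⟨ud _ this, ud _ this⟩
  exact mRz.sp 3 h1 (fun t => and_congr (by
    change 2 * t 3 * t 4 - 2 * t 1 * t 5 ∣ (2 * t 3 + 4 * t 0) * t 5 - t 2 * t 4 ↔ _; ring_nf) (by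
    change 2 * t 3 * t 4 - 2 * t 1 * t 5 ∣ (2 * t 3 + 4 * t 0) * (2 * t 3) - 2 * t 1 * t 2 ↔ _; exact dv2 (by ring) (by ring))) (fun t => Iff.rfl)

lemma c000 : MM (fun t => Xk (t 0) (2 * t 1) (2 * t 2) (t 3) 0 ∧
    Su (t 0) (2 * t 1) (2 * t 2) (t 3) (t 4) (2 * t 5)) (607 / 5376) := by
  have h1 : MM (fun t => 4 ∣ 2 * t 0 ∧ Su (t 3 + 2 * t 0) (2 * t 1) (2 * t 2) (t 3) (t 4) (2 * t 5)) (607 / 2688) := by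
    refine mQ.sf 0 (fun t => ?_) (fun t h => nd (x := 1) (y := t 0) ?_) (by norm_num)
    · change 4 ∣ 2 * (2 * t 0) ∧ Su (t 3 + 2 * (2 * t 0)) (2 * t 1) (2 * t 2) (t 3) (t 4) (2 * t 5) ↔ _
      rw [and_iff_right ⟨t 0, by ring⟩]
      exact and_congr ((dv2 (y := 2 * ((t 3 + 4 * t 0) * t 5 - t 2 * t 4)) rfl (by ring)).trans (dv2 (by ring) (by ring))) ((dv2 (y := 2 * ((t 3 + 4 * t 0) * t 3 - 2 * t 1 * t 2)) rfl (by ring)).trans (dv2 (by ring) (by ring)))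
    · have := h.1; change 4 ∣ 2 * (2 * t 0 + 1) at this
      rw [dv2 (a := 4) (x := 2 * 1) (by norm_num) rfl] at this; exact this
  have h2 : MM (fun t => 4 ∣ t 0 ∧ Su (t 3 + t 0) (2 * t 1) (2 * t 2) (t 3) (t 4) (2 * t 5)) (607 / 5376) := by
    refine h1.sf 0 (fun t => Iff.rfl) (fun t h => nd (x := 2) (y := t 0) ?_) (by norm_num)
    have := h.1; change 4 ∣ 2 * t 0 + 1 at this; convert this using 1; norm_num
  refine h2.sub 0 (fun _ => 0) (fun t => - t 3) fun t => ?_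
  change _ ↔ 4 ∣ (_ * t 0 + _) ∧ Su (t 3 + (_ * t 0 + _)) (2 * t 1) (2 * t 2) (t 3) (t 4) (2 * t 5)
  refine and_congr ?_ (by ring_nf)
  have h4 : ∀ x y q : Z2, x = y + 4 * q → (4 ∣ x ↔ 4 ∣ y) := fun x y q h => dd q h
  rcases par (t 3) with ⟨y, h⟩ | ⟨y, h⟩ <;> rw [h, Xk]
  · exact h4 _ _ (y + t 0 * y - t 1 * t 2) (by ring)
  · rw [← uR (w := 1)]
    exact (h4 _ _ (t 0 * y * 3+ 2 * t 0 + 2 * y - 3 * t 1 * t 2 + 1) (by ring))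
end comp2
section comp3
open Function
lemma ip (x : Z2) : ((2 : Z2) ∣ 2 * x) = True := by simp
lemma iq (x : Z2) : ((2 : Z2) ∣ 2 * x + 1) = False := by simp [two_n]
variable (k : Prop → Prop → Prop → Z2)
def Xf (t : V6) : Prop := Xk (t 0) (t 1) (t 2) (t 3) (k (2 ∣ t 1) (2 ∣ t 2) (2 ∣ t 5))
def Sf (t : V6) : Prop := Su (t 0) (t 1) (t 2) (t 3) (t 4) (t 5)
noncomputable def Df (t : V6) : Z2 := 4 * t 0 * t 3 - 2 * t 1 * t 2

lemma X8 (P : V6 → Prop) {r1 r2 r3 r4 r5 r6 r7 r8 r : ℝ}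
    (h1 : MM (fun t => Xk (t 0) (2 * t 1) (2 * t 2) (t 3) (k True True True) ∧ P ![t 0, 2 * t 1, 2 * t 2, t 3, t 4, 2 * t 5]) r1)
    (h2 : MM (fun t => Xk (t 0) (2 * t 1) (2 * t 2) (t 3) (k True True False) ∧ P ![t 0, 2 * t 1, 2 * t 2, t 3, t 4, 2 * t 5 + 1]) r2)
    (h3 : MM (fun t => Xk (t 0) (2 * t 1) (2 * t 2 + 1) (t 3) (k True False True) ∧ P ![t 0, 2 * t 1, 2 * t 2 + 1, t 3, t 4, 2 * t 5]) r3)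
    (h4 : MM (fun t => Xk (t 0) (2 * t 1) (2 * t 2 + 1) (t 3) (k True False False) ∧ P ![t 0, 2 * t 1, 2 * t 2 + 1, t 3, t 4, 2 * t 5 + 1]) r4)
    (h5 : MM (fun t => Xk (t 0) (2 * t 1 + 1) (2 * t 2) (t 3) (k False True True) ∧ P ![t 0, 2 * t 1 + 1, 2 * t 2, t 3, t 4, 2 * t 5]) r5)
    (h6 : MM (fun t => Xk (t 0) (2 * t 1 + 1) (2 * t 2) (t 3) (k False True False) ∧ P ![t 0, 2 * t 1 + 1, 2 * t 2, t 3, t 4, 2 * t 5 + 1]) r6)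
    (h7 : MM (fun t => Xk (t 0) (2 * t 1 + 1) (2 * t 2 + 1) (t 3) (k False False True) ∧ P ![t 0, 2 * t 1 + 1, 2 * t 2 + 1, t 3, t 4, 2 * t 5]) r7)
    (h8 : MM (fun t => Xk (t 0) (2 * t 1 + 1) (2 * t 2 + 1) (t 3) (k False False False) ∧ P ![t 0, 2 * t 1 + 1, 2 * t 2 + 1, t 3, t 4, 2 * t 5 + 1]) r8)
    (hr : (r1 + r2 + r3 + r4 + r5 + r6 + r7 + r8) / 8 = r) : MM (fun t => Xf k t ∧ P t) r := by
  have key : ∀ x y z : V6 → Z2, ∀ t : V6, (Xf k (![t 0, x t, y t, t 3, t 4, z t]) ∧ P ![t 0, x t, y t, t 3, t 4, z t]) ↔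
      (Xk (t 0) (x t) (y t) (t 3) (k (2 ∣ x t) (2 ∣ y t) (2 ∣ z t)) ∧ P ![t 0, x t, y t, t 3, t 4, z t]) := fun x y z t => Iff.rfl
  have e : ∀ x y z : V6 → Z2, ∀ (p q r : Prop) (s : ℝ), MM (fun t => Xk (t 0) (x t) (y t) (t 3) (k p q r) ∧ P ![t 0, x t, y t, t 3, t 4, z t]) s →
      (∀ t, (2 ∣ x t) = p) → (∀ t, (2 ∣ y t) = q) → (∀ t, (2 ∣ z t) = r) → MM (fun t => Xf k (![t 0, x t, y t, t 3, t 4, z t]) ∧ P ![t 0, x t, y t, t 3, t 4, z t]) s :=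
    fun x y z p q r s h h1 h2 h3 => h.congr fun t => by rw [key, h1, h2, h3]
  have ex : ∀ (t : V6) (a b c d e f : Z2), t 0 = a → t 1 = b → t 2 = c → t 3 = d → t 4 = e → t 5 = f → t = ![a, b, c, d, e, f] := by
    intro t a b c d e f h0 h1 h2 h3 h4 h5
    ext1 i; fin_cases i <;> assumption
  have m1 := (e _ _ _ _ _ _ _ h1 (fun t => ip _) (fun t => ip _) (fun t => ip _)).sp 5 (e _ _ _ _ _ _ _ h2 (fun t => ip _) (fun t => ip _) (fun t => iq _))
    (S := fun t => Xf k (![t 0, 2 * t 1, 2 * t 2, t 3, t 4, t 5]) ∧ P ![t 0, 2 * t 1, 2 * t 2, t 3, t 4, t 5]) (fun t => Iff.rfl) (fun t => Iff.rfl) rfl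
  have m2 := (e _ _ _ _ _ _ _ h3 (fun t => ip _) (fun t => iq _) (fun t => ip _)).sp 5 (e _ _ _ _ _ _ _ h4 (fun t => ip _) (fun t => iq _) (fun t => iq _))
    (S := fun t => Xf k (![t 0, 2 * t 1, 2 * t 2 + 1, t 3, t 4, t 5]) ∧ P ![t 0, 2 * t 1, 2 * t 2 + 1, t 3, t 4, t 5]) (fun t => Iff.rfl) (fun t => Iff.rfl) rfl
  have m3 := (e _ _ _ _ _ _ _ h5 (fun t => iq _) (fun t => ip _) (fun t => ip _)).sp 5 (e _ _ _ _ _ _ _ h6 (fun t => iq _) (fun t => ip _) (fun t => iq _))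
    (S := fun t => Xf k (![t 0, 2 * t 1 + 1, 2 * t 2, t 3, t 4, t 5]) ∧ P ![t 0, 2 * t 1 + 1, 2 * t 2, t 3, t 4, t 5]) (fun t => Iff.rfl) (fun t => Iff.rfl) rfl
  have m4 := (e _ _ _ _ _ _ _ h7 (fun t => iq _) (fun t => iq _) (fun t => ip _)).sp 5 (e _ _ _ _ _ _ _ h8 (fun t => iq _) (fun t => iq _) (fun t => iq _))
    (S := fun t => Xf k (![t 0, 2 * t 1 + 1, 2 * t 2 + 1, t 3, t 4, t 5]) ∧ P ![t 0, 2 * t 1 + 1, 2 * t 2 + 1, t 3, t 4, t 5]) (fun t => Iff.rfl) (fun t => Iff.rfl) rfl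
  have n1 := m1.sp 2 m2 (S := fun t => Xf k (![t 0, 2 * t 1, t 2, t 3, t 4, t 5]) ∧ P ![t 0, 2 * t 1, t 2, t 3, t 4, t 5]) (fun t => Iff.rfl) (fun t => Iff.rfl) rfl
  have n2 := m3.sp 2 m4 (S := fun t => Xf k (![t 0, 2 * t 1 + 1, t 2, t 3, t 4, t 5]) ∧ P ![t 0, 2 * t 1 + 1, t 2, t 3, t 4, t 5]) (fun t => Iff.rfl) (fun t => Iff.rfl) rfl
  refine (n1.sp 1 n2 (S := fun t => Xf k (![t 0, t 1, t 2, t 3, t 4, t 5]) ∧ P ![t 0, t 1, t 2, t 3, t 4, t 5]) (fun t => Iff.rfl) (fun t => Iff.rfl) (by rw [← hr]; ring)).congr fun t => ?_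
  rw [← ex t _ _ _ _ _ _ rfl rfl rfl rfl rfl rfl]

lemma cX : MM (Xf k) (1 / 4) := by
  have : ∀ (b g : Z2 → Z2) (hb : Continuous b) (hg : Continuous g) (k : Z2), MM (fun t => Xk (t 0) (b (t 1)) (g (t 2)) (t 3) k ∧ True) (1 / 4) := by
    intro b g hb hg k
    refine (Xc (fun t => b (t 1) * g (t 2) + k) (by fun_prop) (by simp)).congr fun t => ?_
    rw [Xk, and_true]; ring_nf
  refine (X8 k (fun _ => True) (this (2 * ·) (2 * ·) ?_ ?_ _) (this (2 * ·) (2 * ·) ?_ ?_ _) (this (2 * ·) (2 * · + 1) ?_ ?_ _) (this (2 * ·) (2 * · + 1) ?_ ?_ _)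
    (this (2 * · + 1) (2 * ·) ?_ ?_ _) (this (2 * · + 1) (2 * ·) ?_ ?_ _) (this (2 * · + 1) (2 * · + 1) ?_ ?_ _) (this (2 * · + 1) (2 * · + 1) ?_ ?_ _) (by norm_num)).congr
    fun t => (and_true _).symm.to_iff
  all_goals fun_prop
lemma cS (h : k True True True = 0) : MM (fun t => Xf k t ∧ Sf t) (5087 / 43008) :=
  X8 k Sf (by rw [h]; exact c000) (c001 _) (c010 _) (c011 _) (c100 _) (c1x1 _ (2 * ·) (by fun_prop)) (c110 _) (c1x1 _ (2 * · + 1) (by fun_prop)) (by norm_num)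

lemma dvd_nm {x y : Z2} : x ∣ y ↔ ‖y‖ ≤ ‖x‖ := by
  constructor
  · rintro ⟨z, rfl⟩; rw [norm_mul]; exact mul_le_of_le_one_right (norm_nonneg _) (PadicInt.norm_le_one _)
  · intro h
    rcases ValuationRing.dvd_total x y with h' | ⟨z, rfl⟩
    · exact h'
    rcases eq_or_ne y 0 with rfl | h0
    · simp
    rw [norm_mul, le_mul_iff_one_le_right (norm_pos_iff.2 h0)] at h
    exact (PadicInt.isUnit_iff.2 (le_antisymm (PadicInt.norm_le_one _) h)).mul_right_dvd.2 dvd_rfl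
lemma cld {f g : V6 → Z2} (hf : Continuous f) (hg : Continuous g) : IsClosed {t | f t ∣ g t} := by
  simp only [dvd_nm]; exact isClosed_le (by fun_prop) (by fun_prop)

lemma n0 : MM (fun t => t 0 * t 3 = t 1 * t 2) 0 := by
  obtain ⟨r, h⟩ := MM.ex fun t => t 0 * t 3 = t 1 * t 2
  have h1 : MM (fun t => 2 * t 0 * t 3 = (2 * t 1 + 1) * t 2) 0 :=
    (nul 2).sub 2 (fun t => t 1) (fun t => - 2 * t 0 * t 3) fun t => by
      rw [update_self, ← sub_eq_zero (a := 2 * t 0 * t 3), ← neg_eq_zero]; ring_nf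
  have h2 : MM (fun t => (2 * t 0 + 1) * t 3 = t 1 * t 2) 0 :=
    (nul 3).sub 3 (fun t => t 0) (fun t => - t 1 * t 2) fun t => by
      rw [update_self, ← sub_eq_zero (a := (2 * t 0 + 1) * t 3)]; ring_nf
  have h3 : MM (fun t => 2 * t 0 * t 3 = t 1 * t 2) (r / 2) := h.sp 1 h1 (fun t => by
    change 2 * t 0 * t 3 = 2 * t 1 * t 2 ↔ _
    rw [mul_assoc, mul_assoc, mul_right_inj' two0]) (fun t => Iff.rfl) (by ring)
  have := h.uq (h3.sp 0 h2 (fun t => Iff.rfl) (fun t => Iff.rfl) rfl)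
  convert h; linarith
lemma nD : MM (fun t => Df t = 0) 0 := by
  have h1 : MM (fun t => 4 * t 0 * t 3 - 2 * (2 * t 1 + 1) * t 2 = 0) 0 :=
    (nul 2).sub 2 (fun t => - t 1 - 1) (fun t => 2 * t 0 * t 3) fun t => by
      rw [update_self, show 4 * t 0 * t 3 - 2 * (2 * t 1 + 1) * t 2 = 2 * ((2 * (-t 1 - 1) + 1) * t 2 + 2 * t 0 * t 3) by ring, mul_eq_zero, or_iff_right two0]
  refine n0.sp 1 h1 (fun t => ?_) (fun t => Iff.rfl)
  change 4 * t 0 * t 3 - 2 * (2 * t 1) * t 2 = 0 ↔ _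
  rw [show 4 * t 0 * t 3 - 2 * (2 * t 1) * t 2 = 4 * (t 0 * t 3 - t 1 * t 2) by ring, mul_eq_zero, or_iff_right (by norm_num), sub_eq_zero]

lemma tl : Tendsto (fun K : ℕ => mm.real {t | 2 ^ K ∣ Df t}) atTop (𝓝 0) := by
  have hm : ∀ K : ℕ, MeasurableSet {t | 2 ^ K ∣ Df t} := fun K => (cld (by fun_prop) (by unfold Df; fun_prop)).measurableSet
  have h := tendsto_measure_iInter_atTop (μ := mm) (s := fun K : ℕ => {t | 2 ^ K ∣ Df t}) (fun K => (hm K).nullMeasurableSet)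
    (fun a b hab t ht => (pow_dvd_pow 2 hab).trans ht) ⟨0, measure_ne_top _ _⟩
  have e : (⋂ K : ℕ, {t | (2 : Z2) ^ K ∣ Df t}) = {t | Df t = 0} := by
    ext t
    rw [mem_iInter]
    refine ⟨fun h => ?_, fun h K => by change 2 ^ K ∣ Df t; rw [show Df t = 0 from h]; exact dvd_zero _⟩
    change Df t = 0
    rw [← norm_le_zero_iff]
    refine ge_of_tendsto' (tendsto_pow_atTop_nhds_zero_of_lt_one (r := ((1:ℝ)/2)) (by norm_num) (by norm_num)) fun K => ?_
    have := dvd_nm.1 (h K)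
    rw [norm_pow] at this
    have h2 := PadicInt.norm_p (p := 2)
    rw [Nat.cast_ofNat] at h2; rw [h2] at this; simpa using this
  rw [e] at h
  have h2 := (ENNReal.tendsto_toReal (measure_ne_top mm {t | Df t = 0})).comp h
  rw [show (mm {t | Df t = 0}).toReal = 0 from nD] at h2
  exact h2
lemma cF (h : k True True True = 0) : MM (fun t => Xf k t ∧ ¬ Sf t) (1 / 4 - 5087 / 43008) := by
  have hm : MeasurableSet {t | Sf t} := ((cld (by fun_prop) (by fun_prop)).inter (cld (by fun_prop) (by fun_prop))).measurableSet
  have := measureReal_inter_add_diff (μ := mm) (s := {t | Xf k t}) hm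
  have h1 := cX k
  have h2 := cS k h
  rw [MM] at *
  rw [← h1, ← h2, ← this]
  exact (add_sub_cancel_left _ _).symm
end comp3
section link
lemma zd {N : ℕ} {a : ℤ} : (2 : Z2) ^ N ∣ (a : Z2) ↔ (2 : ℤ) ^ N ∣ a := by
  have := PadicInt.pow_p_dvd_int_iff (p := 2) N a
  exact_mod_cast this
lemma apx (N : ℕ) (x : Z2) : ∃ (a : ℤ) (e : Z2), x = a + 2 ^ N * e := by
  have := PadicInt.appr_spec N x
  rw [Ideal.mem_span_singleton] at this
  obtain ⟨e, he⟩ := this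
  exact ⟨x.appr N, e, by push_cast at he ⊢; linear_combination he⟩
def Ap (N : ℕ) (x : V6) (t : T6) : Prop := ∃ e : V6, x = ![t.α + 2 ^ N * e 0, t.β + 2 ^ N * e 1, t.γ + 2 ^ N * e 2,
  t.δ + 2 ^ N * e 3, t.c + 2 ^ N * e 4, t.d + 2 ^ N * e 5]

variable {L : Type*} [Field L] [NumberField L] {K : ℕ} {V : Lev L K} {σ : L ≃ₐ[ℚ] L} {t : T6}
lemma hlf {N : ℕ} {a : ℤ} : (2 : ℤ) ^ (N + 1) ∣ 2 * a ↔ 2 ^ N ∣ a := by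
  rw [pow_succ']; exact mul_dvd_mul_iff_left two_ne_zero
lemma CK_iff (h : Rp V σ t) : CK K σ ↔ ∃ m u v : ℤ, 2 ^ K ∣ m * t.c + t.α * (1 + 2 * u) + t.β * v ∧
    2 ^ K ∣ m * t.d + t.γ * (1 + 2 * u) + 2 * t.δ * v := by
  have hS := V.hS
  have hX := V.hX
  have key : ∀ m u v : ℤ, sg σ ((2 * m) • V.S + V.X + (2 * u) • V.X + (2 * v) • V.Y) = (2 * m) • V.S + V.X + (2 * u) • V.X + (2 * v) • V.Y ↔
      2 ^ K ∣ m * t.c + t.α * (1 + 2 * u) + t.β * v ∧ 2 ^ K ∣ m * t.d + t.γ * (1 + 2 * u) + 2 * t.δ * v := by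
    intro m u v
    rw [← hlf, ← hlf (a := _ + _ + 2 * t.δ * v)]
    have := V.bas.iff (2 * (m * t.c + t.α * (1 + 2 * u) + t.β * v)) (2 * (m * t.d + t.γ * (1 + 2 * u) + 2 * t.δ * v)) 0 0
    rw [sub_zero, sub_zero] at this
    rw [← this, map_add, map_add, map_add, map_zsmul, map_zsmul, map_zsmul, h.hX, h.hY, h.hS]
    constructor <;> intro e <;> linear_combination (norm := module) e
  constructor
  · rintro ⟨m, s, h1, h2⟩
    rw [← hX, ← hS] at h1
    have h3 : (2 ^ K : ℤ) • (s - ((2 * m) • V.S + V.X)) = 0 := by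
      rw [smul_sub, h1, pow_succ']; module
    obtain ⟨a, b, hab⟩ := V.bas.span (s - ((2 * m) • V.S + V.X)) (by rw [pow_succ', mul_smul, h3, smul_zero])
    rw [hab, smul_add, smul_smul, smul_smul] at h3
    have := V.bas.ind _ _ h3
    rw [pow_succ, mul_dvd_mul_iff_left (by positivity), mul_dvd_mul_iff_left (by positivity)] at this
    obtain ⟨⟨u, rfl⟩, v, rfl⟩ := this
    rw [sub_eq_iff_eq_add'] at hab
    refine ⟨m, u, v, (key m u v).1 ?_⟩
    rw [add_assoc, ← hab, h2]
  · rintro ⟨m, u, v, h1⟩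
    refine ⟨m, _, ?_, (key m u v).2 h1⟩
    have oX := V.bas.oX
    have oY := V.bas.oY
    rw [← hX, ← hS]
    rw [pow_succ'] at *
    linear_combination (norm := module) u • oX + v • oY

lemma alg1 {α β γ δ c d : Z2} (hs : Su α β γ δ c d) (hd : 4 * α * δ - 2 * β * γ ≠ 0) :
    ∃ m v, m * c + α + β * v = 0 ∧ m * d + γ + 2 * δ * v = 0 := by
  obtain ⟨⟨q, hq⟩, ⟨p, hp⟩⟩ := hs
  have h0 : 2 * (2 * δ * c - β * d) ≠ 0 := fun h => hd (by rw [hp, h, zero_mul])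
  exact ⟨-p, q, mul_left_cancel₀ h0 (by linear_combination c * hp - β * hq), mul_left_cancel₀ h0 (by linear_combination d * hp - 2 * δ * hq)⟩
lemma alg2 {α β γ δ c d m u v : Z2} (h1 : 2 ^ K ∣ m * c + α * (1 + 2 * u) + β * v) (h2 : 2 ^ K ∣ m * d + γ * (1 + 2 * u) + 2 * δ * v)
    (hd : ¬ 2 ^ K ∣ 4 * α * δ - 2 * β * γ) : Su α β γ δ c d := by
  have a1 : 2 * 2 ^ K ∣ (2 * u + 1) * (4 * α * δ - 2 * β * γ) + 2 * (2 * δ * c - β * d) * m := by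
    convert mul_dvd_mul_left 2 ((h1.mul_left (2 * δ)).sub (h2.mul_left β)) using 1; ring
  have a2 : 2 * 2 ^ K ∣ (2 * u + 1) * (2 * α * d - 2 * γ * c) + 2 * (2 * δ * c - β * d) * (-v) := by
    convert mul_dvd_mul_left 2 ((h1.mul_left d).sub (h2.mul_left c)) using 1; ring
  rcases ValuationRing.dvd_total (2 * (2 * δ * c - β * d)) (2 * 2 ^ K) with h | h
  · refine ⟨uR.1 ((dvd_add_left ?_).1 (h.trans a2)), uR.1 ((dvd_add_left ?_).1 (h.trans a1))⟩ <;> exact dvd_mul_right _ _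
  · exact (hd ((dvd_mul_left _ _).trans (uR.1 ((dvd_add_left (h.mul_right _)).1 a1)))).elim

lemma link1 (h : Rp V σ t) {x : V6} (hx : Ap (K + 1) x t) (hs : Sf x) (hd : ¬ 2 ^ K ∣ Df x) : CK K σ ∧ BK K σ := by
  obtain ⟨e, rfl⟩ := hx
  constructor
  · obtain ⟨m, v, h1, h2⟩ := alg1 hs (fun h => hd (by rw [Df, h]; exact dvd_zero _))
    obtain ⟨m, m', rfl⟩ := apx K m
    obtain ⟨v, v', rfl⟩ := apx K v
    change (_ + _) * (t.c + _ * e 4) + (t.α + _ * e 0) + (t.β + _ * e 1) * _ = 0 at h1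
    change (_ + _) * (t.d + _ * e 5) + (t.γ + _ * e 2) + 2 * (t.δ + _ * e 3) * _ = 0 at h2
    refine (CK_iff h).2 ⟨m, 0, v, zd.1 ?_, zd.1 ?_⟩ <;> push_cast
    · exact ⟨-(m * 2 * e 4 + m' * t.c + m' * 2 ^ (K + 1) * e 4 + 2 * e 0 + t.β * v' + 2 * e 1 * v + 2 ^ (K + 1) * e 1 * v'), by linear_combination h1⟩
    · exact ⟨-(m * 2 * e 5 + m' * t.d + m' * 2 ^ (K + 1) * e 5 + 2 * e 2 + 2 * t.δ * v' + 4 * e 3 * v + 2 * 2 ^ (K + 1) * e 3 * v'), by linear_combination h2⟩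
  · have hd' : ¬ (2 : ℤ) ^ (K + 1) ∣ 4 * t.α * t.δ - 2 * t.β * t.γ := fun h' => hd (by
      obtain ⟨y, hy⟩ := zd.2 h'
      push_cast at hy
      change 2 ^ K ∣ 4 * (t.α + _ * e 0) * (t.δ + _ * e 3) - 2 * (t.β + _ * e 1) * (t.γ + _ * e 2)
      exact ⟨2 * (y + 4 * t.α * e 3 + 4 * t.δ * e 0 + 4 * e 0 * e 3 * 2 ^ (K + 1) - 2 * t.β * e 2 - 2 * t.γ * e 1 - 2 * e 1 * e 2 * 2 ^ (K + 1)), by linear_combination hy⟩)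
    intro T h1 h2
    obtain ⟨a, b, rfl⟩ := V.bas.span T h1
    rw [map_add, map_zsmul, map_zsmul, h.hX, h.hY] at h2
    obtain ⟨e1, e2⟩ := V.bas.ind (2 * t.α * a + t.β * b) (2 * t.γ * a + 2 * t.δ * b) (by linear_combination (norm := module) h2)
    have od : ∀ n : ℤ, (2 : ℤ) ^ (K + 1) ∣ n * (4 * t.α * t.δ - 2 * t.β * t.γ) → ∃ k, n = 2 * k := fun n hn => by
      rcases Int.even_or_odd' n with ⟨k, hk | hk⟩
      · exact ⟨k, hk⟩
      refine (hd' (IsCoprime.dvd_of_dvd_mul_left (IsCoprime.pow_left ?_) hn)).elim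
      exact ⟨-k, 1, by rw [hk]; ring⟩
    obtain ⟨a, rfl⟩ := od a (((e1.mul_left (2 * t.δ)).sub (e2.mul_left t.β)).trans (dvd_of_eq (by ring)))
    obtain ⟨b, rfl⟩ := od b (((e2.mul_left (2 * t.α)).sub (e1.mul_left (2 * t.γ))).trans (dvd_of_eq (by ring)))
    have oX := V.bas.oX
    have oY := V.bas.oY
    rw [pow_succ'] at oX oY
    linear_combination (norm := module) a • oX + b • oY

lemma link2 (h : Rp V σ t) {x : V6} (hx : Ap (K + 1) x t) (hs : ¬ Sf x) (hd : ¬ 2 ^ K ∣ Df x) : ¬ CK K σ := by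
  rw [CK_iff h]
  rintro ⟨m, u, v, h1, h2⟩
  obtain ⟨e, rfl⟩ := hx
  obtain ⟨y1, h1⟩ := zd.2 h1
  obtain ⟨y2, h2⟩ := zd.2 h2
  push_cast at h1 h2
  refine hs (alg2 (K := K) (m := m) (u := u) (v := v) ?_ ?_ hd)
  · change 2 ^ K ∣ m * (t.c + _ * e 4) + (t.α + _ * e 0) * (1 + 2 * u) + (t.β + _ * e 1) * v
    exact ⟨y1 + 2 * m * e 4 + 2 * e 0 * (1 + 2 * u) + 2 * e 1 * v, by linear_combination h1⟩
  · change 2 ^ K ∣ m * (t.d + _ * e 5) + (t.γ + _ * e 2) * (1 + 2 * u) + 2 * (t.δ + _ * e 3) * v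
    exact ⟨y2 + 2 * m * e 5 + 2 * e 2 * (1 + 2 * u) + 4 * e 3 * v, by linear_combination h2⟩
end link
section count
variable {L : Type*} [Field L] [NumberField L] {K : ℕ} (V : Lev L K)
noncomputable def vec (t : T6) : V6 := ![t.α, t.β, t.γ, t.δ, t.c, t.d]
lemma Ap_iff {N : ℕ} {x : V6} {t : T6} : Ap N x t ↔ ∀ i, 2 ^ N ∣ x i - vec t i := by
  constructor
  · rintro ⟨e, rfl⟩ i
    exact ⟨e i, by fin_cases i <;> exact add_sub_cancel_left _ _⟩
  · intro h
    choose e he using h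
    refine ⟨e, ?_⟩
    ext1 i
    have := sub_eq_iff_eq_add'.1 (he i)
    rw [this]
    fin_cases i <;> rfl
instance : Countable T6 := Function.Injective.countable (f := fun t : T6 => (t.α, t.β, t.γ, t.δ, t.c, t.d)) fun s t h => by
  simp only [Prod.mk.injEq] at h
  ext <;> simp [h]
def Aw (σ : L ≃ₐ[ℚ] L) : Set V6 := {x | ∃ t, Rp V σ t ∧ Ap (K + 1) x t}
def A0 : Set V6 := {x | ∃ t : T6, ((2 * t.α) • V.X + (2 * t.γ) • V.Y = 0 ∧ t.β • V.X + (2 * t.δ) • V.Y = 0 ∧ t.c • V.X + t.d • V.Y = 0) ∧ Ap (K + 1) x t}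
noncomputable def psi (σ : L ≃ₐ[ℚ] L) : EE L × EE L × EE L := (sg σ V.X, sg σ V.Y, sg σ V.S)

lemma Aw_meas (σ : L ≃ₐ[ℚ] L) : MeasurableSet (Aw V σ) := by
  have : Aw V σ = ⋃ t : T6, ⋃ _ : Rp V σ t, ⋂ i, {x | 2 ^ (K + 1) ∣ x i - vec t i} := by
    ext x; simp [Aw, Ap_iff]
  rw [this]
  exact .iUnion fun t => .iUnion fun _ => .iInter fun i => (cld (by fun_prop) (by fun_prop)).measurableSet
instance : mm.IsAddRightInvariant := by unfold mm; infer_instance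
lemma Aw_c (σ : L ≃ₐ[ℚ] L) : mm.real (Aw V σ) = mm.real (A0 V) := by
  obtain ⟨s, hs⟩ := Rp.ex V σ
  have : Aw V σ = (fun x => x + -vec s) ⁻¹' A0 V := by
    ext x
    constructor
    · rintro ⟨t, h, h'⟩
      refine ⟨⟨t.α - s.α, t.β - s.β, t.γ - s.γ, t.δ - s.δ, t.c - s.c, t.d - s.d⟩, ⟨?_, ?_, ?_⟩, ?_⟩
      · linear_combination (norm := module) hs.hX - h.hX
      · linear_combination (norm := module) hs.hY - h.hY
      · linear_combination (norm := module) hs.hS - h.hS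
      · rw [Ap_iff] at *
        intro i
        refine (h' i).trans (dvd_of_eq ?_)
        fin_cases i <;> simp [vec] <;> ring
    · rintro ⟨t, ⟨h1, h2, h3⟩, h'⟩
      refine ⟨⟨t.α + s.α, t.β + s.β, t.γ + s.γ, t.δ + s.δ, t.c + s.c, t.d + s.d⟩, ⟨?_, ?_, ?_⟩, ?_⟩
      · rw [hs.hX]; linear_combination (norm := module) -h1
      · rw [hs.hY]; linear_combination (norm := module) -h2
      · rw [hs.hS]; linear_combination (norm := module) -h3
      · rw [Ap_iff] at *
        intro i
        refine (h' i).trans (dvd_of_eq ?_)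
        fin_cases i <;> simp [vec] <;> ring
  rw [this, measureReal_def, measure_preimage_add_right]; rfl
lemma Aw_psi {σ τ : L ≃ₐ[ℚ] L} (h : psi V σ = psi V τ) : Aw V σ = Aw V τ := by
  simp only [psi, Prod.mk.injEq] at h
  ext x
  refine exists_congr fun t => and_congr_left fun _ => ⟨fun ⟨a, b, c⟩ => ⟨?_, ?_, ?_⟩, fun ⟨a, b, c⟩ => ⟨?_, ?_, ?_⟩⟩ <;> simp_all
lemma Aw_dis {σ τ : L ≃ₐ[ℚ] L} {x : V6} (h : x ∈ Aw V σ) (h' : x ∈ Aw V τ) : psi V σ = psi V τ := by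
  obtain ⟨t, h, e⟩ := h
  obtain ⟨s, h', e'⟩ := h'
  rw [Ap_iff] at e e'
  have d : ∀ i, (2 : Z2) ^ (K + 1) ∣ vec s i - vec t i := fun i => ((e i).sub (e' i)).trans (dvd_of_eq (by ring))
  have z : ∀ a b : ℤ, (2 : Z2) ^ (K + 1) ∣ b - a → ∃ k, b = a + 2 ^ (K + 1) * k := fun a b h => by
    obtain ⟨k, hk⟩ := zd.1 (by push_cast; exact h : (2 : Z2) ^ (K + 1) ∣ ((b - a : ℤ) : Z2))
    exact ⟨k, by linarith⟩
  obtain ⟨k0, h0⟩ := z _ _ (d 0)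
  obtain ⟨k1, h1⟩ := z _ _ (d 1)
  obtain ⟨k2, h2⟩ := z _ _ (d 2)
  obtain ⟨k3, h3⟩ := z _ _ (d 3)
  obtain ⟨k4, h4⟩ := z _ _ (d 4)
  obtain ⟨k5, h5⟩ := z _ _ (d 5)
  have oX := V.bas.oX
  have oY := V.bas.oY
  simp only [psi, Prod.mk.injEq]
  rw [h.hX, h.hY, h.hS, h'.hX, h'.hY, h'.hS, h0, h1, h2, h3, h4, h5]
  refine ⟨?_, ?_, ?_⟩
  · linear_combination (norm := module) (-2 * k0) • oX - (2 * k2) • oY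
  · linear_combination (norm := module) (-k1) • oX - (2 * k3) • oY
  · linear_combination (norm := module) (-k4) • oX - k5 • oY

lemma cnt_le [IsGalois ℚ L] (B : Set V6) : mm.real ((⋃ σ, Aw V σ) ∩ B) * Nat.card (L ≃ₐ[ℚ] L) ≤
    Nat.card {σ | (Aw V σ ∩ B).Nonempty} * mm.real (⋃ σ, Aw V σ) := by
  haveI := Fintype.ofFinite (L ≃ₐ[ℚ] L)
  set E : Finset (L ≃ₐ[ℚ] L) := Finset.univ.filter fun σ => (Aw V σ ∩ B).Nonempty with hE
  set n := (Finset.univ.filter fun σ => psi V σ = psi V 1).card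
  have fib : ∀ τ, (Finset.univ.filter fun σ => psi V σ = psi V τ).card = n := fun τ => by
    refine (Finset.card_equiv (Equiv.mulLeft τ) fun σ => ?_).symm
    have : ∀ C, sg τ C = sg τ (sg 1 C) := fun C => by rw [← sg_mul, mul_one]
    have q : ∀ C D : EE L, sg τ C = sg τ D ↔ C = D := fun C D => ⟨sg_inj τ, fun h => by rw [h]⟩
    simp only [Finset.mem_filter, Finset.mem_univ, true_and, psi, Prod.mk.injEq, Equiv.coe_mulLeft, sg_mul]
    rw [this V.X, this V.Y, this V.S, q, q, q]
  let A' : EE L × EE L × EE L → Set V6 := fun b => {x | ∃ σ, psi V σ = b ∧ x ∈ Aw V σ}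
  have hA' : ∀ τ, A' (psi V τ) = Aw V τ := fun τ => by
    ext x; exact ⟨fun ⟨σ, h, h'⟩ => Aw_psi V h ▸ h', fun h => ⟨τ, rfl, h⟩⟩
  have sat : ∀ E : Finset (L ≃ₐ[ℚ] L), (∀ σ τ, psi V σ = psi V τ → τ ∈ E → σ ∈ E) → E.card = (E.image (psi V)).card * n := by
    intro E hs
    rw [Finset.card_eq_sum_card_image (psi V) E, Finset.sum_const_nat (m := n)]
    intro b hb
    obtain ⟨τ, hτ, rfl⟩ := Finset.mem_image.1 hb
    rw [← fib τ]
    congr 1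
    ext σ
    simp only [Finset.mem_filter, Finset.mem_univ, true_and, and_iff_right_iff_imp]
    exact fun h => hs _ _ h hτ
  have s1 := sat E fun σ τ h h' => by
    simp only [hE, Finset.mem_filter, Finset.mem_univ, true_and] at *
    rwa [Aw_psi V h]
  have s2 := sat Finset.univ fun σ τ h h' => Finset.mem_univ _
  have cst : ∀ E : Finset (L ≃ₐ[ℚ] L), ∑ b ∈ E.image (psi V), mm.real (A' b) = (E.image (psi V)).card * mm.real (A0 V) := by
    intro E
    rw [Finset.sum_congr rfl (g := fun _ => mm.real (A0 V)), Finset.sum_const, nsmul_eq_mul]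
    intro b hb
    obtain ⟨τ, hτ, rfl⟩ := Finset.mem_image.1 hb
    rw [hA', Aw_c]
  have b1 : mm.real ((⋃ σ, Aw V σ) ∩ B) ≤ (E.image (psi V)).card * mm.real (A0 V) := by
    rw [← cst]
    refine (measureReal_mono ?_ (measure_ne_top _ _)).trans (measureReal_biUnion_finset_le _ _)
    rintro x ⟨hx, hB⟩
    obtain ⟨σ, hσ⟩ := mem_iUnion.1 hx
    refine mem_biUnion (x := psi V σ) ?_ (hA' σ ▸ hσ)
    exact Finset.mem_coe.2 (Finset.mem_image_of_mem _ (by rw [hE, Finset.mem_filter]; exact ⟨Finset.mem_univ _, x, hσ, hB⟩))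
  have b2 : mm.real (⋃ σ, Aw V σ) = (Finset.univ.image (psi V)).card * mm.real (A0 V) := by
    rw [← cst, ← measureReal_biUnion_finset]
    · congr 1
      ext x
      simp only [mem_iUnion, Finset.mem_image, Finset.mem_univ, true_and, exists_prop]
      exact ⟨fun ⟨σ, h⟩ => ⟨_, ⟨σ, rfl⟩, hA' σ ▸ h⟩, fun ⟨_, ⟨σ, rfl⟩, h⟩ => ⟨σ, hA' σ ▸ h⟩⟩
    · rintro _ - _ - hne
      rw [Function.onFun, Set.disjoint_left]
      rintro x ⟨σ, rfl, h⟩ ⟨τ, rfl, h'⟩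
      exact hne (Aw_dis V h h')
    · intro b hb
      obtain ⟨τ, hτ, rfl⟩ := Finset.mem_image.1 hb
      rw [hA']; exact Aw_meas V τ
  have c1 : Nat.card {σ | (Aw V σ ∩ B).Nonempty} = E.card := by
    rw [Nat.card_coe_set_eq, ← Set.ncard_coe_finset]; congr 1; ext; simp [hE]
  rw [c1, b2, Nat.card_eq_fintype_card, ← Finset.card_univ, s1, s2]
  push_cast
  calc _ ≤ _ := mul_le_mul_of_nonneg_right b1 (by positivity)
    _ = _ := by ring

lemma k_ex [IsGalois ℚ L] {J : ℕ} (V : Lev L (J + 2)) : ∃ k : Prop → Prop → Prop → Z2, k True True True = 0 ∧ {x | Xf k x} = ⋃ σ, Aw V σ := by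
  have g := V.gp
  have : ∀ v : Fin 3 → ZMod 2, ∃ s : T6, (∃ σ, Rp V σ s) ∧ s.cls = v ∧ (v = 0 → s.det = 1) := fun v => by
    rcases eq_or_ne v 0 with rfl | h
    · exact ⟨_, g.one, by ext i; fin_cases i <;> simp [T6.cls, T6.o], fun _ => by simp [T6.det, T6.o]⟩
    · obtain ⟨s, hs, h'⟩ := g.cl v; exact ⟨s, hs, h', fun h'' => (h h'').elim⟩
  choose f hf hc h1 using this
  let iv : Prop → ZMod 2 := fun p => if p then 0 else 1
  let k : Prop → Prop → Prop → Z2 := fun p q r => (((f ![iv p, iv q, iv r]).det - 1) / 2 : ℤ)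
  have key : ∀ x t, Ap (J + 2 + 1) x t → (Xf k x ↔ ∃ σ, Rp V σ t) := by
    rintro x t hx
    have e : ∀ i (a : ℤ), vec t i = a → iv (2 ∣ x i) = a := fun i a ha => by
      have := (Ap_iff.1 hx) i
      rw [ha] at this
      have h2 : (2 : Z2) ∣ x i ↔ (2 : ℤ) ∣ a := by
        rw [← pow_one (2 : ℤ), ← zd, pow_one]
        exact (dvd_iff_dvd_of_dvd_sub ((dvd_pow_self 2 (by omega)).trans this))
      simp only [iv, h2]
      rcases Int.even_or_odd' a with ⟨b, rfl | rfl⟩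
      · simp [show (2 : ZMod 2) = 0 from rfl]
      · simp [show (2 : ZMod 2) = 0 from rfl]
    have c : ![iv (2 ∣ x 1), iv (2 ∣ x 2), iv (2 ∣ x 5)] = t.cls := by
      rw [e 1 t.β rfl, e 2 t.γ rfl, e 5 t.d rfl]; rfl
    rw [g.full (hf t.cls) (hc _).symm, Xf, Xk]
    change (4 : Z2) ∣ _ - ((((f ![iv (2 ∣ x 1), iv (2 ∣ x 2), iv (2 ∣ x 5)]).det - 1) / 2 : ℤ) : Z2) ↔ _
    rw [c]
    clear e
    obtain ⟨n, hn⟩ : ∃ n, (f t.cls).det = 1 + 2 * n := ⟨(f t.cls).α + (f t.cls).δ + 2 * (f t.cls).α * (f t.cls).δ - (f t.cls).β * (f t.cls).γ, by rw [T6.det]; ring⟩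
    rw [hn, show (1 + 2 * n - 1) / 2 = n by omega, T6.det]
    obtain ⟨e, rfl⟩ := hx
    change 4 ∣ (t.α + _ * e 0) + (t.δ + _ * e 3) + 2 * (t.α + _ * e 0) * (t.δ + _ * e 3) - (t.β + _ * e 1) * (t.γ + _ * e 2) - n ↔ _
    rw [show (8 : ℤ) = 2 * 2 ^ 2 by norm_num, show (1 + 2 * t.α) * (1 + 2 * t.δ) - 2 * t.β * t.γ - (1 + 2 * n) = 2 * (t.α + t.δ + 2 * t.α * t.δ - t.β * t.γ - n) by ring,
      mul_dvd_mul_iff_left two_ne_zero, ← zd, show (2 : Z2) ^ 2 = 4 by norm_num]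
    push_cast
    exact dd (2 ^ (J + 1) * (e 0 + e 3 + 2 * t.α * e 3 + 2 * e 0 * t.δ + 2 * 2 ^ (J + 3) * e 0 * e 3 - t.β * e 2 - e 1 * t.γ - 2 ^ (J + 3) * e 1 * e 2)) (by ring)
  refine ⟨k, ?_, ?_⟩
  · have : ![iv True, iv True, iv True] = 0 := by ext i; fin_cases i <;> simp [iv]
    simp only [k, this, h1 0 rfl]; simp
  · ext x
    rw [mem_iUnion]
    refine ⟨fun h => ?_, fun ⟨σ, t, h, h'⟩ => (key x t h').2 ⟨σ, h⟩⟩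
    have ap := fun i => apx (J + 2 + 1) (x i)
    choose a e he using ap
    have : Ap (J + 2 + 1) x ⟨a 0, a 1, a 2, a 3, a 4, a 5⟩ := ⟨e, by ext1 i; rw [he]; fin_cases i <;> rfl⟩
    obtain ⟨σ, h'⟩ := (key x _ this).1 h
    exact ⟨σ, _, h', this⟩
end count
section fin
open NumberField
variable {L : Type*} [Field L] [NumberField L] {K : ℕ}
lemma sg_one (C : EE L) : sg 1 C = C := by
  rcases pt_cases C with rfl | ⟨x, y, ho, rfl⟩
  · simp
  · rw [emap_pt _ ho]; rfl
noncomputable def stb (A : EE L) : Subgroup (L ≃ₐ[ℚ] L) where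
  carrier := {σ | sg σ A = A}
  one_mem' := sg_one A
  mul_mem' {a b} ha hb := by
    have ha : sg a A = A := ha
    have hb : sg b A = A := hb
    change sg (a * b) A = A
    rw [sg_mul, hb, ha]
  inv_mem' {a} ha := by
    have ha : sg a A = A := ha
    change sg a⁻¹ A = A
    apply sg_inj a
    rw [← sg_mul, mul_inv_cancel, sg_one, ha]
lemma sg_zp {s t : L ≃ₐ[ℚ] L} (h : Subgroup.zpowers s = Subgroup.zpowers t) {A : EE L} (hA : sg s A = A) : sg t A = A := by
  have : Subgroup.zpowers t ≤ stb A := h ▸ (Subgroup.zpowers_le.2 (show s ∈ stb A from hA))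
  exact Subgroup.zpowers_le.1 this
lemma CK_zp {s t : L ≃ₐ[ℚ] L} (h : Subgroup.zpowers s = Subgroup.zpowers t) (c : CK K s) : CK K t := by
  obtain ⟨m, u, h1, h2⟩ := c
  exact ⟨m, u, h1, sg_zp h h2⟩
lemma BK_zp {s t : L ≃ₐ[ℚ] L} (h : Subgroup.zpowers s = Subgroup.zpowers t) (c : BK K s) : BK K t :=
  fun T h1 h2 => c T h1 (sg_zp h.symm h2)
lemma CK_cj {x s : L ≃ₐ[ℚ] L} (c : CK K s) : CK K (x⁻¹ * s * x) := by
  obtain ⟨m, u, h1, h2⟩ := c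
  refine ⟨m, sg x⁻¹ u, ?_, ?_⟩
  · rw [← map_zsmul, h1, map_add, map_zsmul, emap_P, emap_Q]
  · rw [← sg_mul, mul_assoc, mul_inv_cancel, mul_one, sg_mul, h2]
lemma BK_cj {x s : L ≃ₐ[ℚ] L} (c : BK K s) : BK K (x⁻¹ * s * x) := by
  intro T h1 h2
  have h3 := c (sg x T) (by rw [← map_zsmul, h1, map_zero]) (by
    rw [← sg_mul]
    apply sg_inj x⁻¹
    rw [← sg_mul, ← mul_assoc, h2, ← sg_mul, inv_mul_cancel, sg_one])
  apply sg_inj x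
  rw [map_zsmul, h3, map_zero]

def SS : Set ℕ := {p | ∃ m, (p : ℤ) ∣ (somos m).num}

lemma cl_le {v w : ℕ → ℝ} {c : ℝ} {B : ℕ} (hv : Tendsto (LD v) atTop (𝓝 c)) (h0 : ∀ p, 0 ≤ w p)
    (h : ∀ p, p.Prime → B ≤ p → v p ≤ w p) {ε : ℝ} (hε : 0 < ε) : ∀ᶠ n in atTop, c - ε < LD w n := by
  have := LD_congr B (v := v) (w := fun p => if p < B then 0 else v p) (fun p _ hb => by simp [not_lt.2 hb]) hv
  filter_upwards [this.eventually (lt_mem_nhds (show c - ε < c by linarith))] with n hn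
  refine hn.trans_le (LD_mono (fun p hp => ?_) n)
  split_ifs with h1
  · exact h0 p
  · exact h p hp (not_lt.1 h1)

lemma cls_le (r e : ℝ) (hr : 0 ≤ e) {V : Lev L K} [IsGalois ℚ L] {k : Prop → Prop → Prop → Z2} (hk : {x | Xf k x} = ⋃ σ, Aw V σ)
    {Q : V6 → Prop} (hQ : MM (fun t => Xf k t ∧ Q t) r) (he : mm.real {t | 2 ^ K ∣ Df t} = e) (C : Set (L ≃ₐ[ℚ] L))
    (hC : ∀ σ t (x : V6), Rp V σ t → Ap (K + 1) x t → Q x → ¬ 2 ^ K ∣ Df x → σ ∈ C) :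
    4 * (r - e) ≤ (Nat.card C : ℝ) / Nat.card (L ≃ₐ[ℚ] L) := by
  have h := cnt_le V {x | Q x ∧ ¬ 2 ^ K ∣ Df x}
  rw [← hk, show mm.real {x | Xf k x} = 1 / 4 from cX k] at h
  have hG : (0 : ℝ) < Nat.card (L ≃ₐ[ℚ] L) := by exact_mod_cast Nat.card_pos
  have h1 : (Nat.card {σ | (Aw V σ ∩ {x | Q x ∧ ¬ 2 ^ K ∣ Df x}).Nonempty} : ℝ) ≤ Nat.card C := by
    exact Nat.cast_le.2 <| Nat.card_mono (Set.toFinite C) (by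
      rintro σ ⟨x, ⟨t, ht, hx⟩, h1, h2⟩
      exact hC σ t x ht hx h1 h2)
  have h2 : r ≤ mm.real ({x | Xf k x} ∩ {x | Q x ∧ ¬ 2 ^ K ∣ Df x}) + e := by
    have hQ : mm.real {t | Xf k t ∧ Q t} = r := hQ
    rw [← hQ, ← he]
    refine (measureReal_mono ?_).trans (measureReal_union_le _ _)
    rintro x ⟨h1, h2⟩
    by_cases h3 : 2 ^ K ∣ Df x
    · exact Or.inr h3
    · exact Or.inl ⟨h1, h2, h3⟩
  rw [le_div_iff₀ hG]
  nlinarith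

lemma bnd (J : ℕ) {ε : ℝ} (hε : 0 < ε) : ∀ᶠ n in atTop,
    4 * (5087 / 43008 - mm.real {t | 2 ^ (J + 2) ∣ Df t}) - ε < LD (SS.indicator fun _ => 1) n ∧
    LD (SS.indicator fun _ => 1) n < 4 * (5087 / 43008 + mm.real {t | 2 ^ (J + 2) ∣ Df t}) + ε := by
  obtain ⟨L, _, _, hG, ⟨V⟩⟩ := lev_ex (J + 2)
  obtain ⟨k, hk0, hk⟩ := k_ex V
  set e := mm.real {t | 2 ^ (J + 2) ∣ Df t} with he
  have he0 : 0 ≤ e := measureReal_nonneg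
  have c1 := cls_le _ e he0 hk (cS k hk0) he.symm {σ | CK (J + 2) σ ∧ BK (J + 2) σ} (fun σ t x a b c d => link1 a b c d)
  have c2 := cls_le _ e he0 hk (cF k hk0) he.symm {σ | ¬ CK (J + 2) σ} (fun σ t x a b c d => link2 a b c d)
  choose! P σ hσ using frob_exists (L := L)
  have hl := frob_LD σ (fun p hp => ⟨P p, hσ p hp⟩)
  have t1 := LD_class σ hl {σ | CK (J + 2) σ ∧ BK (J + 2) σ} (fun x s h => ⟨CK_cj h.1, BK_cj h.2⟩)
    (fun s t h h' => ⟨CK_zp h h'.1, BK_zp h h'.2⟩)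
  have t2 := LD_class σ hl {σ | ¬ CK (J + 2) σ} (fun x s h h' => h (by
      have := CK_cj (x := x⁻¹) h'
      rwa [show x⁻¹⁻¹ * (x⁻¹ * s * x) * x⁻¹ = s by group] at this))
    (fun s t h h' h'' => h' (CK_zp h.symm h''))
  obtain ⟨B, hB⟩ := eventually_atTop.1 (eventually_comap.1 V.spec)
  have key : ∀ p, p.Prime → max B 18 ≤ p → ((CK (J + 2) (σ p) → BK (J + 2) (σ p) → p ∈ SS) ∧ (p ∈ SS → CK (J + 2) (σ p))) := by
    intro p hp hb
    let w : Plc L := ⟨p, hp, by have := le_max_right B 18; omega, P p, (hσ p hp).1, (hσ p hp).2.1⟩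
    have h := hB p ((le_max_left _ _).trans hb) w rfl (σ p) (hσ p hp).2.2
    have hs : p ∈ SS ↔ ∃ m : ℤ, (m • P0 + Q0 : EE w.k) = 0 := somos_iff (F := w.k) (p := w.p) hp
    rw [hs]
    exact h
  have h0 : ∀ p, 0 ≤ SS.indicator (fun _ => (1 : ℝ)) p := fun p => indicator_nonneg (fun _ _ => zero_le_one) p
  have h0' : ∀ p, 0 ≤ SSᶜ.indicator (fun _ => (1 : ℝ)) p := fun p => indicator_nonneg (fun _ _ => zero_le_one) p
  have l1 := cl_le (B := max B 18) t1 h0 (fun p hp hb => by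
    split_ifs with h
    · rw [indicator_of_mem ((key p hp hb).1 h.1 h.2)]
    · exact h0 p) hε
  have l2 := cl_le (B := max B 18) t2 h0' (fun p hp hb => by
    split_ifs with h
    · rw [indicator_of_mem (s := SSᶜ) (fun h' => h ((key p hp hb).2 h'))]
    · exact h0' p) (half_pos hε)
  have l3 := LD_one.eventually (gt_mem_nhds (show (1 : ℝ) < 1 + ε / 2 by linarith))
  filter_upwards [l1, l2, l3] with n a1 a2 a3
  have hs := LD_add (SS.indicator fun _ => (1 : ℝ)) (SSᶜ.indicator fun _ => (1 : ℝ)) n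
  have hs' : (fun p => SS.indicator (fun _ => (1 : ℝ)) p + SSᶜ.indicator (fun _ => (1 : ℝ)) p) = fun _ => 1 := by
    ext p; by_cases h : p ∈ SS <;> simp [h]
  rw [hs'] at hs
  constructor <;> linarith

lemma SS_dens : Tendsto (LD (SS.indicator fun _ => 1)) atTop (𝓝 (5087 / 10752)) := by
  rw [Metric.tendsto_atTop']
  intro ε hε
  have := ((tl.comp (tendsto_add_atTop_nat 2)).eventually (gt_mem_nhds (show (0 : ℝ) < ε / 8 by linarith))).exists
  obtain ⟨J, hJ⟩ := this
  simp only [Function.comp] at hJ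
  obtain ⟨N, hN⟩ := eventually_atTop.1 (bnd J (half_pos hε))
  refine ⟨N, fun n hn => ?_⟩
  have := hN n hn.le
  rw [Real.dist_eq, abs_lt]
  constructor <;> linarith
end fin

theorem somos5_prime_density :
    Tendsto (fun x : ℕ => (somosPi x : ℝ) / (primePi x : ℝ)) atTop
      (nhds (5087 / 10752)) := by
  exact dens_final SS SS_dens
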